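/- Let N≥8 be an integer, −1/2<δ<1/2, 0<α<1, and let Q_i (i=1,…,d) be null forms. Let (φ_0,φ_1) ∈ H^{N+1}_δ(ℝ³,ℝ^d)×H^N_{δ+1}(ℝ³,ℝ^d) with ‖φ_0‖_{H^{N+1}_δ}+‖φ_1‖_{H^N_{δ+1}} ≤ ε. There exists ε_0>0 such that if ε≤ε_0 the Cauchy problem □φ_i=Q_i(∂φ,∂φ), (φ,∂_tφ)|_{t=0}=(φ_0,φ_1), admits a unique global solution φ on ℝ₊×ℝ³, and there is a constant C such that for all t≥0 and all multi-indices |I|≤N, ‖w_1(q)^{1/2} ∂Z^Iφ(t,·)‖_{L²(ℝ³)} ≤ Cε, where w_1(q)=1+(1+|q|)^{−α} for q<0 and w_1(q)=1+(1+|q|)^{2(δ+1)} for q>0. -/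

import Mathlib

noncomputable section

open Real MeasureTheory

/-- Spatial points x ∈ ℝ³. -/
abbrev Spc := Fin 3 → ℝ

/-- Spacetime points (t, x) ∈ ℝ × ℝ³. -/
abbrev Pt := ℝ × Spc

/-- Euclidean radius r = |x|. -/
def rad (x : Spc) : ℝ := Real.sqrt (∑ i, x i ^ 2)

/-- Partial derivative in time, ∂_t. -/
def ptd (u : Pt → ℝ) (p : Pt) : ℝ := deriv (fun s => u (s, p.2)) p.1

/-- Partial derivative in the i-th spatial direction, ∂_i. -/
def pxd (i : Fin 3) (u : Pt → ℝ) (p : Pt) : ℝ :=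
  deriv (fun s => u (p.1, Function.update p.2 i s)) (p.2 i)

/-- Radial derivative ∂_r = ω^i ∂_i, with ω_i = x_i / r. -/
def prd (u : Pt → ℝ) (p : Pt) : ℝ := ∑ i, (p.2 i / rad p.2) * pxd i u p

/-- d'Alembertian □ = -∂_t² + Δ. -/
def box (u : Pt → ℝ) (p : Pt) : ℝ := - ptd (ptd u) p + ∑ i, pxd i (pxd i u) p

/-- Spacetime gradient ∂u = (∂_t u, ∂_1 u, ∂_2 u, ∂_3 u). -/
def sgrad (u : Pt → ℝ) (p : Pt) : Fin 4 → ℝ :=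
  ![ptd u p, pxd 0 u p, pxd 1 u p, pxd 2 u p]

/-- Good spatial derivative ∂̄_i = ∂_i - ω_i ∂_r. -/
def gb (i : Fin 3) (u : Pt → ℝ) (p : Pt) : ℝ :=
  pxd i u p - (p.2 i / rad p.2) * prd u p

/-- Good derivatives (∂̄_0, ∂̄_1, ∂̄_2, ∂̄_3), ∂̄_0 = (∂_t+∂_r)/2. -/
def gdrv (u : Pt → ℝ) (p : Pt) : Fin 4 → ℝ :=
  ![(ptd u p + prd u p) / 2, gb 0 u p, gb 1 u p, gb 2 u p]

/-- |∂u| = Σ_α |∂_α u|. -/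
def gradAbs (u : Pt → ℝ) (p : Pt) : ℝ := ∑ α, |sgrad u p α|

/-- |∂̄u| = Σ_α |∂̄_α u|. -/
def gdrvAbs (u : Pt → ℝ) (p : Pt) : ℝ := ∑ α, |gdrv u p α|

/-- Basic null form Q₀(X,Y) = -X₀Y₀ + δ^{ij}X_iY_j. -/
def Q0form (X Y : Fin 4 → ℝ) : ℝ := -(X 0 * Y 0) + X 1 * Y 1 + X 2 * Y 2 + X 3 * Y 3

/-- Basic null forms Q_{αβ}(X,Y) = X_αY_β - X_βY_α. -/
def Qform (a b : Fin 4) (X Y : Fin 4 → ℝ) : ℝ := X a * Y b - X b * Y a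

/-- A null form is a linear combination of Q₀ and the Q_{αβ}. -/
def IsNullForm (Q : (Fin 4 → ℝ) → (Fin 4 → ℝ) → ℝ) : Prop :=
  ∃ (c : ℝ) (d : Fin 4 → Fin 4 → ℝ), ∀ X Y,
    Q X Y = c * Q0form X Y + ∑ a, ∑ b, d a b * Qform a b X Y

/-- First-order operators acting on scalar functions on spacetime. -/
abbrev Op := (Pt → ℝ) → Pt → ℝ

/-- Scaling vector field S = t∂_t + r∂_r. -/
def vfS : Op := fun u p => p.1 * ptd u p + ∑ i, p.2 i * pxd i u p

/-- Rotations Ω_{ij} = x_i∂_j - x_j∂_i. -/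
def vfRot (i j : Fin 3) : Op := fun u p => p.2 i * pxd j u p - p.2 j * pxd i u p

/-- Lorentz boosts Ω_{0i} = -t∂_i - x_i∂_t. -/
def vfBoost (i : Fin 3) : Op := fun u p => -(p.1 * pxd i u p) - p.2 i * ptd u p

/-- The 11 Minkowski vector fields. -/
def mink : Fin 11 → Op :=
  ![ptd, pxd 0, pxd 1, pxd 2, vfS, vfBoost 0, vfBoost 1, vfBoost 2,
    vfRot 0 1, vfRot 0 2, vfRot 1 2]

/-- Application of a product Z^I of first-order operators, I given as a list. -/
def applyOps (L : List Op) (u : Pt → ℝ) : Pt → ℝ := L.foldr (fun Z v => Z v) u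

/-- A multi-index: a word in the Minkowski vector fields. -/
def IsMulti (L : List Op) : Prop := ∀ Z ∈ L, ∃ n : Fin 11, Z = mink n

/-- A word in the spatial rotations only. -/
def IsRotMulti (L : List Op) : Prop :=
  ∀ Z ∈ L, Z = vfRot 0 1 ∨ Z = vfRot 0 2 ∨ Z = vfRot 1 2

/-- The region A^R = {1/R ≤ r - t ≤ R}. -/
def regA (R : ℝ) : Set Pt := {p | 1 / R ≤ rad p.2 - p.1 ∧ rad p.2 - p.1 ≤ R}

/-- The region B^R = {r - t ≤ R}. -/
def regB (R : ℝ) : Set Pt := {p | rad p.2 - p.1 ≤ R}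

/-- The region A₀^R = A^R ∩ {t = 0}. -/
def regA0 (R : ℝ) : Set Spc := {x | 1 / R ≤ rad x ∧ rad x ≤ R}

/-- L² norm of a function on a spatial slice. -/
def L2 (f : Spc → ℝ) : ℝ := (∫ x : Spc, (f x) ^ 2) ^ (1/2 : ℝ)

/-- Weighted Sobolev norm ‖u‖_{H^m_δ} = Σ_{k≤m} ‖⟨x⟩^{δ+k} ∇^k u‖_{L²}. -/
def sobNorm (m : ℕ) (δ : ℝ) (u : Spc → ℝ) : ℝ :=
  ∑ k ∈ Finset.range (m + 1),
    (∫ x : Spc, ((1 + ∑ i, x i ^ 2) ^ ((δ + k) / 2) * ‖iteratedFDeriv ℝ k u x‖) ^ 2) ^ (1/2 : ℝ)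

/-- Membership in the weighted Sobolev space H^m_δ (finiteness of the norm). -/
def MemSob (m : ℕ) (δ : ℝ) (u : Spc → ℝ) : Prop :=
  ∀ k ≤ m, Integrable (fun x : Spc =>
    ((1 + ∑ i, x i ^ 2) ^ ((δ + k) / 2) * ‖iteratedFDeriv ℝ k u x‖) ^ 2)

/-- ‖f‖_{C^M} ≤ ε, stated derivative by derivative. -/
def CMBound (M : ℕ) (f : Spc → ℝ) (ε : ℝ) : Prop :=
  ∀ k ≤ M, ∀ x, ‖iteratedFDeriv ℝ k f x‖ ≤ ε

/-- The transport operator 𝓛 = ∂_t + ∂_r + 1/r. -/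
def opLb : Op := fun u p => ptd u p + prd u p + u p / rad p.2

/-- The spacetime gradient of u = t - r, namely (1, -ω₁, -ω₂, -ω₃). -/
def duTmR (p : Pt) : Fin 4 → ℝ :=
  ![1, -(p.2 0 / rad p.2), -(p.2 1 / rad p.2), -(p.2 2 / rad p.2)]

/-- Oscillating profiles T_λ^{(k,i)}. -/
def Ttrig (lam : ℝ) (k i : ℤ) (p : Pt) : ℝ :=
  if (k + i) % 2 = 0 then Real.cos (i * (p.1 - rad p.2) / lam)
  else Real.sin (i * (p.1 - rad p.2) / lam)

/-- The ghost weight w₁. -/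
def w1 (δ α q : ℝ) : ℝ :=
  if q < 0 then 1 + (1 + |q|) ^ (-α) else 1 + (1 + |q|) ^ (2 * (δ + 1))

open scoped ContDiff
set_option linter.all false

/-- Coordinate basis of spacetime. -/
def ev : Fin 4 → Pt := Fin.cons ((1 : ℝ), (0 : Spc)) (fun i => ((0 : ℝ), (Pi.single i 1 : Spc)))

/-- Coordinate functions on spacetime. -/
def Xc : Fin 4 → Pt → ℝ := Fin.cons (fun p => p.1) (fun i p => p.2 i)

/-- Coordinate derivative. -/
def D (a : Fin 4) (u : Pt → ℝ) (p : Pt) : ℝ := fderiv ℝ u p (ev a)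

/-- Minkowski signs. -/
def eta : Fin 4 → ℝ := ![-1, 1, 1, 1]

@[simp] lemma ev_zero : ev 0 = ((1 : ℝ), (0 : Spc)) := rfl
@[simp] lemma ev_succ (i : Fin 3) : ev i.succ = ((0 : ℝ), (Pi.single i 1 : Spc)) := rfl
@[simp] lemma Xc_zero (p : Pt) : Xc 0 p = p.1 := rfl
@[simp] lemma Xc_succ (i : Fin 3) (p : Pt) : Xc i.succ p = p.2 i := rfl
@[simp] lemma eta_zero : eta 0 = -1 := rfl
@[simp] lemma eta_succ (i : Fin 3) : eta i.succ = 1 := by fin_cases i <;> rfl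

lemma pt_decomp (p : Pt) : p = ∑ a, Xc a p • ev a := by
  rw [Fin.sum_univ_succ]
  ext j
  · simp [Prod.fst_sum]
  · simp [Prod.snd_sum, Finset.sum_apply, Pi.single_apply]

lemma contDiff_Xc (a : Fin 4) : ContDiff ℝ ∞ (Xc a) := by
  refine Fin.cases ?_ (fun i => ?_) a
  · exact contDiff_fst
  · show ContDiff ℝ ∞ (fun p : Pt => p.2 i)
    fun_prop

lemma hasFDerivAt_Xc_apply (a b : Fin 4) (p : Pt) : D b (Xc a) p = if a = b then 1 else 0 := by
  unfold D
  refine Fin.cases ?_ (fun i => ?_) a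
  · have h : HasFDerivAt (Xc 0) (ContinuousLinearMap.fst ℝ ℝ Spc) p :=
      (ContinuousLinearMap.fst ℝ ℝ Spc).hasFDerivAt
    rw [h.fderiv]
    refine Fin.cases ?_ (fun j => ?_) b
    · simp
    · simp [(Fin.succ_ne_zero j).symm]
  · have h : HasFDerivAt (Xc i.succ)
      ((ContinuousLinearMap.proj i).comp (ContinuousLinearMap.snd ℝ ℝ Spc)) p :=
      ((ContinuousLinearMap.proj (R := ℝ) (φ := fun _ : Fin 3 => ℝ) i).comp
        (ContinuousLinearMap.snd ℝ ℝ Spc)).hasFDerivAt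
    rw [h.fderiv]
    refine Fin.cases ?_ (fun j => ?_) b
    · simp [(Fin.succ_ne_zero i)]
    · simp [Pi.single_apply]

lemma D_Xc (a b : Fin 4) : D b (Xc a) = fun _ => if a = b then 1 else 0 :=
  funext (hasFDerivAt_Xc_apply a b)

lemma fderiv_apply_eq (u : Pt → ℝ) (p v : Pt) : fderiv ℝ u p v = ∑ a, Xc a v * D a u p := by
  conv_lhs => rw [pt_decomp v]
  simp [D]

lemma D_add {u v : Pt → ℝ} (hu : Differentiable ℝ u) (hv : Differentiable ℝ v) (a : Fin 4) :
    D a (fun p => u p + v p) = fun p => D a u p + D a v p := by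
  funext p
  unfold D
  rw [fderiv_fun_add (hu p) (hv p)]; rfl

lemma D_sub {u v : Pt → ℝ} (hu : Differentiable ℝ u) (hv : Differentiable ℝ v) (a : Fin 4) :
    D a (fun p => u p - v p) = fun p => D a u p - D a v p := by
  funext p
  unfold D
  rw [fderiv_fun_sub (hu p) (hv p)]; rfl

lemma D_neg {u : Pt → ℝ} (a : Fin 4) :
    D a (fun p => - u p) = fun p => - D a u p := by
  funext p
  unfold D
  rw [fderiv_fun_neg]; rfl

lemma D_mul {u v : Pt → ℝ} (hu : Differentiable ℝ u) (hv : Differentiable ℝ v) (a : Fin 4) :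
    D a (fun p => u p * v p) = fun p => D a u p * v p + u p * D a v p := by
  funext p
  unfold D
  rw [fderiv_fun_mul (hu p) (hv p)]
  simp; ring

lemma D_const (c : ℝ) (a : Fin 4) : D a (fun _ => c) = fun _ => 0 := by
  funext p
  simp [D]

lemma D_const_mul {u : Pt → ℝ} (hu : Differentiable ℝ u) (c : ℝ) (a : Fin 4) :
    D a (fun p => c * u p) = fun p => c * D a u p := by
  rw [D_mul (differentiable_const c) hu, D_const]; simp

lemma D_sum {ι : Type*} (s : Finset ι) {u : ι → Pt → ℝ} (hu : ∀ i ∈ s, Differentiable ℝ (u i))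
    (a : Fin 4) : D a (fun p => ∑ i ∈ s, u i p) = fun p => ∑ i ∈ s, D a (u i) p := by
  funext p
  unfold D
  rw [fderiv_fun_sum (fun i hi => hu i hi p)]
  simp

lemma contDiff_D {n m : WithTop ℕ∞} {u : Pt → ℝ} (hu : ContDiff ℝ n u) (h : m + 1 ≤ n) (a : Fin 4) :
    ContDiff ℝ m (D a u) :=
  (hu.fderiv_right h).clm_apply contDiff_const

lemma smooth_D {u : Pt → ℝ} (hu : ContDiff ℝ ∞ u) (a : Fin 4) : ContDiff ℝ ∞ (D a u) :=
  contDiff_D hu (by simp) a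

lemma D_comm {u : Pt → ℝ} (hu : ContDiff ℝ 2 u) (a b : Fin 4) : D a (D b u) = D b (D a u) := by
  funext p
  have hd : DifferentiableAt ℝ (fderiv ℝ u) p :=
    ((hu.fderiv_right (m := 1) (by norm_num)).differentiable (by norm_num)) p
  have key : ∀ c d : Fin 4, D c (D d u) p = fderiv ℝ (fderiv ℝ u) p (ev c) (ev d) := by
    intro c d
    have := (hd.hasFDerivAt.clm_apply (hasFDerivAt_const (ev d) p)).fderiv
    unfold D
    rw [this]; simp
  rw [key, key]
  have hs : IsSymmSndFDerivAt ℝ u p := hu.contDiffAt.isSymmSndFDerivAt (by simp)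
  exact hs.eq _ _

lemma diff_of_smooth {u : Pt → ℝ} (hu : ContDiff ℝ ∞ u) : Differentiable ℝ u :=
  hu.differentiable (by simp)

lemma ptd_eq {u : Pt → ℝ} {p : Pt} (hu : DifferentiableAt ℝ u p) : ptd u p = D 0 u p := by
  unfold ptd D
  have h1 : HasDerivAt (fun s : ℝ => ((s, p.2) : Pt)) (1, 0) p.1 :=
    (hasDerivAt_id p.1).prodMk (hasDerivAt_const _ _)
  have : HasDerivAt (fun s => u (s, p.2)) (fderiv ℝ u p (1, 0)) p.1 :=
    HasFDerivAt.comp_hasDerivAt (f := fun s : ℝ => ((s, p.2) : Pt)) p.1 hu.hasFDerivAt h1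
  simpa using this.deriv

lemma pxd_eq {u : Pt → ℝ} {p : Pt} (i : Fin 3) (hu : DifferentiableAt ℝ u p) :
    pxd i u p = D i.succ u p := by
  unfold pxd D
  have h0 : HasDerivAt (fun s : ℝ => Function.update p.2 i s) (Pi.single i 1) (p.2 i) :=
    hasDerivAt_update p.2 i (p.2 i)
  have h1 : HasDerivAt (fun s : ℝ => ((p.1, Function.update p.2 i s) : Pt)) (0, Pi.single i 1) (p.2 i) :=
    (hasDerivAt_const _ _).prodMk h0
  have h2 : ((p.1, Function.update p.2 i (p.2 i)) : Pt) = p := by simp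
  have h3 : HasFDerivAt u (fderiv ℝ u p) ((p.1, Function.update p.2 i (p.2 i)) : Pt) := by
    rw [h2]; exact hu.hasFDerivAt
  have : HasDerivAt (fun s => u (p.1, Function.update p.2 i s)) (fderiv ℝ u p (0, Pi.single i 1)) (p.2 i) :=
    HasFDerivAt.comp_hasDerivAt (f := fun s : ℝ => ((p.1, Function.update p.2 i s) : Pt)) (p.2 i) h3 h1
  simpa using this.deriv

/-- d'Alembertian in terms of `D`. -/
def bx (u : Pt → ℝ) (p : Pt) : ℝ := ∑ a, eta a * D a (D a u) p

lemma smooth_bx {u : Pt → ℝ} (hu : ContDiff ℝ ∞ u) : ContDiff ℝ ∞ (bx u) := by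
  unfold bx
  exact ContDiff.sum fun a _ => contDiff_const.mul (smooth_D (smooth_D hu a) a)

lemma box_eq {u : Pt → ℝ} (hu : ContDiff ℝ 2 u) (p : Pt) : box u p = bx u p := by
  have hd : Differentiable ℝ u := hu.differentiable (by norm_num)
  have hD : ∀ a, Differentiable ℝ (D a u) := fun a =>
    (contDiff_D (m := 1) hu (by norm_num) a).differentiable (by norm_num)
  have e0 : ptd u = D 0 u := funext fun p => ptd_eq (hd p)
  have e1 : ∀ i, pxd i u = D i.succ u := fun i => funext fun p => pxd_eq i (hd p)
  unfold box bx
  rw [Fin.sum_univ_succ (n := 3), e0, ptd_eq (hD 0 p)]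
  simp only [e1, eta_zero, eta_succ, neg_mul, one_mul]
  congr 1
  exact Finset.sum_congr rfl fun i _ => pxd_eq i (hD _ p)

lemma sgrad_eq {u : Pt → ℝ} {p : Pt} (hu : DifferentiableAt ℝ u p) : sgrad u p = fun a => D a u p := by
  unfold sgrad
  rw [ptd_eq hu, pxd_eq 0 hu, pxd_eq 1 hu, pxd_eq 2 hu]
  funext a
  fin_cases a <;> rfl

/-- Constant part of the coefficients of the Minkowski fields. -/
def va : Fin 11 → Fin 4 → ℝ :=
  ![Pi.single 0 1, Pi.single 1 1, Pi.single 2 1, Pi.single 3 1, 0, 0, 0, 0, 0, 0, 0]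

/-- Linear part of the coefficients: `vB n a b` is the coefficient of `X_b` in front of `∂_a`. -/
def vB : Fin 11 → Matrix (Fin 4) (Fin 4) ℝ :=
  ![0, 0, 0, 0, 1,
    !![0, -1, 0, 0; -1, 0, 0, 0; 0, 0, 0, 0; 0, 0, 0, 0],
    !![0, 0, -1, 0; 0, 0, 0, 0; -1, 0, 0, 0; 0, 0, 0, 0],
    !![0, 0, 0, -1; 0, 0, 0, 0; 0, 0, 0, 0; -1, 0, 0, 0],
    !![0, 0, 0, 0; 0, 0, -1, 0; 0, 1, 0, 0; 0, 0, 0, 0],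
    !![0, 0, 0, 0; 0, 0, 0, -1; 0, 0, 0, 0; 0, 1, 0, 0],
    !![0, 0, 0, 0; 0, 0, 0, 0; 0, 0, 0, -1; 0, 0, 1, 0]]

/-- Conformal factors. -/
def vmu : Fin 11 → ℝ := ![0, 0, 0, 0, 2, 0, 0, 0, 0, 0, 0]

lemma vB_conf (n : Fin 11) (a b : Fin 4) :
    eta b * vB n a b + eta a * vB n b a = vmu n * (if a = b then eta a else 0) := by
  fin_cases n <;> fin_cases a <;> fin_cases b <;> norm_num [vB, vmu, eta, Matrix.one_apply]

/-- Coefficients. -/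
def vc (n : Fin 11) (a : Fin 4) (p : Pt) : ℝ := va n a + ∑ b, vB n a b * Xc b p

/-- The Minkowski vector fields through `D`. -/
def Zf (n : Fin 11) (u : Pt → ℝ) (p : Pt) : ℝ := ∑ a, vc n a p * D a u p

lemma smooth_vc (n : Fin 11) (a : Fin 4) : ContDiff ℝ ∞ (vc n a) := by
  unfold vc
  exact contDiff_const.add (ContDiff.sum fun b _ => contDiff_const.mul (contDiff_Xc b))

lemma smooth_Zf {u : Pt → ℝ} (hu : ContDiff ℝ ∞ u) (n : Fin 11) : ContDiff ℝ ∞ (Zf n u) := by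
  unfold Zf
  exact ContDiff.sum fun a _ => (smooth_vc n a).mul (smooth_D hu a)

lemma D_vc (n : Fin 11) (a b : Fin 4) : D b (vc n a) = fun _ => vB n a b := by
  unfold vc
  rw [D_add (differentiable_const _) (diff_of_smooth
    (ContDiff.sum fun b _ => contDiff_const.mul (contDiff_Xc b))), D_const,
    D_sum _ (fun i _ => diff_of_smooth (contDiff_const.mul (contDiff_Xc i)))]
  funext p
  simp only [D_const_mul (diff_of_smooth (contDiff_Xc _)), D_Xc]
  simp

lemma c2_of_smooth {u : Pt → ℝ} (hu : ContDiff ℝ ∞ u) : ContDiff ℝ 2 u :=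
  contDiff_infty.mp hu 2

lemma Zf_add {u v : Pt → ℝ} (hu : ContDiff ℝ ∞ u) (hv : ContDiff ℝ ∞ v) (n : Fin 11) :
    Zf n (fun p => u p + v p) = fun p => Zf n u p + Zf n v p := by
  funext p
  simp only [Zf, D_add (diff_of_smooth hu) (diff_of_smooth hv), mul_add, Finset.sum_add_distrib]

lemma Zf_const_mul {u : Pt → ℝ} (hu : ContDiff ℝ ∞ u) (c : ℝ) (n : Fin 11) :
    Zf n (fun p => c * u p) = fun p => c * Zf n u p := by
  funext p
  simp only [Zf, D_const_mul (diff_of_smooth hu), Finset.mul_sum]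
  exact Finset.sum_congr rfl fun a _ => by ring

lemma Zf_mul {u v : Pt → ℝ} (hu : ContDiff ℝ ∞ u) (hv : ContDiff ℝ ∞ v) (n : Fin 11) :
    Zf n (fun p => u p * v p) = fun p => Zf n u p * v p + u p * Zf n v p := by
  funext p
  simp only [Zf, D_mul (diff_of_smooth hu) (diff_of_smooth hv), Finset.mul_sum, Finset.sum_mul,
    ← Finset.sum_add_distrib]
  exact Finset.sum_congr rfl fun a _ => by ring

lemma Zf_sum {ι : Type*} (s : Finset ι) {u : ι → Pt → ℝ} (hu : ∀ i ∈ s, ContDiff ℝ ∞ (u i))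
    (n : Fin 11) : Zf n (fun p => ∑ i ∈ s, u i p) = fun p => ∑ i ∈ s, Zf n (u i) p := by
  funext p
  simp only [Zf, D_sum s (fun i hi => diff_of_smooth (hu i hi)), Finset.mul_sum]
  rw [Finset.sum_comm]

lemma D_Zf {u : Pt → ℝ} (hu : ContDiff ℝ ∞ u) (n : Fin 11) (b : Fin 4) :
    D b (Zf n u) = fun p => Zf n (D b u) p + ∑ a, vB n a b * D a u p := by
  unfold Zf
  rw [D_sum _ (fun a _ => diff_of_smooth ((smooth_vc n a).mul (smooth_D hu a)))]
  funext p
  rw [← Finset.sum_add_distrib]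
  refine Finset.sum_congr rfl fun a _ => ?_
  rw [D_mul (diff_of_smooth (smooth_vc n a)) (diff_of_smooth (smooth_D hu a)), D_vc,
    D_comm (c2_of_smooth hu) b a]
  ring

lemma bx_Zf {u : Pt → ℝ} (hu : ContDiff ℝ ∞ u) (n : Fin 11) :
    bx (Zf n u) = fun p => Zf n (bx u) p + vmu n * bx u p := by
  funext p
  have h1 : ∀ b, D b (D b (Zf n u)) p = Zf n (D b (D b u)) p + 2 * ∑ a, vB n a b * D a (D b u) p := by
    intro b
    rw [D_Zf hu n b, D_add (diff_of_smooth (smooth_Zf (smooth_D hu b) n)) (diff_of_smooth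
      (ContDiff.sum fun a _ => contDiff_const.mul (smooth_D hu a))), D_Zf (smooth_D hu b) n b,
      D_sum _ (fun a _ => diff_of_smooth (contDiff_const.mul (smooth_D hu a)))]
    simp only [D_const_mul (diff_of_smooth (smooth_D hu _))]
    rw [add_assoc, two_mul]
    congr 2
    exact Finset.sum_congr rfl fun a _ => by rw [D_comm (c2_of_smooth hu) b a]
  have h2 : Zf n (bx u) p = ∑ b, eta b * Zf n (D b (D b u)) p := by
    unfold bx
    rw [Zf_sum _ (fun b _ => contDiff_const.mul (smooth_D (smooth_D hu b) b))]
    simp only [Zf_const_mul (smooth_D (smooth_D hu _) _)]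
  have h3 : ∑ b, eta b * (2 * ∑ a, vB n a b * D a (D b u) p) = vmu n * bx u p := by
    have : ∑ b, eta b * (2 * ∑ a, vB n a b * D a (D b u) p)
        = ∑ a, ∑ b, (eta b * vB n a b + eta a * vB n b a) * D a (D b u) p := by
      simp only [add_mul, Finset.sum_add_distrib]
      have e2 : ∑ a, ∑ b, eta a * vB n b a * D a (D b u) p
          = ∑ a, ∑ b, eta b * vB n a b * D a (D b u) p := by
        rw [Finset.sum_comm]
        refine Finset.sum_congr rfl fun a _ => Finset.sum_congr rfl fun b _ => ?_
        rw [D_comm (c2_of_smooth hu) b a]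
      rw [e2, ← two_mul, Finset.sum_comm, Finset.mul_sum]
      refine Finset.sum_congr rfl fun b _ => ?_
      rw [Finset.mul_sum, Finset.mul_sum, Finset.mul_sum]
      exact Finset.sum_congr rfl fun a _ => by ring
    rw [this]
    simp only [vB_conf]
    unfold bx
    rw [Finset.mul_sum]
    refine Finset.sum_congr rfl fun a _ => ?_
    simp [mul_ite, ite_mul]
    ring
  rw [h2, ← h3, ← Finset.sum_add_distrib]
  unfold bx
  refine Finset.sum_congr rfl fun b _ => ?_
  rw [h1]; ring

/-- Words in the vector fields. -/
def Zw (I : List (Fin 11)) (u : Pt → ℝ) : Pt → ℝ := I.foldr Zf u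

@[simp] lemma Zw_nil (u : Pt → ℝ) : Zw [] u = u := rfl
@[simp] lemma Zw_cons (n : Fin 11) (I : List (Fin 11)) (u : Pt → ℝ) : Zw (n :: I) u = Zf n (Zw I u) := rfl
lemma Zw_append (I J : List (Fin 11)) (u : Pt → ℝ) : Zw (I ++ J) u = Zw I (Zw J u) := by
  simp [Zw, List.foldr_append]
lemma Zw_snoc (I : List (Fin 11)) (n : Fin 11) (u : Pt → ℝ) : Zw (I ++ [n]) u = Zw I (Zf n u) := by
  rw [Zw_append]; rfl

lemma smooth_Zw {u : Pt → ℝ} (hu : ContDiff ℝ ∞ u) (I : List (Fin 11)) : ContDiff ℝ ∞ (Zw I u) := by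
  induction I with
  | nil => exact hu
  | cons n I ih => exact smooth_Zf ih n

lemma Zw_add {u v : Pt → ℝ} (hu : ContDiff ℝ ∞ u) (hv : ContDiff ℝ ∞ v) (I : List (Fin 11)) :
    Zw I (fun p => u p + v p) = fun p => Zw I u p + Zw I v p := by
  induction I with
  | nil => rfl
  | cons n I ih => rw [Zw_cons, ih, Zf_add (smooth_Zw hu I) (smooth_Zw hv I)]; rfl

lemma Zw_const_mul {u : Pt → ℝ} (hu : ContDiff ℝ ∞ u) (c : ℝ) (I : List (Fin 11)) :
    Zw I (fun p => c * u p) = fun p => c * Zw I u p := by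
  induction I with
  | nil => rfl
  | cons n I ih => rw [Zw_cons, ih, Zf_const_mul (smooth_Zw hu I)]; rfl

lemma Zw_sum {ι : Type*} (s : Finset ι) {u : ι → Pt → ℝ} (hu : ∀ i ∈ s, ContDiff ℝ ∞ (u i))
    (I : List (Fin 11)) : Zw I (fun p => ∑ i ∈ s, u i p) = fun p => ∑ i ∈ s, Zw I (u i) p := by
  induction I with
  | nil => rfl
  | cons n I ih => rw [Zw_cons, ih, Zf_sum s (fun i hi => smooth_Zw (hu i hi) I)]; rfl

lemma Zw_sub {u v : Pt → ℝ} (hu : ContDiff ℝ ∞ u) (hv : ContDiff ℝ ∞ v) (I : List (Fin 11)) :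
    Zw I (fun p => u p - v p) = fun p => Zw I u p - Zw I v p := by
  have h : (fun p => u p - v p) = fun p => u p + (-1) * v p := by funext p; ring
  rw [h, Zw_add hu (contDiff_const.mul hv), Zw_const_mul hv]
  funext p; ring

/-- Words of length at most `k`. -/
def wds (k : ℕ) : Finset (List (Fin 11)) := (List.finite_length_le (Fin 11) k).toFinset
@[simp] lemma mem_wds {k : ℕ} {I : List (Fin 11)} : I ∈ wds k ↔ I.length ≤ k := by
  simp [wds]
attribute [irreducible] wds

/-- Japanese bracket. -/
def jb (x : Spc) : ℝ := Real.sqrt (1 + ∑ i, x i ^ 2)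

lemma jb_sq (x : Spc) : jb x ^ 2 = 1 + ∑ i, x i ^ 2 := by
  unfold jb
  rw [Real.sq_sqrt]
  have : 0 ≤ ∑ i, x i ^ 2 := Finset.sum_nonneg fun i _ => sq_nonneg _
  linarith

lemma jb_ge_one (x : Spc) : 1 ≤ jb x := by
  unfold jb
  rw [Real.one_le_sqrt]
  have : 0 ≤ ∑ i, x i ^ 2 := Finset.sum_nonneg fun i _ => sq_nonneg _
  linarith

lemma jb_pos (x : Spc) : 0 < jb x := lt_of_lt_of_le one_pos (jb_ge_one x)

lemma smooth_jb : ContDiff ℝ ∞ (fun p : Pt => jb p.2) := by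
  unfold jb
  apply ContDiff.sqrt
  · exact contDiff_const.add (ContDiff.sum fun i _ => by fun_prop)
  · intro p
    have : 0 ≤ ∑ i, p.2 i ^ 2 := Finset.sum_nonneg fun i _ => sq_nonneg _
    linarith

/-- `Σ |∂u|²`. -/
def dsq (u : Pt → ℝ) (p : Pt) : ℝ := ∑ a, D a u p ^ 2

/-- Sum of the squares of the good derivatives. -/
def tsq (u : Pt → ℝ) (p : Pt) : ℝ :=
  (∑ i : Fin 3, (D i.succ u p + p.2 i / jb p.2 * D 0 u p) ^ 2) + (D 0 u p / jb p.2) ^ 2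

lemma dsq_nonneg (u : Pt → ℝ) (p : Pt) : 0 ≤ dsq u p := Finset.sum_nonneg fun _ _ => sq_nonneg _
lemma tsq_nonneg (u : Pt → ℝ) (p : Pt) : 0 ≤ tsq u p :=
  add_nonneg (Finset.sum_nonneg fun _ _ => sq_nonneg _) (sq_nonneg _)

lemma D_sq_le_dsq (u : Pt → ℝ) (p : Pt) (a : Fin 4) : D a u p ^ 2 ≤ dsq u p :=
  Finset.single_le_sum (f := fun a => D a u p ^ 2) (fun _ _ => sq_nonneg _) (Finset.mem_univ a)

/-- Bilinear forms in the gradients. -/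
def QF (M : Matrix (Fin 4) (Fin 4) ℝ) (u v : Pt → ℝ) (p : Pt) : ℝ :=
  ∑ a, ∑ b, M a b * (D a u p * D b v p)

/-- Null condition for the matrix of a bilinear form. -/
def NullM (M : Matrix (Fin 4) (Fin 4) ℝ) : Prop :=
  ∃ l : ℝ, ∀ a b, M a b + M b a = l * (if a = b then eta a else 0)

lemma smooth_QF (M : Matrix (Fin 4) (Fin 4) ℝ) {u v : Pt → ℝ} (hu : ContDiff ℝ ∞ u)
    (hv : ContDiff ℝ ∞ v) : ContDiff ℝ ∞ (QF M u v) := by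
  unfold QF
  exact ContDiff.sum fun a _ => ContDiff.sum fun b _ =>
    contDiff_const.mul ((smooth_D hu a).mul (smooth_D hv b))

lemma bil_cs (M : Matrix (Fin 4) (Fin 4) ℝ) (A B : Fin 4 → ℝ) :
    (∑ a, ∑ b, M a b * (A a * B b)) ^ 2 ≤ (∑ a, ∑ b, M a b ^ 2) * ((∑ a, A a ^ 2) * ∑ b, B b ^ 2) := by
  have h := Finset.sum_mul_sq_le_sq_mul_sq (Finset.univ : Finset (Fin 4 × Fin 4))
    (fun x => M x.1 x.2) (fun x => A x.1 * B x.2)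
  rw [Fintype.sum_prod_type, Fintype.sum_prod_type, Fintype.sum_prod_type] at h
  have e : ∑ a, ∑ b, (A a * B b) ^ 2 = (∑ a, A a ^ 2) * ∑ b, B b ^ 2 := by
    rw [Finset.sum_mul_sum]
    exact Finset.sum_congr rfl fun a _ => Finset.sum_congr rfl fun b _ => by ring
  simpa [e] using h

lemma null_alg (M : Matrix (Fin 4) (Fin 4) ℝ) (hM : NullM M) :
    ∃ C : ℝ, 0 ≤ C ∧ ∀ (u v : Pt → ℝ) (p : Pt),
      QF M u v p ^ 2 ≤ C * (tsq u p * dsq v p + dsq u p * tsq v p) := by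
  obtain ⟨l, hl⟩ := hM
  set m := ∑ a, ∑ b, M a b ^ 2 with hm
  have hm0 : 0 ≤ m := Finset.sum_nonneg fun _ _ => Finset.sum_nonneg fun _ _ => sq_nonneg _
  refine ⟨6 * m + l ^ 2, by positivity, fun u v p => ?_⟩
  set j := jb p.2 with hj
  have hjp : 0 < j := jb_pos _
  have hj2 : j ^ 2 = 1 + ∑ i, p.2 i ^ 2 := jb_sq _
  set k : Fin 4 → ℝ := Fin.cons 1 (fun i => - (p.2 i / j)) with hk
  set TX : Fin 4 → ℝ := Fin.cons 0 (fun i => D i.succ u p + p.2 i / j * D 0 u p) with hTX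
  set TY : Fin 4 → ℝ := Fin.cons 0 (fun i => D i.succ v p + p.2 i / j * D 0 v p) with hTY
  have dX : ∀ a, D a u p = D 0 u p * k a + TX a := by
    intro a; refine Fin.cases ?_ (fun i => ?_) a
    · simp [hk, hTX]
    · simp [hk, hTX]; ring
  have dY : ∀ a, D a v p = D 0 v p * k a + TY a := by
    intro a; refine Fin.cases ?_ (fun i => ?_) a
    · simp [hk, hTY]
    · simp [hk, hTY]; ring
  have hsumθ : ∑ i, (p.2 i / j) ^ 2 = 1 - 1 / j ^ 2 := by
    simp only [div_pow]
    rw [← Finset.sum_div, eq_sub_iff_add_eq, ← add_div, div_eq_one_iff_eq (by positivity)]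
    linarith
  have kk : ∑ a, ∑ b, M a b * (k a * k b) = - (l / 2) / j ^ 2 := by
    have h1 : 2 * ∑ a, ∑ b, M a b * (k a * k b) = ∑ a, ∑ b, (M a b + M b a) * (k a * k b) := by
      simp only [add_mul, Finset.sum_add_distrib]
      rw [two_mul]; congr 1
      rw [Finset.sum_comm]
      exact Finset.sum_congr rfl fun a _ => Finset.sum_congr rfl fun b _ => by ring
    have h2 : ∑ a, ∑ b, (M a b + M b a) * (k a * k b) = l * ∑ a, eta a * k a ^ 2 := by
      simp only [hl]
      rw [Finset.mul_sum]
      refine Finset.sum_congr rfl fun a _ => ?_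
      simp [mul_ite, ite_mul]; ring
    have h3 : ∑ a, eta a * k a ^ 2 = - (1 / j ^ 2) := by
      rw [Fin.sum_univ_succ]
      simp only [hk, Fin.cons_zero, Fin.cons_succ, eta_zero, eta_succ, one_mul, neg_sq]
      rw [hsumθ]; ring
    have : ∑ a, ∑ b, M a b * (k a * k b) = (l * (-(1 / j ^ 2))) / 2 := by
      rw [← h3, ← h2, ← h1]; ring
    rw [this]; ring
  have hdec : QF M u v p = (∑ a, ∑ b, M a b * (TX a * D b v p))
      + D 0 u p * (∑ a, ∑ b, M a b * (k a * TY b)) + D 0 u p * D 0 v p * (- (l / 2) / j ^ 2) := by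
    rw [← kk]
    unfold QF
    simp only [Finset.mul_sum, ← Finset.sum_add_distrib]
    refine Finset.sum_congr rfl fun a _ => Finset.sum_congr rfl fun b _ => ?_
    have h1 := dX a
    have h2 := dY b
    rw [h1, h2]; ring
  have b1 := bil_cs M TX (fun b => D b v p)
  have b2 := bil_cs M k TY
  have hk2 : ∑ a, k a ^ 2 ≤ 2 := by
    rw [Fin.sum_univ_succ]
    simp only [hk, Fin.cons_zero, Fin.cons_succ, neg_sq]
    rw [hsumθ]
    have : 0 ≤ 1 / j ^ 2 := by positivity
    linarith
  have tX : ∑ a, TX a ^ 2 ≤ tsq u p := by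
    rw [Fin.sum_univ_succ]
    simp only [hTX, Fin.cons_zero, Fin.cons_succ, tsq]
    nlinarith [sq_nonneg (D 0 u p / jb p.2)]
  have tY : ∑ a, TY a ^ 2 ≤ tsq v p := by
    rw [Fin.sum_univ_succ]
    simp only [hTY, Fin.cons_zero, Fin.cons_succ, tsq]
    nlinarith [sq_nonneg (D 0 v p / jb p.2)]
  have t0X : (D 0 u p / j) ^ 2 ≤ tsq u p := by
    unfold tsq
    have : 0 ≤ ∑ i : Fin 3, (D i.succ u p + p.2 i / jb p.2 * D 0 u p) ^ 2 :=
      Finset.sum_nonneg fun _ _ => sq_nonneg _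
    linarith
  have t0Y : (D 0 v p / j) ^ 2 ≤ dsq v p := by
    refine le_trans ?_ (D_sq_le_dsq v p 0)
    rw [div_pow]
    apply div_le_self (sq_nonneg _)
    rw [hj2]
    have : 0 ≤ ∑ i, p.2 i ^ 2 := Finset.sum_nonneg fun i _ => sq_nonneg _
    linarith
  have d0X := D_sq_le_dsq u p 0
  have nX := tsq_nonneg u p
  have nY := tsq_nonneg v p
  have mX := dsq_nonneg u p
  have mY := dsq_nonneg v p
  have c1 : (∑ a, ∑ b, M a b * (TX a * D b v p)) ^ 2 ≤ m * (tsq u p * dsq v p) := by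
    refine b1.trans ?_
    gcongr
    exact le_of_eq rfl
  have c2 : (D 0 u p * (∑ a, ∑ b, M a b * (k a * TY b))) ^ 2 ≤ m * (2 * (dsq u p * tsq v p)) := by
    rw [mul_pow]
    calc _ ≤ dsq u p * (m * (2 * tsq v p)) := by
          gcongr
          refine b2.trans ?_
          gcongr
      _ = _ := by ring
  have c3 : (D 0 u p * D 0 v p * (- (l / 2) / j ^ 2)) ^ 2 ≤ l ^ 2 / 4 * (tsq u p * dsq v p) := by
    have : (D 0 u p * D 0 v p * (- (l / 2) / j ^ 2)) ^ 2
        = l ^ 2 / 4 * ((D 0 u p / j) ^ 2 * (D 0 v p / j) ^ 2) := by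
      field_simp
      ring
    rw [this]
    gcongr
  rw [hdec]
  generalize (∑ a, ∑ b, M a b * (TX a * D b v p)) = A at *
  generalize (D 0 u p * (∑ a, ∑ b, M a b * (k a * TY b))) = B at *
  generalize (D 0 u p * D 0 v p * (- (l / 2) / j ^ 2)) = E at *
  have h3 : (A + B + E) ^ 2 ≤ 3 * (A ^ 2 + B ^ 2 + E ^ 2) := by
    nlinarith [sq_nonneg (A - B), sq_nonneg (A - E), sq_nonneg (B - E)]
  have q1 : 0 ≤ tsq u p * dsq v p := by positivity
  have q2 : 0 ≤ dsq u p * tsq v p := by positivity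
  nlinarith [mul_nonneg hm0 q1, mul_nonneg hm0 q2, mul_nonneg (sq_nonneg l) q1, mul_nonneg (sq_nonneg l) q2]

lemma Zf_QF (M : Matrix (Fin 4) (Fin 4) ℝ) {u v : Pt → ℝ} (hu : ContDiff ℝ ∞ u)
    (hv : ContDiff ℝ ∞ v) (n : Fin 11) :
    Zf n (QF M u v) = fun p => QF M (Zf n u) v p + (QF M u (Zf n v) p
      + QF (-(vB n * M + M * (vB n).transpose)) u v p) := by
  funext p
  unfold QF
  have hA : Zf n (fun p => ∑ a, ∑ b, M a b * (D a u p * D b v p)) p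
      = ∑ a, ∑ b, Zf n (fun p => M a b * (D a u p * D b v p)) p := by
    have := congrFun (Zf_sum (u := fun a p => ∑ b, M a b * (D a u p * D b v p)) Finset.univ
      (fun a _ => ContDiff.sum fun b _ =>
      contDiff_const.mul ((smooth_D hu a).mul (smooth_D hv b))) n) p
    refine this.trans (Finset.sum_congr rfl fun a _ => ?_)
    exact congrFun (Zf_sum (u := fun b p => M a b * (D a u p * D b v p)) Finset.univ (fun b _ =>
      contDiff_const.mul ((smooth_D hu a).mul (smooth_D hv b))) n) p
  rw [show Zf n (fun p => ∑ a, ∑ b, M a b * (D a u p * D b v p)) p = _ from hA]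
  simp only [Zf_const_mul ((smooth_D hu _).mul (smooth_D hv _)), Zf_mul (smooth_D hu _) (smooth_D hv _),
    D_Zf hu, D_Zf hv, Matrix.neg_apply, Matrix.add_apply, Matrix.mul_apply, Matrix.transpose_apply,
    mul_add, add_mul, neg_mul, neg_add, Finset.sum_add_distrib, Finset.sum_neg_distrib, Finset.sum_mul,
    Finset.mul_sum]
  have e1 : ∑ x, ∑ x_1, ∑ i, M x x_1 * (vB n i x * D i u p * D x_1 v p)
     = ∑ x, ∑ x_1, ∑ i, vB n x i * M i x_1 * (D x u p * D x_1 v p) := by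
    rw [Finset.sum_comm]
    conv_rhs => rw [Finset.sum_comm]
    refine Finset.sum_congr rfl fun b _ => ?_
    rw [Finset.sum_comm]
    exact Finset.sum_congr rfl fun a _ => Finset.sum_congr rfl fun c _ => by ring
  have e2 : ∑ x, ∑ x_1, ∑ i, M x x_1 * (D x u p * (vB n i x_1 * D i v p))
     = ∑ x, ∑ x_1, ∑ i, M x i * vB n x_1 i * (D x u p * D x_1 v p) := by
    refine Finset.sum_congr rfl fun b _ => ?_
    rw [Finset.sum_comm]
    exact Finset.sum_congr rfl fun a _ => Finset.sum_congr rfl fun c _ => by ring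
  rw [e1, e2]
  ring

lemma NullM_step {M : Matrix (Fin 4) (Fin 4) ℝ} (hM : NullM M) (n : Fin 11) :
    NullM (-(vB n * M + M * (vB n).transpose)) := by
  obtain ⟨l, hl⟩ := hM
  refine ⟨-(l * vmu n), fun a b => ?_⟩
  have hc := vB_conf n a b
  simp only [Matrix.neg_apply, Matrix.add_apply, Matrix.mul_apply, Matrix.transpose_apply]
  have h1 : ∑ c, vB n a c * M c b + ∑ c, M b c * vB n a c = l * (vB n a b * eta b) := by
    rw [← Finset.sum_add_distrib]
    have : ∀ c, vB n a c * M c b + M b c * vB n a c = vB n a c * (l * (if c = b then eta c else 0)) := by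
      intro c; rw [← hl]; ring
    simp only [this]
    simp [mul_ite]; ring
  have h2 : ∑ c, vB n b c * M c a + ∑ c, M a c * vB n b c = l * (vB n b a * eta a) := by
    rw [← Finset.sum_add_distrib]
    have : ∀ c, vB n b c * M c a + M a c * vB n b c = vB n b c * (l * (if c = a then eta c else 0)) := by
      intro c; rw [← hl]; ring
    simp only [this]
    simp [mul_ite]; ring
  have : l * (vB n a b * eta b) + l * (vB n b a * eta a) = l * vmu n * (if a = b then eta a else 0) := by
    rw [mul_assoc, ← hc]; ring
  linarith

/-- uniform bounds over a finite index set -/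
lemma sum_bd {ι X : Type*} (s : Finset ι) (f : ι → X → ℝ) (g : X → ℝ)
    (h : ∀ i ∈ s, ∃ C : ℝ, 0 ≤ C ∧ ∀ x, f i x ≤ C * g x) :
    ∃ C : ℝ, 0 ≤ C ∧ ∀ x, ∑ i ∈ s, f i x ≤ C * g x := by
  classical
  induction s using Finset.induction_on with
  | empty => exact ⟨0, le_refl _, by simp⟩
  | insert a s ha ih =>
    obtain ⟨C1, h1, h2⟩ := h a (by simp)
    obtain ⟨C2, h3, h4⟩ := ih (fun i hi => h i (by simp [hi]))
    refine ⟨C1 + C2, by positivity, fun x => ?_⟩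
    rw [Finset.sum_insert ha, add_mul]
    exact add_le_add (h2 x) (h4 x)

/-- smooth functions -/
abbrev Sm := {u : Pt → ℝ // ContDiff ℝ ∞ u}

/-- sum over words of squares -/
def sW (k : ℕ) (f : Pt → ℝ) (p : Pt) : ℝ := ∑ J ∈ wds k, Zw J f p ^ 2
def eW (k : ℕ) (u : Pt → ℝ) (p : Pt) : ℝ := ∑ J ∈ wds k, dsq (Zw J u) p
def tW (k : ℕ) (u : Pt → ℝ) (p : Pt) : ℝ := ∑ J ∈ wds k, tsq (Zw J u) p

lemma sW_nonneg (k : ℕ) (f : Pt → ℝ) (p : Pt) : 0 ≤ sW k f p :=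
  Finset.sum_nonneg fun _ _ => sq_nonneg _
lemma eW_nonneg (k : ℕ) (f : Pt → ℝ) (p : Pt) : 0 ≤ eW k f p :=
  Finset.sum_nonneg fun _ _ => dsq_nonneg _ _
lemma tW_nonneg (k : ℕ) (f : Pt → ℝ) (p : Pt) : 0 ≤ tW k f p :=
  Finset.sum_nonneg fun _ _ => tsq_nonneg _ _
lemma le_sW {k : ℕ} {J : List (Fin 11)} (hJ : J.length ≤ k) (f : Pt → ℝ) (p : Pt) :
    Zw J f p ^ 2 ≤ sW k f p :=
  Finset.single_le_sum (f := fun J => Zw J f p ^ 2) (fun _ _ => sq_nonneg _) (mem_wds.2 hJ)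
lemma le_eW {k : ℕ} {J : List (Fin 11)} (hJ : J.length ≤ k) (f : Pt → ℝ) (p : Pt) :
    dsq (Zw J f) p ≤ eW k f p :=
  Finset.single_le_sum (f := fun J => dsq (Zw J f) p) (fun _ _ => dsq_nonneg _ _) (mem_wds.2 hJ)
lemma le_tW {k : ℕ} {J : List (Fin 11)} (hJ : J.length ≤ k) (f : Pt → ℝ) (p : Pt) :
    tsq (Zw J f) p ≤ tW k f p :=
  Finset.single_le_sum (f := fun J => tsq (Zw J f) p) (fun _ _ => tsq_nonneg _ _) (mem_wds.2 hJ)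

lemma wds_mono {k l : ℕ} (h : k ≤ l) : wds k ⊆ wds l := fun J hJ =>
  mem_wds.2 ((mem_wds.1 hJ).trans h)
lemma sW_mono {k l : ℕ} (h : k ≤ l) (f : Pt → ℝ) (p : Pt) : sW k f p ≤ sW l f p :=
  Finset.sum_le_sum_of_subset_of_nonneg (wds_mono h) fun _ _ _ => sq_nonneg _
lemma eW_mono {k l : ℕ} (h : k ≤ l) (f : Pt → ℝ) (p : Pt) : eW k f p ≤ eW l f p :=
  Finset.sum_le_sum_of_subset_of_nonneg (wds_mono h) fun _ _ _ => dsq_nonneg _ _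

lemma sW_Zf (k : ℕ) (n : Fin 11) : ∃ C : ℝ, 0 ≤ C ∧ ∀ x : (Pt → ℝ) × Pt,
    sW k (Zf n x.1) x.2 ≤ C * sW (k + 1) x.1 x.2 := by
  have key := sum_bd (wds k) (fun J (x : (Pt → ℝ) × Pt) => Zw J (Zf n x.1) x.2 ^ 2) (fun x => sW (k+1) x.1 x.2)
  refine key fun J hJ => ?_
  refine ⟨1, zero_le_one, fun x => ?_⟩
  rw [one_mul, ← Zw_snoc]
  exact le_sW (by simpa using mem_wds.1 hJ) _ _

lemma eW_Zf (k : ℕ) (n : Fin 11) : ∃ C : ℝ, 0 ≤ C ∧ ∀ x : (Pt → ℝ) × Pt,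
    eW k (Zf n x.1) x.2 ≤ C * eW (k + 1) x.1 x.2 := by
  have key := sum_bd (wds k) (fun J (x : (Pt → ℝ) × Pt) => dsq (Zw J (Zf n x.1)) x.2) (fun x => eW (k+1) x.1 x.2)
  refine key fun J hJ => ?_
  refine ⟨1, zero_le_one, fun x => ?_⟩
  rw [one_mul, ← Zw_snoc]
  exact le_eW (by simpa using mem_wds.1 hJ) _ _

lemma sq_add_le (a b : ℝ) : (a + b) ^ 2 ≤ 2 * a ^ 2 + 2 * b ^ 2 := by nlinarith [sq_nonneg (a - b)]

lemma comm_bx1 (I : List (Fin 11)) : ∃ C : ℝ, 0 ≤ C ∧ ∀ x : Sm × Pt,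
    bx (Zw I x.1.1) x.2 ^ 2 ≤ C * sW I.length (bx x.1.1) x.2 := by
  induction I using List.reverseRecOn with
  | nil => exact ⟨1, zero_le_one, fun x => by rw [one_mul]; exact le_sW (J := []) (le_refl _) (bx x.1.1) _⟩
  | append_singleton I n ih =>
    obtain ⟨C, hC, h⟩ := ih
    obtain ⟨C1, hC1, h1⟩ := sW_Zf I.length n
    refine ⟨C * (2 * C1 + 2 * vmu n ^ 2), by positivity, fun ⟨⟨u, hu⟩, p⟩ => ?_⟩
    simp only
    rw [Zw_snoc]
    refine (h ⟨⟨Zf n u, smooth_Zf hu n⟩, p⟩).trans ?_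
    simp only
    rw [mul_assoc]
    gcongr
    have e : sW I.length (bx (Zf n u)) p
        ≤ 2 * sW I.length (Zf n (bx u)) p + 2 * vmu n ^ 2 * sW I.length (bx u) p := by
      unfold sW
      rw [Finset.mul_sum, Finset.mul_sum, ← Finset.sum_add_distrib]
      refine Finset.sum_le_sum fun J _ => ?_
      rw [bx_Zf hu, Zw_add (smooth_Zf (smooth_bx hu) n) (contDiff_const.mul (smooth_bx hu)),
        Zw_const_mul (smooth_bx hu)]
      refine (sq_add_le _ _).trans (le_of_eq ?_)
      ring
    refine e.trans ?_
    rw [List.length_append, List.length_singleton]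
    have := h1 (bx u, p)
    have h2 := sW_mono (Nat.le_succ I.length) (bx u) p
    simp only at this
    have h3 : 0 ≤ 2 * vmu n ^ 2 := by positivity
    have := mul_le_mul_of_nonneg_left h2 h3
    simp only [Nat.succ_eq_add_one] at this
    linarith

lemma comm_bx (k : ℕ) : ∃ C : ℝ, 0 ≤ C ∧ ∀ x : Sm × Pt,
    ∑ I ∈ wds k, bx (Zw I x.1.1) x.2 ^ 2 ≤ C * sW k (bx x.1.1) x.2 := by
  refine sum_bd (wds k) (fun I (x : Sm × Pt) => bx (Zw I x.1.1) x.2 ^ 2)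
    (fun x => sW k (bx x.1.1) x.2) fun I hI => ?_
  obtain ⟨C, hC, h⟩ := comm_bx1 I
  exact ⟨C, hC, fun x => (h x).trans (mul_le_mul_of_nonneg_left (sW_mono (mem_wds.1 hI) _ _) hC)⟩

lemma comm_D1 (I : List (Fin 11)) (a : Fin 4) : ∃ C : ℝ, 0 ≤ C ∧ ∀ x : Sm × Pt,
    Zw I (D a x.1.1) x.2 ^ 2 ≤ C * eW I.length x.1.1 x.2 := by
  induction I using List.reverseRecOn generalizing a with
  | nil => exact ⟨1, zero_le_one, fun x => by
      rw [one_mul]; exact (D_sq_le_dsq _ _ _).trans (le_eW (J := []) (le_refl _) _ _)⟩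
  | append_singleton I n ih =>
    choose C hC h using ih
    obtain ⟨C1, hC1, h1⟩ := eW_Zf I.length n
    refine ⟨2 * (C a * C1) + 2 * (4 * ∑ b, vB n b a ^ 2 * C b), by
      have : 0 ≤ ∑ b, vB n b a ^ 2 * C b := Finset.sum_nonneg fun b _ =>
        mul_nonneg (sq_nonneg _) (hC b)
      have := mul_nonneg (hC a) hC1
      positivity, fun ⟨⟨u, hu⟩, p⟩ => ?_⟩
    simp only
    rw [Zw_snoc]
    have hD : Zf n (D a u) = fun p => D a (Zf n u) p + ∑ b, (-vB n b a) * D b u p := by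
      rw [D_Zf hu]; funext p; simp
    rw [hD, Zw_add (smooth_D (smooth_Zf hu n) a) (ContDiff.sum fun b _ => contDiff_const.mul (smooth_D hu b)),
      Zw_sum _ (fun b _ => contDiff_const.mul (smooth_D hu b))]
    refine (sq_add_le _ _).trans ?_
    rw [add_mul, List.length_append, List.length_singleton]
    refine add_le_add ?_ ?_
    · rw [mul_assoc]
      gcongr
      refine (h a ⟨⟨Zf n u, smooth_Zf hu n⟩, p⟩).trans ?_
      rw [mul_assoc]
      exact mul_le_mul_of_nonneg_left (h1 (u, p)) (hC a)
    · rw [mul_assoc, mul_assoc]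
      gcongr
      refine (sq_sum_le_card_mul_sum_sq).trans ?_
      simp only [Finset.card_univ, Fintype.card_fin, Nat.cast_ofNat]
      gcongr
      rw [Finset.sum_mul]
      refine Finset.sum_le_sum fun b _ => ?_
      rw [Zw_const_mul (smooth_D hu b)]
      simp only
      rw [mul_pow, neg_sq, mul_assoc]
      gcongr
      refine (h b ⟨⟨u, hu⟩, p⟩).trans ?_
      exact mul_le_mul_of_nonneg_left (eW_mono (Nat.le_succ _) _ _) (hC b)

/-- pairs of words of total length at most `k` -/
def pw (k : ℕ) : Finset (List (Fin 11) × List (Fin 11)) :=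
  ((wds k) ×ˢ (wds k)).filter fun x => x.1.length + x.2.length ≤ k

lemma mem_pw {k : ℕ} {x : List (Fin 11) × List (Fin 11)} :
    x ∈ pw k ↔ x.1.length + x.2.length ≤ k := by
  unfold pw
  simp only [Finset.mem_filter, Finset.mem_product, mem_wds]
  omega
attribute [irreducible] pw

def nt (u v : Pt → ℝ) (p : Pt) : ℝ := tsq u p * dsq v p + dsq u p * tsq v p
def NQ (k : ℕ) (u v : Pt → ℝ) (p : Pt) : ℝ := ∑ x ∈ pw k, nt (Zw x.1 u) (Zw x.2 v) p

lemma nt_nonneg (u v : Pt → ℝ) (p : Pt) : 0 ≤ nt u v p :=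
  add_nonneg (mul_nonneg (tsq_nonneg _ _) (dsq_nonneg _ _))
    (mul_nonneg (dsq_nonneg _ _) (tsq_nonneg _ _))

lemma le_NQ {k : ℕ} {J K : List (Fin 11)} (h : J.length + K.length ≤ k) (u v : Pt → ℝ) (p : Pt) :
    nt (Zw J u) (Zw K v) p ≤ NQ k u v p := by
  have hm : (J, K) ∈ pw k := mem_pw.2 h
  unfold NQ
  have key := Finset.single_le_sum (s := pw k) (a := (J, K))
    (f := fun x : List (Fin 11) × List (Fin 11) => nt (Zw x.1 u) (Zw x.2 v) p)
    (fun _ _ => nt_nonneg _ _ _) hm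
  exact key

lemma NQ_mono {k l : ℕ} (h : k ≤ l) (u v : Pt → ℝ) (p : Pt) : NQ k u v p ≤ NQ l u v p :=
  Finset.sum_le_sum_of_subset_of_nonneg (fun x hx => mem_pw.2 ((mem_pw.1 hx).trans h))
    fun _ _ _ => nt_nonneg _ _ _

lemma NQ_Zf (k : ℕ) (n : Fin 11) : ∃ C : ℝ, 0 ≤ C ∧ ∀ x : (Pt → ℝ) × (Pt → ℝ) × Pt,
    NQ k (Zf n x.1) x.2.1 x.2.2 + NQ k x.1 (Zf n x.2.1) x.2.2 ≤ C * NQ (k + 1) x.1 x.2.1 x.2.2 := by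
  have h := sum_bd (pw k) (fun J (x : (Pt → ℝ) × (Pt → ℝ) × Pt) =>
      nt (Zw J.1 (Zf n x.1)) (Zw J.2 x.2.1) x.2.2 + nt (Zw J.1 x.1) (Zw J.2 (Zf n x.2.1)) x.2.2)
    (fun x => NQ (k + 1) x.1 x.2.1 x.2.2) (by
      intro J hJ
      have hJ := mem_pw.1 hJ
      refine ⟨2, zero_le_two, fun x => ?_⟩
      rw [← Zw_snoc, ← Zw_snoc, two_mul]
      refine add_le_add (le_NQ ?_ _ _ _) (le_NQ ?_ _ _ _)
      · simp; omega
      · simp; omega)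
  obtain ⟨C, hC, h⟩ := h
  refine ⟨C, hC, fun x => ?_⟩
  have := h x
  rwa [Finset.sum_add_distrib] at this

lemma comm_QF1 (I : List (Fin 11)) (M : Matrix (Fin 4) (Fin 4) ℝ) (hM : NullM M) :
    ∃ C : ℝ, 0 ≤ C ∧ ∀ x : Sm × Sm × Pt,
    Zw I (QF M x.1.1 x.2.1.1) x.2.2 ^ 2 ≤ C * NQ I.length x.1.1 x.2.1.1 x.2.2 := by
  induction I using List.reverseRecOn generalizing M with
  | nil =>
    obtain ⟨C, hC, h⟩ := null_alg M hM
    refine ⟨C, hC, fun x => (h _ _ _).trans ?_⟩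
    exact mul_le_mul_of_nonneg_left (le_NQ (J := []) (K := []) (le_refl _) _ _ _) hC
  | append_singleton I n ih =>
    obtain ⟨C, hC, h⟩ := ih M hM
    obtain ⟨C2, hC2, h2⟩ := ih _ (NullM_step hM n)
    obtain ⟨C1, hC1, h1⟩ := NQ_Zf I.length n
    refine ⟨4 * C * C1 + 4 * C2, by positivity, fun ⟨⟨u, hu⟩, ⟨v, hv⟩, p⟩ => ?_⟩
    simp only
    rw [Zw_snoc, Zf_QF M hu hv, Zw_add (smooth_QF M (smooth_Zf hu n) hv)
      ((smooth_QF M hu (smooth_Zf hv n)).add (smooth_QF _ hu hv)),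
      Zw_add (smooth_QF M hu (smooth_Zf hv n)) (smooth_QF _ hu hv)]
    have k1 := h ⟨⟨Zf n u, smooth_Zf hu n⟩, ⟨v, hv⟩, p⟩
    have k2 := h ⟨⟨u, hu⟩, ⟨Zf n v, smooth_Zf hv n⟩, p⟩
    have k3 := h2 ⟨⟨u, hu⟩, ⟨v, hv⟩, p⟩
    have k4 := h1 (u, v, p)
    have k5 := NQ_mono (Nat.le_succ I.length) u v p
    simp only [Nat.succ_eq_add_one] at *
    rw [List.length_append, List.length_singleton]
    have s1 := sq_add_le (Zw I (QF M (Zf n u) v) p) (Zw I (QF M u (Zf n v)) p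
      + Zw I (QF (-(vB n * M + M * (vB n).transpose)) u v) p)
    have s2 := sq_add_le (Zw I (QF M u (Zf n v)) p)
      (Zw I (QF (-(vB n * M + M * (vB n).transpose)) u v) p)
    have m1 := mul_le_mul_of_nonneg_left k4 hC
    have m2 := mul_le_mul_of_nonneg_left k5 hC2
    have q1 := sq_nonneg (Zw I (QF M (Zf n u) v) p)
    have q2 := sq_nonneg (Zw I (QF M u (Zf n v)) p)
    nlinarith

lemma comm_QF (k : ℕ) (M : Matrix (Fin 4) (Fin 4) ℝ) (hM : NullM M) :
    ∃ C : ℝ, 0 ≤ C ∧ ∀ x : Sm × Sm × Pt,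
    sW k (QF M x.1.1 x.2.1.1) x.2.2 ≤ C * NQ k x.1.1 x.2.1.1 x.2.2 := by
  refine sum_bd (wds k) (fun I (x : Sm × Sm × Pt) => Zw I (QF M x.1.1 x.2.1.1) x.2.2 ^ 2)
    (fun x => NQ k x.1.1 x.2.1.1 x.2.2) fun I hI => ?_
  obtain ⟨C, hC, h⟩ := comm_QF1 I M hM
  exact ⟨C, hC, fun x => (h x).trans (mul_le_mul_of_nonneg_left (NQ_mono (mem_wds.1 hI) _ _ _) hC)⟩

lemma rad_nonneg (x : Spc) : 0 ≤ rad x := Real.sqrt_nonneg _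
lemma rad_sq (x : Spc) : rad x ^ 2 = ∑ i, x i ^ 2 :=
  Real.sq_sqrt (Finset.sum_nonneg fun i _ => sq_nonneg _)
lemma cont_rad : Continuous rad := by
  unfold rad
  fun_prop
lemma abs_le_rad (x : Spc) (i : Fin 3) : |x i| ≤ rad x := by
  rw [← Real.sqrt_sq_eq_abs]
  exact Real.sqrt_le_sqrt (Finset.single_le_sum (f := fun i => x i ^ 2)
    (fun _ _ => sq_nonneg _) (Finset.mem_univ i))
lemma norm_le_rad (x : Spc) : ‖x‖ ≤ rad x :=
  (pi_norm_le_iff_of_nonneg (rad_nonneg x)).2 fun i => abs_le_rad x i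
lemma rad_le_jb (x : Spc) : rad x ≤ jb x := Real.sqrt_le_sqrt (by linarith)
lemma jb_le_rad (x : Spc) : jb x ≤ 1 + rad x := by
  have h1 := jb_sq x
  have h2 := rad_sq x
  have h3 := rad_nonneg x
  have h4 := jb_pos x
  nlinarith

lemma compact_rad (c : ℝ) : IsCompact {x : Spc | rad x ≤ c} := by
  refine (isCompact_closedBall (0 : Spc) c).of_isClosed_subset (isClosed_le cont_rad continuous_const) ?_
  intro x hx
  simp only [Metric.mem_closedBall, dist_zero_right]
  exact (norm_le_rad x).trans hx

/-- support property -/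
def Scs (u : Pt → ℝ) : Prop := ∃ R : ℝ, ∀ p : Pt, R + |p.1| < rad p.2 → u p = 0

lemma Scs.mul_left {u : Pt → ℝ} (hu : Scs u) (v : Pt → ℝ) : Scs (fun p => v p * u p) := by
  obtain ⟨R, h⟩ := hu
  exact ⟨R, fun p hp => by simp [h p hp]⟩
lemma Scs.mul_right {u : Pt → ℝ} (hu : Scs u) (v : Pt → ℝ) : Scs (fun p => u p * v p) := by
  obtain ⟨R, h⟩ := hu
  exact ⟨R, fun p hp => by simp [h p hp]⟩
lemma Scs.add {u v : Pt → ℝ} (hu : Scs u) (hv : Scs v) : Scs (fun p => u p + v p) := by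
  obtain ⟨R, h⟩ := hu
  obtain ⟨R2, h2⟩ := hv
  exact ⟨max R R2, fun p hp => by
    show u p + v p = 0
    rw [h p (lt_of_le_of_lt (by gcongr; exact le_max_left _ _) hp),
      h2 p (lt_of_le_of_lt (by gcongr; exact le_max_right _ _) hp), add_zero]⟩
lemma Scs.zero : Scs (fun _ => 0) := ⟨0, fun _ _ => rfl⟩
lemma Scs.neg {u : Pt → ℝ} (hu : Scs u) : Scs (fun p => - u p) := by
  obtain ⟨R, h⟩ := hu
  exact ⟨R, fun p hp => by simp [h p hp]⟩
lemma Scs.sub {u v : Pt → ℝ} (hu : Scs u) (hv : Scs v) : Scs (fun p => u p - v p) := by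
  simpa only [sub_eq_add_neg] using hu.add hv.neg
lemma Scs.sum {ι : Type*} (s : Finset ι) {u : ι → Pt → ℝ} (hu : ∀ i ∈ s, Scs (u i)) :
    Scs (fun p => ∑ i ∈ s, u i p) := by
  classical
  induction s using Finset.induction_on with
  | empty => simpa using Scs.zero
  | insert a s ha ih =>
    simp only [Finset.sum_insert ha]
    exact (hu a (by simp)).add (ih fun i hi => hu i (by simp [hi]))
lemma Scs.sq {u : Pt → ℝ} (hu : Scs u) : Scs (fun p => u p ^ 2) := by
  simpa only [_root_.sq] using hu.mul_left u
lemma Scs.D {u : Pt → ℝ} (hu : Scs u) (a : Fin 4) : Scs (D a u) := by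
  obtain ⟨R, h⟩ := hu
  refine ⟨R, fun p hp => ?_⟩
  have ho : IsOpen {p : Pt | R + |p.1| < rad p.2} :=
    isOpen_lt (by fun_prop) (cont_rad.comp continuous_snd)
  have : u =ᶠ[nhds p] fun _ => 0 :=
    Filter.eventually_of_mem (ho.mem_nhds hp) fun q hq => h q hq
  unfold _root_.D
  rw [this.fderiv_eq]
  simp
lemma Scs.Zf {u : Pt → ℝ} (hu : Scs u) (n : Fin 11) : Scs (Zf n u) :=
  Scs.sum _ fun a _ => (hu.D a).mul_left _
lemma Scs.Zw {u : Pt → ℝ} (hu : Scs u) (I : List (Fin 11)) : Scs (Zw I u) := by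
  induction I with
  | nil => exact hu
  | cons n I ih => exact ih.Zf n
lemma Scs.dsq {u : Pt → ℝ} (hu : Scs u) : Scs (dsq u) := Scs.sum _ fun a _ => (hu.D a).sq
lemma Scs.bx {u : Pt → ℝ} (hu : Scs u) : Scs (bx u) :=
  Scs.sum _ fun a _ => ((hu.D a).D a).mul_left _
lemma Scs.tsq {u : Pt → ℝ} (hu : Scs u) : Scs (tsq u) := by
  refine Scs.add (Scs.sum _ fun a _ => ((hu.D _).add ((hu.D 0).mul_left _)).sq) (Scs.sq ?_)
  simpa only [div_eq_mul_inv] using (hu.D 0).mul_right _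

lemma slice_hcs {g : Pt → ℝ} (hs : Scs g) (t : ℝ) : HasCompactSupport fun x => g (t, x) := by
  obtain ⟨R, h⟩ := hs
  refine HasCompactSupport.intro (compact_rad (R + |t|)) fun x hx => h (t, x) ?_
  simpa using hx

lemma slice_int {g : Pt → ℝ} (hg : Continuous g) (hs : Scs g) (t : ℝ) :
    Integrable fun x => g (t, x) :=
  (hg.comp (by fun_prop : Continuous fun x : Spc => ((t, x) : Pt))).integrable_of_hasCompactSupport
    (slice_hcs hs t)

lemma slice_D {g : Pt → ℝ} (hg : Differentiable ℝ g) (t : ℝ) (x : Spc) (i : Fin 3) :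
    fderiv ℝ (fun x => g (t, x)) x (Pi.single i 1) = D i.succ g (t, x) := by
  have h1 : HasFDerivAt (fun x : Spc => ((t, x) : Pt)) (ContinuousLinearMap.inr ℝ ℝ Spc) x :=
    hasFDerivAt_prodMk_right t x
  have h2 := (hg (t, x)).hasFDerivAt.comp x h1
  have h3 : (fun x => g (t, x)) = g ∘ fun x : Spc => ((t, x) : Pt) := rfl
  rw [h3, h2.fderiv]
  simp [D]

lemma slice_Dt {g : Pt → ℝ} (hg : Differentiable ℝ g) (t : ℝ) (x : Spc) :
    HasDerivAt (fun s => g (s, x)) (D 0 g (t, x)) t := by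
  have h1 : HasDerivAt (fun s : ℝ => ((s, x) : Pt)) (1, 0) t :=
    (hasDerivAt_id t).prodMk (hasDerivAt_const _ _)
  exact (hg (t, x)).hasFDerivAt.comp_hasDerivAt t h1

lemma cont_D {u : Pt → ℝ} (hu : ContDiff ℝ 1 u) (a : Fin 4) : Continuous (D a u) :=
  (contDiff_D (m := 0) hu (by norm_num) a).continuous

lemma int_div_zero {g : Pt → ℝ} (hg : ContDiff ℝ 1 g) (hs : Scs g) (t : ℝ) (i : Fin 3) :
    ∫ x, D i.succ g (t, x) = 0 := by
  have hd : Differentiable ℝ g := hg.differentiable (by norm_num)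
  have h := integral_mul_fderiv_eq_neg_fderiv_mul_of_integrable (μ := (volume : Measure Spc))
    (𝕜 := ℝ) (f := fun _ => (1 : ℝ)) (g := fun x => g (t, x)) (v := Pi.single i 1)
    (by simp) (by
      simp only [slice_D hd, one_mul]
      exact slice_int (cont_D hg _) (hs.D _) t)
    (by simpa using slice_int hg.continuous hs t)
    (fun x _ => by fun_prop)
    (fun x _ => (hd.comp (by fun_prop : Differentiable ℝ fun x : Spc => ((t, x) : Pt))) x)
  simpa [slice_D hd] using h

lemma hasDerivAt_int {g : Pt → ℝ} (hg : ContDiff ℝ 1 g) (hs : Scs g) (t : ℝ) :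
    HasDerivAt (fun s => ∫ x, g (s, x)) (∫ x, D 0 g (t, x)) t := by
  have hd : Differentiable ℝ g := hg.differentiable (by norm_num)
  obtain ⟨R, hR⟩ := hs.D 0
  set K : Set Spc := {x : Spc | rad x ≤ R + (|t| + 1)} with hK
  have hKc : IsCompact K := compact_rad _
  have hc := cont_D hg 0
  obtain ⟨C, hC⟩ := ((isCompact_closedBall t 1).prod hKc).exists_bound_of_continuousOn hc.continuousOn
  refine (hasDerivAt_integral_of_dominated_loc_of_deriv_le (F := fun s x => g (s, x))
    (F' := fun s x => D 0 g (s, x)) (bound := K.indicator fun _ => C)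
    (Metric.closedBall_mem_nhds t one_pos) ?_ (slice_int hg.continuous hs t) ?_ ?_ ?_ ?_).2
  · exact Filter.Eventually.of_forall fun s => (slice_int hg.continuous hs s).aestronglyMeasurable
  · exact (slice_int hc (hs.D 0) t).aestronglyMeasurable
  · refine Filter.Eventually.of_forall fun x s hx => ?_
    by_cases hxK : x ∈ K
    · rw [Set.indicator_of_mem hxK]
      exact hC (s, x) ⟨hx, hxK⟩
    · rw [Set.indicator_of_notMem hxK, hR (s, x)]
      · simp
      · simp only [hK, Set.mem_setOf_eq, not_le] at hxK
        refine lt_of_le_of_lt ?_ hxK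
        have h1 : |s - t| ≤ 1 := by simpa [Real.dist_eq] using hx
        have h2 : |s| ≤ |t| + |s - t| := by
          have := abs_add_le t (s - t); simpa using this
        simp only
        linarith
  · exact (integrable_indicator_iff hKc.measurableSet).2 (integrableOn_const hKc.measure_lt_top.ne)
  · exact Filter.Eventually.of_forall fun x s _ => slice_Dt hd s x

lemma cont_dsq {u : Pt → ℝ} (hu : ContDiff ℝ 1 u) : Continuous (dsq u) := by
  unfold dsq
  exact continuous_finset_sum _ fun a _ => (cont_D hu a).pow 2

lemma D_sq {u : Pt → ℝ} (hu : Differentiable ℝ u) (a : Fin 4) :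
    D a (fun p => u p ^ 2) = fun p => 2 * u p * D a u p := by
  have : (fun p => u p ^ 2) = fun p => u p * u p := by funext p; ring
  rw [this, D_mul hu hu]; funext p; ring

/-- The energy identity with a general weight. -/
lemma energy_deriv {u W : Pt → ℝ} (hu : ContDiff ℝ 2 u) (hW : ContDiff ℝ 1 W)
    (hs : Scs u ∨ Scs W) (t : ℝ) :
    HasDerivAt (fun s => ∫ x, W (s, x) * dsq u (s, x))
      (∫ x, (D 0 W (t, x) * dsq u (t, x) - 2 * (∑ i : Fin 3, D i.succ W (t, x) * (D 0 u (t, x) * D i.succ u (t, x)))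
        - 2 * (W (t, x) * (D 0 u (t, x) * bx u (t, x))))) t := by
  have hu1 : ∀ a, ContDiff ℝ 1 (D a u) := fun a => contDiff_D hu (by norm_num) a
  have hud : ∀ a, Differentiable ℝ (D a u) := fun a => (hu1 a).differentiable (by norm_num)
  have hWd : Differentiable ℝ W := hW.differentiable (by norm_num)
  have hds : ContDiff ℝ 1 (dsq u) := by
    unfold dsq
    exact ContDiff.sum fun a _ => (hu1 a).pow 2
  have hsWd : Scs (fun p => W p * dsq u p) := by
    rcases hs with h | h
    · exact h.dsq.mul_left _
    · exact h.mul_right _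
  have hsF : ∀ i : Fin 3, Scs (fun p => W p * (D 0 u p * D i.succ u p)) := by
    intro i
    rcases hs with h | h
    · exact ((h.D _).mul_left _).mul_left _
    · exact h.mul_right _
  have hF1 : ∀ i : Fin 3, ContDiff ℝ 1 (fun p => W p * (D 0 u p * D i.succ u p)) :=
    fun i => hW.mul ((hu1 _).mul (hu1 _))
  have h := hasDerivAt_int (hW.mul hds) hsWd t
  refine h.congr_deriv ?_
  have hpt : ∀ p, D 0 (fun p => W p * dsq u p) p
      = (D 0 W p * dsq u p - 2 * (∑ i : Fin 3, D i.succ W p * (D 0 u p * D i.succ u p))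
        - 2 * (W p * (D 0 u p * bx u p)))
        + 2 * ∑ i : Fin 3, D i.succ (fun p => W p * (D 0 u p * D i.succ u p)) p := by
    intro p
    rw [D_mul hWd (hds.differentiable (by norm_num))]
    have e1 : D 0 (dsq u) p = ∑ a, 2 * D a u p * D 0 (D a u) p := by
      unfold dsq
      rw [D_sum (u := fun a p => D a u p ^ 2) _ (fun a _ => (hud a).pow 2)]
      exact Finset.sum_congr rfl fun a _ => by rw [D_sq (hud a)]
    have e2 : ∀ i : Fin 3, D i.succ (fun p => W p * (D 0 u p * D i.succ u p)) p
        = D i.succ W p * (D 0 u p * D i.succ u p)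
          + W p * (D 0 (D i.succ u) p * D i.succ u p + D 0 u p * D i.succ (D i.succ u) p) := by
      intro i
      rw [D_mul (v := fun p => D 0 u p * D i.succ u p) hWd ((hud 0).mul (hud _)), D_mul (hud 0) (hud _), D_comm hu i.succ 0]
    simp only [e1, e2]
    unfold bx
    rw [Fin.sum_univ_succ, Fin.sum_univ_succ (f := fun a => eta a * _)]
    simp only [eta_zero, eta_succ, Fin.sum_univ_three]
    ring
  have hcF : ∀ i : Fin 3, Integrable fun x => D i.succ (fun p => W p * (D 0 u p * D i.succ u p)) (t, x) :=
    fun i => slice_int (cont_D (hF1 i) _) ((hsF i).D _) t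
  have hI : Integrable fun x => D 0 (fun p => W p * dsq u p) (t, x) :=
    slice_int (cont_D (hW.mul hds) 0) (hsWd.D 0) t
  have hI2 : Integrable fun x => 2 * ∑ i : Fin 3, D i.succ (fun p => W p * (D 0 u p * D i.succ u p)) (t, x) :=
    (integrable_finset_sum _ fun i _ => hcF i).const_mul 2
  have h0 : ∫ x, 2 * ∑ i : Fin 3, D i.succ (fun p => W p * (D 0 u p * D i.succ u p)) (t, x) = 0 := by
    rw [integral_const_mul, integral_finset_sum _ fun i _ => hcF i]
    simp only [int_div_zero (hF1 _) (hsF _)]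
    simp
  have h1 := integral_sub hI hI2
  rw [h0, sub_zero] at h1
  rw [← h1]
  refine integral_congr_ae (Filter.Eventually.of_forall fun x => ?_)
  simp only
  rw [hpt (t, x)]
  ring

def jq (q : ℝ) : ℝ := Real.sqrt (1 + q ^ 2)
def pp (q : ℝ) : ℝ := q + jq q
def wt (a q : ℝ) : ℝ := 1 + pp q ^ a + pp q ^ (1/2 : ℝ)
def wd (a q : ℝ) : ℝ := (a * pp q ^ a + (1/2) * pp q ^ (1/2 : ℝ)) / jq q

lemma jq_sq (q : ℝ) : jq q ^ 2 = 1 + q ^ 2 := Real.sq_sqrt (by positivity)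
lemma jq_pos (q : ℝ) : 0 < jq q := Real.sqrt_pos.2 (by positivity)
lemma one_le_jq (q : ℝ) : 1 ≤ jq q := by
  unfold jq; rw [Real.one_le_sqrt]; nlinarith [sq_nonneg q]
lemma abs_lt_jq (q : ℝ) : |q| < jq q := by
  unfold jq
  rw [← Real.sqrt_sq_eq_abs]
  exact Real.sqrt_lt_sqrt (sq_nonneg _) (by linarith)
lemma jq_le (q : ℝ) : jq q ≤ 1 + |q| := by
  have h := jq_sq q
  have h1 := jq_pos q
  have h2 := abs_nonneg q
  nlinarith [sq_abs q]
lemma pp_pos (q : ℝ) : 0 < pp q := by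
  have := abs_lt_jq q
  have := neg_abs_le q
  unfold pp; linarith
lemma pp_inv (q : ℝ) : pp q * (jq q - q) = 1 := by
  unfold pp; nlinarith [jq_sq q]
lemma pp_eq_of {P y : ℝ} (hP : 0 < P) (h : 2 * y = P - 1 / P) : pp y = P := by
  have hj : jq y = (P + 1 / P) / 2 := by
    unfold jq
    rw [show 1 + y ^ 2 = ((P + 1 / P) / 2) ^ 2 by
      rw [show y = (P - 1 / P) / 2 by linarith]; field_simp; ring]
    exact Real.sqrt_sq (by positivity)
  unfold pp; linarith
lemma hasDerivAt_jq (q : ℝ) : HasDerivAt jq (q / jq q) q := by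
  have h := ((hasDerivAt_pow 2 q).const_add 1).sqrt (by positivity)
  refine h.congr_deriv ?_
  unfold jq; simp; field_simp
lemma hasDerivAt_pp (q : ℝ) : HasDerivAt pp (pp q / jq q) q := by
  have h := (hasDerivAt_id q).add (hasDerivAt_jq q)
  refine h.congr_deriv ?_
  have := (jq_pos q).ne'
  unfold pp; field_simp; ring
lemma mono_pp : Monotone pp := by
  apply monotone_of_deriv_nonneg (fun q => (hasDerivAt_pp q).differentiableAt)
  intro q
  rw [(hasDerivAt_pp q).deriv]
  exact div_nonneg (pp_pos q).le (jq_pos q).le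
lemma hasDerivAt_wt (a q : ℝ) : HasDerivAt (wt a) (wd a q) q := by
  have h1 := (hasDerivAt_pp q).rpow_const (p := a) (Or.inl (pp_pos q).ne')
  have h2 := (hasDerivAt_pp q).rpow_const (p := 1/2) (Or.inl (pp_pos q).ne')
  have h := ((h1.const_add 1)).add h2
  refine h.congr_deriv ?_
  unfold wd
  rw [Real.rpow_sub_one (pp_pos q).ne', Real.rpow_sub_one (pp_pos q).ne']
  have := (pp_pos q).ne'
  have := (jq_pos q).ne'
  field_simp
lemma smooth_jq : ContDiff ℝ ∞ jq := by
  unfold jq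
  exact ContDiff.sqrt (by fun_prop) (fun q => by positivity)
lemma smooth_pp : ContDiff ℝ ∞ pp := contDiff_id.add smooth_jq
lemma smooth_wt (a : ℝ) : ContDiff ℝ ∞ (wt a) := by
  unfold wt
  exact (contDiff_const.add (smooth_pp.rpow_const_of_ne fun q => (pp_pos q).ne')).add
    (smooth_pp.rpow_const_of_ne fun q => (pp_pos q).ne')
lemma cont_wd (a : ℝ) : Continuous (wd a) := by
  unfold wd
  refine Continuous.div ?_ smooth_jq.continuous fun q => (jq_pos q).ne'
  exact (continuous_const.mul (smooth_pp.continuous.rpow_const fun q => Or.inl (pp_pos q).ne')).add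
    (continuous_const.mul (smooth_pp.continuous.rpow_const fun q => Or.inl (pp_pos q).ne'))
lemma one_le_wt (a q : ℝ) : 1 ≤ wt a q := by
  unfold wt
  have := Real.rpow_nonneg (pp_pos q).le a
  have := Real.rpow_nonneg (pp_pos q).le (1/2)
  linarith
lemma wt_pos (a q : ℝ) : 0 < wt a q := lt_of_lt_of_le one_pos (one_le_wt a q)
lemma wd_nonneg {a : ℝ} (ha : 0 ≤ a) (q : ℝ) : 0 ≤ wd a q := by
  unfold wd
  have := Real.rpow_nonneg (pp_pos q).le a
  have := Real.rpow_nonneg (pp_pos q).le (1/2)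
  have := jq_pos q
  positivity

lemma wt_le_wd {a : ℝ} (ha : 1 ≤ a) (q : ℝ) : wt a q ≤ 9 * (jq q * Real.sqrt (jq q)) * wd a q := by
  have hj := jq_pos q
  have hj1 := one_le_jq q
  have hp := pp_pos q
  have hs1 : 1 ≤ Real.sqrt (jq q) := by rw [Real.one_le_sqrt]; exact hj1
  have n1 := Real.rpow_nonneg (pp_pos q).le a
  have n2 := Real.rpow_nonneg (pp_pos q).le (1/2)
  have e : 9 * (jq q * Real.sqrt (jq q)) * wd a q
      = 9 * Real.sqrt (jq q) * (a * pp q ^ a + (1/2) * pp q ^ (1/2 : ℝ)) := by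
    unfold wd; field_simp
  rw [e]
  rcases le_or_gt 0 q with hq | hq
  · have h1 : 1 ≤ pp q := by unfold pp; linarith
    have h2 : 1 ≤ pp q ^ a := Real.one_le_rpow h1 (by linarith)
    unfold wt
    nlinarith [mul_nonneg (sub_nonneg.2 hs1) n1, mul_nonneg (sub_nonneg.2 hs1) n2,
      mul_nonneg (mul_nonneg (sub_nonneg.2 ha) n1) (Real.sqrt_nonneg (jq q))]
  · have h1 : pp q ≤ 1 := by
      have := pp_inv q
      have h3 : 1 ≤ jq q - q := by linarith
      nlinarith
    have h2 : pp q ^ a ≤ 1 := Real.rpow_le_one hp.le h1 (by linarith)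
    have h3 : pp q ^ (1/2 : ℝ) ≤ 1 := Real.rpow_le_one hp.le h1 (by norm_num)
    have h4 : 1 ≤ 2 * (pp q * jq q) := by
      have h5 := pp_inv q
      have h6 := abs_lt_jq q
      have h7 := neg_abs_le q
      nlinarith
    have h8 : Real.sqrt (jq q) * pp q ^ (1/2 : ℝ) ≥ 2 / 3 := by
      rw [← Real.sqrt_eq_rpow, ← Real.sqrt_mul hj.le]
      apply Real.le_sqrt_of_sq_le
      nlinarith
    unfold wt
    have : 0 ≤ Real.sqrt (jq q) * (a * pp q ^ a) := by positivity
    nlinarith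

lemma pp_comp {q q2 : ℝ} (h : |q2 - q| ≤ jq q / 2) : pp q / 2 ≤ pp q2 := by
  have hP := pp_pos q
  have hi := pp_inv q
  have hinv : 1 / pp q = jq q - q := by rw [eq_comm, eq_div_iff hP.ne']; linarith
  have hq : pp q = q + jq q := rfl
  set y := (pp q / 2 - 1 / (pp q / 2)) / 2 with hy
  have e : pp y = pp q / 2 := pp_eq_of (by positivity) (by rw [hy]; ring)
  rw [← e]
  apply mono_pp
  have e2 : 1 / (pp q / 2) = 2 * (jq q - q) := by rw [← hinv]; field_simp
  rw [hy, e2, hq]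
  have := neg_le_of_abs_le h
  have h3 := neg_abs_le q
  have h4 := abs_lt_jq q
  have h5 := le_abs_self q
  linarith

lemma wt_comp {a : ℝ} (ha : 1 ≤ a) {q q2 : ℝ} (h : |q2 - q| ≤ jq q / 2) :
    wt a q ≤ 2 ^ a * wt a q2 := by
  have hp := pp_comp h
  have hP := pp_pos q
  have hP2 := pp_pos q2
  have h1 : pp q ≤ 2 * pp q2 := by linarith
  have k1 : pp q ^ a ≤ 2 ^ a * pp q2 ^ a := by
    rw [← Real.mul_rpow (by norm_num) hP2.le]
    exact Real.rpow_le_rpow hP.le h1 (by linarith)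
  have k2 : pp q ^ (1/2 : ℝ) ≤ 2 ^ (1/2 : ℝ) * pp q2 ^ (1/2 : ℝ) := by
    rw [← Real.mul_rpow (by norm_num) hP2.le]
    exact Real.rpow_le_rpow hP.le h1 (by linarith)
  have k3 : (2:ℝ) ^ (1/2 : ℝ) ≤ 2 ^ a := Real.rpow_le_rpow_of_exponent_le (by norm_num) (by linarith)
  have k4 : (1:ℝ) ≤ 2 ^ a := Real.one_le_rpow (by norm_num) (by linarith)
  have n2 := Real.rpow_nonneg hP2.le (1/2)
  have k5 := mul_le_mul_of_nonneg_right k3 n2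
  unfold wt
  nlinarith

lemma w1_le (δ α : ℝ) (hδ1 : -(1/2) < δ) (hα1 : 0 < α) (t : ℝ) (x : Spc) :
    w1 δ α (rad x - t) ≤ 2 * wt (2 * (δ + 1)) (jb x - t) := by
  have h1 := one_le_wt (2 * (δ + 1)) (jb x - t)
  unfold w1
  split_ifs with h
  · have : (1 + |rad x - t|) ^ (-α) ≤ 1 :=
      Real.rpow_le_one_of_one_le_of_nonpos (by have := abs_nonneg (rad x - t); linarith) (by linarith)
    linarith
  · push Not at h
    have hq : rad x - t ≤ jb x - t := by have := rad_le_jb x; linarith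
    have h2 : 1 + |rad x - t| ≤ pp (jb x - t) := by
      rw [abs_of_nonneg h]
      have := one_le_jq (jb x - t)
      unfold pp; linarith
    have h3 : (1 + |rad x - t|) ^ (2 * (δ + 1)) ≤ pp (jb x - t) ^ (2 * (δ + 1)) :=
      Real.rpow_le_rpow (by positivity) h2 (by linarith)
    have := Real.rpow_nonneg (pp_pos (jb x - t)).le (1/2)
    unfold wt at *
    linarith

lemma wt_jb_le {a : ℝ} (ha : 1 ≤ a) (x : Spc) : wt a (jb x) ≤ 3 * 3 ^ a * jb x ^ a := by
  have hj := jb_ge_one x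
  have hp : pp (jb x) ≤ 3 * jb x := by
    have := jq_le (jb x)
    rw [abs_of_pos (by linarith)] at this
    unfold pp; linarith
  have hp1 : 1 ≤ pp (jb x) := by
    have := one_le_jq (jb x)
    unfold pp; linarith
  have k1 : pp (jb x) ^ (1/2:ℝ) ≤ pp (jb x) ^ a := Real.rpow_le_rpow_of_exponent_le hp1 (by linarith)
  have k2 : 1 ≤ pp (jb x) ^ a := Real.one_le_rpow hp1 (by linarith)
  have k3 : pp (jb x) ^ a ≤ 3 ^ a * jb x ^ a := by
    rw [← Real.mul_rpow (by norm_num) (by linarith)]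
    exact Real.rpow_le_rpow (by linarith) hp (by linarith)
  unfold wt
  linarith

/-- the spacetime weight -/
def WW (a : ℝ) (p : Pt) : ℝ := wt a (jb p.2 - p.1)
def WD (a : ℝ) (p : Pt) : ℝ := wd a (jb p.2 - p.1)

lemma smooth_WW (a : ℝ) : ContDiff ℝ ∞ (WW a) :=
  (smooth_wt a).comp (smooth_jb.sub contDiff_fst)
lemma cont_WD (a : ℝ) : Continuous (WD a) :=
  (cont_wd a).comp (smooth_jb.continuous.sub continuous_fst)
lemma one_le_WW (a : ℝ) (p : Pt) : 1 ≤ WW a p := one_le_wt _ _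
lemma WW_pos (a : ℝ) (p : Pt) : 0 < WW a p := wt_pos _ _

lemma D_comp {f : ℝ → ℝ} {f' : ℝ} {g : Pt → ℝ} {p : Pt} (hf : HasDerivAt f f' (g p))
    (hg : DifferentiableAt ℝ g p) (a : Fin 4) : D a (fun p => f (g p)) p = f' * D a g p := by
  unfold D
  have h := (hf.comp_hasFDerivAt p hg.hasFDerivAt).fderiv
  rw [show (fun p => f (g p)) = f ∘ g from rfl, h]
  simp

lemma D_jb_zero (p : Pt) : D 0 (fun p => jb p.2) p = 0 := by
  have h : HasFDerivAt (fun p : Pt => jb p.2) (fderiv ℝ (fun p : Pt => jb p.2) p) p :=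
    (diff_of_smooth smooth_jb p).hasFDerivAt
  have h1 := slice_Dt (diff_of_smooth smooth_jb) p.1 p.2
  have h2 : HasDerivAt (fun s : ℝ => jb p.2) 0 p.1 := hasDerivAt_const _ _
  exact h1.unique h2

lemma D_jb_succ (p : Pt) (i : Fin 3) : D i.succ (fun p => jb p.2) p = p.2 i / jb p.2 := by
  have h0 : (fun p : Pt => jb p.2) = fun p : Pt => Real.sqrt ((fun p : Pt => 1 + ∑ i, p.2 i ^ 2) p) := rfl
  have hp : 0 < 1 + ∑ i, p.2 i ^ 2 := by
    have := jb_sq p.2; have := jb_pos p.2; nlinarith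
  have hX : ∀ i, Differentiable ℝ (fun p : Pt => p.2 i) := fun i => by fun_prop
  have hs : D i.succ (fun p : Pt => 1 + ∑ j, p.2 j ^ 2) p = 2 * p.2 i := by
    rw [D_add (differentiable_const _) (by fun_prop), D_const,
      D_sum (u := fun j (p : Pt) => p.2 j ^ 2) _ (fun j _ => (hX j).pow 2)]
    simp only [D_sq (hX _), zero_add]
    have : ∀ j : Fin 3, D i.succ (fun p : Pt => p.2 j) p = if j = i then 1 else 0 := by
      intro j
      have h := congrFun (D_Xc j.succ i.succ) p
      simp only [Fin.succ_inj] at h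
      exact h
    simp [this]
  rw [h0, D_comp (Real.hasDerivAt_sqrt hp.ne') (by fun_prop), hs]
  show 1 / (2 * jb p.2) * _ = _
  have := (jb_pos p.2).ne'
  field_simp

lemma D_q (a : Fin 4) (p : Pt) : D a (fun p => jb p.2 - p.1) p
    = D a (fun p => jb p.2) p - (if 0 = a then 1 else 0) := by
  rw [D_sub (diff_of_smooth smooth_jb) differentiable_fst]
  have h := congrFun (D_Xc 0 a) p
  simp only
  congr 1

lemma D_WW_zero (a : ℝ) (p : Pt) : D 0 (WW a) p = - WD a p := by
  have := D_comp (g := fun p : Pt => jb p.2 - p.1) (p := p) (hasDerivAt_wt a (jb p.2 - p.1))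
    ((diff_of_smooth smooth_jb p).sub differentiableAt_fst) 0
  rw [D_q, D_jb_zero, if_pos rfl] at this
  refine (show D 0 (WW a) p = _ from this).trans ?_
  unfold WD; ring

lemma D_WW_succ (a : ℝ) (p : Pt) (i : Fin 3) : D i.succ (WW a) p = WD a p * (p.2 i / jb p.2) := by
  have := D_comp (g := fun p : Pt => jb p.2 - p.1) (p := p) (hasDerivAt_wt a (jb p.2 - p.1))
    ((diff_of_smooth smooth_jb p).sub differentiableAt_fst) i.succ
  rw [D_q, D_jb_succ, if_neg (Fin.succ_ne_zero i).symm, sub_zero] at this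
  exact this

lemma tsq_eq (u : Pt → ℝ) (p : Pt) : tsq u p
    = dsq u p + 2 * ∑ i : Fin 3, (p.2 i / jb p.2) * (D 0 u p * D i.succ u p) := by
  have hj := (jb_pos p.2).ne'
  have h := jb_sq p.2
  unfold tsq dsq
  rw [Fin.sum_univ_succ (f := fun a => D a u p ^ 2)]
  simp only [Fin.sum_univ_three] at *
  field_simp
  linear_combination (-(D 0 u p) ^ 2) * h

lemma energy_W (a : ℝ) {u : Pt → ℝ} (hu : ContDiff ℝ 2 u) (hs : Scs u) (t : ℝ) :
    HasDerivAt (fun s => ∫ x, WW a (s, x) * dsq u (s, x))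
      (- (∫ x, WD a (t, x) * tsq u (t, x)) - 2 * ∫ x, WW a (t, x) * (D 0 u (t, x) * bx u (t, x))) t := by
  have h := energy_deriv hu ((smooth_WW a).of_le (by simp)) (Or.inl hs) t
  refine h.congr_deriv ?_
  have hu1 : ContDiff ℝ 1 u := hu.of_le (by norm_num)
  have hcD : ∀ b, Continuous (D b u) := cont_D hu1
  have hct : Continuous (tsq u) := by
    unfold tsq
    have hjc := smooth_jb.continuous
    have : ∀ p : Pt, jb p.2 ≠ 0 := fun p => (jb_pos p.2).ne'
    refine Continuous.add (continuous_finset_sum _ fun i _ => ?_) (((hcD 0).div hjc this).pow 2)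
    exact ((hcD _).add (((by fun_prop : Continuous fun p : Pt => p.2 i).div hjc this).mul (hcD 0))).pow 2
  have hcb : Continuous (bx u) := by
    unfold bx
    exact continuous_finset_sum _ fun b _ => continuous_const.mul
      (cont_D (contDiff_D hu (by norm_num) b) b)
  have i1 := slice_int (g := fun p => WD a p * tsq u p) ((cont_WD a).mul hct) (hs.tsq.mul_left (WD a)) t
  have i2 := slice_int (g := fun p => WW a p * (D 0 u p * bx u p)) ((smooth_WW a).continuous.mul ((hcD 0).mul hcb)) ((hs.bx.mul_left (D 0 u)).mul_left (WW a)) t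
  rw [← integral_neg, ← integral_const_mul, ← integral_sub (f := fun x => -(WD a (t, x) * tsq u (t, x))) i1.neg (i2.const_mul 2)]
  refine integral_congr_ae (Filter.Eventually.of_forall fun x => ?_)
  simp only [D_WW_zero, D_WW_succ, tsq_eq]
  simp only [mul_add, Finset.mul_sum, neg_mul, neg_add, sub_left_inj]
  rw [← sub_eq_add_neg]
  congr 1
  exact Finset.sum_congr rfl fun i _ => by ring

lemma cont_int {g : Pt → ℝ} (hg : Continuous g) (hs : Scs g) : Continuous fun t => ∫ x, g (t, x) := by
  rw [continuous_iff_continuousAt]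
  intro t0
  obtain ⟨R, hR⟩ := hs
  set K : Set Spc := {x : Spc | rad x ≤ R + (|t0| + 1)} with hK
  have hKc : IsCompact K := compact_rad _
  have h1 : ContinuousAt (fun t => ∫ x in K, g (t, x)) t0 :=
    (continuous_parametric_integral_of_continuous (f := fun t x => g (t, x)) hg hKc).continuousAt
  refine h1.congr ?_
  filter_upwards [Metric.ball_mem_nhds t0 one_pos] with t ht
  refine setIntegral_eq_integral_of_forall_compl_eq_zero fun x hx => hR (t, x) ?_
  simp only [hK, Set.mem_setOf_eq, not_le] at hx
  refine lt_of_le_of_lt ?_ hx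
  have h1 : |t - t0| ≤ 1 := by rw [← Real.dist_eq]; exact (Metric.mem_ball.1 ht).le
  have h2 : |t| ≤ |t0| + |t - t0| := by
    have := abs_add_le t0 (t - t0); simpa using this
  simp only
  linarith

lemma cont_tsq {u : Pt → ℝ} (hu : ContDiff ℝ 1 u) : Continuous (tsq u) := by
  unfold tsq
  have hjc := smooth_jb.continuous
  have hcD := cont_D hu
  have : ∀ p : Pt, jb p.2 ≠ 0 := fun p => (jb_pos p.2).ne'
  refine Continuous.add (continuous_finset_sum _ fun i _ => ?_) (((hcD 0).div hjc this).pow 2)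
  exact ((hcD _).add (((by fun_prop : Continuous fun p : Pt => p.2 i).div hjc this).mul (hcD 0))).pow 2

lemma c1_of_smooth {u : Pt → ℝ} (hu : ContDiff ℝ ∞ u) : ContDiff ℝ 1 u := contDiff_infty.mp hu 1

def tw (t : ℝ) : ℝ := (1 + t) ^ (3/2 : ℝ)
lemma cont_tw : Continuous tw := by
  unfold tw
  exact (continuous_const.add continuous_id).rpow_const fun _ => Or.inr (by norm_num)
lemma tw_nonneg {t : ℝ} (ht : 0 ≤ t) : 0 ≤ tw t := Real.rpow_nonneg (by linarith) _
lemma tw_pos {t : ℝ} (ht : 0 ≤ t) : 0 < tw t := Real.rpow_pos_of_pos (by linarith) _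

def mf (t : ℝ) : ℝ := Real.exp (2 * (1 + t) ^ (-(1/2) : ℝ))
lemma hasDerivAt_mf {t : ℝ} (ht : -1 < t) : HasDerivAt mf (-(tw t)⁻¹ * mf t) t := by
  have h0 : (0:ℝ) < 1 + t := by linarith
  have h1 : HasDerivAt (fun t : ℝ => 1 + t) 1 t := (hasDerivAt_id t).const_add 1
  have h2 := ((h1.rpow_const (p := -(1/2)) (Or.inl h0.ne')).const_mul 2).exp
  refine h2.congr_deriv ?_
  unfold mf tw
  rw [← Real.rpow_neg h0.le]
  norm_num
  ring
lemma one_le_mf {t : ℝ} (ht : 0 ≤ t) : 1 ≤ mf t :=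
  Real.one_le_exp (mul_nonneg zero_le_two (Real.rpow_nonneg (by linarith) _))
lemma mf_le {t : ℝ} (ht : 0 ≤ t) : mf t ≤ 8 := by
  have h1 : (1 + t) ^ (-(1/2) : ℝ) ≤ 1 := Real.rpow_le_one_of_one_le_of_nonpos (by linarith) (by norm_num)
  have h2 : mf t ≤ Real.exp 2 := Real.exp_le_exp.2 (by linarith)
  have h3 : Real.exp 2 = Real.exp 1 ^ 2 := by rw [← Real.exp_nat_mul]; norm_num
  have h4 := Real.exp_one_lt_d9
  have h5 := Real.exp_pos 1
  nlinarith

lemma energy_est {a : ℝ} (ha : 0 ≤ a) {u : Pt → ℝ} (hu : ContDiff ℝ ∞ u) (hs : Scs u) {T : ℝ} (hT : 0 ≤ T) :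
    (∫ x, WW a (T, x) * dsq u (T, x)) + (∫ t in (0:ℝ)..T, ∫ x, WD a (t, x) * tsq u (t, x))
      ≤ 8 * ((∫ x, WW a (0, x) * dsq u (0, x))
        + ∫ t in (0:ℝ)..T, tw t * ∫ x, WW a (t, x) * bx u (t, x) ^ 2) := by
  have hu1 := c1_of_smooth hu
  have hWc := (smooth_WW a).continuous
  have hbc := (smooth_bx hu).continuous
  set E := fun t => ∫ x, WW a (t, x) * dsq u (t, x) with hE
  set G := fun t => ∫ x, WD a (t, x) * tsq u (t, x) with hG
  set B := fun t => ∫ x, WW a (t, x) * bx u (t, x) ^ 2 with hB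
  set P := fun t => ∫ x, WW a (t, x) * (D 0 u (t, x) * bx u (t, x)) with hP
  have cG : Continuous G := cont_int (g := fun p => WD a p * tsq u p)
    ((cont_WD a).mul (cont_tsq hu1)) (hs.tsq.mul_left _)
  have cB : Continuous B := cont_int (g := fun p => WW a p * bx u p ^ 2)
    (hWc.mul (hbc.pow 2)) (hs.bx.sq.mul_left _)
  have dE : ∀ t, HasDerivAt E (-G t - 2 * P t) t := fun t => energy_W a (c2_of_smooth hu) hs t
  have nG : ∀ t, 0 ≤ G t := fun t => integral_nonneg fun x =>
    mul_nonneg (wd_nonneg ha _) (tsq_nonneg _ _)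
  have nB : ∀ t, 0 ≤ B t := fun t => integral_nonneg fun x =>
    mul_nonneg (WW_pos _ _).le (sq_nonneg _)
  have nE : ∀ t, 0 ≤ E t := fun t => integral_nonneg fun x =>
    mul_nonneg (WW_pos _ _).le (dsq_nonneg _ _)
  have young : ∀ t, 0 ≤ t → -(2 * P t) ≤ (tw t)⁻¹ * E t + tw t * B t := by
    intro t ht
    have i1 := slice_int (g := fun p => WW a p * dsq u p) (hWc.mul (cont_dsq hu1)) (hs.dsq.mul_left _) t
    have i2 := slice_int (g := fun p => WW a p * bx u p ^ 2)
      (hWc.mul (hbc.pow 2)) (hs.bx.sq.mul_left _) t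
    have i3 := slice_int (g := fun p => WW a p * (D 0 u p * bx u p))
      (hWc.mul ((cont_D hu1 0).mul hbc)) ((hs.bx.mul_left (D 0 u)).mul_left (WW a)) t
    simp only [hP, hE, hB]
    rw [← integral_const_mul, ← integral_const_mul, ← integral_const_mul, ← integral_neg,
      ← integral_add (i1.const_mul _) (i2.const_mul _)]
    refine integral_mono (i3.const_mul 2).neg ((i1.const_mul _).add (i2.const_mul _)) fun x => ?_
    simp only [Pi.neg_apply]
    have h1 := D_sq_le_dsq u (t, x) 0
    have h2 := tw_pos ht
    have h3 := WW_pos a (t, x)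
    have key : -(2 * (D 0 u (t, x) * bx u (t, x))) ≤ (tw t)⁻¹ * D 0 u (t, x) ^ 2 + tw t * bx u (t, x) ^ 2 := by
      have : 0 ≤ (tw t)⁻¹ * (D 0 u (t, x) + tw t * bx u (t, x)) ^ 2 := by positivity
      have e : (tw t)⁻¹ * (D 0 u (t, x) + tw t * bx u (t, x)) ^ 2 = (tw t)⁻¹ * D 0 u (t, x) ^ 2
        + tw t * bx u (t, x) ^ 2 + 2 * (D 0 u (t, x) * bx u (t, x)) := by
        field_simp; ring
      linarith
    have h5 : (tw t)⁻¹ * D 0 u (t, x) ^ 2 ≤ (tw t)⁻¹ * dsq u (t, x) := by gcongr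
    have := mul_le_mul_of_nonneg_left (key.trans (add_le_add_left h5 _)) h3.le
    linarith
  set Φ := fun t => mf t * E t + (∫ s in (0:ℝ)..t, G s) - 8 * ∫ s in (0:ℝ)..t, tw s * B s with hΦ
  have cTB : Continuous fun s => tw s * B s := cont_tw.mul cB
  have dΦ : ∀ t, -1 < t → HasDerivAt Φ ((-(tw t)⁻¹ * mf t) * E t + mf t * (-G t - 2 * P t) + G t
      - 8 * (tw t * B t)) t := by
    intro t ht
    have h1 := (hasDerivAt_mf ht).mul (dE t)
    have h2 := intervalIntegral.integral_hasDerivAt_right (cG.intervalIntegrable 0 t)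
      cG.stronglyMeasurable.stronglyMeasurableAtFilter cG.continuousAt
    have h3 := intervalIntegral.integral_hasDerivAt_right (cTB.intervalIntegrable 0 t)
      cTB.stronglyMeasurable.stronglyMeasurableAtFilter cTB.continuousAt
    exact (h1.add h2).sub (h3.const_mul 8)
  have anti : AntitoneOn Φ (Set.Ici 0) := by
    apply antitoneOn_of_deriv_nonpos (convex_Ici 0)
    · exact fun t ht => (dΦ t (by have : (0:ℝ) ≤ t := ht; linarith)).continuousAt.continuousWithinAt
    · exact fun t ht => (dΦ t (by rw [interior_Ici] at ht; have : (0:ℝ) < t := ht; linarith)).differentiableAt.differentiableWithinAt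
    · intro t ht
      rw [interior_Ici] at ht
      have ht0 : 0 ≤ t := (show (0:ℝ) < t from ht).le
      rw [(dΦ t (by linarith)).deriv]
      have y := young t ht0
      have m1 := one_le_mf ht0
      have m8 := mf_le ht0
      have tp := tw_pos ht0
      have : mf t * (-(2 * P t)) ≤ mf t * ((tw t)⁻¹ * E t + tw t * B t) :=
        mul_le_mul_of_nonneg_left y (by linarith)
      have h1 : G t ≤ mf t * G t := by nlinarith [nG t]
      have h2 : mf t * (tw t * B t) ≤ 8 * (tw t * B t) := by
        have := mul_nonneg tp.le (nB t)
        nlinarith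
      nlinarith
  have key := anti (Set.mem_Ici.2 (le_refl 0)) (Set.mem_Ici.2 hT) hT
  simp only [hΦ, intervalIntegral.integral_same, mul_zero, sub_zero, add_zero] at key
  have k1 : E T ≤ mf T * E T := by nlinarith [nE T, one_le_mf hT]
  have k2 : mf 0 * E 0 ≤ 8 * E 0 := by nlinarith [nE 0, mf_le (le_refl 0)]
  show E T + (∫ t in (0:ℝ)..T, G t) ≤ 8 * (E 0 + ∫ t in (0:ℝ)..T, tw t * B t)
  linarith

def EN (a : ℝ) (N : ℕ) (u : Pt → ℝ) (t : ℝ) : ℝ := ∫ x, WW a (t, x) * eW N u (t, x)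
def GN (a : ℝ) (N : ℕ) (u : Pt → ℝ) (t : ℝ) : ℝ := ∫ x, WD a (t, x) * tW N u (t, x)
def FN (a : ℝ) (N : ℕ) (F : Pt → ℝ) (t : ℝ) : ℝ := ∫ x, WW a (t, x) * sW N F (t, x)

lemma cont_eW {u : Pt → ℝ} (hu : ContDiff ℝ ∞ u) (N : ℕ) : Continuous (eW N u) := by
  unfold eW
  exact continuous_finset_sum _ fun I _ => cont_dsq (c1_of_smooth (smooth_Zw hu I))
lemma cont_tW {u : Pt → ℝ} (hu : ContDiff ℝ ∞ u) (N : ℕ) : Continuous (tW N u) := by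
  unfold tW
  exact continuous_finset_sum _ fun I _ => cont_tsq (c1_of_smooth (smooth_Zw hu I))
lemma cont_sW {u : Pt → ℝ} (hu : ContDiff ℝ ∞ u) (N : ℕ) : Continuous (sW N u) := by
  unfold sW
  exact continuous_finset_sum _ fun I _ => (smooth_Zw hu I).continuous.pow 2
lemma Scs.eW {u : Pt → ℝ} (hu : Scs u) (N : ℕ) : Scs (eW N u) := Scs.sum _ fun I _ => (hu.Zw I).dsq
lemma Scs.tW {u : Pt → ℝ} (hu : Scs u) (N : ℕ) : Scs (tW N u) := Scs.sum _ fun I _ => (hu.Zw I).tsq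
lemma Scs.sW {u : Pt → ℝ} (hu : Scs u) (N : ℕ) : Scs (sW N u) := Scs.sum _ fun I _ => (hu.Zw I).sq

lemma int_EN (a : ℝ) (N : ℕ) {u : Pt → ℝ} (hu : ContDiff ℝ ∞ u) (hs : Scs u) (t : ℝ) :
    Integrable fun x => WW a (t, x) * eW N u (t, x) :=
  slice_int (g := fun p => WW a p * eW N u p)
    ((smooth_WW a).continuous.mul (cont_eW hu N)) ((hs.eW N).mul_left _) t
lemma int_GN (a : ℝ) (N : ℕ) {u : Pt → ℝ} (hu : ContDiff ℝ ∞ u) (hs : Scs u) (t : ℝ) :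
    Integrable fun x => WD a (t, x) * tW N u (t, x) :=
  slice_int (g := fun p => WD a p * tW N u p)
    ((cont_WD a).mul (cont_tW hu N)) ((hs.tW N).mul_left _) t
lemma int_FN (a : ℝ) (N : ℕ) {u : Pt → ℝ} (hu : ContDiff ℝ ∞ u) (hs : Scs u) (t : ℝ) :
    Integrable fun x => WW a (t, x) * sW N u (t, x) :=
  slice_int (g := fun p => WW a p * sW N u p)
    ((smooth_WW a).continuous.mul (cont_sW hu N)) ((hs.sW N).mul_left _) t
lemma cont_GN (a : ℝ) (N : ℕ) {u : Pt → ℝ} (hu : ContDiff ℝ ∞ u) (hs : Scs u) : Continuous (GN a N u) :=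
  cont_int (g := fun p => WD a p * tW N u p)
    ((cont_WD a).mul (cont_tW hu N)) ((hs.tW N).mul_left _)
lemma cont_FN (a : ℝ) (N : ℕ) {u : Pt → ℝ} (hu : ContDiff ℝ ∞ u) (hs : Scs u) : Continuous (FN a N u) :=
  cont_int (g := fun p => WW a p * sW N u p)
    ((smooth_WW a).continuous.mul (cont_sW hu N)) ((hs.sW N).mul_left _)
lemma EN_nonneg (a : ℝ) (N : ℕ) (u : Pt → ℝ) (t : ℝ) : 0 ≤ EN a N u t :=
  integral_nonneg fun x => mul_nonneg (WW_pos _ _).le (eW_nonneg _ _ _)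
lemma GN_nonneg {a : ℝ} (ha : 0 ≤ a) (N : ℕ) (u : Pt → ℝ) (t : ℝ) : 0 ≤ GN a N u t :=
  integral_nonneg fun x => mul_nonneg (wd_nonneg ha _) (tW_nonneg _ _ _)
lemma FN_nonneg (a : ℝ) (N : ℕ) (u : Pt → ℝ) (t : ℝ) : 0 ≤ FN a N u t :=
  integral_nonneg fun x => mul_nonneg (WW_pos _ _).le (sW_nonneg _ _ _)

lemma energy_N {a : ℝ} (ha : 0 ≤ a) (N : ℕ) : ∃ C : ℝ, 0 ≤ C ∧ ∀ u : Pt → ℝ, ContDiff ℝ ∞ u → Scs u →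
    ∀ T, 0 ≤ T → EN a N u T + (∫ t in (0:ℝ)..T, GN a N u t)
      ≤ C * (EN a N u 0 + ∫ t in (0:ℝ)..T, tw t * FN a N (bx u) t) := by
  obtain ⟨C, hC, hcom⟩ := comm_bx N
  refine ⟨8 + 8 * C, by positivity, fun u hu hs T hT => ?_⟩
  have hWc := (smooth_WW a).continuous
  have sm := fun I => smooth_Zw hu I
  have ss := fun I => hs.Zw I
  have e1 : ∀ t, EN a N u t = ∑ I ∈ wds N, ∫ x, WW a (t, x) * dsq (Zw I u) (t, x) := by
    intro t
    unfold EN eW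
    simp only [Finset.mul_sum]
    exact integral_finset_sum _ fun I _ => slice_int (g := fun p => WW a p * dsq (Zw I u) p)
      (hWc.mul (cont_dsq (c1_of_smooth (sm I)))) ((ss I).dsq.mul_left _) t
  have e2 : ∀ t, GN a N u t = ∑ I ∈ wds N, ∫ x, WD a (t, x) * tsq (Zw I u) (t, x) := by
    intro t
    unfold GN tW
    simp only [Finset.mul_sum]
    exact integral_finset_sum _ fun I _ => slice_int (g := fun p => WD a p * tsq (Zw I u) p)
      ((cont_WD a).mul (cont_tsq (c1_of_smooth (sm I)))) ((ss I).tsq.mul_left _) t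
  have cB : ∀ I, Continuous fun t => ∫ x, WW a (t, x) * bx (Zw I u) (t, x) ^ 2 := fun I =>
    cont_int (g := fun p => WW a p * bx (Zw I u) p ^ 2)
      (hWc.mul ((smooth_bx (sm I)).continuous.pow 2)) ((ss I).bx.sq.mul_left _)
  have iB : ∀ I t, Integrable fun x => WW a (t, x) * bx (Zw I u) (t, x) ^ 2 := fun I t =>
    slice_int (g := fun p => WW a p * bx (Zw I u) p ^ 2)
      (hWc.mul ((smooth_bx (sm I)).continuous.pow 2)) ((ss I).bx.sq.mul_left _) t
  have e3 : ∀ t, ∑ I ∈ wds N, (∫ x, WW a (t, x) * bx (Zw I u) (t, x) ^ 2) ≤ C * FN a N (bx u) t := by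
    intro t
    rw [← integral_finset_sum _ fun I _ => iB I t]
    unfold FN
    rw [← integral_const_mul]
    refine integral_mono (integrable_finset_sum _ fun I _ => iB I t)
      ((int_FN a N (smooth_bx hu) hs.bx t).const_mul C) fun x => ?_
    simp only
    rw [← Finset.mul_sum]
    have := mul_le_mul_of_nonneg_left (hcom ⟨⟨u, hu⟩, (t, x)⟩) (WW_pos a (t, x)).le
    simp only at this
    linarith
  have h := Finset.sum_le_sum fun I (_ : I ∈ wds N) => energy_est ha (sm I) (ss I) hT
  rw [Finset.sum_add_distrib, ← Finset.mul_sum, Finset.sum_add_distrib, ← e1, ← e1,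
    ← intervalIntegral.integral_finset_sum (fun I _ => (cont_int (g := fun p => WD a p * tsq (Zw I u) p)
      ((cont_WD a).mul (cont_tsq (c1_of_smooth (sm I)))) ((ss I).tsq.mul_left _)).intervalIntegrable _ _),
    ← intervalIntegral.integral_finset_sum
      (f := fun I t => tw t * ∫ x, WW a (t, x) * bx (Zw I u) (t, x) ^ 2)
      (fun I _ => (cont_tw.mul (cB I)).intervalIntegrable _ _)] at h
  simp only [← e2, ← Finset.mul_sum] at h
  have h4 : (∫ t in (0:ℝ)..T, tw t * ∑ I ∈ wds N, (∫ x, WW a (t, x) * bx (Zw I u) (t, x) ^ 2))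
      ≤ ∫ t in (0:ℝ)..T, tw t * (C * FN a N (bx u) t) := by
    refine intervalIntegral.integral_mono_on hT
      ((cont_tw.mul (continuous_finset_sum _ fun I _ => cB I)).intervalIntegrable _ _)
      ((cont_tw.mul (continuous_const.mul (cont_FN a N (smooth_bx hu) hs.bx))).intervalIntegrable _ _) fun t ht => ?_
    exact mul_le_mul_of_nonneg_left (e3 t) (tw_nonneg ht.1)
  have h5 : (∫ t in (0:ℝ)..T, tw t * (C * FN a N (bx u) t)) = C * ∫ t in (0:ℝ)..T, tw t * FN a N (bx u) t := by
    rw [← intervalIntegral.integral_const_mul]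
    congr 1; funext t; ring
  have h6 : 0 ≤ ∫ t in (0:ℝ)..T, tw t * FN a N (bx u) t :=
    intervalIntegral.integral_nonneg hT fun t ht => mul_nonneg (tw_nonneg ht.1) (FN_nonneg _ _ _ _)
  have h7 := EN_nonneg a N u 0
  nlinarith [mul_nonneg hC h7]

lemma Xc1 (p : Pt) : Xc 1 p = p.2 0 := rfl
lemma Xc2 (p : Pt) : Xc 2 p = p.2 1 := rfl
lemma Xc3 (p : Pt) : Xc 3 p = p.2 2 := rfl
lemma Zf_of (n : Fin 11) (v : Fin 4 → ℝ) (B : Matrix (Fin 4) (Fin 4) ℝ) (hv : va n = v) (hB : vB n = B)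
    (f : Pt → ℝ) (p : Pt) : Zf n f p = ∑ a, (v a + ∑ b, B a b * Xc b p) * D a f p := by
  rw [← hv, ← hB]; rfl
lemma Zf_D (f : Pt → ℝ) (p : Pt) (a : Fin 4) : ∃ n : Fin 11, Zf n f p = D a f p := by
  fin_cases a
  · exact ⟨0, by rw [Zf_of 0 (Pi.single 0 1) 0 rfl rfl]; simp [Pi.single_apply]⟩
  · exact ⟨1, by rw [Zf_of 1 (Pi.single 1 1) 0 rfl rfl]; simp [Pi.single_apply]⟩
  · exact ⟨2, by rw [Zf_of 2 (Pi.single 2 1) 0 rfl rfl]; simp [Pi.single_apply]⟩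
  · exact ⟨3, by rw [Zf_of 3 (Pi.single 3 1) 0 rfl rfl]; simp [Pi.single_apply]⟩
lemma Zf_S (f : Pt → ℝ) (p : Pt) : Zf 4 f p = p.1 * D 0 f p + ∑ i : Fin 3, p.2 i * D i.succ f p := by
  rw [Zf_of 4 0 1 rfl rfl, Fin.sum_univ_succ]
  simp [Matrix.one_apply]
lemma Zf_B (f : Pt → ℝ) (p : Pt) (i : Fin 3) :
    ∃ n : Fin 11, Zf n f p = -(p.1 * D i.succ f p) - p.2 i * D 0 f p := by
  fin_cases i
  · refine ⟨5, ?_⟩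
    rw [Zf_of 5 0 (!![0, -1, 0, 0; -1, 0, 0, 0; 0, 0, 0, 0; 0, 0, 0, 0]) rfl rfl]
    simp [Fin.sum_univ_four, Xc1, Xc2, Xc3]; try ring
  · refine ⟨6, ?_⟩
    rw [Zf_of 6 0 (!![0, 0, -1, 0; 0, 0, 0, 0; -1, 0, 0, 0; 0, 0, 0, 0]) rfl rfl]
    simp [Fin.sum_univ_four, Xc1, Xc2, Xc3]; try ring
  · refine ⟨7, ?_⟩
    rw [Zf_of 7 0 (!![0, 0, 0, -1; 0, 0, 0, 0; 0, 0, 0, 0; -1, 0, 0, 0]) rfl rfl]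
    simp [Fin.sum_univ_four, Xc1, Xc2, Xc3]; try ring
lemma Zf_R01 (f : Pt → ℝ) (p : Pt) : Zf 8 f p = p.2 0 * D 2 f p - p.2 1 * D 1 f p := by
  rw [Zf_of 8 0 (!![0, 0, 0, 0; 0, 0, -1, 0; 0, 1, 0, 0; 0, 0, 0, 0]) rfl rfl]
  simp [Fin.sum_univ_four, Xc1, Xc2, Xc3]; try ring
lemma Zf_R02 (f : Pt → ℝ) (p : Pt) : Zf 9 f p = p.2 0 * D 3 f p - p.2 2 * D 1 f p := by
  rw [Zf_of 9 0 (!![0, 0, 0, 0; 0, 0, 0, -1; 0, 0, 0, 0; 0, 1, 0, 0]) rfl rfl]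
  simp [Fin.sum_univ_four, Xc1, Xc2, Xc3]; try ring
lemma Zf_R12 (f : Pt → ℝ) (p : Pt) : Zf 10 f p = p.2 1 * D 3 f p - p.2 2 * D 2 f p := by
  rw [Zf_of 10 0 (!![0, 0, 0, 0; 0, 0, 0, 0; 0, 0, 0, -1; 0, 0, 1, 0]) rfl rfl]
  simp [Fin.sum_univ_four, Xc1, Xc2, Xc3]; try ring

lemma Zf_le_sW (f : Pt → ℝ) (p : Pt) (n : Fin 11) : Zf n f p ^ 2 ≤ sW 1 f p :=
  le_sW (J := [n]) (by simp) f p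
lemma D_le_sW (f : Pt → ℝ) (p : Pt) (a : Fin 4) : D a f p ^ 2 ≤ sW 1 f p := by
  obtain ⟨n, hn⟩ := Zf_D f p a
  rw [← hn]; exact Zf_le_sW f p n
lemma B_le_sW (f : Pt → ℝ) (p : Pt) (i : Fin 3) : (p.1 * D i.succ f p + p.2 i * D 0 f p) ^ 2 ≤ sW 1 f p := by
  obtain ⟨n, hn⟩ := Zf_B f p i
  have := Zf_le_sW f p n
  rw [hn] at this
  linarith
lemma R_le_sW (f : Pt → ℝ) (p : Pt) (i j : Fin 3) :
    (p.2 i * D j.succ f p - p.2 j * D i.succ f p) ^ 2 ≤ sW 1 f p := by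
  have h1 := Zf_le_sW f p 8
  have h2 := Zf_le_sW f p 9
  have h3 := Zf_le_sW f p 10
  have h0 := sW_nonneg 1 f p
  rw [Zf_R01] at h1
  rw [Zf_R02] at h2
  rw [Zf_R12] at h3
  fin_cases i <;> fin_cases j
  · show (p.2 0 * D 1 f p - p.2 0 * D 1 f p) ^ 2 ≤ _
    simpa using h0
  · exact h1
  · exact h2
  · show (p.2 1 * D 1 f p - p.2 0 * D 2 f p) ^ 2 ≤ _
    linarith
  · show (p.2 1 * D 2 f p - p.2 1 * D 2 f p) ^ 2 ≤ _
    simpa using h0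
  · exact h3
  · show (p.2 2 * D 1 f p - p.2 0 * D 3 f p) ^ 2 ≤ _
    linarith
  · show (p.2 2 * D 2 f p - p.2 1 * D 3 f p) ^ 2 ≤ _
    linarith
  · show (p.2 2 * D 3 f p - p.2 2 * D 3 f p) ^ 2 ≤ _
    simpa using h0

lemma cs5 (t a b c T A B C S : ℝ) (h : T ^ 2 ≤ S) (h1 : A ^ 2 ≤ S) (h2 : B ^ 2 ≤ S) (h3 : C ^ 2 ≤ S) :
    (t * T + a * A + b * B + c * C) ^ 2 ≤ 4 * (t ^ 2 + (a ^ 2 + b ^ 2 + c ^ 2)) * S := by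
  have : (t * T + a * A + b * B + c * C) ^ 2 ≤ (t ^ 2 + (a ^ 2 + b ^ 2 + c ^ 2)) * (T ^ 2 + A ^ 2 + B ^ 2 + C ^ 2) := by
    nlinarith [sq_nonneg (t * A - a * T), sq_nonneg (t * B - b * T), sq_nonneg (t * C - c * T),
      sq_nonneg (a * B - b * A), sq_nonneg (a * C - c * A), sq_nonneg (b * C - c * B)]
  refine this.trans ?_
  have h4 : T ^ 2 + A ^ 2 + B ^ 2 + C ^ 2 ≤ 4 * S := by linarith
  nlinarith [mul_le_mul_of_nonneg_left h4 (by positivity : 0 ≤ t ^ 2 + (a ^ 2 + b ^ 2 + c ^ 2))]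

lemma cone_D (f : Pt → ℝ) (p : Pt) (a : Fin 4) :
    (p.1 ^ 2 - ∑ i, p.2 i ^ 2) ^ 2 * D a f p ^ 2 ≤ 4 * (p.1 ^ 2 + ∑ i, p.2 i ^ 2) * sW 1 f p := by
  have hS := Zf_le_sW f p 4
  rw [Zf_S, Fin.sum_univ_three] at hS
  have b0 := B_le_sW f p 0
  have b1 := B_le_sW f p 1
  have b2 := B_le_sW f p 2
  have r01 := R_le_sW f p 0 1
  have r02 := R_le_sW f p 0 2
  have r12 := R_le_sW f p 1 2
  have r10 := R_le_sW f p 1 0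
  have r20 := R_le_sW f p 2 0
  have r21 := R_le_sW f p 2 1
  have e1 : (Fin.succ 0 : Fin 4) = 1 := rfl
  have e2 : (Fin.succ 1 : Fin 4) = 2 := rfl
  have e3 : (Fin.succ 2 : Fin 4) = 3 := rfl
  rw [e1, e2, e3] at hS
  simp only [e1, e2, e3] at b0 b1 b2 r01 r02 r12 r10 r20 r21
  rw [Fin.sum_univ_three, ← mul_pow]
  fin_cases a
  · refine le_trans (le_of_eq ?_) (cs5 p.1 (-p.2 0) (-p.2 1) (-p.2 2) _ _ _ _ _ hS b0 b1 b2 |>.trans (le_of_eq ?_))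
    · simp only [Fin.zero_eta]; ring
    · ring
  · refine le_trans (le_of_eq ?_) (cs5 p.1 (-p.2 0) (-p.2 1) (-p.2 2) _ _ _ _ _ b0 hS r10 r20 |>.trans (le_of_eq ?_))
    · simp only [Fin.mk_one]; ring
    · ring
  · refine le_trans (le_of_eq ?_) (cs5 p.1 (-p.2 0) (-p.2 1) (-p.2 2) _ _ _ _ _ b1 r01 hS r21 |>.trans (le_of_eq ?_))
    · simp only [Fin.reduceFinMk]; ring
    · ring
  · refine le_trans (le_of_eq ?_) (cs5 p.1 (-p.2 0) (-p.2 1) (-p.2 2) _ _ _ _ _ b2 r02 r12 hS |>.trans (le_of_eq ?_))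
    · simp only [Fin.reduceFinMk]; ring
    · ring

lemma jq_D (f : Pt → ℝ) {p : Pt} (ht : 0 ≤ p.1) (a : Fin 4) :
    jq (jb p.2 - p.1) ^ 2 * D a f p ^ 2 ≤ 11 * sW 1 f p := by
  have h1 := cone_D f p a
  have h2 := D_le_sW f p a
  have h3 := jb_sq p.2
  have h4 := jb_ge_one p.2
  have h5 : 0 ≤ ∑ i, p.2 i ^ 2 := Finset.sum_nonneg fun i _ => sq_nonneg _
  rw [jq_sq]
  set r2 := ∑ i, p.2 i ^ 2
  set d := D a f p ^ 2
  have hd : 0 ≤ d := sq_nonneg _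
  set j := jb p.2
  set t := p.1
  have h0 := sW_nonneg 1 f p
  set s := sW 1 f p
  have k1 : (1 + r2 + t ^ 2) * (j - t) ^ 2 ≤ 2 + 2 * (t ^ 2 - r2) ^ 2 := by
    have e : (j - t) ^ 2 * (j + t) ^ 2 = (1 + r2 - t ^ 2) ^ 2 := by
      rw [← mul_pow]; congr 1; nlinarith
    have : (1 + r2 + t ^ 2) * (j - t) ^ 2 ≤ (j - t) ^ 2 * (j + t) ^ 2 := by
      rw [mul_comm]
      apply mul_le_mul_of_nonneg_left _ (sq_nonneg _)
      nlinarith [mul_nonneg (by linarith : (0:ℝ) ≤ j) ht]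
    nlinarith [sq_nonneg (1 - (r2 - t ^ 2))]
  have hm : 0 < 1 + r2 + t ^ 2 := by positivity
  have k2 : (1 + r2 + t ^ 2) * ((j - t) ^ 2 * d) ≤ (1 + r2 + t ^ 2) * (10 * s) := by
    have := mul_le_mul_of_nonneg_right k1 hd
    nlinarith [mul_nonneg h5 h0, mul_nonneg (sq_nonneg t) h0]
  have k3 := le_of_mul_le_mul_left k2 hm
  linarith

lemma tsq_Z (f : Pt → ℝ) {p : Pt} (ht : 0 ≤ p.1) :
    (1 + p.1 + rad p.2) ^ 2 * tsq f p ≤ 2000 * sW 1 f p := by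
  have h4 := jb_ge_one p.2
  have hr := rad_le_jb p.2
  have hr0 := rad_nonneg p.2
  have h0 := sW_nonneg 1 f p
  have d0 := jq_D f ht 0
  have dd0 := D_le_sW f p 0
  have hj := jq_sq (jb p.2 - p.1)
  rw [hj] at d0
  have hjr : ∀ i, (p.2 i / jb p.2) ^ 2 ≤ 1 := by
    intro i
    rw [div_pow, div_le_one (by positivity), sq_le_sq, abs_of_pos (jb_pos _)]
    exact (abs_le_rad _ i).trans hr
  set j := jb p.2
  set t := p.1
  set s := sW 1 f p
  set q := j - t with hq
  have hm : (1 + t + rad p.2) ^ 2 ≤ 18 * j ^ 2 + 2 * q ^ 2 := by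
    have : (1 + t + rad p.2) ^ 2 ≤ (3 * j - q) ^ 2 := by
      apply pow_le_pow_left₀ (by positivity); linarith
    nlinarith [sq_nonneg (3 * j + q)]
  have key : ∀ X : ℝ, j ^ 2 * X ^ 2 ≤ 30 * s → q ^ 2 * X ^ 2 ≤ 50 * s → (1 + t + rad p.2) ^ 2 * X ^ 2 ≤ 640 * s := by
    intro X h1 h2
    have := mul_le_mul_of_nonneg_right hm (sq_nonneg X)
    nlinarith
  unfold tsq
  rw [mul_add, Finset.mul_sum]
  have b1 : ∀ i : Fin 3, (1 + t + rad p.2) ^ 2 * (D i.succ f p + p.2 i / jb p.2 * D 0 f p) ^ 2 ≤ 640 * s := by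
    intro i
    have di := jq_D f ht i.succ
    rw [hj] at di
    have hb := B_le_sW f p i
    have dd := D_le_sW f p i.succ
    apply key
    · have e : j ^ 2 * (D i.succ f p + p.2 i / jb p.2 * D 0 f p) ^ 2
          = (q * D i.succ f p + (t * D i.succ f p + p.2 i * D 0 f p)) ^ 2 := by
        have : j ≠ 0 := by positivity
        rw [← mul_pow]; congr 1
        show j * (D i.succ f p + p.2 i / j * D 0 f p) = _
        rw [hq]; field_simp; ring
      rw [e]
      have := sq_add_le (q * D i.succ f p) (t * D i.succ f p + p.2 i * D 0 f p)
      nlinarith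
    · have h1 := sq_add_le (D i.succ f p) (p.2 i / jb p.2 * D 0 f p)
      have h2 : (p.2 i / jb p.2 * D 0 f p) ^ 2 ≤ D 0 f p ^ 2 := by
        rw [mul_pow]; nlinarith [hjr i, sq_nonneg (D 0 f p)]
      have := mul_le_mul_of_nonneg_left (h1.trans (add_le_add_right (mul_le_mul_of_nonneg_left h2 zero_le_two) _)) (sq_nonneg q)
      nlinarith
  have b2 : (1 + t + rad p.2) ^ 2 * (D 0 f p / jb p.2) ^ 2 ≤ 80 * s := by
    have hm2 : (1 + t + rad p.2) ^ 2 ≤ (20 + 2 * q ^ 2) * j ^ 2 := by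
      nlinarith [mul_le_mul_of_nonneg_left (by nlinarith : (1:ℝ) ≤ j ^ 2) (sq_nonneg q)]
    rw [div_pow, mul_div_assoc', div_le_iff₀ (by positivity)]
    have := mul_le_mul_of_nonneg_right hm2 (sq_nonneg (D 0 f p))
    have h6 : (20 + 2 * q ^ 2) * D 0 f p ^ 2 ≤ 80 * s := by nlinarith
    have := mul_le_mul_of_nonneg_right h6 (sq_nonneg j)
    show _ ≤ 80 * s * j ^ 2
    nlinarith
  rw [Fin.sum_univ_three]
  have := b1 0
  have := b1 1
  have := b1 2
  linarith

open scoped ENNReal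

lemma mv {g g' B : ℝ → ℝ} {z a : ℝ} (ha : 0 < a) (h : ∀ s ∈ Set.Icc z (z + a), HasDerivAt g (g' s) s)
    (hc : ContinuousOn g' (Set.Icc z (z + a)))
    (hB : ∀ s ∈ Set.Icc z (z + a), g s ^ 2 + a ^ 2 * g' s ^ 2 ≤ B s) :
    ENNReal.ofReal (g z ^ 2) ≤ ENNReal.ofReal (2 / a) * ∫⁻ s in Set.Icc z (z + a), ENNReal.ofReal (B s) := by
  have hza : z ≤ z + a := by linarith
  have hgc : ContinuousOn g (Set.Icc z (z + a)) := fun s hs => (h s hs).continuousAt.continuousWithinAt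
  set P := fun s => (1 - (s - z) / a) * g s ^ 2 with hP
  set P' := fun s => (-(1 / a)) * g s ^ 2 + (1 - (s - z) / a) * (2 * g s * g' s) with hP'
  have dP : ∀ s ∈ Set.uIcc z (z + a), HasDerivAt P (P' s) s := by
    intro s hs
    rw [Set.uIcc_of_le hza] at hs
    have h1 : HasDerivAt (fun s => 1 - (s - z) / a) (-(1 / a)) s := by
      have := (((hasDerivAt_id s).sub_const z).div_const a).const_sub 1
      simpa using this
    have := h1.mul ((h s hs).pow 2)
    refine this.congr_deriv ?_
    simp [hP']
  have cP' : ContinuousOn P' (Set.Icc z (z + a)) := by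
    simp only [hP']
    refine (continuousOn_const.mul (hgc.pow 2)).add (ContinuousOn.mul (by fun_prop) ((continuousOn_const.mul hgc).mul hc))
  have ftc := intervalIntegral.integral_eq_sub_of_hasDerivAt dP (by
    apply ContinuousOn.intervalIntegrable; rwa [Set.uIcc_of_le hza])
  have e1 : P (z + a) = 0 := by simp [hP, ha.ne']
  have e2 : P z = g z ^ 2 := by simp [hP]
  rw [e1, e2] at ftc
  set R := fun s => (2 / a) * (g s ^ 2 + a ^ 2 * g' s ^ 2) with hR
  have cR : ContinuousOn R (Set.Icc z (z + a)) :=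
    continuousOn_const.mul ((hgc.pow 2).add (continuousOn_const.mul (hc.pow 2)))
  have k1 : g z ^ 2 ≤ ∫ s in Set.Icc z (z + a), R s := by
    rw [integral_Icc_eq_integral_Ioc, ← intervalIntegral.integral_of_le hza]
    have : g z ^ 2 = ∫ s in z..(z + a), - P' s := by
      rw [intervalIntegral.integral_neg, ftc]; ring
    rw [this]
    refine intervalIntegral.integral_mono_on hza ?_ ?_ fun s hs => ?_
    · apply ContinuousOn.intervalIntegrable; rw [Set.uIcc_of_le hza]; exact cP'.neg
    · apply ContinuousOn.intervalIntegrable; rwa [Set.uIcc_of_le hza]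
    · simp only [hP', hR]
      set m := 1 - (s - z) / a with hm
      have hs1 : 0 ≤ (s - z) / a := div_nonneg (by linarith [hs.1]) ha.le
      have hs2 : (s - z) / a ≤ 1 := by rw [div_le_one ha]; linarith [hs.2]
      have m0 : 0 ≤ m := by linarith
      have m1 : m ≤ 1 := by linarith
      have e : (2 / a) * (g s ^ 2 + a ^ 2 * g' s ^ 2) - -(-(1 / a) * g s ^ 2 + m * (2 * g s * g' s))
          = (1 / a) * ((g s + m * (a * g' s)) ^ 2 + (2 - m ^ 2) * (a * g' s) ^ 2) := by
        field_simp; ring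
      have : 0 ≤ (1 / a) * ((g s + m * (a * g' s)) ^ 2 + (2 - m ^ 2) * (a * g' s) ^ 2) := by
        have : 0 ≤ 2 - m ^ 2 := by nlinarith
        positivity
      linarith
  refine (ENNReal.ofReal_le_ofReal k1).trans ?_
  rw [ofReal_integral_eq_lintegral_ofReal (cR.integrableOn_Icc)
    (Filter.Eventually.of_forall fun s => by simp only [hR]; positivity),
    ← lintegral_const_mul' _ _ ENNReal.ofReal_ne_top]
  refine setLIntegral_mono' measurableSet_Icc fun s hs => ?_
  rw [← ENNReal.ofReal_mul (by positivity)]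
  exact ENNReal.ofReal_le_ofReal (mul_le_mul_of_nonneg_left (hB s hs) (by positivity))

/-- A move along a curve `γ` of parameter length `a`. -/
lemma mv_sW (k : ℕ) (K : ℝ) (hK : 0 ≤ K) : ∃ C : ℝ, 0 ≤ C ∧ ∀ (f : Pt → ℝ), ContDiff ℝ ∞ f →
    ∀ (γ γ' : ℝ → Pt) (z a : ℝ), 0 < a → (∀ s ∈ Set.Icc z (z + a), HasDerivAt γ (γ' s) s) →
    ContinuousOn γ' (Set.Icc z (z + a)) →
    (∀ s ∈ Set.Icc z (z + a), ∀ h : Pt → ℝ, ContDiff ℝ ∞ h →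
      a ^ 2 * (fderiv ℝ h (γ s) (γ' s)) ^ 2 ≤ K * sW 1 h (γ s)) →
    ENNReal.ofReal (sW k f (γ z)) ≤ ENNReal.ofReal (C / a) *
      ∫⁻ s in Set.Icc z (z + a), ENNReal.ofReal (sW (k + 1) f (γ s)) := by
  have h1 : ∃ C : ℝ, 0 ≤ C ∧ ∀ x : (Pt → ℝ) × Pt, ∑ J ∈ wds k, sW 1 (Zw J x.1) x.2 ≤ C * sW (k + 1) x.1 x.2 := by
    refine sum_bd (wds k) (fun J (x : (Pt → ℝ) × Pt) => sW 1 (Zw J x.1) x.2) (fun x => sW (k+1) x.1 x.2) fun J hJ => ?_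
    refine sum_bd (wds 1) (fun I (x : (Pt → ℝ) × Pt) => Zw I (Zw J x.1) x.2 ^ 2) (fun x => sW (k+1) x.1 x.2) fun I hI => ?_
    refine ⟨1, zero_le_one, fun x => ?_⟩
    rw [one_mul, ← Zw_append]
    apply le_sW
    rw [mem_wds] at hI hJ
    simp; omega
  obtain ⟨C1, hC1, hb⟩ := h1
  set cd : ℝ := ((wds k).card : ℝ) with hcdd
  have hcd : 0 ≤ cd := Nat.cast_nonneg _
  refine ⟨cd * (2 * (1 + K * C1)), by positivity, fun f hf γ γ' z a ha hγ hc hh => ?_⟩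
  have key : ∀ J ∈ wds k, ENNReal.ofReal (Zw J f (γ z) ^ 2) ≤ ENNReal.ofReal (2 * (1 + K * C1) / a) *
      ∫⁻ s in Set.Icc z (z + a), ENNReal.ofReal (sW (k + 1) f (γ s)) := by
    intro J hJ
    have hJs := smooth_Zw hf J
    have hcγ : ContinuousOn γ (Set.Icc z (z + a)) := fun s hs => (hγ s hs).continuousAt.continuousWithinAt
    have := mv (g := fun s => Zw J f (γ s)) (g' := fun s => fderiv ℝ (Zw J f) (γ s) (γ' s))
      (B := fun s => (1 + K * C1) * sW (k + 1) f (γ s)) (z := z) ha ?_ ?_ ?_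
    · refine this.trans (le_of_eq ?_)
      have e : ∀ s, ENNReal.ofReal ((1 + K * C1) * sW (k + 1) f (γ s))
        = ENNReal.ofReal (1 + K * C1) * ENNReal.ofReal (sW (k + 1) f (γ s)) := fun s =>
          ENNReal.ofReal_mul (by positivity)
      simp only [e]
      rw [lintegral_const_mul' _ _ ENNReal.ofReal_ne_top, ← mul_assoc, ← ENNReal.ofReal_mul (by positivity)]
      congr 2; ring
    · intro s hs
      exact (diff_of_smooth hJs (γ s)).hasFDerivAt.comp_hasDerivAt s (hγ s hs)
    · have h2 : Continuous (fderiv ℝ (Zw J f)) := hJs.continuous_fderiv (by simp)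
      exact (h2.comp_continuousOn hcγ).clm_apply hc
    · intro s hs
      have h2 := hh s hs (Zw J f) hJs
      have h3 : Zw J f (γ s) ^ 2 ≤ sW (k + 1) f (γ s) := le_sW (by rw [mem_wds] at hJ; omega) f _
      have h4 : sW 1 (Zw J f) (γ s) ≤ C1 * sW (k + 1) f (γ s) :=
        le_trans (Finset.single_le_sum (f := fun J => sW 1 (Zw J f) (γ s)) (fun _ _ => sW_nonneg _ _ _) hJ) (hb (f, γ s))
      have h5 := mul_le_mul_of_nonneg_left h4 hK
      nlinarith
  unfold sW at key ⊢
  rw [ENNReal.ofReal_sum_of_nonneg fun _ _ => sq_nonneg _]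
  refine (Finset.sum_le_sum key).trans (le_of_eq ?_)
  rw [Finset.sum_const, nsmul_eq_mul, ← mul_assoc]
  congr 1
  rw [mul_div_assoc cd, ENNReal.ofReal_mul hcd, hcdd, ENNReal.ofReal_natCast]

/-- Point with `i`-th coordinate `s` and the remaining ones `b`, `c`. -/
def ins (i : Fin 3) (b c s : ℝ) : Spc := i.insertNth s ![b, c]

lemma tonelli3 (i : Fin 3) (H : Spc → ℝ≥0∞) (hH : Measurable H) :
    ∫⁻ b, ∫⁻ c, ∫⁻ s, H (ins i b c s) = ∫⁻ y, H y := by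
  have h1 := (volume_preserving_piFinSuccAbove (fun _ : Fin 3 => ℝ) i).symm
  have h2 := (volume_preserving_finTwoArrow ℝ).symm
  set F : ℝ × (Fin 2 → ℝ) → ℝ≥0∞ := fun x => H ((MeasurableEquiv.piFinSuccAbove (fun _ : Fin 3 => ℝ) i).symm x) with hF
  have mF : Measurable F := hH.comp (MeasurableEquiv.measurable _)
  have m2 : Measurable fun y => ∫⁻ s, F (s, y) := mF.lintegral_prod_left'
  have e1 : ∫⁻ y, H y = ∫⁻ x, F x := (h1.lintegral_comp hH).symm
  have e2 : ∫⁻ x, F x = ∫⁻ y, ∫⁻ s, F (s, y) := lintegral_prod_symm _ mF.aemeasurable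
  have e3 : ∫⁻ y, ∫⁻ s, F (s, y) = ∫⁻ z : ℝ × ℝ, ∫⁻ s, F (s, MeasurableEquiv.finTwoArrow.symm z) :=
    (h2.lintegral_comp m2).symm
  have e4 : (∫⁻ z : ℝ × ℝ, ∫⁻ s, F (s, MeasurableEquiv.finTwoArrow.symm z))
      = ∫⁻ b, ∫⁻ c, ∫⁻ s, F (s, MeasurableEquiv.finTwoArrow.symm (b, c)) :=
    lintegral_prod _ (m2.comp (MeasurableEquiv.measurable _)).aemeasurable
  rw [e1, e2, e3, e4]
  rfl

lemma ins_sum (i : Fin 3) (b c s : ℝ) : ∑ k, (ins i b c s) k ^ 2 = s ^ 2 + b ^ 2 + c ^ 2 := by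
  rw [Fin.sum_univ_succAbove _ i]
  simp [ins, Fin.sum_univ_two]; ring
lemma ins_self (i : Fin 3) (b c s : ℝ) : ins i b c s i = s := by simp [ins]
lemma ins_zero (i : Fin 3) (b c s : ℝ) : ins i b c s (i.succAbove 0) = b := by simp [ins]
lemma ins_one (i : Fin 3) (b c s : ℝ) : ins i b c s (i.succAbove 1) = c := by simp [ins]
lemma ins_eta (i : Fin 3) (x : Spc) : ins i (x (i.succAbove 0)) (x (i.succAbove 1)) (x i) = x := by
  funext k
  rcases Fin.eq_self_or_eq_succAbove i k with h | ⟨j, h⟩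
  · rw [h, ins_self]
  · rw [h]; fin_cases j
    · exact ins_zero _ _ _ _
    · exact ins_one _ _ _ _
lemma ins_lin (i : Fin 3) (b c s : ℝ) : ins i b c s =
    b • Pi.single (i.succAbove 0) 1 + c • Pi.single (i.succAbove 1) 1 + s • (Pi.single i 1 : Spc) := by
  funext k
  have h01 : (0 : Fin 2) ≠ 1 := by decide
  rcases Fin.eq_self_or_eq_succAbove i k with h | ⟨j, h⟩
  · rw [h, ins_self]; simp [Pi.single_apply, Fin.succAbove_ne, (Fin.succAbove_ne i _).symm]
  · rw [h]; fin_cases j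
    · refine (ins_zero i b c s).trans ?_
      simp [Pi.single_apply, Fin.succAbove_ne, (Fin.succAbove_ne i _).symm, Fin.succAbove_right_inj]
    · refine (ins_one i b c s).trans ?_
      simp [Pi.single_apply, Fin.succAbove_ne, (Fin.succAbove_ne i _).symm, Fin.succAbove_right_inj]

lemma fderiv_two (h : Pt → ℝ) (p : Pt) (j i : Fin 3) (c : ℝ) :
    fderiv ℝ h p ((0 : ℝ), (Pi.single j 1 + c • Pi.single i 1 : Spc)) = D j.succ h p + c * D i.succ h p := by
  have : ((0 : ℝ), (Pi.single j 1 + c • Pi.single i 1 : Spc)) = ev j.succ + c • ev i.succ := by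
    simp
  rw [this, map_add, map_smul]; rfl

lemma der_ins_b (i : Fin 3) (t c : ℝ) {Y : ℝ → ℝ} {Y' b : ℝ} (h : HasDerivAt Y Y' b) :
    HasDerivAt (fun b => ((t, ins i b c (Y b)) : Pt))
      ((0 : ℝ), (Pi.single (i.succAbove 0) 1 + Y' • Pi.single i 1 : Spc)) b := by
  refine (hasDerivAt_const b t).prodMk ?_
  have e : (fun b => ins i b c (Y b)) = fun b => _ := funext fun b => ins_lin i b c (Y b)
  rw [e]
  have h1 := ((hasDerivAt_id b).smul_const (Pi.single (i.succAbove 0) 1 : Spc)).add_const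
    (c • (Pi.single (i.succAbove 1) 1 : Spc))
  have := h1.add (h.smul_const (Pi.single i 1 : Spc))
  exact (show HasDerivAt _ _ b from this).congr_deriv (by simp)
lemma der_ins_c (i : Fin 3) (t b : ℝ) {Y : ℝ → ℝ} {Y' c : ℝ} (h : HasDerivAt Y Y' c) :
    HasDerivAt (fun c => ((t, ins i b c (Y c)) : Pt))
      ((0 : ℝ), (Pi.single (i.succAbove 1) 1 + Y' • Pi.single i 1 : Spc)) c := by
  refine (hasDerivAt_const c t).prodMk ?_
  have e : (fun c => ins i b c (Y c)) = fun c => _ := funext fun c => ins_lin i b c (Y c)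
  rw [e]
  have h1 := ((hasDerivAt_id c).smul_const (Pi.single (i.succAbove 1) 1 : Spc)).const_add
    (b • (Pi.single (i.succAbove 0) 1 : Spc))
  have := h1.add (h.smul_const (Pi.single i 1 : Spc))
  exact (show HasDerivAt _ _ c from this).congr_deriv (by simp)
lemma der_ins_s (i : Fin 3) (t b c s : ℝ) :
    HasDerivAt (fun s => ((t, ins i b c s) : Pt)) ((0 : ℝ), (Pi.single i 1 : Spc)) s := by
  refine (hasDerivAt_const s t).prodMk ?_
  have e : ins i b c = fun s => _ := funext fun s => ins_lin i b c s
  rw [e]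
  have := ((hasDerivAt_id s).smul_const (Pi.single i 1 : Spc)).const_add
    (b • (Pi.single (i.succAbove 0) 1 : Spc) + c • (Pi.single (i.succAbove 1) 1 : Spc))
  exact (show HasDerivAt _ _ s from this).congr_deriv (by simp)

lemma three (K : ℝ) (hK : 0 ≤ K) : ∃ C : ℝ, 0 ≤ C ∧ ∀ (a : ℝ) (f : Pt → ℝ), ContDiff ℝ ∞ f →
    ∀ (i : Fin 3) (t b0 c0 l m Wx : ℝ) (Y : ℝ → ℝ → ℝ) (Yb : ℝ → ℝ) (Yc : ℝ → ℝ → ℝ), 0 < l → 0 < m → 0 ≤ Wx →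
    (∀ b ∈ Set.Icc b0 (b0 + l), HasDerivAt (fun b => Y b c0) (Yb b) b) →
    ContinuousOn Yb (Set.Icc b0 (b0 + l)) →
    (∀ b ∈ Set.Icc b0 (b0 + l), ∀ c ∈ Set.Icc c0 (c0 + l), HasDerivAt (Y b) (Yc b c) c) →
    (∀ b ∈ Set.Icc b0 (b0 + l), ContinuousOn (Yc b) (Set.Icc c0 (c0 + l))) →
    (∀ h : Pt → ℝ, ContDiff ℝ ∞ h → ∀ b ∈ Set.Icc b0 (b0 + l),
      l ^ 2 * (D (i.succAbove 0).succ h (t, ins i b c0 (Y b c0)) + Yb b * D i.succ h (t, ins i b c0 (Y b c0))) ^ 2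
        ≤ K * sW 1 h (t, ins i b c0 (Y b c0))) →
    (∀ h : Pt → ℝ, ContDiff ℝ ∞ h → ∀ b ∈ Set.Icc b0 (b0 + l), ∀ c ∈ Set.Icc c0 (c0 + l),
      l ^ 2 * (D (i.succAbove 1).succ h (t, ins i b c (Y b c)) + Yc b c * D i.succ h (t, ins i b c (Y b c))) ^ 2
        ≤ K * sW 1 h (t, ins i b c (Y b c))) →
    (∀ h : Pt → ℝ, ContDiff ℝ ∞ h → ∀ b ∈ Set.Icc b0 (b0 + l), ∀ c ∈ Set.Icc c0 (c0 + l),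
      ∀ s ∈ Set.Icc (Y b c) (Y b c + m), m ^ 2 * D i.succ h (t, ins i b c s) ^ 2 ≤ K * sW 1 h (t, ins i b c s)) →
    (∀ b ∈ Set.Icc b0 (b0 + l), ∀ c ∈ Set.Icc c0 (c0 + l), ∀ s ∈ Set.Icc (Y b c) (Y b c + m),
      Wx ≤ K * WW a (t, ins i b c s)) →
    ENNReal.ofReal (Wx * f (t, ins i b0 c0 (Y b0 c0)) ^ 2) ≤ ENNReal.ofReal (C / (l * l * m)) *
      ∫⁻ y, ENNReal.ofReal (WW a (t, y) * sW 3 f (t, y)) := by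
  obtain ⟨C0, hC0, h0⟩ := mv_sW 0 K hK
  obtain ⟨C1, hC1, h1⟩ := mv_sW 1 K hK
  obtain ⟨C2, hC2, h2⟩ := mv_sW 2 K hK
  refine ⟨C0 * C1 * C2 * K, by positivity, ?_⟩
  intro a f hf i t b0 c0 l m Wx Y Yb Yc hl hm hW dYb cYb dYc cYc kb kc ks hw
  set H : Spc → ℝ≥0∞ := fun y => ENNReal.ofReal (WW a (t, y) * sW 3 f (t, y)) with hH
  have mH : Measurable H := by
    refine ENNReal.measurable_ofReal.comp (Continuous.measurable ?_)
    exact ((smooth_WW a).continuous.mul (cont_sW hf 3)).comp (by fun_prop : Continuous fun y : Spc => ((t, y) : Pt))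
  -- step 3
  have s3 : ∀ b ∈ Set.Icc b0 (b0 + l), ∀ c ∈ Set.Icc c0 (c0 + l),
      ENNReal.ofReal (Wx * sW 2 f (t, ins i b c (Y b c))) ≤ ENNReal.ofReal (C2 * K / m) * ∫⁻ s, H (ins i b c s) := by
    intro b hb c hc
    have := h2 f hf (fun s => (t, ins i b c s)) (fun _ => ((0 : ℝ), (Pi.single i 1 : Spc))) (Y b c) m hm
      (fun s _ => der_ins_s i t b c s) continuousOn_const (fun s hs h hh => ks h hh b hb c hc s hs)
    rw [ENNReal.ofReal_mul hW]
    refine (mul_le_mul_right this _).trans ?_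
    rw [← mul_assoc, ← ENNReal.ofReal_mul hW, ← lintegral_const_mul' _ _ ENNReal.ofReal_ne_top,
      ← lintegral_const_mul' _ _ ENNReal.ofReal_ne_top]
    refine (setLIntegral_mono' measurableSet_Icc fun s hs => ?_).trans (setLIntegral_le_lintegral (Set.Icc (Y b c) (Y b c + m)) _)
    simp only [hH]
    rw [← ENNReal.ofReal_mul (by positivity), ← ENNReal.ofReal_mul (by positivity)]
    apply ENNReal.ofReal_le_ofReal
    have e1 := hw b hb c hc s hs
    have e2 := sW_nonneg 3 f (t, ins i b c s)
    have e3 : 0 ≤ C2 / m := by positivity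
    calc Wx * (C2 / m) * sW 3 f (t, ins i b c s) = (C2 / m) * (Wx * sW 3 f (t, ins i b c s)) := by ring
      _ ≤ (C2 / m) * (K * WW a (t, ins i b c s) * sW 3 f (t, ins i b c s)) := by gcongr
      _ = _ := by ring
  have s2 : ∀ b ∈ Set.Icc b0 (b0 + l),
      ENNReal.ofReal (Wx * sW 1 f (t, ins i b c0 (Y b c0))) ≤
        ENNReal.ofReal (C1 / l * (C2 * K / m)) * ∫⁻ c, ∫⁻ s, H (ins i b c s) := by
    intro b hb
    have := h1 f hf (fun c => (t, ins i b c (Y b c)))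
      (fun c => ((0 : ℝ), (Pi.single (i.succAbove 1) 1 + Yc b c • Pi.single i 1 : Spc))) c0 l hl
      (fun c hc => der_ins_c i t b (dYc b hb c hc))
      (continuousOn_const.prodMk (continuousOn_const.add ((cYc b hb).smul continuousOn_const)))
      (fun c hc h hh => by rw [fderiv_two]; exact kc h hh b hb c hc)
    rw [ENNReal.ofReal_mul hW]
    refine (mul_le_mul_right this _).trans ?_
    rw [mul_left_comm, ENNReal.ofReal_mul (by positivity), mul_assoc]
    refine mul_le_mul_right ?_ _
    rw [← lintegral_const_mul' _ _ ENNReal.ofReal_ne_top, ← lintegral_const_mul' _ _ ENNReal.ofReal_ne_top]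
    refine (setLIntegral_mono' measurableSet_Icc fun c hc => ?_).trans (setLIntegral_le_lintegral (Set.Icc c0 (c0 + l)) _)
    rw [← ENNReal.ofReal_mul hW]
    exact s3 b hb c hc
  have hb0 : b0 ∈ Set.Icc b0 (b0 + l) := ⟨le_refl _, by linarith⟩
  have s1 : ENNReal.ofReal (Wx * sW 0 f (t, ins i b0 c0 (Y b0 c0))) ≤
        ENNReal.ofReal (C0 / l * (C1 / l * (C2 * K / m))) * ∫⁻ b, ∫⁻ c, ∫⁻ s, H (ins i b c s) := by
    have := h0 f hf (fun b => (t, ins i b c0 (Y b c0)))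
      (fun b => ((0 : ℝ), (Pi.single (i.succAbove 0) 1 + Yb b • Pi.single i 1 : Spc))) b0 l hl
      (fun b hb => der_ins_b i t c0 (Y := fun b => Y b c0) (dYb b hb))
      (continuousOn_const.prodMk (continuousOn_const.add (cYb.smul continuousOn_const)))
      (fun b hb h hh => by rw [fderiv_two]; exact kb h hh b hb)
    rw [ENNReal.ofReal_mul hW]
    refine (mul_le_mul_right this _).trans ?_
    rw [mul_left_comm, ENNReal.ofReal_mul (by positivity), mul_assoc]
    refine mul_le_mul_right ?_ _
    rw [← lintegral_const_mul' _ _ ENNReal.ofReal_ne_top, ← lintegral_const_mul' _ _ ENNReal.ofReal_ne_top]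
    refine (setLIntegral_mono' measurableSet_Icc fun b hb => ?_).trans (setLIntegral_le_lintegral (Set.Icc b0 (b0 + l)) _)
    rw [← ENNReal.ofReal_mul hW]
    exact s2 b hb
  rw [tonelli3 i H mH] at s1
  refine le_trans (ENNReal.ofReal_le_ofReal (mul_le_mul_of_nonneg_left (le_sW (J := []) (k := 0) (by simp) f _) hW)) ?_
  refine s1.trans (le_of_eq ?_)
  congr 2
  field_simp

lemma jb_ins_lip (i : Fin 3) (b c s s2 : ℝ) : |jb (ins i b c s) - jb (ins i b c s2)| ≤ |s - s2| := by
  have key : ∀ s s2 : ℝ, jb (ins i b c s) ≤ jb (ins i b c s2) + |s - s2| := by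
    intro s s2
    have h1 := jb_sq (ins i b c s)
    have h2 := jb_sq (ins i b c s2)
    rw [ins_sum] at h1 h2
    have h3 := jb_pos (ins i b c s2)
    have h4 : |s2| ≤ jb (ins i b c s2) := by
      apply abs_le_of_sq_le_sq _ h3.le
      nlinarith [sq_nonneg b, sq_nonneg c]
    refine le_of_abs_le (abs_le_of_sq_le_sq ?_ (by positivity))
    have h5 : s2 * (s - s2) ≤ |s2| * |s - s2| := by rw [← abs_mul]; exact le_abs_self _
    have h6 := sq_abs (s - s2)
    nlinarith [abs_nonneg (s - s2), mul_le_mul_of_nonneg_right h4 (abs_nonneg (s - s2))]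
  rw [abs_sub_le_iff]
  have h1 := key s s2
  have h2 := key s2 s
  rw [abs_sub_comm s2 s] at h2
  constructor <;> linarith

lemma jq_lip {q q2 : ℝ} : jq q ≤ jq q2 + |q - q2| := by
  have h1 := jq_sq q
  have h2 := jq_sq q2
  have h3 := abs_lt_jq q2
  have hp := jq_pos q2
  refine le_of_abs_le (abs_le_of_sq_le_sq ?_ (by positivity))
  have h5 : q2 * (q - q2) ≤ |q2| * |q - q2| := by rw [← abs_mul]; exact le_abs_self _
  have h6 := sq_abs (q - q2)
  nlinarith [abs_nonneg (q - q2), mul_le_mul_of_nonneg_right h3.le (abs_nonneg (q - q2))]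

lemma jb_lip1 (x y : Spc) : jb x ≤ jb y + ∑ k, |x k - y k| := by
  have h1 := jb_sq x
  have h2 := jb_sq y
  have h3 := jb_pos y
  have h4 : ∀ k, |y k| ≤ jb y := fun k => (abs_le_rad y k).trans (rad_le_jb y)
  refine le_of_abs_le (abs_le_of_sq_le_sq ?_ (by positivity))
  have h5 : ∀ k, y k * (x k - y k) ≤ jb y * |x k - y k| := fun k => by
    refine (le_abs_self _).trans ?_
    rw [abs_mul]; exact mul_le_mul_of_nonneg_right (h4 k) (abs_nonneg _)
  have a0 := h5 0
  have a1 := h5 1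
  have a2 := h5 2
  have s0 := sq_abs (x 0 - y 0)
  have s1 := sq_abs (x 1 - y 1)
  have s2 := sq_abs (x 2 - y 2)
  have n0 := abs_nonneg (x 0 - y 0)
  have n1 := abs_nonneg (x 1 - y 1)
  have n2 := abs_nonneg (x 2 - y 2)
  simp only [Fin.sum_univ_three] at h1 h2 ⊢
  generalize |x 0 - y 0| = d0 at *
  generalize |x 1 - y 1| = d1 at *
  generalize |x 2 - y 2| = d2 at *
  nlinarith [mul_nonneg n0 n1, mul_nonneg n0 n2, mul_nonneg n1 n2]
lemma jb_lip (x y : Spc) : |jb x - jb y| ≤ ∑ k, |x k - y k| := by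
  have h1 := jb_lip1 x y
  have h2 := jb_lip1 y x
  simp only [abs_sub_comm (y _) (x _)] at h2
  rw [abs_sub_le_iff]
  constructor <;> linarith
lemma jb_ins (i : Fin 3) (b c s b0 c0 s0 : ℝ) :
    |jb (ins i b c s) - jb (ins i b0 c0 s0)| ≤ |s - s0| + (|b - b0| + |c - c0|) := by
  refine (jb_lip _ _).trans (le_of_eq ?_)
  rw [Fin.sum_univ_succAbove _ i, Fin.sum_univ_two]
  simp only [ins_self, ins_zero, ins_one]

lemma near_q {a : ℝ} (ha : 1 ≤ a) {t : ℝ} {x y : Spc} (h : |jb y - jb x| ≤ jq (jb x - t) / 2) :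
    WW a (t, x) ≤ 2 ^ a * WW a (t, y) ∧ jq (jb x - t) ≤ 2 * jq (jb y - t) := by
  have e : |(jb y - t) - (jb x - t)| ≤ jq (jb x - t) / 2 := by
    rw [show (jb y - t) - (jb x - t) = jb y - jb x by ring]; exact h
  refine ⟨wt_comp ha e, ?_⟩
  have := jq_lip (q := jb x - t) (q2 := jb y - t)
  rw [abs_sub_comm] at this
  linarith

lemma near_D {t : ℝ} (ht : 0 ≤ t) {x y : Spc} {m : ℝ} (hm0 : 0 ≤ m) (hm : m ≤ jq (jb y - t)) (f : Pt → ℝ) (j : Fin 4) :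
    m ^ 2 * D j f (t, y) ^ 2 ≤ 11 * sW 1 f (t, y) := by
  refine le_trans ?_ (jq_D f (p := (t, y)) ht j)
  have : m ^ 2 ≤ jq (jb y - t) ^ 2 := by gcongr
  exact mul_le_mul_of_nonneg_right this (sq_nonneg _)

set_option maxHeartbeats 800000 in
lemma KS_e {a : ℝ} (ha : 1 ≤ a) : ∃ C : ℝ, 0 ≤ C ∧ ∀ (f : Pt → ℝ), ContDiff ℝ ∞ f → ∀ (t : ℝ) (x : Spc), 0 ≤ t →
    ENNReal.ofReal ((1 + t + rad x) ^ 2 * jq (jb x - t) * (WW a (t, x) * f (t, x) ^ 2)) ≤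
      ENNReal.ofReal C * ∫⁻ y, ENNReal.ofReal (WW a (t, y) * sW 3 f (t, y)) := by
  obtain ⟨C, hC, h⟩ := three (20 + 2 ^ a) (by positivity)
  refine ⟨512 * 144 * C, by positivity, ?_⟩
  intro f hf t x ht
  have hK : (0 : ℝ) ≤ 2 ^ a := by positivity
  have hr0 := rad_nonneg x
  set J := jq (jb x - t) with hJ
  have hJ1 : 1 ≤ J := one_le_jq _
  have hWp := WW_pos a (t, x)
  have fin : ∀ {c : ℝ}, 0 ≤ c → (1 + t + rad x) ^ 2 * J * c ≤ 512 * 144 →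
      ENNReal.ofReal (WW a (t, x) * f (t, x) ^ 2) ≤ ENNReal.ofReal (C * c) *
        ∫⁻ y, ENNReal.ofReal (WW a (t, y) * sW 3 f (t, y)) →
      ENNReal.ofReal ((1 + t + rad x) ^ 2 * J * (WW a (t, x) * f (t, x) ^ 2)) ≤
      ENNReal.ofReal (512 * 144 * C) * ∫⁻ y, ENNReal.ofReal (WW a (t, y) * sW 3 f (t, y)) := by
    intro c hc h1 h2
    rw [ENNReal.ofReal_mul (by positivity)]
    refine (mul_le_mul_right h2 _).trans ?_
    rw [← mul_assoc, ← ENNReal.ofReal_mul (by positivity)]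
    refine mul_le_mul_left (ENNReal.ofReal_le_ofReal ?_) _
    calc _ = C * ((1 + t + rad x) ^ 2 * J * c) := by ring
      _ ≤ C * (512 * 144) := by gcongr
      _ = _ := by ring
  have sWn := fun (h : Pt → ℝ) y => sW_nonneg 1 h (t, y)
  by_cases hc : (1 + t + rad x) / 12 ≤ J
  · -- interior / exterior: cubes
    have ex := ins_eta 0 x
    set b0 := x ((0 : Fin 3).succAbove 0) with hb0
    set c0 := x ((0 : Fin 3).succAbove 1) with hc0
    set s0 := x 0 with hs0
    have disp : ∀ b ∈ Set.Icc b0 (b0 + J / 8), ∀ c ∈ Set.Icc c0 (c0 + J / 8), ∀ s ∈ Set.Icc s0 (s0 + J / 8),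
        |jb (ins 0 b c s) - jb x| ≤ J / 2 := by
      intro b hb c hc s hs
      have := jb_ins 0 b c s b0 c0 s0
      rw [ex, abs_of_nonneg (sub_nonneg.2 hb.1), abs_of_nonneg (sub_nonneg.2 hc.1), abs_of_nonneg (sub_nonneg.2 hs.1)] at this
      linarith [hb.2, hc.2, hs.2]
    have hl : 0 < J / 8 := by linarith
    have mb : b0 ∈ Set.Icc b0 (b0 + J / 8) := ⟨le_refl _, by linarith⟩
    have mc : c0 ∈ Set.Icc c0 (c0 + J / 8) := ⟨le_refl _, by linarith⟩
    have ms : s0 ∈ Set.Icc s0 (s0 + J / 8) := ⟨le_refl _, by linarith⟩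
    have key : ∀ (h : Pt → ℝ) (j : Fin 4), ∀ b ∈ Set.Icc b0 (b0 + J / 8), ∀ c ∈ Set.Icc c0 (c0 + J / 8),
        ∀ s ∈ Set.Icc s0 (s0 + J / 8), (J / 8) ^ 2 * D j h (t, ins 0 b c s) ^ 2 ≤ (20 + 2 ^ a) * sW 1 h (t, ins 0 b c s) := by
      intro h j b hb c hc s hs
      have h1 := (near_q ha (disp b hb c hc s hs)).2
      refine (near_D (x := x) ht hl.le (by linarith) h j).trans ?_
      have := sWn h (ins 0 b c s)
      nlinarith
    have := h a f hf 0 t b0 c0 (J / 8) (J / 8) (WW a (t, x)) (fun _ _ => s0) (fun _ => 0) (fun _ _ => 0) hl hl hWp.le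
      (fun b _ => hasDerivAt_const b s0) continuousOn_const (fun b _ c _ => hasDerivAt_const c s0)
      (fun _ _ => continuousOn_const)
      (fun h _ b hb => by simpa using key h _ b hb c0 mc s0 ms)
      (fun h _ b hb c hc => by simpa using key h _ b hb c hc s0 ms)
      (fun h _ b hb c hc s hs => key h _ b hb c hc s hs)
      (fun b hb c hc s hs => by
        have h1 := (near_q ha (disp b hb c hc s hs)).1
        have h2 := WW_pos a (t, ins 0 b c s)
        nlinarith)
    rw [ex] at this
    refine fin (c := 1 / (J / 8 * (J / 8) * (J / 8))) (by positivity) ?_ (by rw [mul_one_div]; exact this)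
    have e : (1 + t + rad x) ^ 2 ≤ (12 * J) ^ 2 := by gcongr; linarith
    have : (1 + t + rad x) ^ 2 * J * (1 / (J / 8 * (J / 8) * (J / 8))) = 512 * ((1 + t + rad x) ^ 2 / J ^ 2) := by
      field_simp; norm_num
    rw [this]
    have : (1 + t + rad x) ^ 2 / J ^ 2 ≤ 144 := by
      rw [div_le_iff₀ (by positivity)]; linarith [e]
    linarith
  · push Not at hc
    have hrr : 3 / 8 * (1 + t + rad x) ≤ rad x := by
      have h1 := abs_lt_jq (jb x - t)
      rw [abs_lt] at h1
      have h2 := jb_le_rad x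
      linarith
    have hrp : 0 < rad x := by linarith
    set r := rad x with hr
    have hrs : r ^ 2 = x 0 ^ 2 + x 1 ^ 2 + x 2 ^ 2 := by rw [hr, rad_sq, Fin.sum_univ_three]
    obtain ⟨i, hi⟩ : ∃ i, r ^ 2 / 3 ≤ x i ^ 2 := by
      by_contra hcon
      push Not at hcon
      linarith [hcon 0, hcon 1, hcon 2]
    have ex := ins_eta i x
    have hsum : r ^ 2 = x i ^ 2 + x (i.succAbove 0) ^ 2 + x (i.succAbove 1) ^ 2 := by
      rw [hr, rad_sq, ← ins_sum i, ex]
    set b0 := x (i.succAbove 0) with hb0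
    set c0 := x (i.succAbove 1) with hc0
    set s0 := x i with hs0
    obtain ⟨σ, hσ, hσ2⟩ : ∃ σ : ℝ, σ * σ = 1 ∧ σ * |s0| = s0 := by
      rcases le_total 0 s0 with h | h
      · exact ⟨1, by norm_num, by rw [abs_of_nonneg h]; ring⟩
      · exact ⟨-1, by norm_num, by rw [abs_of_nonpos h]; ring⟩
    set Y : ℝ → ℝ → ℝ := fun b c => σ * Real.sqrt (r ^ 2 - b ^ 2 - c ^ 2) with hY
    set l := r / 16 with hl
    set m := J / 2 with hm
    have hlp : 0 < l := by positivity
    have hmp : 0 < m := by positivity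
    have base : ∀ b ∈ Set.Icc b0 (b0 + l), ∀ c ∈ Set.Icc c0 (c0 + l), r ^ 2 / 16 ≤ r ^ 2 - b ^ 2 - c ^ 2 := by
      intro b hb c hc
      have e0 : (|b0| + |c0|) ^ 2 ≤ (6 / 5 * r) ^ 2 := by
        nlinarith [sq_abs b0, sq_abs c0, sq_nonneg (|b0| - |c0|)]
      have e1 : |b0| + |c0| ≤ 6 / 5 * r := le_of_abs_le (abs_le_of_sq_le_sq e0 (by positivity))
      have e2 : b ^ 2 ≤ (|b0| + l) ^ 2 := by
        rw [← sq_abs b]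
        have : |b| ≤ |b0| + l := by
          rw [abs_le]; constructor <;> [linarith [neg_abs_le b0, hb.1]; linarith [le_abs_self b0, hb.2]]
        gcongr
      have e3 : c ^ 2 ≤ (|c0| + l) ^ 2 := by
        rw [← sq_abs c]
        have : |c| ≤ |c0| + l := by
          rw [abs_le]; constructor <;> [linarith [neg_abs_le c0, hc.1]; linarith [le_abs_self c0, hc.2]]
        gcongr
      have e4 : (|b0| + |c0|) * l ≤ 6 / 5 * r * l := by gcongr
      rw [hl] at e2 e3 e4
      nlinarith [sq_abs b0, sq_abs c0]
    have Ysq : ∀ b ∈ Set.Icc b0 (b0 + l), ∀ c ∈ Set.Icc c0 (c0 + l), Y b c ^ 2 = r ^ 2 - b ^ 2 - c ^ 2 := by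
      intro b hb c hc
      have := base b hb c hc
      have h1 := Real.sq_sqrt (show 0 ≤ r ^ 2 - b ^ 2 - c ^ 2 by nlinarith [sq_nonneg r])
      simp only [hY]
      rw [mul_pow, h1, sq σ, hσ, one_mul]
    have Y0 : Y b0 c0 = s0 := by
      simp only [hY]
      rw [show r ^ 2 - b0 ^ 2 - c0 ^ 2 = s0 ^ 2 by linarith, Real.sqrt_sq_eq_abs, hσ2]
    have mb : b0 ∈ Set.Icc b0 (b0 + l) := ⟨le_refl _, by linarith⟩
    have mc : c0 ∈ Set.Icc c0 (c0 + l) := ⟨le_refl _, by linarith⟩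
    have jbY : ∀ b ∈ Set.Icc b0 (b0 + l), ∀ c ∈ Set.Icc c0 (c0 + l), jb (ins i b c (Y b c)) = jb x := by
      intro b hb c hc
      have h1 := jb_sq (ins i b c (Y b c))
      rw [ins_sum, Ysq b hb c hc] at h1
      have h2 := jb_sq x
      rw [← ex, ins_sum, ex] at h2
      have h3 := jb_pos x
      have h4 := jb_pos (ins i b c (Y b c))
      exact (sq_eq_sq₀ h4.le h3.le).1 (by linarith)
    -- general derivative of angular motions
    have ang : ∀ (h : Pt → ℝ) (j : Fin 3) (y : Spc) (z : ℝ), y i ^ 2 ≥ r ^ 2 / 16 → y i * z = - y j →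
        l ^ 2 * (D j.succ h (t, y) + z * D i.succ h (t, y)) ^ 2 ≤ (20 + 2 ^ a) * sW 1 h (t, y) := by
      intro h j y z hy hz
      have h1 := R_le_sW h (t, y) i j
      simp only at h1
      have e : y i * D j.succ h (t, y) - y j * D i.succ h (t, y) =
          y i * (D j.succ h (t, y) + z * D i.succ h (t, y)) := by
        rw [mul_add, ← mul_assoc, hz]; ring
      rw [e, mul_pow] at h1
      have h2 : l ^ 2 ≤ y i ^ 2 := by rw [hl]; nlinarith [sq_nonneg r]
      have := sWn h y
      nlinarith [mul_le_mul_of_nonneg_right h2 (sq_nonneg (D j.succ h (t, y) + z * D i.succ h (t, y)))]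
    have dY : ∀ b ∈ Set.Icc b0 (b0 + l), ∀ c ∈ Set.Icc c0 (c0 + l), 0 < Real.sqrt (r ^ 2 - b ^ 2 - c ^ 2) := by
      intro b hb c hc
      refine Real.sqrt_pos.2 (lt_of_lt_of_le (by positivity) (base b hb c hc))
    have YZ : ∀ b ∈ Set.Icc b0 (b0 + l), ∀ c ∈ Set.Icc c0 (c0 + l), ∀ z,
        Y b c * (σ * (-(2 * z) / (2 * Real.sqrt (r ^ 2 - b ^ 2 - c ^ 2)))) = - z := by
      intro b hb c hc z
      have := dY b hb c hc
      simp only [hY]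
      rw [show σ * √(r ^ 2 - b ^ 2 - c ^ 2) * (σ * (-(2 * z) / (2 * √(r ^ 2 - b ^ 2 - c ^ 2)))) =
        (σ * σ) * (√(r ^ 2 - b ^ 2 - c ^ 2) * (-(2 * z) / (2 * √(r ^ 2 - b ^ 2 - c ^ 2)))) by ring, hσ]
      field_simp
    have disp : ∀ b ∈ Set.Icc b0 (b0 + l), ∀ c ∈ Set.Icc c0 (c0 + l), ∀ s ∈ Set.Icc (Y b c) (Y b c + m),
        |jb (ins i b c s) - jb x| ≤ J / 2 := by
      intro b hb c hc s hs
      rw [← jbY b hb c hc]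
      refine (jb_ins_lip i b c s (Y b c)).trans ?_
      rw [abs_of_nonneg (sub_nonneg.2 hs.1)]
      linarith [hs.2]
    have := h a f hf i t b0 c0 l m (WW a (t, x)) Y
      (fun b => σ * (-(2 * b) / (2 * Real.sqrt (r ^ 2 - b ^ 2 - c0 ^ 2))))
      (fun b c => σ * (-(2 * c) / (2 * Real.sqrt (r ^ 2 - b ^ 2 - c ^ 2)))) hlp hmp hWp.le
      (fun b hb => by
        have h1 : HasDerivAt (fun b : ℝ => r ^ 2 - b ^ 2 - c0 ^ 2) (-(2 * b)) b := by
          have := ((hasDerivAt_pow 2 b).const_sub (r ^ 2)).sub_const (c0 ^ 2)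
          exact this.congr_deriv (by norm_num)
        have h2 := base b hb c0 mc
        exact (h1.sqrt (by nlinarith [sq_nonneg r])).const_mul σ)
      (fun b hb => by
        have := dY b hb c0 mc
        refine ContinuousAt.continuousWithinAt ?_
        refine ContinuousAt.mul continuousAt_const (ContinuousAt.div (by fun_prop) (by fun_prop) (by positivity)))
      (fun b hb c hc => by
        have h1 : HasDerivAt (fun c : ℝ => r ^ 2 - b ^ 2 - c ^ 2) (-(2 * c)) c := by
          have := ((hasDerivAt_pow 2 c).const_sub (r ^ 2 - b ^ 2))
          exact this.congr_deriv (by norm_num)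
        have h2 := base b hb c hc
        exact (h1.sqrt (by nlinarith [sq_nonneg r])).const_mul σ)
      (fun b hb c hc => by
        have := dY b hb c hc
        refine ContinuousAt.continuousWithinAt ?_
        refine ContinuousAt.mul continuousAt_const (ContinuousAt.div (by fun_prop) (by fun_prop) (by positivity)))
      (fun h _ b hb => by
        refine ang h _ _ _ ?_ ?_
        · rw [ins_self, Ysq b hb c0 mc]; exact base b hb c0 mc
        · rw [ins_self, ins_zero]; exact YZ b hb c0 mc b)
      (fun h _ b hb c hc => by
        refine ang h _ _ _ ?_ ?_
        · rw [ins_self, Ysq b hb c hc]; exact base b hb c hc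
        · rw [ins_self, ins_one]; exact YZ b hb c hc c)
      (fun h _ b hb c hc s hs => by
        have h1 := (near_q ha (disp b hb c hc s hs)).2
        refine (near_D (x := x) ht hmp.le (by linarith) h i.succ).trans ?_
        have := sWn h (ins i b c s)
        nlinarith)
      (fun b hb c hc s hs => by
        have h1 := (near_q ha (disp b hb c hc s hs)).1
        have h2 := WW_pos a (t, ins i b c s)
        nlinarith)
    rw [Y0, ex] at this
    refine fin (c := 1 / (l * l * m)) (by positivity) ?_ (by rw [mul_one_div]; exact this)
    have e : (1 + t + r) ^ 2 ≤ (8 / 3 * r) ^ 2 := by gcongr; linarith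
    have : (1 + t + r) ^ 2 * J * (1 / (l * l * m)) = 512 * ((1 + t + r) ^ 2 / r ^ 2) := by
      rw [hl, hm]; field_simp; norm_num
    rw [this]
    have : (1 + t + r) ^ 2 / r ^ 2 ≤ 144 := by
      rw [div_le_iff₀ (by positivity)]; nlinarith [e]
    linarith

lemma KS {a : ℝ} (ha : 1 ≤ a) : ∃ C : ℝ, 0 ≤ C ∧ ∀ (f : Pt → ℝ), ContDiff ℝ ∞ f → Scs f → ∀ (p : Pt), 0 ≤ p.1 →
    (1 + p.1 + rad p.2) ^ 2 * jq (jb p.2 - p.1) * (WW a p * f p ^ 2) ≤ C * FN a 3 f p.1 := by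
  obtain ⟨C, hC, h⟩ := KS_e ha
  refine ⟨C, hC, fun f hf hs p hp => ?_⟩
  have h1 := h f hf p.1 p.2 hp
  have h2 := ofReal_integral_eq_lintegral_ofReal (int_FN a 3 hf hs p.1)
    (Filter.Eventually.of_forall fun x => mul_nonneg (WW_pos a _).le (sW_nonneg _ _ _))
  rw [← h2, ← ENNReal.ofReal_mul hC] at h1
  exact (ENNReal.ofReal_le_ofReal_iff (mul_nonneg hC (FN_nonneg a 3 f p.1))).1 h1

lemma comm_D (k : ℕ) : ∃ C : ℝ, 0 ≤ C ∧ ∀ (b : Fin 4) (x : Sm × Pt), sW k (D b x.1.1) x.2 ≤ C * eW k x.1.1 x.2 := by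
  have h : ∀ b : Fin 4, ∃ C : ℝ, 0 ≤ C ∧ ∀ x : Sm × Pt, sW k (D b x.1.1) x.2 ≤ C * eW k x.1.1 x.2 := fun b =>
    sum_bd (wds k) (fun I (x : Sm × Pt) => Zw I (D b x.1.1) x.2 ^ 2) (fun x => eW k x.1.1 x.2) fun I hI => by
      obtain ⟨C, hC, h⟩ := comm_D1 I b
      exact ⟨C, hC, fun x => (h x).trans (mul_le_mul_of_nonneg_left (eW_mono (mem_wds.1 hI) _ _) hC)⟩
  choose C hC h using h
  refine ⟨∑ b, C b, Finset.sum_nonneg fun b _ => hC b, fun b x => (h b x).trans ?_⟩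
  exact mul_le_mul_of_nonneg_right (Finset.single_le_sum (f := C) (fun b _ => hC b) (Finset.mem_univ b)) (eW_nonneg _ _ _)

lemma eW_Zw {k N : ℕ} {J : List (Fin 11)} (h : k + J.length ≤ N) (u : Pt → ℝ) (p : Pt) :
    eW k (Zw J u) p ≤ (wds k).card * eW N u p := by
  unfold eW
  refine (Finset.sum_le_card_nsmul _ _ (eW N u p) fun I hI => ?_).trans (le_of_eq (by rw [nsmul_eq_mul]; rfl))
  rw [← Zw_append]
  refine le_eW ?_ u p
  rw [List.length_append]
  have := mem_wds.1 hI
  omega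

lemma KS_E {a : ℝ} (ha : 1 ≤ a) (N : ℕ) : ∃ C : ℝ, 0 ≤ C ∧ ∀ (u : Pt → ℝ), ContDiff ℝ ∞ u → Scs u → ∀ (p : Pt), 0 ≤ p.1 →
    ∀ J : List (Fin 11), 3 + J.length ≤ N →
    (1 + p.1 + rad p.2) ^ 2 * jq (jb p.2 - p.1) * (WW a p * dsq (Zw J u) p) ≤ C * EN a N u p.1 := by
  obtain ⟨C, hC, h⟩ := KS ha
  obtain ⟨C2, hC2, h2⟩ := comm_D 3
  refine ⟨4 * (C * (C2 * (wds 3).card)), by positivity, fun u hu hs p hp J hJ => ?_⟩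
  have key : ∀ b, (1 + p.1 + rad p.2) ^ 2 * jq (jb p.2 - p.1) * (WW a p * D b (Zw J u) p ^ 2) ≤
      C * (C2 * (wds 3).card) * EN a N u p.1 := by
    intro b
    have hZ := smooth_Zw hu J
    refine (h (D b (Zw J u)) (smooth_D hZ b) ((hs.Zw J).D b) p hp).trans ?_
    rw [mul_assoc]
    refine mul_le_mul_of_nonneg_left ?_ hC
    unfold FN EN
    rw [← integral_const_mul]
    refine integral_mono (int_FN a 3 (smooth_D hZ b) ((hs.Zw J).D b) p.1) ((int_EN a N hu hs p.1).const_mul _) fun x => ?_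
    have h3 := h2 b (⟨Zw J u, hZ⟩, (p.1, x))
    have h4 := eW_Zw hJ u (p.1, x)
    have h5 := WW_pos a (p.1, x)
    have h6 : sW 3 (D b (Zw J u)) (p.1, x) ≤ C2 * (wds 3).card * eW N u (p.1, x) := by
      rw [mul_assoc]; exact h3.trans (mul_le_mul_of_nonneg_left h4 hC2)
    show WW a (p.1, x) * sW 3 (D b (Zw J u)) (p.1, x) ≤ C2 * (wds 3).card * (WW a (p.1, x) * eW N u (p.1, x))
    nlinarith
  unfold dsq
  rw [Finset.mul_sum, Finset.mul_sum, mul_assoc]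
  refine (Finset.sum_le_card_nsmul _ _ _ fun b _ => key b).trans (le_of_eq ?_)
  simp

lemma rad_smul {z : ℝ} (hz : 0 ≤ z) (o : Spc) : rad (z • o) = z * rad o := by
  unfold rad
  simp only [Pi.smul_apply, smul_eq_mul, mul_pow]
  rw [← Finset.mul_sum, Real.sqrt_mul (sq_nonneg z), Real.sqrt_sq hz]

lemma exists_dir (x : Spc) : ∃ o : Spc, rad o = 1 ∧ x = rad x • o := by
  have h0 := rad_nonneg x
  rcases h0.lt_or_eq with h | h
  · refine ⟨(rad x)⁻¹ • x, ?_, ?_⟩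
    · rw [rad_smul (by positivity)]; field_simp
    · rw [smul_smul, mul_inv_cancel₀ h.ne', one_smul]
  · refine ⟨Pi.single 0 1, ?_, ?_⟩
    · unfold rad; rw [Fin.sum_univ_three]; simp
    · rw [← h]; ext k
      have := abs_le_rad x k
      rw [← h] at this
      simpa using this

lemma ray : ∃ C : ℝ, 0 ≤ C ∧ ∀ (f : Pt → ℝ), ContDiff ℝ ∞ f → Scs f → ∀ (t B : ℝ), 0 ≤ B →
    (∀ y, jq (jb y - t) ^ (9/4 : ℝ) * dsq f (t, y) ≤ B) → ∀ x, f (t, x) ^ 2 ≤ C * B := by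
  have hI : Integrable fun z : ℝ => (1 + ‖z‖ ^ 2) ^ (-(9/8 : ℝ) / 2) :=
    integrable_rpow_neg_one_add_norm_sq (by norm_num)
  have hI2 : Integrable fun z : ℝ => jq z ^ (-(9/8 : ℝ)) := by
    refine hI.congr (Filter.Eventually.of_forall fun z => ?_)
    show (1 + ‖z‖ ^ 2) ^ (-(9/8 : ℝ) / 2) = _
    show _ = jq z ^ (-(9/8 : ℝ))
    unfold jq
    rw [Real.sqrt_eq_rpow, ← Real.rpow_mul (by positivity), Real.norm_eq_abs, sq_abs]
    congr 1; norm_num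
  set I0 : ℝ := ∫ z : ℝ, jq z ^ (-(9/8 : ℝ)) with hI0
  have hI00 : 0 ≤ I0 := integral_nonneg fun z => Real.rpow_nonneg (jq_pos z).le _
  refine ⟨8 * I0 ^ 2, by positivity, ?_⟩
  intro f hf hs t B hB h x
  obtain ⟨o, ho, hx⟩ := exists_dir x
  obtain ⟨R, hR⟩ := hs
  set r := rad x with hr
  have hr0 : 0 ≤ r := rad_nonneg x
  set R2 := max r (R + |t| + 1) with hR2
  have hz0 : f (t, R2 • o) = 0 := by
    apply hR
    simp only
    rw [rad_smul (hr0.trans (le_max_left _ _)), ho, mul_one]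
    have := le_max_right r (R + |t| + 1)
    linarith
  set g' : ℝ → ℝ := fun z => ∑ i : Fin 3, o i * D i.succ f (t, z • o) with hg'
  have hd : ∀ z, HasDerivAt (fun z : ℝ => f (t, z • o)) (g' z) z := by
    intro z
    have h1 : HasDerivAt (fun z : ℝ => ((t, z • o) : Pt)) ((0 : ℝ), o) z := by
      refine (hasDerivAt_const z t).prodMk ?_
      exact ((hasDerivAt_id z).smul_const o).congr_deriv (by simp)
    have h2 := (diff_of_smooth hf (t, z • o)).hasFDerivAt.comp_hasDerivAt z h1
    refine (show HasDerivAt _ _ z from h2).congr_deriv ?_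
    rw [fderiv_apply_eq, Fin.sum_univ_succ]
    simp [Xc, hg']
  have hc : Continuous g' := continuous_finset_sum _ fun i _ => continuous_const.mul
    ((smooth_D hf _).continuous.comp (by fun_prop : Continuous fun z : ℝ => ((t, z • o) : Pt)))
  have hle : r ≤ R2 := le_max_left _ _
  have ftc := intervalIntegral.integral_eq_sub_of_hasDerivAt (a := r) (b := R2) (fun z _ => hd z) (hc.intervalIntegrable _ _)
  rw [hz0, ← hx, zero_sub] at ftc
  have bd : ∀ z, 0 ≤ z → ‖g' z‖ ≤ √(8 * B) * jq (z - t) ^ (-(9/8 : ℝ)) := by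
    intro z hz
    have hy := h (z • o)
    set y := z • o with hy'
    have hj1 : jq (z - t) ≤ 2 * jq (jb y - t) := by
      have h1 := jq_lip (q := z - t) (q2 := jb y - t)
      have h2 := rad_le_jb y
      have h3 := jb_le_rad y
      rw [hy', rad_smul hz, ho, mul_one, ← hy'] at h2 h3
      have h4 : |z - t - (jb y - t)| ≤ 1 := by rw [abs_le]; constructor <;> linarith
      have := one_le_jq (jb y - t)
      linarith
    have hcs : g' z ^ 2 ≤ dsq f (t, y) := by
      have h1 := Finset.sum_mul_sq_le_sq_mul_sq Finset.univ o (fun i : Fin 3 => D i.succ f (t, y))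
      rw [← rad_sq, ho, one_pow, one_mul] at h1
      refine h1.trans ?_
      unfold dsq
      rw [Fin.sum_univ_succ (n := 3)]
      linarith [sq_nonneg (D 0 f (t, y))]
    have hjp := jq_pos (z - t)
    have hjp2 := jq_pos (jb y - t)
    rw [Real.norm_eq_abs]
    apply abs_le_of_sq_le_sq _ (by positivity)
    rw [mul_pow, Real.sq_sqrt (by positivity), ← Real.rpow_natCast (jq (z - t) ^ (-(9/8 : ℝ))), ← Real.rpow_mul hjp.le]
    have e1 : jq (z - t) ^ (9/4 : ℝ) ≤ 8 * jq (jb y - t) ^ (9/4 : ℝ) := by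
      calc jq (z - t) ^ (9/4 : ℝ) ≤ (2 * jq (jb y - t)) ^ (9/4 : ℝ) := Real.rpow_le_rpow hjp.le hj1 (by norm_num)
        _ = 2 ^ (9/4 : ℝ) * jq (jb y - t) ^ (9/4 : ℝ) := Real.mul_rpow (by norm_num) hjp2.le
        _ ≤ 2 ^ (3 : ℝ) * jq (jb y - t) ^ (9/4 : ℝ) := by
            gcongr
            · norm_num
            · norm_num
        _ = _ := by norm_num
    have e2 : jq (z - t) ^ ((-(9/8 : ℝ)) * ((2 : ℕ) : ℝ)) = (jq (z - t) ^ (9/4 : ℝ))⁻¹ := by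
      rw [← Real.rpow_neg hjp.le]; norm_num
    rw [e2, ← div_eq_mul_inv, le_div_iff₀ (by positivity)]
    have n1 := dsq_nonneg f (t, y)
    have n2 : 0 < jq (z - t) ^ (9/4 : ℝ) := by positivity
    calc g' z ^ 2 * jq (z - t) ^ (9/4 : ℝ) ≤ dsq f (t, y) * (8 * jq (jb y - t) ^ (9/4 : ℝ)) := by gcongr
      _ ≤ 8 * B := by linarith
  have hI3 : Integrable fun z : ℝ => √(8 * B) * jq (z - t) ^ (-(9/8 : ℝ)) := (hI2.comp_sub_right t).const_mul _
  have h1 := intervalIntegral.norm_integral_le_of_norm_le (μ := volume) (f := g') hle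
    (Filter.Eventually.of_forall fun z hz => bd z (hr0.trans hz.1.le)) (hI3.intervalIntegrable)
  rw [ftc, norm_neg, Real.norm_eq_abs, intervalIntegral.integral_of_le hle] at h1
  have h2 : ∫ z in Set.Ioc r R2, √(8 * B) * jq (z - t) ^ (-(9/8 : ℝ)) ≤ √(8 * B) * I0 := by
    refine (setIntegral_le_integral hI3 (Filter.Eventually.of_forall fun z => ?_)).trans (le_of_eq ?_)
    · exact mul_nonneg (Real.sqrt_nonneg _) (Real.rpow_nonneg (jq_pos _).le _)
    · rw [integral_const_mul, hI0, integral_sub_right_eq_self (fun z => jq z ^ (-(9/8 : ℝ))) t]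
  have h3 := h1.trans h2
  have h4 := pow_le_pow_left₀ (abs_nonneg _) h3 2
  rw [sq_abs, mul_pow, Real.sq_sqrt (by positivity)] at h4
  linarith

lemma jq_le_rho {t : ℝ} (ht : 0 ≤ t) (x : Spc) : jq (jb x - t) ≤ 2 * (1 + t + rad x) := by
  have h1 := jq_le (jb x - t)
  have h2 := jb_le_rad x
  have h3 := jb_pos x
  have h4 := rad_nonneg x
  have : |jb x - t| ≤ 1 + t + rad x := by rw [abs_le]; constructor <;> linarith
  linarith

lemma ray_E {a : ℝ} (ha : 1 ≤ a) (N : ℕ) : ∃ C : ℝ, 0 ≤ C ∧ ∀ (u : Pt → ℝ), ContDiff ℝ ∞ u → Scs u → ∀ (p : Pt), 0 ≤ p.1 →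
    ∀ J : List (Fin 11), 3 + J.length ≤ N →
    (1 + p.1) ^ (3/4 : ℝ) * Zw J u p ^ 2 ≤ C * EN a N u p.1 := by
  obtain ⟨C, hC, h⟩ := KS_E ha N
  obtain ⟨C2, hC2, h2⟩ := ray
  refine ⟨C2 * (4 * C), by positivity, fun u hu hs p hp J hJ => ?_⟩
  have hE := EN_nonneg a N u p.1
  have h1t : 0 < 1 + p.1 := by linarith
  have htp : 0 < (1 + p.1) ^ (3/4 : ℝ) := by positivity
  have key := h2 (Zw J u) (smooth_Zw hu J) (hs.Zw J) p.1 (4 * C * EN a N u p.1 / (1 + p.1) ^ (3/4 : ℝ)) (by positivity) (by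
    intro y
    have h3 := h u hu hs (p.1, y) hp J hJ
    simp only at h3
    rw [le_div_iff₀ htp]
    have hj := jq_le_rho hp y
    have hjp := jq_pos (jb y - p.1)
    have hr := rad_nonneg y
    have hrho : 0 < 1 + p.1 + rad y := by linarith
    have e1 : jq (jb y - p.1) ^ (9/4 : ℝ) * (1 + p.1) ^ (3/4 : ℝ) ≤ 4 * ((1 + p.1 + rad y) ^ 2 * jq (jb y - p.1)) := by
      calc jq (jb y - p.1) ^ (9/4 : ℝ) * (1 + p.1) ^ (3/4 : ℝ)
          = jq (jb y - p.1) ^ (5/4 : ℝ) * jq (jb y - p.1) * (1 + p.1) ^ (3/4 : ℝ) := by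
            rw [show (9/4 : ℝ) = 5/4 + 1 by norm_num, Real.rpow_add hjp, Real.rpow_one]
        _ ≤ (2 * (1 + p.1 + rad y)) ^ (5/4 : ℝ) * jq (jb y - p.1) * (1 + p.1 + rad y) ^ (3/4 : ℝ) := by
            have g1 : (1 + p.1) ^ (3/4 : ℝ) ≤ (1 + p.1 + rad y) ^ (3/4 : ℝ) :=
              Real.rpow_le_rpow h1t.le (by linarith) (by norm_num)
            have g2 : jq (jb y - p.1) ^ (5/4 : ℝ) ≤ (2 * (1 + p.1 + rad y)) ^ (5/4 : ℝ) :=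
              Real.rpow_le_rpow hjp.le hj (by norm_num)
            exact mul_le_mul (mul_le_mul_of_nonneg_right g2 hjp.le) g1 htp.le (by positivity)
        _ = 2 ^ (5/4 : ℝ) * ((1 + p.1 + rad y) ^ (5/4 : ℝ) * (1 + p.1 + rad y) ^ (3/4 : ℝ)) * jq (jb y - p.1) := by
            rw [Real.mul_rpow (by norm_num) hrho.le]; ring
        _ = 2 ^ (5/4 : ℝ) * (1 + p.1 + rad y) ^ 2 * jq (jb y - p.1) := by
            rw [← Real.rpow_add hrho]; norm_num
        _ ≤ 2 ^ (2 : ℝ) * (1 + p.1 + rad y) ^ 2 * jq (jb y - p.1) := by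
            gcongr
            · norm_num
            · norm_num
        _ = _ := by norm_num; ring
    have n1 := dsq_nonneg (Zw J u) (p.1, y)
    have n2 := one_le_WW a (p.1, y)
    have n3 : dsq (Zw J u) (p.1, y) ≤ WW a (p.1, y) * dsq (Zw J u) (p.1, y) := le_mul_of_one_le_left n1 n2
    calc jq (jb y - p.1) ^ (9/4 : ℝ) * dsq (Zw J u) (p.1, y) * (1 + p.1) ^ (3/4 : ℝ)
        = jq (jb y - p.1) ^ (9/4 : ℝ) * (1 + p.1) ^ (3/4 : ℝ) * dsq (Zw J u) (p.1, y) := by ring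
      _ ≤ 4 * ((1 + p.1 + rad y) ^ 2 * jq (jb y - p.1)) * (WW a (p.1, y) * dsq (Zw J u) (p.1, y)) := by gcongr
      _ ≤ _ := by linarith) p.2
  rw [← mul_div_assoc, le_div_iff₀ htp] at key
  calc _ = Zw J u (p.1, p.2) ^ 2 * (1 + p.1) ^ (3/4 : ℝ) := by ring
    _ ≤ _ := by linarith

/-- pointwise form of the bilinear estimate -/
lemma bil_pt {a : ℝ} (ha : 1 ≤ a) {N : ℕ} (hN : 8 ≤ N) : ∃ C : ℝ, 0 ≤ C ∧ ∀ (u v : Pt → ℝ), ContDiff ℝ ∞ u → Scs u →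
    ContDiff ℝ ∞ v → Scs v → ∀ (I J : List (Fin 11)), I.length + J.length ≤ N → ∀ (p : Pt), 0 ≤ p.1 →
    tw p.1 * (WW a p * (tsq (Zw I u) p * dsq (Zw J v) p)) ≤
      C * (EN a N v p.1 * (WD a p * tW N u p) + (1 + p.1) ^ (-(5/4) : ℝ) * (EN a N u p.1 * (WW a p * eW N v p))) := by
  obtain ⟨C, hC, h⟩ := KS_E ha N
  obtain ⟨C2, hC2, h2⟩ := ray_E ha N
  refine ⟨18 * C + 2000 * ((wds 1).card * C2), by positivity, ?_⟩
  intro u v hu hus hv hvs I J hIJ p hp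
  have hr := rad_nonneg p.2
  have hjp := jq_pos (jb p.2 - p.1)
  have hj := jq_le_rho hp p.2
  have hrho : 0 < 1 + p.1 + rad p.2 := by linarith
  have h1t : 0 < 1 + p.1 := by linarith
  have hEv := EN_nonneg a N v p.1
  have hEu := EN_nonneg a N u p.1
  have hW := WW_pos a p
  have hD : 0 ≤ WD a p := wd_nonneg (by linarith) _
  have ht := tsq_nonneg (Zw I u) p
  have hd := dsq_nonneg (Zw J v) p
  have htW := tW_nonneg N u p
  have heW := eW_nonneg N v p
  have X1 : 0 ≤ EN a N v p.1 * (WD a p * tW N u p) := by positivity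
  have X2 : 0 ≤ (1 + p.1) ^ (-(5/4) : ℝ) * (EN a N u p.1 * (WW a p * eW N v p)) := by positivity
  have htw : tw p.1 ^ 2 = (1 + p.1) ^ 3 := by
    unfold tw
    rw [← Real.rpow_natCast, ← Real.rpow_mul h1t.le, ← Real.rpow_natCast]; norm_num
  have htwp := tw_pos hp
  by_cases hc : 3 + J.length ≤ N
  · -- the undifferentiated factor is estimated by Klainerman-Sobolev
    have h3 := h v hv hvs p hp J hc
    have h4 : WW a p ≤ 9 * (jq (jb p.2 - p.1) * √(jq (jb p.2 - p.1))) * WD a p := wt_le_wd ha _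
    have h5 := le_tW (k := N) (J := I) (by omega) u p
    have h6 := one_le_WW a p
    set j := jq (jb p.2 - p.1) with hjdef
    have hsq : √j ^ 2 = j := Real.sq_sqrt hjp.le
    have hs0 := Real.sqrt_nonneg j
    have e1 : tw p.1 * √j ≤ 2 * (1 + p.1 + rad p.2) ^ 2 := by
      refine le_of_abs_le (abs_le_of_sq_le_sq ?_ (by positivity))
      rw [mul_pow, htw, hsq]
      calc (1 + p.1) ^ 3 * j ≤ (1 + p.1 + rad p.2) ^ 3 * (2 * (1 + p.1 + rad p.2)) :=
            mul_le_mul (pow_le_pow_left₀ h1t.le (by linarith) _) hj hjp.le (by positivity)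
        _ ≤ _ := by nlinarith [pow_pos hrho 4]
    -- tw ≤ 18 rho^2 j WD
    have e2 : tw p.1 ≤ 18 * ((1 + p.1 + rad p.2) ^ 2 * j) * WD a p := by
      calc tw p.1 ≤ tw p.1 * (9 * (j * √j) * WD a p) := le_mul_of_one_le_right htwp.le (h6.trans h4)
        _ = (tw p.1 * √j) * (9 * j * WD a p) := by ring
        _ ≤ (2 * (1 + p.1 + rad p.2) ^ 2) * (9 * j * WD a p) := by gcongr
        _ = _ := by ring
    calc tw p.1 * (WW a p * (tsq (Zw I u) p * dsq (Zw J v) p))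
        ≤ 18 * ((1 + p.1 + rad p.2) ^ 2 * j) * WD a p * (WW a p * (tsq (Zw I u) p * dsq (Zw J v) p)) := by gcongr
      _ = 18 * ((1 + p.1 + rad p.2) ^ 2 * j * (WW a p * dsq (Zw J v) p)) * (WD a p * tsq (Zw I u) p) := by ring
      _ ≤ 18 * (C * EN a N v p.1) * (WD a p * tW N u p) := by gcongr
      _ = 18 * C * (EN a N v p.1 * (WD a p * tW N u p)) := by ring
      _ ≤ _ := by
        have : 0 ≤ 2000 * ((wds 1).card * C2) := by positivity
        nlinarith [mul_nonneg hC X2, mul_nonneg this X1, mul_nonneg this X2]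
  · have h3 := tsq_Z (Zw I u) hp
    have h5 := le_eW (k := N) (J := J) (by omega) v p
    have h6 : (1 + p.1) ^ (3/4 : ℝ) * sW 1 (Zw I u) p ≤ (wds 1).card * C2 * EN a N u p.1 := by
      unfold sW
      rw [Finset.mul_sum, mul_assoc]
      refine (Finset.sum_le_card_nsmul _ _ (C2 * EN a N u p.1) fun K hK => ?_).trans (le_of_eq (by rw [nsmul_eq_mul]))
      rw [← Zw_append]
      refine h2 u hu hus p hp _ ?_
      rw [List.length_append]
      have := mem_wds.1 hK
      omega
    have h7 : tw p.1 * tsq (Zw I u) p ≤ 2000 * ((wds 1).card * C2) * ((1 + p.1) ^ (-(5/4) : ℝ) * EN a N u p.1) := by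
      have e0 : tw p.1 = (1 + p.1) ^ (-(5/4) : ℝ) * ((1 + p.1) ^ (3/4 : ℝ) * (1 + p.1) ^ 2) := by
        unfold tw
        rw [← Real.rpow_natCast (1 + p.1) 2, ← Real.rpow_add h1t, ← Real.rpow_add h1t]; norm_num
      calc tw p.1 * tsq (Zw I u) p = (1 + p.1) ^ (-(5/4) : ℝ) * (1 + p.1) ^ (3/4 : ℝ) * ((1 + p.1) ^ 2 * tsq (Zw I u) p) := by
            rw [e0]; ring
        _ ≤ (1 + p.1) ^ (-(5/4) : ℝ) * (1 + p.1) ^ (3/4 : ℝ) * (2000 * sW 1 (Zw I u) p) := by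
            refine mul_le_mul_of_nonneg_left (le_trans ?_ h3) (by positivity)
            exact mul_le_mul_of_nonneg_right (pow_le_pow_left₀ h1t.le (by linarith) _) ht
        _ = 2000 * (1 + p.1) ^ (-(5/4) : ℝ) * ((1 + p.1) ^ (3/4 : ℝ) * sW 1 (Zw I u) p) := by ring
        _ ≤ 2000 * (1 + p.1) ^ (-(5/4) : ℝ) * ((wds 1).card * C2 * EN a N u p.1) := by gcongr
        _ = _ := by ring
    calc tw p.1 * (WW a p * (tsq (Zw I u) p * dsq (Zw J v) p))
        = tw p.1 * tsq (Zw I u) p * (WW a p * dsq (Zw J v) p) := by ring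
      _ ≤ 2000 * ((wds 1).card * C2) * ((1 + p.1) ^ (-(5/4) : ℝ) * EN a N u p.1) * (WW a p * eW N v p) := by gcongr
      _ = 2000 * ((wds 1).card * C2) * ((1 + p.1) ^ (-(5/4) : ℝ) * (EN a N u p.1 * (WW a p * eW N v p))) := by ring
      _ ≤ _ := by
        have : 0 ≤ 2000 * ((wds 1).card * C2) := by positivity
        nlinarith [mul_nonneg hC X2, mul_nonneg hC X1, mul_nonneg this X1]

/-- the solution space bound -/
def XB (a : ℝ) (N : ℕ) (u : Pt → ℝ) (A : ℝ) : Prop :=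
  (∀ t, 0 ≤ t → EN a N u t ≤ A) ∧ ∀ T, 0 ≤ T → ∫ t in (0:ℝ)..T, GN a N u t ≤ A

lemma bil_FN {a : ℝ} (ha : 1 ≤ a) {N : ℕ} (hN : 8 ≤ N) (M : Matrix (Fin 4) (Fin 4) ℝ) (hM : NullM M) :
    ∃ C : ℝ, 0 ≤ C ∧ ∀ (u v : Pt → ℝ), ContDiff ℝ ∞ u → Scs u →
    ContDiff ℝ ∞ v → Scs v → ∀ t, 0 ≤ t →
    tw t * FN a N (QF M u v) t ≤ C * (EN a N v t * GN a N u t + EN a N u t * GN a N v t +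
      (1 + t) ^ (-(5/4) : ℝ) * (EN a N u t * EN a N v t)) := by
  obtain ⟨C1, hC1, h1⟩ := comm_QF N M hM
  obtain ⟨C2, hC2, h2⟩ := bil_pt ha hN
  refine ⟨2 * (C1 * ((pw N).card * C2)), by positivity, ?_⟩
  intro u v hu hus hv hvs t ht
  have i1 := (int_EN a N hu hus t)
  have i2 := (int_EN a N hv hvs t)
  have i3 := (int_GN a N hu hus t)
  have i4 := (int_GN a N hv hvs t)
  have hQ : Scs (QF M u v) := Scs.sum _ fun a _ => Scs.sum _ fun b _ => ((hvs.D b).mul_left _).mul_left _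
  have htw := tw_pos ht
  have h1t : 0 < 1 + t := by linarith
  set B : Spc → ℝ := fun x =>
      (EN a N v t * (WD a (t, x) * tW N u (t, x)) + (1 + t) ^ (-(5/4) : ℝ) * (EN a N u t * (WW a (t, x) * eW N v (t, x)))) +
      (EN a N u t * (WD a (t, x) * tW N v (t, x)) + (1 + t) ^ (-(5/4) : ℝ) * (EN a N v t * (WW a (t, x) * eW N u (t, x)))) with hB
  have pt : ∀ x, tw t * (WW a (t, x) * sW N (QF M u v) (t, x)) ≤ C1 * ((pw N).card * C2) * B x := by
    intro x
    have hW := WW_pos a (t, x)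
    have e1 := h1 (⟨u, hu⟩, ⟨v, hv⟩, (t, x))
    simp only at e1
    have e2 : tw t * (WW a (t, x) * NQ N u v (t, x)) ≤ (pw N).card * (C2 * B x) := by
      unfold NQ
      rw [Finset.mul_sum, Finset.mul_sum]
      refine (Finset.sum_le_card_nsmul _ _ (C2 * B x) fun K hK => ?_).trans (le_of_eq (by rw [nsmul_eq_mul]))
      have hK' := mem_pw.1 hK
      have f1 := h2 u v hu hus hv hvs K.1 K.2 hK' (t, x) ht
      have f2 := h2 v u hv hvs hu hus K.2 K.1 (by omega) (t, x) ht
      unfold nt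
      simp only [hB]
      simp only at f1 f2
      linarith
    calc tw t * (WW a (t, x) * sW N (QF M u v) (t, x)) ≤ tw t * (WW a (t, x) * (C1 * NQ N u v (t, x))) := by gcongr
      _ = C1 * (tw t * (WW a (t, x) * NQ N u v (t, x))) := by ring
      _ ≤ C1 * ((pw N).card * (C2 * B x)) := by gcongr
      _ = _ := by ring
  have iB1 := (i3.const_mul (EN a N v t)).add ((i2.const_mul (EN a N u t)).const_mul ((1 + t) ^ (-(5/4) : ℝ)))
  have iB2 := (i4.const_mul (EN a N u t)).add ((i1.const_mul (EN a N v t)).const_mul ((1 + t) ^ (-(5/4) : ℝ)))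
  have iB : Integrable B := iB1.add iB2
  have vB : ∫ x, B x = (EN a N v t * GN a N u t + (1 + t) ^ (-(5/4) : ℝ) * (EN a N u t * EN a N v t)) +
      (EN a N u t * GN a N v t + (1 + t) ^ (-(5/4) : ℝ) * (EN a N v t * EN a N u t)) := by
    refine (integral_add iB1 iB2).trans ?_
    congr 1
    · refine (integral_add (i3.const_mul _) ((i2.const_mul _).const_mul _)).trans ?_
      rw [integral_const_mul, integral_const_mul, integral_const_mul]; rfl
    · refine (integral_add (i4.const_mul _) ((i1.const_mul _).const_mul _)).trans ?_
      rw [integral_const_mul, integral_const_mul, integral_const_mul]; rfl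
  have h3 : tw t * FN a N (QF M u v) t ≤ C1 * ((pw N).card * C2) * ∫ x, B x := by
    unfold FN
    rw [← integral_const_mul, ← integral_const_mul]
    exact integral_mono ((int_FN a N (smooth_QF M hu hv) hQ t).const_mul _) (iB.const_mul _) pt
  rw [vB] at h3
  have n1 := EN_nonneg a N u t
  have n2 := EN_nonneg a N v t
  have n3 := GN_nonneg (by linarith : 0 ≤ a) N u t
  have n4 := GN_nonneg (by linarith : 0 ≤ a) N v t
  have n5 : 0 ≤ C1 * ((pw N).card * C2) := by positivity
  refine h3.trans ?_
  have m1 : 0 ≤ EN a N v t * GN a N u t := by positivity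
  have m2 : 0 ≤ EN a N u t * GN a N v t := by positivity
  have := mul_nonneg n5 m1
  have := mul_nonneg n5 m2
  linarith

lemma bil {a : ℝ} (ha : 1 ≤ a) {N : ℕ} (hN : 8 ≤ N) (M : Matrix (Fin 4) (Fin 4) ℝ) (hM : NullM M) :
    ∃ C : ℝ, 0 ≤ C ∧ ∀ (u v : Pt → ℝ), ContDiff ℝ ∞ u → Scs u →
    ContDiff ℝ ∞ v → Scs v → ∀ A B, XB a N u A → XB a N v B → ∀ T, 0 ≤ T →
    ∫ t in (0:ℝ)..T, tw t * FN a N (QF M u v) t ≤ C * (A * B) := by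
  obtain ⟨C, hC, h⟩ := bil_FN ha hN M hM
  refine ⟨C * 6, by positivity, ?_⟩
  intro u v hu hus hv hvs A B hA hB T hT
  have hA0 : 0 ≤ A := (EN_nonneg a N u 0).trans (hA.1 0 le_rfl)
  have hB0 : 0 ≤ B := (EN_nonneg a N v 0).trans (hB.1 0 le_rfl)
  have hQ : Scs (QF M u v) := Scs.sum _ fun a _ => Scs.sum _ fun b _ => ((hvs.D b).mul_left _).mul_left _
  have cF : Continuous fun t => tw t * FN a N (QF M u v) t := cont_tw.mul (cont_FN a N (smooth_QF M hu hv) hQ)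
  have cu := cont_GN a N hu hus
  have cv := cont_GN a N hv hvs
  have c5 : ContinuousOn (fun t : ℝ => (1 + t) ^ (-(5/4) : ℝ)) (Set.uIcc 0 T) := by
    rw [Set.uIcc_of_le hT]
    refine ContinuousOn.rpow_const (by fun_prop) fun t ht => Or.inl ?_
    have := ht.1; linarith
  have i5 : IntervalIntegrable (fun t : ℝ => (1 + t) ^ (-(5/4) : ℝ)) volume 0 T := c5.intervalIntegrable
  have v5 : ∫ t in (0:ℝ)..T, (1 + t) ^ (-(5/4) : ℝ) ≤ 4 := by
    have hd : ∀ t ∈ Set.uIcc 0 T, HasDerivAt (fun t : ℝ => -4 * (1 + t) ^ (-(1/4) : ℝ)) ((1 + t) ^ (-(5/4) : ℝ)) t := by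
      intro t ht
      rw [Set.uIcc_of_le hT] at ht
      have h1 : HasDerivAt (fun t : ℝ => 1 + t) 1 t := (hasDerivAt_id t).const_add 1
      have h2 := (h1.rpow_const (p := (-(1/4) : ℝ)) (Or.inl (by have := ht.1; linarith))).const_mul (-4)
      exact h2.congr_deriv (by norm_num; ring)
    rw [intervalIntegral.integral_eq_sub_of_hasDerivAt hd i5]
    have : 0 ≤ (1 + T) ^ (-(1/4) : ℝ) := Real.rpow_nonneg (by linarith) _
    simp; linarith
  have mono := intervalIntegral.integral_mono_on (μ := volume) hT (cF.intervalIntegrable 0 T)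
    (g := fun t => C * ((B * GN a N u t + A * GN a N v t) + (A * B) * (1 + t) ^ (-(5/4) : ℝ)))
    (((((cu.intervalIntegrable 0 T).const_mul B).add ((cv.intervalIntegrable 0 T).const_mul A)).add
      (i5.const_mul (A * B))).const_mul C) (by
    intro t ht
    refine (h u v hu hus hv hvs t ht.1).trans (mul_le_mul_of_nonneg_left ?_ hC)
    have g1 := GN_nonneg (by linarith : 0 ≤ a) N u t
    have g2 := GN_nonneg (by linarith : 0 ≤ a) N v t
    have e1 := hA.1 t ht.1
    have e2 := hB.1 t ht.1
    have e3 := EN_nonneg a N u t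
    have e4 := EN_nonneg a N v t
    have p : 0 ≤ (1 + t) ^ (-(5/4) : ℝ) := Real.rpow_nonneg (by linarith [ht.1]) _
    calc EN a N v t * GN a N u t + EN a N u t * GN a N v t + (1 + t) ^ (-(5/4) : ℝ) * (EN a N u t * EN a N v t)
        ≤ B * GN a N u t + A * GN a N v t + (1 + t) ^ (-(5/4) : ℝ) * (A * B) := by gcongr
      _ = _ := by ring)
  refine mono.trans ?_
  rw [intervalIntegral.integral_const_mul, intervalIntegral.integral_add
    (((cu.intervalIntegrable 0 T).const_mul B).add ((cv.intervalIntegrable 0 T).const_mul A)) (i5.const_mul (A * B)),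
    intervalIntegral.integral_add ((cu.intervalIntegrable 0 T).const_mul B) ((cv.intervalIntegrable 0 T).const_mul A),
    intervalIntegral.integral_const_mul, intervalIntegral.integral_const_mul, intervalIntegral.integral_const_mul]
  have k1 := mul_le_mul_of_nonneg_left (hA.2 T hT) hB0
  have k2 := mul_le_mul_of_nonneg_left (hB.2 T hT) hA0
  have k3 := mul_le_mul_of_nonneg_left v5 (mul_nonneg hA0 hB0)
  have : B * (∫ t in (0:ℝ)..T, GN a N u t) + A * (∫ t in (0:ℝ)..T, GN a N v t) + A * B * (∫ t in (0:ℝ)..T, (1 + t) ^ (-(5/4) : ℝ)) ≤ 6 * (A * B) := by linarith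
  nlinarith

/-- Words in the coordinate derivatives. -/
def Dw (w : List (Fin 4)) (u : Pt → ℝ) : Pt → ℝ := w.foldr D u

@[simp] lemma Dw_nil (u : Pt → ℝ) : Dw [] u = u := rfl
lemma Dw_cons (a : Fin 4) (w : List (Fin 4)) (u : Pt → ℝ) : Dw (a :: w) u = D a (Dw w u) := rfl
lemma Dw_append (w v : List (Fin 4)) (u : Pt → ℝ) : Dw (w ++ v) u = Dw w (Dw v u) := by
  unfold Dw; rw [List.foldr_append]
lemma Dw_snoc (w : List (Fin 4)) (a : Fin 4) (u : Pt → ℝ) : Dw (w ++ [a]) u = Dw w (D a u) := Dw_append w [a] u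

lemma smooth_Dw {u : Pt → ℝ} (hu : ContDiff ℝ ∞ u) (w : List (Fin 4)) : ContDiff ℝ ∞ (Dw w u) := by
  induction w with
  | nil => exact hu
  | cons a w ih => exact smooth_D ih a

lemma Scs.Dw {u : Pt → ℝ} (hu : Scs u) (w : List (Fin 4)) : Scs (Dw w u) := by
  induction w with
  | nil => exact hu
  | cons a w ih => exact ih.D a

lemma Dw_add {u v : Pt → ℝ} (hu : ContDiff ℝ ∞ u) (hv : ContDiff ℝ ∞ v) (w : List (Fin 4)) :
    Dw w (fun p => u p + v p) = fun p => Dw w u p + Dw w v p := by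
  induction w with
  | nil => rfl
  | cons a w ih => rw [Dw_cons, ih, D_add (diff_of_smooth (smooth_Dw hu w)) (diff_of_smooth (smooth_Dw hv w))]; rfl

lemma Dw_sub {u v : Pt → ℝ} (hu : ContDiff ℝ ∞ u) (hv : ContDiff ℝ ∞ v) (w : List (Fin 4)) :
    Dw w (fun p => u p - v p) = fun p => Dw w u p - Dw w v p := by
  induction w with
  | nil => rfl
  | cons a w ih => rw [Dw_cons, ih, D_sub (diff_of_smooth (smooth_Dw hu w)) (diff_of_smooth (smooth_Dw hv w))]; rfl

lemma Dw_const_mul {u : Pt → ℝ} (hu : ContDiff ℝ ∞ u) (c : ℝ) (w : List (Fin 4)) :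
    Dw w (fun p => c * u p) = fun p => c * Dw w u p := by
  induction w with
  | nil => rfl
  | cons a w ih => rw [Dw_cons, ih, D_const_mul (diff_of_smooth (smooth_Dw hu w))]; rfl

lemma Dw_sum {ι : Type*} (s : Finset ι) {u : ι → Pt → ℝ} (hu : ∀ i ∈ s, ContDiff ℝ ∞ (u i)) (w : List (Fin 4)) :
    Dw w (fun p => ∑ i ∈ s, u i p) = fun p => ∑ i ∈ s, Dw w (u i) p := by
  induction w with
  | nil => rfl
  | cons a w ih => rw [Dw_cons, ih, D_sum s (u := fun i => Dw w (u i)) (fun i hi => diff_of_smooth (smooth_Dw (hu i hi) w))]; rfl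

lemma Dw_perm {u : Pt → ℝ} (hu : ContDiff ℝ ∞ u) {w v : List (Fin 4)} (h : w.Perm v) : Dw w u = Dw v u := by
  induction h with
  | nil => rfl
  | cons a _ ih => rw [Dw_cons, Dw_cons, ih]
  | swap a b l => rw [Dw_cons, Dw_cons, Dw_cons, Dw_cons, D_comm (c2_of_smooth (smooth_Dw hu l))]
  | trans _ _ h1 h2 => rw [h1, h2]

def wd4 (k : ℕ) : Finset (List (Fin 4)) := (List.finite_length_le (Fin 4) k).toFinset
lemma mem_wd4 {k : ℕ} {I : List (Fin 4)} : I ∈ wd4 k ↔ I.length ≤ k := by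
  simp [wd4]
attribute [irreducible] wd4

def rho (p : Pt) : ℝ := 1 + p.1 ^ 2 + ∑ i, p.2 i ^ 2
lemma one_le_rho (p : Pt) : 1 ≤ rho p := by
  have : 0 ≤ ∑ i, p.2 i ^ 2 := Finset.sum_nonneg fun i _ => sq_nonneg _
  unfold rho; nlinarith [sq_nonneg p.1]
lemma rho_zero (x : Spc) : rho (0, x) = jb x ^ 2 := by rw [jb_sq]; simp [rho]

def dW (k : ℕ) (f : Pt → ℝ) (p : Pt) : ℝ := ∑ w ∈ wd4 k, rho p ^ w.length * Dw w f p ^ 2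
lemma le_dW {k : ℕ} {w : List (Fin 4)} (h : w.length ≤ k) (f : Pt → ℝ) (p : Pt) :
    rho p ^ w.length * Dw w f p ^ 2 ≤ dW k f p := by
  have := one_le_rho p
  exact Finset.single_le_sum (f := fun w : List (Fin 4) => rho p ^ w.length * Dw w f p ^ 2) (fun _ _ => by positivity) (mem_wd4.2 h)
lemma dW_nonneg (k : ℕ) (f : Pt → ℝ) (p : Pt) : 0 ≤ dW k f p := by
  have := one_le_rho p
  exact Finset.sum_nonneg fun _ _ => by positivity
lemma dW_mono {k l : ℕ} (h : k ≤ l) (f : Pt → ℝ) (p : Pt) : dW k f p ≤ dW l f p := by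
  have := one_le_rho p
  exact Finset.sum_le_sum_of_subset_of_nonneg (fun w hw => mem_wd4.2 ((mem_wd4.1 hw).trans h)) fun _ _ _ => by positivity

/-- gaining one weight when a derivative is peeled off -/
lemma dW_D (k : ℕ) (c : Fin 4) (f : Pt → ℝ) (p : Pt) : rho p * dW k (D c f) p ≤ (wd4 k).card * dW (k + 1) f p := by
  unfold dW
  rw [Finset.mul_sum]
  refine (Finset.sum_le_card_nsmul _ _ (dW (k+1) f p) fun w hw => ?_).trans (le_of_eq (by rw [nsmul_eq_mul]; rfl))
  have h := le_dW (k := k + 1) (w := w ++ [c]) (by have := mem_wd4.1 hw; simpa using this) f p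
  rw [Dw_snoc, List.length_append, List.length_singleton] at h
  refine le_trans (le_of_eq ?_) h
  ring

lemma dW_D0 (k : ℕ) (c : Fin 4) (f : Pt → ℝ) (p : Pt) : dW k (D c f) p ≤ (wd4 k).card * dW (k + 1) f p :=
  le_trans (le_mul_of_one_le_left (dW_nonneg _ _ _) (one_le_rho p)) (dW_D k c f p)

lemma Xc_sq_le (b : Fin 4) (p : Pt) : Xc b p ^ 2 ≤ rho p := by
  have h0 : 0 ≤ ∑ i, p.2 i ^ 2 := Finset.sum_nonneg fun i _ => sq_nonneg _
  refine Fin.cases ?_ (fun i => ?_) b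
  · show p.1 ^ 2 ≤ rho p
    unfold rho; linarith
  · have := Finset.single_le_sum (f := fun i => p.2 i ^ 2) (fun i _ => sq_nonneg _) (Finset.mem_univ i)
    show p.2 i ^ 2 ≤ rho p
    unfold rho
    nlinarith [sq_nonneg p.1]

lemma vc_sq_le (n : Fin 11) (a : Fin 4) : ∃ C : ℝ, 0 ≤ C ∧ ∀ p : Pt, vc n a p ^ 2 ≤ C * rho p := by
  refine ⟨2 * va n a ^ 2 + 2 * ((∑ b, vB n a b ^ 2) * 4), by positivity, fun p => ?_⟩
  unfold vc
  have h1 := Finset.sum_mul_sq_le_sq_mul_sq (Finset.univ : Finset (Fin 4)) (fun b => vB n a b) (fun b => Xc b p)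
  have h2 : ∑ b, Xc b p ^ 2 ≤ 4 * rho p :=
    (Finset.sum_le_card_nsmul _ _ _ fun b _ => Xc_sq_le b p).trans (by simp)
  have h3 := one_le_rho p
  have h4 : 0 ≤ ∑ b, vB n a b ^ 2 := Finset.sum_nonneg fun b _ => sq_nonneg _
  have h5 := sq_add_le (va n a) (∑ b, vB n a b * Xc b p)
  have h6 := mul_le_mul_of_nonneg_left h2 h4
  nlinarith [sq_nonneg (va n a)]

lemma lin_sq {k : ℕ} (c : Fin 4 → ℝ) (y : Fin 4 → ℝ) : (∑ a, c a * y a) ^ 2 ≤ (∑ a, c a ^ 2) * ∑ a, y a ^ 2 :=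
  Finset.sum_mul_sq_le_sq_mul_sq _ _ _

lemma dW_Z1 (n : Fin 11) (w : List (Fin 4)) : ∃ C : ℝ, 0 ≤ C ∧ ∀ x : Sm × Pt,
    rho x.2 ^ w.length * Dw w (Zf n x.1.1) x.2 ^ 2 ≤ C * dW (w.length + 1) x.1.1 x.2 := by
  induction w using List.reverseRecOn with
  | nil =>
    choose C hC h using vc_sq_le n
    refine ⟨4 * ∑ a, C a, by have := Finset.sum_nonneg (fun a (_ : a ∈ Finset.univ) => hC a); positivity, fun x => ?_⟩
    simp only [List.length_nil, pow_zero, one_mul, Dw_nil]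
    unfold Zf
    refine (Finset.sum_mul_sq_le_sq_mul_sq _ _ _).trans ?_
    have h1 : ∑ a, vc n a x.2 ^ 2 ≤ (∑ a, C a) * rho x.2 := by
      rw [Finset.sum_mul]; exact Finset.sum_le_sum fun a _ => h a x.2
    have h2 : rho x.2 * ∑ a, D a x.1.1 x.2 ^ 2 ≤ 4 * dW 1 x.1.1 x.2 := by
      rw [Finset.mul_sum]
      refine (Finset.sum_le_card_nsmul _ _ (dW 1 x.1.1 x.2) fun a _ => ?_).trans (by simp)
      simpa [Dw_cons] using le_dW (k := 1) (w := [a]) (by simp) x.1.1 x.2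
    have h3 : 0 ≤ ∑ a, D a x.1.1 x.2 ^ 2 := Finset.sum_nonneg fun a _ => sq_nonneg _
    have h4 : 0 ≤ ∑ a, C a := Finset.sum_nonneg fun a _ => hC a
    calc _ ≤ (∑ a, C a) * rho x.2 * ∑ a, D a x.1.1 x.2 ^ 2 := mul_le_mul_of_nonneg_right h1 h3
      _ = (∑ a, C a) * (rho x.2 * ∑ a, D a x.1.1 x.2 ^ 2) := by ring
      _ ≤ (∑ a, C a) * (4 * dW 1 x.1.1 x.2) := mul_le_mul_of_nonneg_left h2 h4
      _ = _ := by ring_nf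
  | append_singleton w c ih =>
    obtain ⟨C, hC, h⟩ := ih
    set B := ∑ a, vB n a c ^ 2 with hB
    have hB0 : 0 ≤ B := Finset.sum_nonneg fun b _ => sq_nonneg _
    refine ⟨2 * (C * (wd4 (w.length + 1)).card) + 2 * (B * 4), by positivity, fun x => ?_⟩
    obtain ⟨⟨f, hf⟩, p⟩ := x
    simp only
    have hr := one_le_rho p
    have hr0 : 0 ≤ rho p := by linarith
    rw [Dw_snoc, D_Zf hf, Dw_add (smooth_Zf (smooth_D hf c) n) (ContDiff.sum fun a _ => contDiff_const.mul (smooth_D hf a)),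
      Dw_sum _ (u := fun a p => vB n a c * D a f p) (fun a _ => contDiff_const.mul (smooth_D hf a))]
    simp only [Dw_const_mul (smooth_D hf _)]
    rw [List.length_append, List.length_singleton]
    have h1 := h (⟨D c f, smooth_D hf c⟩, p)
    simp only at h1
    have h2 := dW_D (w.length + 1) c f p
    have h3 := lin_sq (k := 0) (fun a => vB n a c) (fun a => Dw w (D a f) p)
    have h4 : rho p ^ (w.length + 1) * ∑ a, Dw w (D a f) p ^ 2 ≤ 4 * dW (w.length + 1 + 1) f p := by
      rw [Finset.mul_sum]
      refine (Finset.sum_le_card_nsmul _ _ (dW (w.length + 1 + 1) f p) fun a _ => ?_).trans (by simp)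
      have := le_dW (k := w.length + 1 + 1) (w := w ++ [a]) (by simp) f p
      rw [Dw_snoc, List.length_append, List.length_singleton] at this
      exact this
    have h5 := sq_add_le (Dw w (Zf n (D c f)) p) (∑ a, vB n a c * Dw w (D a f) p)
    calc rho p ^ (w.length + 1) * (Dw w (Zf n (D c f)) p + ∑ a, vB n a c * Dw w (D a f) p) ^ 2
        ≤ rho p ^ (w.length + 1) * (2 * Dw w (Zf n (D c f)) p ^ 2 + 2 * (B * ∑ a, Dw w (D a f) p ^ 2)) := by
          refine mul_le_mul_of_nonneg_left (h5.trans ?_) (by positivity)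
          linarith
      _ = 2 * (rho p * (rho p ^ w.length * Dw w (Zf n (D c f)) p ^ 2)) + 2 * (B * (rho p ^ (w.length + 1) * ∑ a, Dw w (D a f) p ^ 2)) := by ring
      _ ≤ 2 * (rho p * (C * dW (w.length + 1) (D c f) p)) + 2 * (B * (4 * dW (w.length + 1 + 1) f p)) := by gcongr
      _ = 2 * (C * (rho p * dW (w.length + 1) (D c f) p)) + 2 * (B * (4 * dW (w.length + 1 + 1) f p)) := by ring
      _ ≤ 2 * (C * ((wd4 (w.length + 1)).card * dW (w.length + 1 + 1) f p)) + 2 * (B * (4 * dW (w.length + 1 + 1) f p)) := by gcongr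
      _ = _ := by ring

lemma dW_Z (n : Fin 11) (k : ℕ) : ∃ C : ℝ, 0 ≤ C ∧ ∀ x : Sm × Pt,
    dW k (Zf n x.1.1) x.2 ≤ C * dW (k + 1) x.1.1 x.2 :=
  sum_bd (wd4 k) (fun w (x : Sm × Pt) => rho x.2 ^ w.length * Dw w (Zf n x.1.1) x.2 ^ 2) (fun x => dW (k+1) x.1.1 x.2) fun w hw => by
    obtain ⟨C, hC, h⟩ := dW_Z1 n w
    exact ⟨C, hC, fun x => (h x).trans (mul_le_mul_of_nonneg_left (dW_mono (by have := mem_wd4.1 hw; omega) _ _) hC)⟩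

def dE (k : ℕ) (u : Pt → ℝ) (p : Pt) : ℝ := ∑ b, dW k (D b u) p
lemma dE_nonneg (k : ℕ) (u : Pt → ℝ) (p : Pt) : 0 ≤ dE k u p := Finset.sum_nonneg fun b _ => dW_nonneg _ _ _

lemma dE_Z (n : Fin 11) (k : ℕ) : ∃ C : ℝ, 0 ≤ C ∧ ∀ x : Sm × Pt,
    dE k (Zf n x.1.1) x.2 ≤ C * dE (k + 1) x.1.1 x.2 := by
  obtain ⟨C, hC, h⟩ := dW_Z n k
  refine sum_bd Finset.univ (fun b (x : Sm × Pt) => dW k (D b (Zf n x.1.1)) x.2) (fun x => dE (k+1) x.1.1 x.2) fun b _ => ?_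
  set B := ∑ a, vB n a b ^ 2 with hB
  have hB0 : 0 ≤ B := Finset.sum_nonneg fun b _ => sq_nonneg _
  refine ⟨2 * C + 2 * B, by positivity, fun x => ?_⟩
  obtain ⟨⟨f, hf⟩, p⟩ := x
  simp only
  have hr := one_le_rho p
  have hr0 : 0 ≤ rho p := by linarith
  have h1 := h (⟨D b f, smooth_D hf b⟩, p)
  simp only at h1
  have h2 : dW (k+1) (D b f) p ≤ dE (k+1) f p :=
    Finset.single_le_sum (f := fun b => dW (k+1) (D b f) p) (fun b _ => dW_nonneg _ _ _) (Finset.mem_univ b)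
  have h3 : ∑ a, dW k (D a f) p ≤ dE (k+1) f p := Finset.sum_le_sum fun a _ => dW_mono (by omega) _ _
  have h4 : dW k (D b (Zf n f)) p ≤ 2 * dW k (Zf n (D b f)) p + 2 * (B * ∑ a, dW k (D a f) p) := by
    unfold dW
    rw [Finset.sum_comm, Finset.mul_sum, Finset.mul_sum, Finset.mul_sum, ← Finset.sum_add_distrib]
    refine Finset.sum_le_sum fun w _ => ?_
    rw [D_Zf hf, Dw_add (smooth_Zf (smooth_D hf b) n) (ContDiff.sum fun a _ => contDiff_const.mul (smooth_D hf a)),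
      Dw_sum _ (u := fun a p => vB n a b * D a f p) (fun a _ => contDiff_const.mul (smooth_D hf a))]
    simp only [Dw_const_mul (smooth_D hf _)]
    have h3 := lin_sq (k := 0) (fun a => vB n a b) (fun a => Dw w (D a f) p)
    have h5 := sq_add_le (Dw w (Zf n (D b f)) p) (∑ a, vB n a b * Dw w (D a f) p)
    rw [← Finset.mul_sum]
    calc rho p ^ w.length * (Dw w (Zf n (D b f)) p + ∑ a, vB n a b * Dw w (D a f) p) ^ 2
        ≤ rho p ^ w.length * (2 * Dw w (Zf n (D b f)) p ^ 2 + 2 * (B * ∑ a, Dw w (D a f) p ^ 2)) := by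
          refine mul_le_mul_of_nonneg_left (h5.trans ?_) (by positivity)
          linarith
      _ = _ := by ring
  have h6 := mul_le_mul_of_nonneg_left h3 hB0
  have h7 := mul_le_mul_of_nonneg_left h2 hC
  linarith

lemma dE_Zw (J : List (Fin 11)) : ∀ k : ℕ, ∃ C : ℝ, 0 ≤ C ∧ ∀ x : Sm × Pt,
    dE k (Zw J x.1.1) x.2 ≤ C * dE (k + J.length) x.1.1 x.2 := by
  induction J with
  | nil => exact fun k => ⟨1, zero_le_one, fun x => by rw [one_mul]; exact le_refl _⟩
  | cons n J ih =>
    intro k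
    obtain ⟨C, hC, h⟩ := dE_Z n k
    obtain ⟨C2, hC2, h2⟩ := ih (k + 1)
    refine ⟨C * C2, by positivity, fun x => ?_⟩
    refine (h (⟨Zw J x.1.1, smooth_Zw x.1.2 J⟩, x.2)).trans ?_
    rw [mul_assoc, List.length_cons, show k + (J.length + 1) = k + 1 + J.length by ring]
    exact mul_le_mul_of_nonneg_left (h2 x) hC

lemma dE_mono {k l : ℕ} (h : k ≤ l) (f : Pt → ℝ) (p : Pt) : dE k f p ≤ dE l f p :=
  Finset.sum_le_sum fun b _ => dW_mono h _ _

lemma eW_dE (k : ℕ) : ∃ C : ℝ, 0 ≤ C ∧ ∀ x : Sm × Pt, eW k x.1.1 x.2 ≤ C * dE k x.1.1 x.2 :=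
  sum_bd (wds k) (fun J (x : Sm × Pt) => dsq (Zw J x.1.1) x.2) (fun x => dE k x.1.1 x.2) fun J hJ => by
    obtain ⟨C, hC, h⟩ := dE_Zw J 0
    refine ⟨C, hC, fun x => le_trans ?_ ((h x).trans (mul_le_mul_of_nonneg_left (dE_mono (by have := mem_wds.1 hJ; omega) _ _) hC))⟩
    refine Finset.sum_le_sum fun b _ => ?_
    simpa using le_dW (k := 0) (w := []) (by simp) (D b (Zw J x.1.1)) x.2

/-- at time zero, derivatives gain weights -/
lemma sW_D0 (k : ℕ) (c : Fin 4) : ∃ C : ℝ, 0 ≤ C ∧ ∀ x : Sm × Spc,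
    jb x.2 ^ 2 * sW k (D c x.1.1) (0, x.2) ≤ C * sW (k + 1) x.1.1 (0, x.2) := by
  obtain ⟨C, hC, h⟩ := comm_D k
  refine ⟨C * ((wds k).card * (44 * (wds 1).card)), by positivity, fun x => ?_⟩
  have hj := jb_pos x.2
  have h1 : jb x.2 ^ 2 * eW k x.1.1 (0, x.2) ≤ ((wds k).card * (44 * (wds 1).card)) * sW (k+1) x.1.1 (0, x.2) := by
    unfold eW
    rw [Finset.mul_sum, mul_assoc]
    refine (Finset.sum_le_card_nsmul _ _ _ fun J hJ => ?_).trans (le_of_eq (by rw [nsmul_eq_mul]))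
    unfold dsq
    have h2 : ∀ a, jb x.2 ^ 2 * D a (Zw J x.1.1) (0, x.2) ^ 2 ≤ 11 * sW 1 (Zw J x.1.1) (0, x.2) := by
      intro a
      refine le_trans (mul_le_mul_of_nonneg_right ?_ (sq_nonneg _)) (jq_D (Zw J x.1.1) (p := (0, x.2)) le_rfl a)
      rw [jq_sq]; simp
    have h3 : sW 1 (Zw J x.1.1) (0, x.2) ≤ (wds 1).card * sW (k+1) x.1.1 (0, x.2) := by
      unfold sW
      refine (Finset.sum_le_card_nsmul _ _ (sW (k+1) x.1.1 (0, x.2)) fun I hI => ?_).trans (le_of_eq (by rw [nsmul_eq_mul]; rfl))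
      rw [← Zw_append]
      refine le_sW ?_ _ _
      have := mem_wds.1 hI
      have := mem_wds.1 hJ
      rw [List.length_append]; omega
    rw [Finset.mul_sum]
    refine (Finset.sum_le_card_nsmul _ _ _ fun a _ => h2 a).trans ?_
    simp only [Finset.card_univ, Fintype.card_fin, nsmul_eq_mul]
    push_cast
    linarith
  calc jb x.2 ^ 2 * sW k (D c x.1.1) (0, x.2) ≤ jb x.2 ^ 2 * (C * eW k x.1.1 (0, x.2)) :=
        mul_le_mul_of_nonneg_left (h c (x.1, (0, x.2))) (by positivity)
    _ = C * (jb x.2 ^ 2 * eW k x.1.1 (0, x.2)) := by ring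
    _ ≤ C * (((wds k).card * (44 * (wds 1).card)) * sW (k+1) x.1.1 (0, x.2)) := mul_le_mul_of_nonneg_left h1 hC
    _ = _ := by ring

lemma Dw_sW (w : List (Fin 4)) : ∃ C : ℝ, 0 ≤ C ∧ ∀ x : Sm × Spc,
    (jb x.2 ^ 2) ^ w.length * Dw w x.1.1 (0, x.2) ^ 2 ≤ C * sW w.length x.1.1 (0, x.2) := by
  induction w using List.reverseRecOn with
  | nil => exact ⟨1, zero_le_one, fun x => by
      simpa using le_sW (k := 0) (J := []) (by simp) x.1.1 (0, x.2)⟩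
  | append_singleton w c ih =>
    obtain ⟨C, hC, h⟩ := ih
    obtain ⟨C2, hC2, h2⟩ := sW_D0 w.length c
    refine ⟨C * C2, by positivity, fun x => ?_⟩
    have hj := jb_pos x.2
    rw [Dw_snoc, List.length_append, List.length_singleton]
    calc (jb x.2 ^ 2) ^ (w.length + 1) * Dw w (D c x.1.1) (0, x.2) ^ 2
        = jb x.2 ^ 2 * ((jb x.2 ^ 2) ^ w.length * Dw w (D c x.1.1) (0, x.2) ^ 2) := by ring
      _ ≤ jb x.2 ^ 2 * (C * sW w.length (D c x.1.1) (0, x.2)) :=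
        mul_le_mul_of_nonneg_left (h (⟨D c x.1.1, smooth_D x.1.2 c⟩, x.2)) (by positivity)
      _ = C * (jb x.2 ^ 2 * sW w.length (D c x.1.1) (0, x.2)) := by ring
      _ ≤ C * (C2 * sW (w.length + 1) x.1.1 (0, x.2)) := mul_le_mul_of_nonneg_left (h2 x) hC
      _ = _ := by ring

/-- the size of the data: words with at most one time derivative -/
def wdd (N : ℕ) : Finset (List (Fin 4)) := (wd4 (N + 1)).filter fun w => 1 ≤ w.length ∧ w.count 0 ≤ 1
def DAT (N : ℕ) (u : Pt → ℝ) (x : Spc) : ℝ := ∑ w ∈ wdd N, (jb x ^ 2) ^ (w.length - 1) * Dw w u (0, x) ^ 2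

lemma DAT_nonneg (N : ℕ) (u : Pt → ℝ) (x : Spc) : 0 ≤ DAT N u x :=
  Finset.sum_nonneg fun w _ => by have := jb_pos x; positivity

lemma bx_split {u : Pt → ℝ} : D 0 (D 0 u) = fun p => (∑ i : Fin 3, D i.succ (D i.succ u) p) - bx u p := by
  funext p
  have h : bx u p = eta 0 * D 0 (D 0 u) p + ∑ i : Fin 3, eta i.succ * D i.succ (D i.succ u) p := by
    unfold bx; exact Fin.sum_univ_succ _
  have h2 : ∑ i : Fin 3, eta i.succ * D i.succ (D i.succ u) p = ∑ i : Fin 3, D i.succ (D i.succ u) p :=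
    Finset.sum_congr rfl fun i _ => by
      have : eta i.succ = 1 := by fin_cases i <;> simp [eta]
      rw [this, one_mul]
  rw [h, h2]
  simp [eta]

lemma Dw_dat (N : ℕ) : ∀ (m : ℕ) (w : List (Fin 4)), w.count 0 ≤ m → 1 ≤ w.length → w.length ≤ N + 1 →
    ∃ C : ℝ, 0 ≤ C ∧ ∀ x : Sm × Spc, (jb x.2 ^ 2) ^ (w.length - 1) * Dw w x.1.1 (0, x.2) ^ 2 ≤
      C * (DAT N x.1.1 x.2 + jb x.2 ^ 2 * sW (N - 1) (bx x.1.1) (0, x.2)) := by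
  intro m
  induction m using Nat.strong_induction_on with
  | _ m ih =>
  intro w hm h1 h2
  by_cases hc : w.count 0 ≤ 1
  · refine ⟨1, zero_le_one, fun x => ?_⟩
    have hj := jb_pos x.2
    have hw : w ∈ wdd N := by
      unfold wdd; rw [Finset.mem_filter]; exact ⟨mem_wd4.2 h2, h1, hc⟩
    have := Finset.single_le_sum (f := fun w : List (Fin 4) => (jb x.2 ^ 2) ^ (w.length - 1) * Dw w x.1.1 (0, x.2) ^ 2) (fun _ _ => by positivity) hw
    have h3 := sW_nonneg (N-1) (bx x.1.1) (0, x.2)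
    have h4 : 0 ≤ jb x.2 ^ 2 * sW (N - 1) (bx x.1.1) (0, x.2) := by positivity
    rw [one_mul]
    refine le_trans this ?_
    unfold DAT; linarith
  · push Not at hc
    have m0 : (0 : Fin 4) ∈ w := List.count_pos_iff.1 (by omega)
    have p1 := List.perm_cons_erase m0
    have c1 : (w.erase 0).count 0 = w.count 0 - 1 := by rw [List.count_erase_self]
    have m1 : (0 : Fin 4) ∈ w.erase 0 := List.count_pos_iff.1 (by omega)
    have p2 := List.perm_cons_erase m1
    have c2 : ((w.erase 0).erase 0).count 0 = w.count 0 - 2 := by rw [List.count_erase_self, c1]; rfl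
    set v := (w.erase 0).erase 0 with hv
    have p3 : w.Perm ([0, 0] ++ v) := p1.trans (p2.cons 0)
    have p4 : w.Perm (v ++ [0, 0]) := p3.trans List.perm_append_comm
    have hl : w.length = v.length + 2 := by rw [p4.length_eq]; simp
    have key : ∀ i : Fin 3, ∃ C : ℝ, 0 ≤ C ∧ ∀ x : Sm × Spc, (jb x.2 ^ 2) ^ (w.length - 1) * Dw (v ++ [i.succ, i.succ]) x.1.1 (0, x.2) ^ 2 ≤
      C * (DAT N x.1.1 x.2 + jb x.2 ^ 2 * sW (N - 1) (bx x.1.1) (0, x.2)) := by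
      intro i
      have := ih (m - 1) (by omega) (v ++ [i.succ, i.succ]) (by
        rw [List.count_append, c2]
        have : List.count (0 : Fin 4) [i.succ, i.succ] = 0 := List.count_eq_zero.2 (by simp [Fin.succ_ne_zero, (Fin.succ_ne_zero _).symm])
        omega) (by simp) (by rw [List.length_append]; simp; omega)
      have e : (v ++ [i.succ, i.succ]).length = w.length := by rw [hl]; simp
      rwa [e] at this
    choose C hC h using key
    obtain ⟨C2, hC2, h2⟩ := Dw_sW v
    refine ⟨2 * (3 * ∑ i, C i) + 2 * C2, by have := Finset.sum_nonneg (fun a (_ : a ∈ Finset.univ) => hC a); positivity, fun x => ?_⟩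
    obtain ⟨⟨u, hu⟩, x⟩ := x
    have hj := jb_pos x
    have k1 : Dw w u (0, x) = (∑ i : Fin 3, Dw (v ++ [i.succ, i.succ]) u (0, x)) - Dw v (bx u) (0, x) := by
      rw [Dw_perm hu p4, Dw_append]
      show Dw v (D 0 (D 0 u)) (0, x) = _
      rw [bx_split, Dw_sub (ContDiff.sum fun i _ => smooth_D (smooth_D hu _) _) (smooth_bx hu),
        Dw_sum _ (u := fun (i : Fin 3) p => D i.succ (D i.succ u) p) (fun i _ => smooth_D (smooth_D hu _) _)]
      have e : ∀ i : Fin 3, Dw (v ++ [i.succ, i.succ]) u (0, x) = Dw v (fun p => D i.succ (D i.succ u) p) (0, x) := fun i => by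
        rw [Dw_append]; rfl
      rw [Finset.sum_congr rfl fun i _ => e i]
    have k2 : (∑ i : Fin 3, Dw (v ++ [i.succ, i.succ]) u (0, x)) ^ 2 ≤ 3 * ∑ i : Fin 3, Dw (v ++ [i.succ, i.succ]) u (0, x) ^ 2 := by
      simpa using sq_sum_le_card_mul_sum_sq (s := (Finset.univ : Finset (Fin 3))) (f := fun i : Fin 3 => Dw (v ++ [i.succ, i.succ]) u (0, x))
    set X := DAT N u x + jb x ^ 2 * sW (N - 1) (bx u) (0, x) with hX
    have k3 : (jb x ^ 2) ^ (w.length - 1) * ∑ i : Fin 3, Dw (v ++ [i.succ, i.succ]) u (0, x) ^ 2 ≤ (∑ i, C i) * X := by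
      rw [Finset.mul_sum, Finset.sum_mul]
      exact Finset.sum_le_sum fun i _ => h i (⟨u, hu⟩, x)
    have k4 : (jb x ^ 2) ^ (w.length - 1) * Dw v (bx u) (0, x) ^ 2 ≤ C2 * X := by
      have e : w.length - 1 = v.length + 1 := by omega
      have f1 := h2 (⟨bx u, smooth_bx hu⟩, x)
      simp only at f1
      have f2 : sW v.length (bx u) (0, x) ≤ sW (N-1) (bx u) (0, x) := sW_mono (by omega) _ _
      have f3 := DAT_nonneg N u x
      rw [e]
      calc (jb x ^ 2) ^ (v.length + 1) * Dw v (bx u) (0, x) ^ 2 = jb x ^ 2 * ((jb x ^ 2) ^ v.length * Dw v (bx u) (0, x) ^ 2) := by ring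
        _ ≤ jb x ^ 2 * (C2 * sW (N-1) (bx u) (0, x)) := mul_le_mul_of_nonneg_left (f1.trans (mul_le_mul_of_nonneg_left f2 hC2)) (by positivity)
        _ = C2 * (jb x ^ 2 * sW (N-1) (bx u) (0, x)) := by ring
        _ ≤ _ := mul_le_mul_of_nonneg_left (by rw [hX]; linarith) hC2
    have k5 : Dw w u (0, x) ^ 2 ≤ 2 * (∑ i : Fin 3, Dw (v ++ [i.succ, i.succ]) u (0, x)) ^ 2 + 2 * Dw v (bx u) (0, x) ^ 2 := by
      rw [k1]
      nlinarith [sq_nonneg ((∑ i : Fin 3, Dw (v ++ [i.succ, i.succ]) u (0, x)) + Dw v (bx u) (0, x))]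
    calc (jb x ^ 2) ^ (w.length - 1) * Dw w u (0, x) ^ 2
        ≤ (jb x ^ 2) ^ (w.length - 1) * (2 * (3 * ∑ i : Fin 3, Dw (v ++ [i.succ, i.succ]) u (0, x) ^ 2) + 2 * Dw v (bx u) (0, x) ^ 2) :=
          mul_le_mul_of_nonneg_left (by linarith) (by positivity)
      _ = 2 * (3 * ((jb x ^ 2) ^ (w.length - 1) * ∑ i : Fin 3, Dw (v ++ [i.succ, i.succ]) u (0, x) ^ 2)) + 2 * ((jb x ^ 2) ^ (w.length - 1) * Dw v (bx u) (0, x) ^ 2) := by ring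
      _ ≤ 2 * (3 * ((∑ i, C i) * X)) + 2 * (C2 * X) := by linarith
      _ = _ := by ring

lemma eW_dat (N : ℕ) : ∃ C : ℝ, 0 ≤ C ∧ ∀ x : Sm × Spc, eW N x.1.1 (0, x.2) ≤
      C * (DAT N x.1.1 x.2 + jb x.2 ^ 2 * sW (N - 1) (bx x.1.1) (0, x.2)) := by
  obtain ⟨C, hC, h⟩ := eW_dE N
  have key := sum_bd Finset.univ (fun (b : Fin 4) (x : Sm × Spc) => dW N (D b x.1.1) (0, x.2))
    (fun x => DAT N x.1.1 x.2 + jb x.2 ^ 2 * sW (N - 1) (bx x.1.1) (0, x.2)) (fun b _ =>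
      sum_bd (wd4 N) (fun w (x : Sm × Spc) => rho (0, x.2) ^ w.length * Dw w (D b x.1.1) (0, x.2) ^ 2)
      (fun x => DAT N x.1.1 x.2 + jb x.2 ^ 2 * sW (N - 1) (bx x.1.1) (0, x.2)) fun w hw => by
        have hw := mem_wd4.1 hw
        obtain ⟨C, hC, h⟩ := Dw_dat N _ (w ++ [b]) le_rfl (by simp) (by simpa using hw)
        refine ⟨C, hC, fun x => ?_⟩
        have := h x
        rw [Dw_snoc, List.length_append, List.length_singleton, Nat.add_sub_cancel] at this
        rw [rho_zero]
        exact this)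
  obtain ⟨C2, hC2, h2⟩ := key
  refine ⟨C * C2, by positivity, fun x => ?_⟩
  rw [mul_assoc]
  exact (h (x.1, (0, x.2))).trans (mul_le_mul_of_nonneg_left (h2 x) hC)

def HN (a : ℝ) (N : ℕ) (F : Pt → ℝ) : ℝ := ∫ x, WW a (0, x) * (jb x ^ 2 * sW (N - 1) F (0, x))
def DN (a : ℝ) (N : ℕ) (u : Pt → ℝ) : ℝ := ∫ x, WW a (0, x) * DAT N u x

lemma HN_nonneg (a : ℝ) (N : ℕ) (F : Pt → ℝ) : 0 ≤ HN a N F :=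
  integral_nonneg fun x => mul_nonneg (WW_pos a _).le (mul_nonneg (sq_nonneg _) (sW_nonneg _ _ _))
lemma DN_nonneg (a : ℝ) (N : ℕ) (F : Pt → ℝ) : 0 ≤ DN a N F :=
  integral_nonneg fun x => mul_nonneg (WW_pos a _).le (DAT_nonneg _ _ _)

lemma int_HN (a : ℝ) (N : ℕ) {F : Pt → ℝ} (hF : ContDiff ℝ ∞ F) (hs : Scs F) :
    Integrable fun x => WW a (0, x) * (jb x ^ 2 * sW (N - 1) F (0, x)) :=
  slice_int (g := fun p => WW a p * (jb p.2 ^ 2 * sW (N - 1) F p))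
    ((smooth_WW a).continuous.mul ((smooth_jb.continuous.pow 2).mul (cont_sW hF _))) (((hs.sW _).mul_left _).mul_left _) 0

lemma int_DN (a : ℝ) (N : ℕ) {u : Pt → ℝ} (hu : ContDiff ℝ ∞ u) (hs : Scs u) :
    Integrable fun x => WW a (0, x) * DAT N u x :=
  slice_int (g := fun p => WW a p * ∑ w ∈ wdd N, (jb p.2 ^ 2) ^ (w.length - 1) * Dw w u p ^ 2)
    ((smooth_WW a).continuous.mul (continuous_finset_sum _ fun w _ =>
      ((smooth_jb.continuous.pow 2).pow _).mul ((smooth_Dw hu w).continuous.pow 2)))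
    ((Scs.sum _ fun w _ => ((hs.Dw w).sq).mul_left _).mul_left _) 0

lemma lin0 (a : ℝ) (N : ℕ) : ∃ C : ℝ, 0 ≤ C ∧ ∀ u : Pt → ℝ, ContDiff ℝ ∞ u → Scs u →
    EN a N u 0 ≤ C * (DN a N u + HN a N (bx u)) := by
  obtain ⟨C, hC, h⟩ := eW_dat N
  refine ⟨C, hC, fun u hu hs => ?_⟩
  unfold EN DN HN
  rw [← integral_add (int_DN a N hu hs) (int_HN a N (smooth_bx hu) hs.bx), ← integral_const_mul]
  refine integral_mono (int_EN a N hu hs 0) (((int_DN a N hu hs).add (int_HN a N (smooth_bx hu) hs.bx)).const_mul C) fun x => ?_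
  have h1 := h (⟨u, hu⟩, x)
  have h2 := WW_pos a (0, x)
  simp only at h1
  refine (mul_le_mul_of_nonneg_left h1 h2.le).trans (le_of_eq ?_)
  show _ = C * (WW a (0, x) * DAT N u x + WW a (0, x) * (jb x ^ 2 * sW (N - 1) (bx u) (0, x)))
  ring

lemma tsq_le_dsq (u : Pt → ℝ) (p : Pt) : tsq u p ≤ 7 * dsq u p := by
  have hj := jb_pos p.2
  have h1 : ∀ i, (p.2 i / jb p.2) ^ 2 ≤ 1 := fun i => by
    rw [div_pow, div_le_one (by positivity), sq_le_sq, abs_of_pos hj]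
    exact (abs_le_rad _ i).trans (rad_le_jb _)
  have h2 : (D 0 u p / jb p.2) ^ 2 ≤ D 0 u p ^ 2 := by
    rw [div_pow]
    refine div_le_self (sq_nonneg _) ?_
    nlinarith [jb_ge_one p.2]
  have h3 : ∀ i : Fin 3, (D i.succ u p + p.2 i / jb p.2 * D 0 u p) ^ 2 ≤ 2 * D i.succ u p ^ 2 + 2 * D 0 u p ^ 2 := fun i => by
    refine (sq_add_le _ _).trans ?_
    rw [mul_pow]
    have := mul_le_mul_of_nonneg_right (h1 i) (sq_nonneg (D 0 u p))
    linarith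
  have h4 := Finset.sum_le_sum fun i (_ : i ∈ (Finset.univ : Finset (Fin 3))) => h3 i
  unfold tsq dsq
  rw [Fin.sum_univ_succ (fun a => D a u p ^ 2)]
  rw [Finset.sum_add_distrib, ← Finset.mul_sum] at h4
  simp only [Finset.sum_const, Finset.card_univ, Fintype.card_fin, nsmul_eq_mul] at h4
  have h5 : 0 ≤ ∑ i : Fin 3, D i.succ u p ^ 2 := Finset.sum_nonneg fun i _ => sq_nonneg _
  push_cast at h4
  linarith

lemma QF_scs (M : Matrix (Fin 4) (Fin 4) ℝ) (u : Pt → ℝ) {v : Pt → ℝ} (hvs : Scs v) : Scs (QF M u v) :=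
  Scs.sum _ fun a _ => Scs.sum _ fun b _ => ((hvs.D b).mul_left _).mul_left _

lemma bil0 {a : ℝ} (ha : 1 ≤ a) {N : ℕ} (hN : 8 ≤ N) (M : Matrix (Fin 4) (Fin 4) ℝ) (hM : NullM M) :
    ∃ C : ℝ, 0 ≤ C ∧ ∀ (u v : Pt → ℝ), ContDiff ℝ ∞ u → Scs u → ContDiff ℝ ∞ v → Scs v →
    HN a N (QF M u v) ≤ C * (EN a N u 0 * EN a N v 0) := by
  obtain ⟨C1, hC1, h1⟩ := comm_QF (N - 1) M hM
  obtain ⟨C2, hC2, h2⟩ := KS_E ha N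
  refine ⟨C1 * ((pw (N-1)).card * (14 * C2)) * 2, by positivity, ?_⟩
  intro u v hu hus hv hvs
  have key : ∀ (u v : Pt → ℝ), ContDiff ℝ ∞ u → Scs u → ContDiff ℝ ∞ v → Scs v → ∀ (I J : List (Fin 11)),
      3 + J.length ≤ N → I.length ≤ N → ∀ x : Spc,
      WW a (0, x) * (jb x ^ 2 * (dsq (Zw I u) (0, x) * dsq (Zw J v) (0, x))) ≤ C2 * (EN a N v 0 * (WW a (0, x) * eW N u (0, x))) := by
    intro u v hu hus hv hvs I J hJ hI x
    have k1 := h2 v hv hvs (0, x) le_rfl J hJ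
    simp only at k1
    have k2 := le_eW (k := N) (J := I) hI u (0, x)
    have hW := WW_pos a (0, x)
    have hW1 := one_le_WW a (0, x)
    have hd := dsq_nonneg (Zw J v) (0, x)
    have hdI := dsq_nonneg (Zw I u) (0, x)
    have hj : jb x ^ 2 * dsq (Zw J v) (0, x) ≤ C2 * EN a N v 0 := by
      refine le_trans ?_ k1
      have e1 : jb x ^ 2 ≤ (1 + 0 + rad x) ^ 2 := pow_le_pow_left₀ (jb_pos x).le (by have := jb_le_rad x; linarith) 2
      have e2 := one_le_jq (jb x - 0)
      have e3 : 0 ≤ (1 + 0 + rad x) ^ 2 := sq_nonneg _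
      calc jb x ^ 2 * dsq (Zw J v) (0, x) ≤ (1 + 0 + rad x) ^ 2 * 1 * (1 * dsq (Zw J v) (0, x)) := by
            rw [mul_one, one_mul]; exact mul_le_mul_of_nonneg_right e1 hd
        _ ≤ _ := mul_le_mul (mul_le_mul_of_nonneg_left e2 e3) (mul_le_mul_of_nonneg_right hW1 hd) (by positivity) (by positivity)
    have hE := EN_nonneg a N v 0
    calc WW a (0, x) * (jb x ^ 2 * (dsq (Zw I u) (0, x) * dsq (Zw J v) (0, x)))
        = WW a (0, x) * dsq (Zw I u) (0, x) * (jb x ^ 2 * dsq (Zw J v) (0, x)) := by ring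
      _ ≤ WW a (0, x) * eW N u (0, x) * (C2 * EN a N v 0) := by
          refine mul_le_mul (mul_le_mul_of_nonneg_left k2 hW.le) hj (by positivity) (mul_nonneg hW.le (eW_nonneg _ _ _))
      _ = _ := by ring
  set B : Spc → ℝ := fun x => EN a N v 0 * (WW a (0, x) * eW N u (0, x)) + EN a N u 0 * (WW a (0, x) * eW N v (0, x)) with hB
  have i1 := (int_EN a N hu hus 0).const_mul (EN a N v 0)
  have i2 := (int_EN a N hv hvs 0).const_mul (EN a N u 0)
  have iB : Integrable B := i1.add i2
  have vB : ∫ x, B x = EN a N v 0 * EN a N u 0 + EN a N u 0 * EN a N v 0 := by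
    refine (integral_add i1 i2).trans ?_
    rw [integral_const_mul, integral_const_mul]; rfl
  have hB0 : ∀ x, 0 ≤ B x := fun x => by
    have := WW_pos a (0, x)
    have := EN_nonneg a N u 0
    have := EN_nonneg a N v 0
    have := eW_nonneg N u (0, x)
    have := eW_nonneg N v (0, x)
    simp only [hB]; positivity
  have pt : ∀ x, WW a (0, x) * (jb x ^ 2 * sW (N - 1) (QF M u v) (0, x)) ≤ C1 * ((pw (N-1)).card * (14 * C2)) * B x := by
    intro x
    have hW := WW_pos a (0, x)
    have e1 := h1 (⟨u, hu⟩, ⟨v, hv⟩, (0, x))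
    simp only at e1
    have e2 : WW a (0, x) * (jb x ^ 2 * NQ (N-1) u v (0, x)) ≤ (pw (N-1)).card * (14 * C2 * B x) := by
      unfold NQ
      rw [Finset.mul_sum, Finset.mul_sum]
      refine (Finset.sum_le_card_nsmul _ _ (14 * C2 * B x) fun K hK => ?_).trans (le_of_eq (by rw [nsmul_eq_mul]))
      have hK' := mem_pw.1 hK
      have f0 : nt (Zw K.1 u) (Zw K.2 v) (0, x) ≤ 14 * (dsq (Zw K.1 u) (0, x) * dsq (Zw K.2 v) (0, x)) := by
        unfold nt
        have := mul_le_mul_of_nonneg_right (tsq_le_dsq (Zw K.1 u) (0, x)) (dsq_nonneg (Zw K.2 v) (0, x))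
        have := mul_le_mul_of_nonneg_left (tsq_le_dsq (Zw K.2 v) (0, x)) (dsq_nonneg (Zw K.1 u) (0, x))
        linarith
      have f1 : WW a (0, x) * (jb x ^ 2 * (dsq (Zw K.1 u) (0, x) * dsq (Zw K.2 v) (0, x))) ≤ C2 * B x := by
        have n1 := EN_nonneg a N u 0
        have n2 := EN_nonneg a N v 0
        have n3 := eW_nonneg N u (0, x)
        have n4 := eW_nonneg N v (0, x)
        have m1 : 0 ≤ C2 * (EN a N v 0 * (WW a (0, x) * eW N u (0, x))) := by positivity
        have m2 : 0 ≤ C2 * (EN a N u 0 * (WW a (0, x) * eW N v (0, x))) := by positivity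
        simp only [hB]
        by_cases hc : 3 + K.2.length ≤ N
        · have := key u v hu hus hv hvs K.1 K.2 hc (by omega) x
          linarith
        · have := key v u hv hvs hu hus K.2 K.1 (by omega) (by omega) x
          rw [mul_comm (dsq (Zw K.2 v) (0, x))] at this
          linarith
      calc WW a (0, x) * (jb x ^ 2 * nt (Zw K.1 u) (Zw K.2 v) (0, x))
          ≤ WW a (0, x) * (jb x ^ 2 * (14 * (dsq (Zw K.1 u) (0, x) * dsq (Zw K.2 v) (0, x)))) := by gcongr
        _ = 14 * (WW a (0, x) * (jb x ^ 2 * (dsq (Zw K.1 u) (0, x) * dsq (Zw K.2 v) (0, x)))) := by ring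
        _ ≤ 14 * (C2 * B x) := by linarith
        _ = _ := by ring
    calc WW a (0, x) * (jb x ^ 2 * sW (N - 1) (QF M u v) (0, x)) ≤ WW a (0, x) * (jb x ^ 2 * (C1 * NQ (N-1) u v (0, x))) := by gcongr
      _ = C1 * (WW a (0, x) * (jb x ^ 2 * NQ (N-1) u v (0, x))) := by ring
      _ ≤ C1 * ((pw (N-1)).card * (14 * C2 * B x)) := by gcongr
      _ = _ := by ring
  have h3 : HN a N (QF M u v) ≤ C1 * ((pw (N-1)).card * (14 * C2)) * ∫ x, B x := by
    unfold HN
    rw [← integral_const_mul]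
    exact integral_mono (int_HN a N (smooth_QF M hu hv) (QF_scs M u hvs)) (iB.const_mul _) pt
  rw [vB] at h3
  refine h3.trans (le_of_eq ?_)
  ring

/-- source bound -/
def YB (a : ℝ) (N : ℕ) (F : Pt → ℝ) (H : ℝ) : Prop :=
  HN a N F ≤ H ∧ ∀ T, 0 ≤ T → ∫ t in (0:ℝ)..T, tw t * FN a N F t ≤ H

lemma YB.nonneg {a : ℝ} {N : ℕ} {F : Pt → ℝ} {H : ℝ} (h : YB a N F H) : 0 ≤ H := (HN_nonneg _ _ _).trans h.1
lemma XB.nonneg {a : ℝ} {N : ℕ} {F : Pt → ℝ} {H : ℝ} (h : XB a N F H) : 0 ≤ H := (EN_nonneg _ _ _ _).trans (h.1 0 le_rfl)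
lemma XB.mono {a : ℝ} {N : ℕ} {F : Pt → ℝ} {H K : ℝ} (h : XB a N F H) (hk : H ≤ K) : XB a N F K :=
  ⟨fun t ht => (h.1 t ht).trans hk, fun t ht => (h.2 t ht).trans hk⟩
lemma YB.mono {a : ℝ} {N : ℕ} {F : Pt → ℝ} {H K : ℝ} (h : YB a N F H) (hk : H ≤ K) : YB a N F K :=
  ⟨h.1.trans hk, fun t ht => (h.2 t ht).trans hk⟩

lemma bilY {a : ℝ} (ha : 1 ≤ a) {N : ℕ} (hN : 8 ≤ N) (M : Matrix (Fin 4) (Fin 4) ℝ) (hM : NullM M) :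
    ∃ C : ℝ, 0 ≤ C ∧ ∀ (u v : Pt → ℝ), ContDiff ℝ ∞ u → Scs u → ContDiff ℝ ∞ v → Scs v →
    ∀ A B, XB a N u A → XB a N v B → YB a N (QF M u v) (C * (A * B)) := by
  obtain ⟨C, hC, h⟩ := bil ha hN M hM
  obtain ⟨C2, hC2, h2⟩ := bil0 ha hN M hM
  refine ⟨C + C2, by positivity, fun u v hu hus hv hvs A B hA hB => ?_⟩
  have hAB := mul_nonneg hA.nonneg hB.nonneg
  have h3 := mul_nonneg hC hAB
  have h4 := mul_nonneg hC2 hAB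
  refine ⟨(h2 u v hu hus hv hvs).trans ?_, fun T hT => (h u v hu hus hv hvs A B hA hB T hT).trans ?_⟩
  · have := mul_le_mul (hA.1 0 le_rfl) (hB.1 0 le_rfl) (EN_nonneg _ _ _ _) hA.nonneg
    have := mul_le_mul_of_nonneg_left this hC2
    linarith
  · linarith

lemma linX {a : ℝ} (ha : 0 ≤ a) (N : ℕ) : ∃ C : ℝ, 0 ≤ C ∧ ∀ u : Pt → ℝ, ContDiff ℝ ∞ u → Scs u →
    ∀ A H, DN a N u ≤ A → YB a N (bx u) H → XB a N u (C * (A + H)) := by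
  obtain ⟨C, hC, h⟩ := lin0 a N
  obtain ⟨C2, hC2, h2⟩ := energy_N ha N
  refine ⟨C2 * (C + 1), by positivity, fun u hu hs A H hA hH => ?_⟩
  have key : ∀ T, 0 ≤ T → EN a N u T + (∫ t in (0:ℝ)..T, GN a N u t) ≤ C2 * (C + 1) * (A + H) := by
    intro T hT
    refine (h2 u hu hs T hT).trans ?_
    rw [mul_assoc]
    refine mul_le_mul_of_nonneg_left ?_ hC2
    have e1 := h u hu hs
    have e2 := hH.2 T hT
    have e3 := mul_le_mul_of_nonneg_left (add_le_add hA hH.1) hC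
    have := (DN_nonneg a N u).trans hA
    linarith
  refine ⟨fun t ht => ?_, fun T hT => ?_⟩
  · have := key t ht
    have : 0 ≤ ∫ s in (0:ℝ)..t, GN a N u s := intervalIntegral.integral_nonneg ht fun s _ => GN_nonneg ha N u s
    linarith
  · have := key T hT
    have := EN_nonneg a N u T
    linarith

lemma sW_sum {ι : Type*} (s : Finset ι) {F : ι → Pt → ℝ} (hF : ∀ i ∈ s, ContDiff ℝ ∞ (F i)) (k : ℕ) (p : Pt) :
    sW k (fun p => ∑ i ∈ s, F i p) p ≤ s.card * ∑ i ∈ s, sW k (F i) p := by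
  unfold sW
  rw [Finset.sum_comm, Finset.mul_sum]
  refine Finset.sum_le_sum fun J _ => ?_
  rw [Zw_sum s hF]
  exact sq_sum_le_card_mul_sum_sq

lemma YB_sum {ι : Type*} (s : Finset ι) {a : ℝ} {N : ℕ} {F : ι → Pt → ℝ} {H : ι → ℝ} (hF : ∀ i ∈ s, ContDiff ℝ ∞ (F i))
    (hs : ∀ i ∈ s, Scs (F i)) (h : ∀ i ∈ s, YB a N (F i) (H i)) :
    YB a N (fun p => ∑ i ∈ s, F i p) (s.card * ∑ i ∈ s, H i) := by
  have hFs : ContDiff ℝ ∞ (fun p => ∑ i ∈ s, F i p) := ContDiff.sum hF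
  have hss : Scs (fun p => ∑ i ∈ s, F i p) := Scs.sum s hs
  have h0 : (0:ℝ) ≤ s.card := Nat.cast_nonneg _
  constructor
  · calc HN a N (fun p => ∑ i ∈ s, F i p) ≤ ∫ x, s.card * ∑ i ∈ s, WW a (0, x) * (jb x ^ 2 * sW (N - 1) (F i) (0, x)) := by
          refine integral_mono (int_HN a N hFs hss) ((integrable_finset_sum _ fun i hi => int_HN a N (hF i hi) (hs i hi)).const_mul _) fun x => ?_
          have h1 := sW_sum s hF (N-1) (0, x)
          have h2 := WW_pos a (0, x)
          show WW a (0, x) * (jb x ^ 2 * sW (N - 1) (fun p => ∑ i ∈ s, F i p) (0, x)) ≤ _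
          calc _ ≤ WW a (0, x) * (jb x ^ 2 * (s.card * ∑ i ∈ s, sW (N-1) (F i) (0, x))) := by gcongr
            _ = s.card * ∑ i ∈ s, WW a (0, x) * (jb x ^ 2 * sW (N - 1) (F i) (0, x)) := by
              rw [← Finset.mul_sum, ← Finset.mul_sum]; ring
      _ = s.card * ∑ i ∈ s, HN a N (F i) := by
          rw [integral_const_mul, integral_finset_sum _ fun i hi => int_HN a N (hF i hi) (hs i hi)]; rfl
      _ ≤ _ := mul_le_mul_of_nonneg_left (Finset.sum_le_sum fun i hi => (h i hi).1) h0
  · intro T hT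
    have hc : ∀ i ∈ s, Continuous fun t => tw t * FN a N (F i) t := fun i hi => cont_tw.mul (cont_FN a N (hF i hi) (hs i hi))
    have key : ∀ t, 0 ≤ t → tw t * FN a N (fun p => ∑ i ∈ s, F i p) t ≤ s.card * ∑ i ∈ s, tw t * FN a N (F i) t := by
      intro t ht
      have : FN a N (fun p => ∑ i ∈ s, F i p) t ≤ s.card * ∑ i ∈ s, FN a N (F i) t := by
        calc FN a N (fun p => ∑ i ∈ s, F i p) t ≤ ∫ x, s.card * ∑ i ∈ s, WW a (t, x) * sW N (F i) (t, x) := by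
              refine integral_mono (int_FN a N hFs hss t) ((integrable_finset_sum _ fun i hi => int_FN a N (hF i hi) (hs i hi) t).const_mul _) fun x => ?_
              have h1 := sW_sum s hF N (t, x)
              have h2 := WW_pos a (t, x)
              show WW a (t, x) * sW N (fun p => ∑ i ∈ s, F i p) (t, x) ≤ _
              calc _ ≤ WW a (t, x) * (s.card * ∑ i ∈ s, sW N (F i) (t, x)) := by gcongr
                _ = s.card * ∑ i ∈ s, WW a (t, x) * sW N (F i) (t, x) := by
                  rw [← Finset.mul_sum]; ring
          _ = s.card * ∑ i ∈ s, FN a N (F i) t := by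
              rw [integral_const_mul, integral_finset_sum _ fun i hi => int_FN a N (hF i hi) (hs i hi) t]; rfl
      have := mul_le_mul_of_nonneg_left this (tw_nonneg ht)
      refine this.trans (le_of_eq ?_)
      rw [← Finset.mul_sum]; ring
    have c2 : Continuous fun t => (s.card : ℝ) * ∑ i ∈ s, tw t * FN a N (F i) t :=
      continuous_const.mul (continuous_finset_sum _ fun i hi => hc i hi)
    refine (intervalIntegral.integral_mono_on hT ((cont_tw.mul (cont_FN a N hFs hss)).intervalIntegrable 0 T)
      (c2.intervalIntegrable 0 T) (fun t ht => key t ht.1)).trans ?_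
    rw [intervalIntegral.integral_const_mul, intervalIntegral.integral_finset_sum fun i hi => (hc i hi).intervalIntegrable 0 T]
    exact mul_le_mul_of_nonneg_left (Finset.sum_le_sum fun i hi => (h i hi).2 T hT) h0

/-- Time reversal. -/
def rp (p : Pt) : Pt := (-p.1, p.2)
def rv (u : Pt → ℝ) (p : Pt) : ℝ := u (rp p)
lemma smooth_rp : ContDiff ℝ ∞ rp := contDiff_fst.neg.prodMk contDiff_snd
lemma smooth_rv {u : Pt → ℝ} (hu : ContDiff ℝ ∞ u) : ContDiff ℝ ∞ (rv u) := hu.comp smooth_rp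
lemma rp_rp (p : Pt) : rp (rp p) = p := by simp [rp]
lemma Scs.rv {u : Pt → ℝ} (h : Scs u) : Scs (rv u) := by
  obtain ⟨R, hR⟩ := h
  exact ⟨R, fun p hp => hR _ (by simpa [rp] using hp)⟩
lemma D_rv {u : Pt → ℝ} (hu : Differentiable ℝ u) (a : Fin 4) : D a (rv u) = fun p => eta a * rv (D a u) p := by
  funext p
  have h1 : HasFDerivAt rp ((-ContinuousLinearMap.fst ℝ ℝ Spc).prod (ContinuousLinearMap.snd ℝ ℝ Spc)) p :=
    (hasFDerivAt_fst.neg).prodMk hasFDerivAt_snd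
  have h2 := ((hu (rp p)).hasFDerivAt.comp p h1).fderiv
  show fderiv ℝ (u ∘ rp) p (ev a) = eta a * fderiv ℝ u (rp p) (ev a)
  rw [h2]
  refine Fin.cases ?_ (fun i => ?_) a
  · have e : ((-ContinuousLinearMap.fst ℝ ℝ Spc).prod (ContinuousLinearMap.snd ℝ ℝ Spc)) (ev 0) = -(ev 0) := by
      ext j <;> simp
    show fderiv ℝ u (rp p) (((-ContinuousLinearMap.fst ℝ ℝ Spc).prod (ContinuousLinearMap.snd ℝ ℝ Spc)) (ev 0)) = _
    rw [e, map_neg]; simp only [eta]; simp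
  · have : eta i.succ = 1 := by fin_cases i <;> simp [eta]
    simp [this]
lemma eta_sq (a : Fin 4) : eta a * eta a = 1 := by fin_cases a <;> simp [eta]
lemma bx_rv {u : Pt → ℝ} (hu : ContDiff ℝ ∞ u) : bx (rv u) = rv (bx u) := by
  funext p
  show ∑ a, eta a * D a (D a (rv u)) p = ∑ a, eta a * D a (D a u) (rp p)
  refine Finset.sum_congr rfl fun a _ => ?_
  rw [D_rv (diff_of_smooth hu), D_const_mul (diff_of_smooth (smooth_rv (smooth_D hu a))), D_rv (diff_of_smooth (smooth_D hu a))]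
  show eta a * (eta a * (eta a * _)) = _
  rw [← mul_assoc (eta a) (eta a), eta_sq, one_mul]; rfl
def rM (M : Matrix (Fin 4) (Fin 4) ℝ) : Matrix (Fin 4) (Fin 4) ℝ := fun a b => eta a * eta b * M a b
lemma NullM_rM {M : Matrix (Fin 4) (Fin 4) ℝ} (h : NullM M) : NullM (rM M) := by
  obtain ⟨l, hl⟩ := h
  refine ⟨l, fun a b => ?_⟩
  have := hl a b
  show eta a * eta b * M a b + eta b * eta a * M b a = _
  rw [mul_comm (eta b), ← mul_add, this]
  split_ifs with h
  · subst h; rw [eta_sq]; ring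
  · ring
lemma QF_rv {u v : Pt → ℝ} (hu : ContDiff ℝ ∞ u) (hv : ContDiff ℝ ∞ v) (M : Matrix (Fin 4) (Fin 4) ℝ) (p : Pt) :
    QF (rM M) (rv u) (rv v) p = QF M u v (rp p) := by
  unfold QF
  refine Finset.sum_congr rfl fun a _ => Finset.sum_congr rfl fun b _ => ?_
  rw [D_rv (diff_of_smooth hu), D_rv (diff_of_smooth hv)]
  show eta a * eta b * M a b * (eta a * D a u (rp p) * (eta b * D b v (rp p))) = _
  linear_combination (M a b * D a u (rp p) * D b v (rp p) * (eta b * eta b)) * eta_sq a + (M a b * D a u (rp p) * D b v (rp p)) * eta_sq b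
def sz : Fin 11 → ℝ := ![-1, 1, 1, 1, 1, -1, -1, -1, 1, 1, 1]
lemma sz_sq (n : Fin 11) : sz n * sz n = 1 := by fin_cases n <;> simp [sz]
lemma vc_rv (n : Fin 11) (a : Fin 4) (p : Pt) : vc n a p * eta a = sz n * vc n a (rp p) := by
  have h1 : va n a * eta a = sz n * va n a := by
    fin_cases n <;> fin_cases a <;> norm_num [va, sz, eta, Pi.single_apply, Fin.ext_iff]
  have h2 : ∀ b, vB n a b * eta a = sz n * vB n a b * eta b := by
    intro b
    fin_cases n <;> fin_cases a <;> fin_cases b <;> norm_num [vB, sz, eta, Matrix.one_apply]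
  have h3 : ∀ b, Xc b (rp p) = eta b * Xc b p := by
    intro b
    refine Fin.cases ?_ (fun i => ?_) b
    · simp [Xc, rp, eta]
    · have : eta i.succ = 1 := by fin_cases i <;> simp [eta]
      simp [Xc, rp, this]
  unfold vc
  rw [add_mul, h1, mul_add, Finset.sum_mul, Finset.mul_sum]
  congr 1
  refine Finset.sum_congr rfl fun b _ => ?_
  rw [h3]; linear_combination (Xc b p) * h2 b
lemma Zf_rv {u : Pt → ℝ} (hu : ContDiff ℝ ∞ u) (n : Fin 11) : Zf n (rv u) = fun p => sz n * rv (Zf n u) p := by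
  funext p
  show ∑ a, vc n a p * D a (rv u) p = sz n * ∑ a, vc n a (rp p) * D a u (rp p)
  rw [Finset.mul_sum]
  refine Finset.sum_congr rfl fun a _ => ?_
  rw [D_rv (diff_of_smooth hu)]
  show vc n a p * (eta a * D a u (rp p)) = _
  linear_combination (D a u (rp p)) * vc_rv n a p
lemma Zw_rv {u : Pt → ℝ} (hu : ContDiff ℝ ∞ u) (J : List (Fin 11)) :
    ∃ s : ℝ, s * s = 1 ∧ Zw J (rv u) = fun p => s * rv (Zw J u) p := by
  induction J with
  | nil => exact ⟨1, by norm_num, by funext p; simp [Zw]⟩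
  | cons n J ih =>
    obtain ⟨s, hs, h⟩ := ih
    refine ⟨s * sz n, by linear_combination (sz n * sz n) * hs + sz_sq n, ?_⟩
    rw [Zw_cons, h, Zf_const_mul (smooth_rv (smooth_Zw hu J)), Zf_rv (smooth_Zw hu J), Zw_cons]
    funext p; ring
lemma dsq_rv {u : Pt → ℝ} (hu : ContDiff ℝ ∞ u) (J : List (Fin 11)) (p : Pt) : dsq (Zw J (rv u)) p = dsq (Zw J u) (rp p) := by
  obtain ⟨s, hs, h⟩ := Zw_rv hu J
  rw [h]
  unfold dsq
  refine Finset.sum_congr rfl fun a _ => ?_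
  rw [D_const_mul (diff_of_smooth (smooth_rv (smooth_Zw hu J))), D_rv (diff_of_smooth (smooth_Zw hu J))]
  show (s * (eta a * D a (Zw J u) (rp p))) ^ 2 = _
  linear_combination (eta a * D a (Zw J u) (rp p)) ^ 2 * hs + (D a (Zw J u) (rp p)) ^ 2 * eta_sq a
lemma eW_rv {u : Pt → ℝ} (hu : ContDiff ℝ ∞ u) (N : ℕ) (p : Pt) : eW N (rv u) p = eW N u (rp p) :=
  Finset.sum_congr rfl fun J _ => dsq_rv hu J p
lemma Dw_rv {u : Pt → ℝ} (hu : ContDiff ℝ ∞ u) (w : List (Fin 4)) :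
    ∃ s : ℝ, s * s = 1 ∧ Dw w (rv u) = fun p => s * rv (Dw w u) p := by
  induction w with
  | nil => exact ⟨1, by norm_num, by funext p; simp⟩
  | cons n J ih =>
    obtain ⟨s, hs, h⟩ := ih
    refine ⟨s * eta n, by linear_combination (eta n * eta n) * hs + eta_sq n, ?_⟩
    rw [Dw_cons, h, D_const_mul (diff_of_smooth (smooth_rv (smooth_Dw hu J))), D_rv (diff_of_smooth (smooth_Dw hu J)), Dw_cons]
    funext p; ring
lemma DN_rv {u : Pt → ℝ} (hu : ContDiff ℝ ∞ u) (a : ℝ) (N : ℕ) : DN a N (rv u) = DN a N u := by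
  unfold DN DAT
  congr 1
  funext x
  congr 1
  refine Finset.sum_congr rfl fun w _ => ?_
  obtain ⟨s, hs, h⟩ := Dw_rv hu w
  rw [h]
  have : rv (Dw w u) (0, x) = Dw w u (0, x) := by simp [rv, rp]
  simp only [this]; linear_combination ((jb x ^ 2) ^ (w.length - 1) * Dw w u (0, x) ^ 2) * hs

lemma bx_sub {u v : Pt → ℝ} (hu : ContDiff ℝ ∞ u) (hv : ContDiff ℝ ∞ v) :
    bx (fun p => u p - v p) = fun p => bx u p - bx v p := by
  funext p
  simp only [bx, D_sub (diff_of_smooth hu) (diff_of_smooth hv), D_sub (diff_of_smooth (smooth_D hu _)) (diff_of_smooth (smooth_D hv _)), mul_sub, Finset.sum_sub_distrib]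

/-- The quadratic nonlinearity. -/
def NL {d : ℕ} (M : Fin d → Fin d → Fin d → Matrix (Fin 4) (Fin 4) ℝ) (f : Fin d → Pt → ℝ) (i : Fin d) (p : Pt) : ℝ :=
  ∑ k : Fin d × Fin d, QF (M i k.1 k.2) (f k.1) (f k.2) p

structure Itr {d : ℕ} (M : Fin d → Fin d → Fin d → Matrix (Fin 4) (Fin 4) ℝ) (a : ℝ) (N : ℕ) (E : ℝ)
    (f : ℕ → Fin d → Pt → ℝ) : Prop where
  sm : ∀ n i, ContDiff ℝ ∞ (f n i)
  sc : ∀ n i, Scs (f n i)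
  z : ∀ i, bx (f 0 i) = fun _ => 0
  eq : ∀ n i, bx (f (n + 1) i) = NL M (f n) i
  dn : ∀ n i, DN a N (f n i) ≤ E
  dd : ∀ n i, DN a N (fun p => f (n + 1) i p - f n i p) ≤ E / 4 ^ (n + 1)

lemma Itr.rv {d : ℕ} {M : Fin d → Fin d → Fin d → Matrix (Fin 4) (Fin 4) ℝ} {a : ℝ} {N : ℕ} {E : ℝ}
    {f : ℕ → Fin d → Pt → ℝ} (h : Itr M a N E f) : Itr (fun i k l => rM (M i k l)) a N E (fun n i => rv (f n i)) where
  sm n i := smooth_rv (h.sm n i)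
  sc n i := (h.sc n i).rv
  z i := by rw [bx_rv (h.sm 0 i), h.z i]; rfl
  eq n i := by
    rw [bx_rv (h.sm _ i), h.eq n i]
    funext p
    exact Finset.sum_congr rfl fun k _ => (QF_rv (h.sm _ _) (h.sm _ _) _ _).symm
  dn n i := by rw [DN_rv (h.sm n i)]; exact h.dn n i
  dd n i := by
    have := DN_rv ((h.sm (n + 1) i).sub (h.sm n i)) a N
    exact (le_of_eq this).trans (h.dd n i)

lemma iter {d : ℕ} {a : ℝ} (ha : 1 ≤ a) {N : ℕ} (hN : 8 ≤ N) (M : Fin d → Fin d → Fin d → Matrix (Fin 4) (Fin 4) ℝ)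
    (hM : ∀ i k l, NullM (M i k l)) : ∃ E0 : ℝ, 0 < E0 ∧ ∃ K : ℝ, 0 ≤ K ∧ ∀ E, 0 ≤ E → E ≤ E0 → ∀ f, Itr M a N E f →
    ∀ n i, XB a N (f n i) (K * E) ∧ XB a N (fun p => f (n + 1) i p - f n i p) (K * E / 4 ^ n) := by
  obtain ⟨C1, hC1, h1⟩ := linX (a := a) (by linarith) N
  choose c hc hb using fun i k l => bilY ha hN (M i k l) (hM i k l)
  obtain ⟨C2, hC2, h2⟩ : ∃ C2 : ℝ, 0 ≤ C2 ∧ ∀ i k l, c i k l ≤ C2 := by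
    refine ⟨∑ x : Fin d × Fin d × Fin d, c x.1 x.2.1 x.2.2, Finset.sum_nonneg fun _ _ => hc _ _ _, fun i k l => ?_⟩
    exact Finset.single_le_sum (f := fun x : Fin d × Fin d × Fin d => c x.1 x.2.1 x.2.2) (fun _ _ => hc _ _ _) (Finset.mem_univ (i, k, l))
  have hbil : ∀ i k l (u v : Pt → ℝ), ContDiff ℝ ∞ u → Scs u → ContDiff ℝ ∞ v → Scs v → ∀ A B, XB a N u A → XB a N v B →
      YB a N (QF (M i k l) u v) (C2 * (A * B)) := fun i k l u v hu hus hv hvs A B hA hB =>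
    (hb i k l u v hu hus hv hvs A B hA hB).mono (mul_le_mul_of_nonneg_right (h2 i k l) (mul_nonneg hA.nonneg hB.nonneg))
  set m : ℝ := (Fintype.card (Fin d × Fin d) : ℝ) with hm
  have hm0 : 0 ≤ m := Nat.cast_nonneg _
  set K : ℝ := 2 * C1 with hK
  have hK0 : 0 ≤ K := by positivity
  set G : ℝ := 16 * (m * m * C2 * K ^ 2) with hG
  have hG0 : 0 ≤ G := by positivity
  refine ⟨1 / (G + 1), by positivity, K, hK0, fun E hE hEE f hf => ?_⟩
  have hGE : G * E ≤ 1 := by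
    rw [le_div_iff₀ (by positivity)] at hEE
    nlinarith
  -- nonlinear bound
  have hNL : ∀ n i, (∀ k, XB a N (f n k) (K * E)) → YB a N (NL M (f n) i) (E / 16) := by
    intro n i hx
    have := YB_sum (a := a) (N := N) (Finset.univ : Finset (Fin d × Fin d)) (F := fun k => QF (M i k.1 k.2) (f n k.1) (f n k.2))
      (H := fun _ => C2 * (K * E * (K * E))) (fun k _ => smooth_QF _ (hf.sm _ _) (hf.sm _ _)) (fun k _ => QF_scs _ _ (hf.sc _ _))
      (fun k _ => hbil _ _ _ _ _ (hf.sm _ _) (hf.sc _ _) (hf.sm _ _) (hf.sc _ _) _ _ (hx _) (hx _))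
    refine YB.mono this ?_
    rw [Finset.sum_const, nsmul_eq_mul, Finset.card_univ, ← hm]
    nlinarith [mul_le_mul_of_nonneg_right hGE hE]
  have hX : ∀ n i, XB a N (f n i) (K * E) := by
    intro n
    induction n with
    | zero =>
      intro i
      have hy : YB a N (bx (f 0 i)) E := by
        have := YB_sum (a := a) (N := N) (∅ : Finset (Fin 1)) (F := fun k => fun _ => 0) (H := fun _ => 0) (by simp) (by simp) (by simp)
        rw [hf.z i]
        refine YB.mono (by simpa using this) ?_
        simpa using hE
      exact (h1 _ (hf.sm _ _) (hf.sc _ _) E E (hf.dn _ _) hy).mono (le_of_eq (by rw [hK]; ring))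
    | succ n ih =>
      intro i
      have := h1 _ (hf.sm _ _) (hf.sc _ _) E (E / 16) (hf.dn (n + 1) i) (by rw [hf.eq]; exact hNL n i ih)
      exact this.mono (by rw [hK]; nlinarith [mul_nonneg hC1 hE])
  have hXd : ∀ n i, XB a N (fun p => f (n + 1) i p - f n i p) (K * E / 4 ^ n) := by
    intro n
    have hsd : ∀ n i, ContDiff ℝ ∞ (fun p => f (n + 1) i p - f n i p) := fun n i => (hf.sm _ _).sub (hf.sm _ _)
    have hcd : ∀ n i, Scs (fun p => f (n + 1) i p - f n i p) := fun n i => (hf.sc _ _).sub (hf.sc _ _)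
    induction n with
    | zero =>
      intro i
      have hy : YB a N (bx (fun p => f (0 + 1) i p - f 0 i p)) (E / 16) := by
        rw [bx_sub (hf.sm _ _) (hf.sm _ _), hf.z i, hf.eq]
        simpa using hNL 0 i (hX 0)
      refine (h1 _ (hsd _ _) (hcd _ _) _ _ (hf.dd 0 i) hy).mono ?_
      rw [hK]; norm_num; nlinarith [mul_nonneg hC1 hE]
    | succ n ih =>
      intro i
      have h4 : (0:ℝ) < 4 ^ n := by positivity
      have hy : YB a N (bx (fun p => f (n + 1 + 1) i p - f (n + 1) i p)) (E / 4 ^ (n + 1)) := by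
        rw [bx_sub (hf.sm _ _) (hf.sm _ _), hf.eq, hf.eq]
        have hs := YB_sum (a := a) (N := N) (Finset.univ : Finset ((Fin d × Fin d) × Fin 2))
          (F := fun k => if k.2 = 0 then QF (M i k.1.1 k.1.2) (fun p => f (n + 1) k.1.1 p - f n k.1.1 p) (f (n + 1) k.1.2)
            else QF (M i k.1.1 k.1.2) (f n k.1.1) (fun p => f (n + 1) k.1.2 p - f n k.1.2 p))
          (H := fun _ => C2 * (K * E * (K * E / 4 ^ n)))
          (fun k _ => by
            split_ifs
            · exact smooth_QF _ (hsd _ _) (hf.sm _ _)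
            · exact smooth_QF _ (hf.sm _ _) (hsd _ _))
          (fun k _ => by
            split_ifs
            · exact QF_scs _ _ (hf.sc _ _)
            · exact QF_scs _ _ (hcd _ _))
          (fun k _ => by
            split_ifs
            · exact (hbil _ _ _ _ _ (hsd _ _) (hcd _ _) (hf.sm _ _) (hf.sc _ _) _ _ (ih _) (hX _ _)).mono (le_of_eq (by ring))
            · exact (hbil _ _ _ _ _ (hf.sm _ _) (hf.sc _ _) (hsd _ _) (hcd _ _) _ _ (hX _ _) (ih _)).mono (le_of_eq (by ring)))
        have e1 : (fun p => NL M (f (n + 1)) i p - NL M (f n) i p) = fun p => ∑ k : (Fin d × Fin d) × Fin 2, (if k.2 = 0 then QF (M i k.1.1 k.1.2) (fun p => f (n + 1) k.1.1 p - f n k.1.1 p) (f (n + 1) k.1.2)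
            else QF (M i k.1.1 k.1.2) (f n k.1.1) (fun p => f (n + 1) k.1.2 p - f n k.1.2 p)) p := by
          funext p
          rw [Fintype.sum_prod_type, NL, NL, ← Finset.sum_sub_distrib]
          refine Finset.sum_congr rfl fun k _ => ?_
          rw [Fin.sum_univ_two]
          simp only [if_true, one_ne_zero, if_false, Fin.isValue]
          simp only [QF, D_sub (diff_of_smooth (hf.sm _ _)) (diff_of_smooth (hf.sm _ _))]
          rw [← Finset.sum_sub_distrib, ← Finset.sum_add_distrib]
          refine Finset.sum_congr rfl fun a _ => ?_
          rw [← Finset.sum_sub_distrib, ← Finset.sum_add_distrib]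
          exact Finset.sum_congr rfl fun b _ => by ring
        rw [e1]
        refine YB.mono hs ?_
        rw [Finset.sum_const, nsmul_eq_mul, Finset.card_univ, Fintype.card_prod, Fintype.card_fin 2]
        push_cast
        rw [← hm]
        rw [le_div_iff₀ (by positivity), pow_succ]
        have : m * 2 * (m * 2 * (C2 * (K * E * (K * E / 4 ^ n)))) * (4 ^ n * 4) = G * E * E := by
          rw [hG]; field_simp; ring
        nlinarith [mul_le_mul_of_nonneg_right hGE hE]
      refine (h1 _ (hsd _ _) (hcd _ _) _ _ ((hf.dd (n + 1) i).trans (c := E / 4 ^ (n + 1)) ?_) hy).mono (le_of_eq (by rw [hK]; ring))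
      exact div_le_div_of_nonneg_left hE (by positivity) (pow_le_pow_right₀ (by norm_num) (by omega))
  exact fun n i => ⟨hX n i, hXd n i⟩

/-- Energy and pointwise bounds for all times. -/
structure AB (N : ℕ) (u : Pt → ℝ) (A : ℝ) : Prop where
  en : ∀ t, ∫ x, eW N u (t, x) ≤ A
  pt : ∀ J : List (Fin 11), 3 + J.length ≤ N → ∀ p, Zw J u p ^ 2 ≤ A
  pd : ∀ J : List (Fin 11), 3 + J.length ≤ N → ∀ p, dsq (Zw J u) p ≤ A

lemma XB_AB {a : ℝ} (ha : 1 ≤ a) (N : ℕ) : ∃ C : ℝ, 0 ≤ C ∧ ∀ u, ContDiff ℝ ∞ u → Scs u → ∀ A, XB a N u A → XB a N (rv u) A →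
    AB N u (C * A) := by
  obtain ⟨C1, hC1, h1⟩ := KS_E ha N
  obtain ⟨C2, hC2, h2⟩ := ray_E ha N
  have en : ∀ u, ContDiff ℝ ∞ u → Scs u → ∀ A, XB a N u A → ∀ t, 0 ≤ t → ∫ x, eW N u (t, x) ≤ A := by
    intro u hu hs A hx t ht
    refine le_trans ?_ (hx.1 t ht)
    refine integral_mono_of_nonneg (.of_forall fun x => eW_nonneg _ _ _) (int_EN a N hu hs t) (.of_forall fun x => ?_)
    exact le_mul_of_one_le_left (eW_nonneg _ _ _) (one_le_WW a _)
  have pt : ∀ u, ContDiff ℝ ∞ u → Scs u → ∀ A, XB a N u A → ∀ J : List (Fin 11), 3 + J.length ≤ N → ∀ p : Pt, 0 ≤ p.1 →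
      Zw J u p ^ 2 ≤ C2 * A := by
    intro u hu hs A hx J hJ p hp
    refine le_trans ?_ ((h2 u hu hs p hp J hJ).trans (mul_le_mul_of_nonneg_left (hx.1 _ hp) hC2))
    exact le_mul_of_one_le_left (sq_nonneg _) (one_le_rpow (by linarith) (by norm_num))
  have pd : ∀ u, ContDiff ℝ ∞ u → Scs u → ∀ A, XB a N u A → ∀ J : List (Fin 11), 3 + J.length ≤ N → ∀ p : Pt, 0 ≤ p.1 →
      dsq (Zw J u) p ≤ C1 * A := by
    intro u hu hs A hx J hJ p hp
    refine le_trans ?_ ((h1 u hu hs p hp J hJ).trans (mul_le_mul_of_nonneg_left (hx.1 _ hp) hC1))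
    have e1 : (1:ℝ) ≤ (1 + p.1 + rad p.2) ^ 2 := one_le_pow₀ (by have := rad_nonneg p.2; linarith)
    have e2 := one_le_jq (jb p.2 - p.1)
    have e3 := one_le_WW a p
    have e4 := dsq_nonneg (Zw J u) p
    calc dsq (Zw J u) p = 1 * (1 * dsq (Zw J u) p) := by ring
      _ ≤ _ := mul_le_mul (one_le_mul_of_one_le_of_one_le e1 e2) (mul_le_mul_of_nonneg_right e3 e4) (by positivity) (by positivity)
  refine ⟨C1 + C2 + 1, by positivity, fun u hu hs A hx hr => ?_⟩
  have hA := hx.nonneg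
  have q1 := mul_nonneg hC1 hA
  have q2 := mul_nonneg hC2 hA
  have hr1 : ∀ p : Pt, p.1 < 0 → 0 ≤ (rp p).1 := fun p hp => by simp [rp]; linarith
  refine ⟨fun t => ?_, fun J hJ p => ?_, fun J hJ p => ?_⟩
  · rcases le_or_gt 0 t with ht | ht
    · exact (en u hu hs A hx t ht).trans (by linarith)
    · have := en _ (smooth_rv hu) hs.rv A hr (-t) (by linarith)
      simp only [eW_rv hu] at this
      simp only [rp, neg_neg] at this
      exact this.trans (by linarith)
  · rcases le_or_gt 0 p.1 with ht | ht
    · exact (pt u hu hs A hx J hJ p ht).trans (by linarith)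
    · have := pt _ (smooth_rv hu) hs.rv A hr J hJ (rp p) (hr1 p ht)
      obtain ⟨s, hs, h⟩ := Zw_rv hu J
      rw [h] at this
      have e : rv (Zw J u) (rp p) = Zw J u p := by simp [rv, rp_rp]
      simp only [e] at this
      rw [mul_pow, pow_two s, hs, one_mul] at this
      exact this.trans (by linarith)
  · rcases le_or_gt 0 p.1 with ht | ht
    · exact (pd u hu hs A hx J hJ p ht).trans (by linarith)
    · have := pd _ (smooth_rv hu) hs.rv A hr J hJ (rp p) (hr1 p ht)
      rw [dsq_rv hu, rp_rp] at this
      exact this.trans (by linarith)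

/-- Differentiation of an integral over a compact set. -/
lemma par_fderiv {E Z F : Type} [NormedAddCommGroup E] [NormedSpace ℝ E] [ProperSpace E] [NormedAddCommGroup Z] [NormedSpace ℝ Z]
    [ProperSpace Z] [MeasurableSpace Z] [BorelSpace Z] [NormedAddCommGroup F] [NormedSpace ℝ F] [CompleteSpace F]
    (μ : Measure Z) [IsFiniteMeasureOnCompacts μ] {K : Set Z} (hK : IsCompact K) {G : E × Z → F} (hG : ContDiff ℝ 1 G) (p : E) :
    HasFDerivAt (fun p => ∫ z in K, G (p, z) ∂μ) (∫ z in K, (fderiv ℝ G (p, z)).comp (ContinuousLinearMap.inl ℝ E Z) ∂μ) p := by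
  have hc : Continuous (fderiv ℝ G) := hG.continuous_fderiv (by norm_num)
  have hcc : Continuous fun q : E × Z => (fderiv ℝ G q).comp (ContinuousLinearMap.inl ℝ E Z) := hc.clm_comp continuous_const
  obtain ⟨C, hC⟩ := ((isCompact_closedBall p 1).prod hK).exists_bound_of_continuousOn hcc.continuousOn
  haveI : IsFiniteMeasure (μ.restrict K) := ⟨by rw [Measure.restrict_apply_univ]; exact hK.measure_lt_top⟩
  have hitgr : ∀ p : E, IntegrableOn (fun z => G (p, z)) K μ := fun p =>
    (hG.continuous.comp (by fun_prop : Continuous fun z : Z => (p, z))).continuousOn.integrableOn_compact hK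
  refine hasFDerivAt_integral_of_dominated_of_fderiv_le (bound := fun _ => C) (F' := fun p z => (fderiv ℝ G (p, z)).comp (ContinuousLinearMap.inl ℝ E Z))
    (Metric.ball_mem_nhds p one_pos) ?_ (hitgr p) ?_ ?_ (integrable_const C) ?_
  · exact .of_forall fun p => (hitgr p).aestronglyMeasurable
  · exact ((hcc.comp (by fun_prop : Continuous fun z : Z => (p, z))).continuousOn.integrableOn_compact hK).aestronglyMeasurable
  · refine (ae_restrict_iff' hK.measurableSet).2 (.of_forall fun z hz x hx => ?_)
    exact hC (x, z) ⟨Metric.ball_subset_closedBall hx, hz⟩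
  · refine .of_forall fun z x _ => ?_
    exact (hG.differentiable (by norm_num) (x, z)).hasFDerivAt.comp x (hasFDerivAt_prodMk_left x z)

lemma par_smooth_aux {E Z : Type} [NormedAddCommGroup E] [NormedSpace ℝ E] [ProperSpace E] [NormedAddCommGroup Z] [NormedSpace ℝ Z]
    [ProperSpace Z] [MeasurableSpace Z] [BorelSpace Z]
    (μ : Measure Z) [IsFiniteMeasureOnCompacts μ] {K : Set Z} (hK : IsCompact K) (n : ℕ) :
    ∀ (F : Type) [NormedAddCommGroup F] [NormedSpace ℝ F] [CompleteSpace F] (G : E × Z → F), ContDiff ℝ ∞ G →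
    ContDiff ℝ n (fun p => ∫ z in K, G (p, z) ∂μ) := by
  induction n with
  | zero =>
    intro F _ _ _ G hG
    have h : Differentiable ℝ (fun p => ∫ z in K, G (p, z) ∂μ) := fun p =>
      (par_fderiv μ hK (hG.of_le (by exact_mod_cast le_top)) p).differentiableAt
    exact contDiff_zero.2 h.continuous
  | succ n ih =>
    intro F _ _ _ G hG
    have hd := fun p => par_fderiv μ hK (hG.of_le (by exact_mod_cast le_top)) p
    rw [show ((n + 1 : ℕ) : WithTop ℕ∞) = (n : WithTop ℕ∞) + 1 by norm_cast, contDiff_succ_iff_hasFDerivAt]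
    refine ⟨fun p => ∫ z in K, (fderiv ℝ G (p, z)).comp (ContinuousLinearMap.inl ℝ E Z) ∂μ, ?_, hd⟩
    refine ih (E →L[ℝ] F) (fun q => (fderiv ℝ G q).comp (ContinuousLinearMap.inl ℝ E Z)) ?_
    exact (hG.fderiv_right (m := ∞) (by simp)).clm_comp contDiff_const

lemma par_smooth {E Z : Type} [NormedAddCommGroup E] [NormedSpace ℝ E] [ProperSpace E] [NormedAddCommGroup Z] [NormedSpace ℝ Z]
    [ProperSpace Z] [MeasurableSpace Z] [BorelSpace Z]
    (μ : Measure Z) [IsFiniteMeasureOnCompacts μ] {K : Set Z} (hK : IsCompact K) {G : E × Z → ℝ} (hG : ContDiff ℝ ∞ G) :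
    ContDiff ℝ ∞ (fun p => ∫ z in K, G (p, z) ∂μ) :=
  contDiff_infty.2 fun n => par_smooth_aux μ hK n ℝ G hG

lemma par_D {Z : Type} [NormedAddCommGroup Z] [NormedSpace ℝ Z]
    [ProperSpace Z] [MeasurableSpace Z] [BorelSpace Z]
    (μ : Measure Z) [IsFiniteMeasureOnCompacts μ] {K : Set Z} (hK : IsCompact K) {G : Pt × Z → ℝ} (hG : ContDiff ℝ ∞ G) (a : Fin 4) :
    D a (fun p => ∫ z in K, G (p, z) ∂μ) = fun p => ∫ z in K, D a (fun p => G (p, z)) p ∂μ := by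
  funext p
  have h1 : ContDiff ℝ 1 G := hG.of_le (by exact_mod_cast le_top)
  unfold D
  rw [(par_fderiv μ hK h1 p).fderiv, ContinuousLinearMap.integral_apply]
  · refine integral_congr_ae (.of_forall fun z => ?_)
    have := ((h1.differentiable (by norm_num) (p, z)).hasFDerivAt.comp p (hasFDerivAt_prodMk_left (𝕜 := ℝ) p z)).fderiv
    exact (congrArg (fun L => L (ev a)) this).symm
  · have hcc : Continuous fun q : Pt × Z => (fderiv ℝ G q).comp (ContinuousLinearMap.inl ℝ Pt Z) :=
      (h1.continuous_fderiv (by norm_num)).clm_comp continuous_const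
    exact (hcc.comp (by fun_prop : Continuous fun z : Z => (p, z))).continuousOn.integrableOn_compact hK

/-- Profile functions for spherical means. -/
def gg (s : ℝ) : ℝ := 1 + Real.smoothTransition s * (s - 1)
def psi (s : ℝ) : ℝ := (Real.sqrt (gg s))⁻¹
def Bb (s : ℝ) : ℝ := Real.smoothTransition (s - 1) * Real.smoothTransition (4 - s)
def n2 (y : Spc) : ℝ := ∑ i, y i ^ 2
def ro (y : Spc) : ℝ := Bb (n2 y)
def om (y : Spc) : Spc := psi (n2 y) • y

lemma gg_pos (s : ℝ) : 0 < gg s := by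
  unfold gg
  have h0 := Real.smoothTransition.nonneg s
  have h1 := Real.smoothTransition.le_one s
  rcases le_or_gt s 0 with h | h
  · rw [Real.smoothTransition.zero_of_nonpos h]; norm_num
  · rcases h0.eq_or_lt with h3 | h3
    · rw [← h3]; norm_num
    · nlinarith [mul_pos h3 h]
lemma smooth_psi : ContDiff ℝ ∞ psi := by
  have h : ContDiff ℝ ∞ gg := contDiff_const.add (Real.smoothTransition.contDiff.mul (contDiff_id.sub contDiff_const))
  exact (h.sqrt fun s => (gg_pos s).ne').inv fun s => (Real.sqrt_pos.2 (gg_pos s)).ne'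
lemma smooth_Bb : ContDiff ℝ ∞ Bb :=
  (Real.smoothTransition.contDiff.comp (contDiff_id.sub contDiff_const)).mul
    (Real.smoothTransition.contDiff.comp (contDiff_const.sub contDiff_id))
lemma smooth_n2 : ContDiff ℝ ∞ n2 := by unfold n2; fun_prop
lemma smooth_ro : ContDiff ℝ ∞ ro := smooth_Bb.comp smooth_n2
lemma smooth_om : ContDiff ℝ ∞ om := (smooth_psi.comp smooth_n2).smul contDiff_id
lemma ro_ne {y : Spc} (h : ro y ≠ 0) : 1 < n2 y ∧ n2 y < 4 := by
  constructor
  · by_contra hh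
    exact h (by rw [ro, Bb, Real.smoothTransition.zero_of_nonpos (by linarith), zero_mul])
  · by_contra hh
    exact h (by rw [ro, Bb, Real.smoothTransition.zero_of_nonpos (x := 4 - n2 y) (by linarith), mul_zero])
lemma om_sq {y : Spc} (h : 1 < n2 y) : n2 (om y) = 1 := by
  have e : n2 (om y) = psi (n2 y) ^ 2 * n2 y := by
    simp only [n2, om, Pi.smul_apply, smul_eq_mul, mul_pow, Finset.mul_sum]
  have g : gg (n2 y) = n2 y := by rw [gg, Real.smoothTransition.one_of_one_le h.le]; ring
  rw [e, psi, inv_pow, Real.sq_sqrt (gg_pos _).le, g]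
  exact inv_mul_cancel₀ (by linarith)
def Ka : Set Spc := {x | rad x ≤ 2}
lemma Ka_c : IsCompact Ka := compact_rad 2
lemma ro_out {y : Spc} (h : y ∉ Ka) : ro y = 0 := by
  by_contra hh
  have := (ro_ne hh).2
  simp only [Ka, Set.mem_setOf_eq, not_le] at h
  have h2 : rad y ^ 2 = n2 y := rad_sq y
  nlinarith
def cro : ℝ := ∫ y in Ka, ro y
lemma cro_pos : 0 < cro := by
  have e : cro = ∫ y, ro y := setIntegral_eq_integral_of_forall_compl_eq_zero fun y hy => ro_out hy
  rw [e]
  refine Continuous.integral_pos_of_hasCompactSupport_nonneg_nonzero smooth_ro.continuous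
    (HasCompactSupport.intro Ka_c fun y hy => ro_out hy) (fun y => ?_) (x := fun i => if i = 0 then 3 / 2 else 0) ?_
  · exact mul_nonneg (Real.smoothTransition.nonneg _) (Real.smoothTransition.nonneg _)
  · have : n2 (fun i => if i = 0 then 3 / 2 else 0) = 9 / 4 := by simp [n2, Fin.sum_univ_three]; norm_num
    rw [ro, this, Bb]
    exact (mul_pos (Real.smoothTransition.pos_of_pos (by norm_num)) (Real.smoothTransition.pos_of_pos (by norm_num))).ne'

/-- Translation along a direction. -/
def TT (s : ℝ) (o : Spc) (F : Pt → ℝ) (q : Pt) : ℝ := F (s, q.2 + q.1 • o)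
lemma smooth_TT {F : Pt → ℝ} (hF : ContDiff ℝ ∞ F) (s : ℝ) (o : Spc) : ContDiff ℝ ∞ (TT s o F) :=
  hF.comp (contDiff_const.prodMk (contDiff_snd.add (contDiff_fst.smul contDiff_const)))
lemma D_TT {F : Pt → ℝ} (hF : ContDiff ℝ ∞ F) (s : ℝ) (o : Spc) (q v : Pt) :
    fderiv ℝ (TT s o F) q v = ∑ i : Fin 3, (v.2 i + v.1 * o i) * TT s o (D i.succ F) q := by
  have h1 : HasFDerivAt (fun q : Pt => ((s, q.2 + q.1 • o) : Pt))
      ((0 : Pt →L[ℝ] ℝ).prod (ContinuousLinearMap.snd ℝ ℝ Spc + (ContinuousLinearMap.fst ℝ ℝ Spc).smulRight o)) q :=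
    (hasFDerivAt_const s q).prodMk (hasFDerivAt_snd.add (hasFDerivAt_fst.smul_const o))
  have h2 := ((diff_of_smooth hF (s, q.2 + q.1 • o)).hasFDerivAt.comp q h1).fderiv
  show fderiv ℝ (F ∘ fun q : Pt => ((s, q.2 + q.1 • o) : Pt)) q v = _
  rw [h2, ContinuousLinearMap.comp_apply, fderiv_apply_eq, Fin.sum_univ_succ]
  simp [Xc, TT]
lemma D_TT0 {F : Pt → ℝ} (hF : ContDiff ℝ ∞ F) (s : ℝ) (o : Spc) :
    D 0 (TT s o F) = fun q => ∑ i : Fin 3, o i * TT s o (D i.succ F) q := by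
  funext q
  show fderiv ℝ (TT s o F) q (ev 0) = _
  rw [D_TT hF]; simp
lemma D_TTs {F : Pt → ℝ} (hF : ContDiff ℝ ∞ F) (s : ℝ) (o : Spc) (j : Fin 3) :
    D j.succ (TT s o F) = TT s o (D j.succ F) := by
  funext q
  show fderiv ℝ (TT s o F) q (ev j.succ) = _
  rw [D_TT hF]
  simp [Pi.single_apply]

lemma bx_TT {F : Pt → ℝ} (hF : ContDiff ℝ ∞ F) (s : ℝ) (o : Spc) (q : Pt) :
    bx (fun q => q.1 * TT s o F q) q = -(2 * ∑ i : Fin 3, o i * TT s o (D i.succ F) q)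
      - q.1 * (∑ i : Fin 3, ∑ j : Fin 3, o i * o j * TT s o (D j.succ (D i.succ F)) q) + q.1 * ∑ i : Fin 3, TT s o (D i.succ (D i.succ F)) q := by
  have hX : ContDiff ℝ ∞ (fun q : Pt => q.1) := contDiff_fst
  have hT := smooth_TT hF s o
  have d1 : ∀ a, D a (fun q => q.1 * TT s o F q) = fun q => (if (0 : Fin 4) = a then 1 else 0) * TT s o F q + q.1 * D a (TT s o F) q := by
    intro a
    rw [D_mul (diff_of_smooth hX) (diff_of_smooth hT)]
    have := D_Xc 0 a
    funext q
    rw [show (fun q : Pt => q.1) = Xc 0 from rfl, this]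
  have d2 : ∀ a, D a (D a (fun q => q.1 * TT s o F q)) = fun q => 2 * ((if (0 : Fin 4) = a then 1 else 0) * D a (TT s o F) q) + q.1 * D a (D a (TT s o F)) q := by
    intro a
    rw [d1, D_add (diff_of_smooth (contDiff_const.mul hT)) (diff_of_smooth (hX.mul (smooth_D hT a))), D_const_mul (diff_of_smooth hT),
      D_mul (diff_of_smooth hX) (diff_of_smooth (smooth_D hT a))]
    have := D_Xc 0 a
    funext q
    rw [show (fun q : Pt => q.1) = Xc 0 from rfl, this]
    show _ + (_ + Xc 0 q * _) = _ + Xc 0 q * _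
    ring
  have d0 : D 0 (D 0 (TT s o F)) q = ∑ i : Fin 3, ∑ j : Fin 3, o i * o j * TT s o (D j.succ (D i.succ F)) q := by
    rw [D_TT0 hF, D_sum _ (fun i _ => diff_of_smooth (contDiff_const.mul (smooth_TT (smooth_D hF _) s o)))]
    refine Finset.sum_congr rfl fun i _ => ?_
    rw [D_const_mul (diff_of_smooth (smooth_TT (smooth_D hF _) s o)), D_TT0 (smooth_D hF _)]
    simp only [Finset.mul_sum, mul_assoc]
  unfold bx
  rw [Fin.sum_univ_succ]
  simp only [d2]
  rw [d0, D_TT0 hF]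
  have e0 : eta 0 = -1 := by simp [eta]
  have e1 : ∀ i : Fin 3, eta i.succ = 1 := fun i => by fin_cases i <;> simp [eta]
  simp only [e0, e1, D_TTs hF, D_TTs (smooth_D hF _)]
  simp only [if_true, (Fin.succ_ne_zero _).symm, if_false, Finset.mul_sum]
  simp only [zero_mul, mul_zero, zero_add, one_mul]
  ring

lemma int_rot {P : Spc → ℝ} (hP : ContDiff ℝ ∞ P) (hs : ∀ y ∉ Ka, P y = 0) (i j : Fin 3) :
    ∫ y, fderiv ℝ P y (y i • Pi.single j 1 - y j • Pi.single i 1) = 0 := by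
  set g : Fin 3 → Pt → ℝ := fun i z => z.2 i * P z.2 with hg
  have hP2 : ContDiff ℝ ∞ (fun z : Pt => P z.2) := hP.comp contDiff_snd
  have hx : ∀ i : Fin 3, ContDiff ℝ ∞ (fun z : Pt => z.2 i) := fun i => contDiff_Xc i.succ
  have hgs : ∀ i, ContDiff ℝ ∞ (g i) := fun i => (hx i).mul hP2
  have hsc : Scs (fun z : Pt => P z.2) := ⟨2, fun z hz => hs _ (by
    simp only [Ka, Set.mem_setOf_eq, not_le]; linarith [abs_nonneg z.1])⟩
  have hD : ∀ (k : Fin 3) (y : Spc), D k.succ (fun z : Pt => P z.2) (0, y) = fderiv ℝ P y (Pi.single k 1) := fun k y =>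
    (slice_D (diff_of_smooth hP2) 0 y k).symm
  have hgd : ∀ (i j : Fin 3) (y : Spc), D j.succ (g i) (0, y) = (if i = j then 1 else 0) * P y + y i * fderiv ℝ P y (Pi.single j 1) := by
    intro i j y
    rw [hg, D_mul (diff_of_smooth (hx i)) (diff_of_smooth hP2)]
    have : D j.succ (fun z : Pt => z.2 i) = _ := D_Xc i.succ j.succ
    rw [this]
    simp only [hD, Fin.succ_inj]
  have h1 := int_div_zero (c1_of_smooth (hgs i)) (Scs.mul_left hsc _) 0 j
  have h2 := int_div_zero (c1_of_smooth (hgs j)) (Scs.mul_left hsc _) 0 i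
  have i1 := slice_int (cont_D (c1_of_smooth (hgs i)) j.succ) ((Scs.mul_left hsc _).D j.succ) 0
  have i2 := slice_int (cont_D (c1_of_smooth (hgs j)) i.succ) ((Scs.mul_left hsc _).D i.succ) 0
  have h3 := integral_sub i1 i2
  rw [h1, h2, sub_zero] at h3
  rw [← h3]
  congr 1
  funext y
  rw [hgd, hgd, map_sub, map_smul, map_smul]
  by_cases h : i = j
  · subst h; simp
  · simp [h, Ne.symm h]

lemma n2_rot (y : Spc) (i j : Fin 3) : fderiv ℝ n2 y (y i • Pi.single j 1 - y j • Pi.single i 1) = 0 := by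
  have h : HasFDerivAt n2 (∑ k : Fin 3, (2 * y k) • (ContinuousLinearMap.proj (R := ℝ) k : Spc →L[ℝ] ℝ)) y := by
    unfold n2
    refine HasFDerivAt.fun_sum fun k _ => ?_
    have h := (ContinuousLinearMap.proj (R := ℝ) (φ := fun _ : Fin 3 => ℝ) k).hasFDerivAt (x := y)
    have h2 := h.mul h
    refine (h2.congr_of_eventuallyEq (.of_forall fun z => ?_)).congr_fderiv ?_
    · simp [pow_two]
    · ext z; simp; ring
  rw [h.fderiv]
  fin_cases i <;> fin_cases j <;> simp [Fin.sum_univ_three] <;> ring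

lemma ro_rot (y : Spc) (i j : Fin 3) : fderiv ℝ ro y (y i • Pi.single j 1 - y j • Pi.single i 1) = 0 := by
  have h : HasFDerivAt ro _ y := ((smooth_Bb.differentiable (by simp) (n2 y)).hasFDerivAt).comp y (smooth_n2.differentiable (by simp) y).hasFDerivAt
  rw [h.fderiv, ContinuousLinearMap.comp_apply, n2_rot, map_zero]
lemma om_rot (y : Spc) (i j : Fin 3) : fderiv ℝ om y (y i • Pi.single j 1 - y j • Pi.single i 1) =
    psi (n2 y) • (y i • Pi.single j 1 - y j • Pi.single i 1) := by
  have h0 : HasFDerivAt (fun y => psi (n2 y)) _ y := ((smooth_psi.differentiable (by simp) (n2 y)).hasFDerivAt).comp y (smooth_n2.differentiable (by simp) y).hasFDerivAt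
  have h : HasFDerivAt om _ y := h0.smul (hasFDerivAt_id y)
  rw [h.fderiv, ContinuousLinearMap.add_apply, ContinuousLinearMap.smulRight_apply, ContinuousLinearMap.comp_apply, n2_rot, map_zero]
  simp

lemma mean_zero {F : Pt → ℝ} (hF : ContDiff ℝ ∞ F) (s : ℝ) (q : Pt) :
    ∫ y in Ka, ro y * bx (fun q => q.1 * TT s (om y) F q) q = 0 := by
  rw [setIntegral_eq_integral_of_forall_compl_eq_zero fun y hy => by rw [ro_out hy, zero_mul]]
  set P : Fin 3 → Fin 3 → Spc → ℝ := fun i j y => ro y * (om y i * D j.succ F (s, q.2 + q.1 • om y)) with hP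
  have hom : ∀ i, ContDiff ℝ ∞ (fun y => om y i) := fun i => contDiff_pi.1 smooth_om i
  have hk : ∀ j : Fin 3, ContDiff ℝ ∞ (fun y => D j.succ F (s, q.2 + q.1 • om y)) := fun j =>
    (smooth_D hF _).comp (contDiff_const.prodMk (contDiff_const.add (smooth_om.const_smul q.1)))
  have hPs : ∀ i j, ContDiff ℝ ∞ (P i j) := fun i j => smooth_ro.mul ((hom i).mul (hk j))
  have hPz : ∀ i j, ∀ y ∉ Ka, P i j y = 0 := fun i j y hy => by simp [hP, ro_out hy]
  have key : ∀ y, ro y * bx (fun q => q.1 * TT s (om y) F q) q =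
      ∑ i, ∑ j, fderiv ℝ (P i j) y (y i • Pi.single j 1 - y j • Pi.single i 1) := by
    intro y
    have e1 : ∀ i j, fderiv ℝ (P i j) y (y i • Pi.single j 1 - y j • Pi.single i 1) =
        ro y * ((psi (n2 y) • (y i • Pi.single j 1 - y j • Pi.single i 1 : Spc)) i * TT s (om y) (D j.succ F) q
          + om y i * (q.1 * ∑ m : Fin 3, (psi (n2 y) • (y i • Pi.single j 1 - y j • Pi.single i 1 : Spc)) m * TT s (om y) (D m.succ (D j.succ F)) q)) := by
      intro i j
      have ho := (smooth_om.differentiable (by simp) y).hasFDerivAt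
      have hoi : HasFDerivAt (fun y => om y i) ((ContinuousLinearMap.proj (R := ℝ) (φ := fun _ : Fin 3 => ℝ) i).comp (fderiv ℝ om y)) y :=
        (ContinuousLinearMap.proj (R := ℝ) (φ := fun _ : Fin 3 => ℝ) i).hasFDerivAt.comp y ho
      have hz : HasFDerivAt (fun y => ((s, q.2 + q.1 • om y) : Pt)) ((0 : Spc →L[ℝ] ℝ).prod (q.1 • fderiv ℝ om y)) y :=
        (hasFDerivAt_const s y).prodMk ((ho.const_smul q.1).const_add q.2)
      have hf : HasFDerivAt (fun y => D j.succ F (s, q.2 + q.1 • om y)) ((fderiv ℝ (D j.succ F) (s, q.2 + q.1 • om y)).comp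
          ((0 : Spc →L[ℝ] ℝ).prod (q.1 • fderiv ℝ om y))) y :=
        HasFDerivAt.comp (g := D j.succ F) y (diff_of_smooth (smooth_D hF j.succ) (s, q.2 + q.1 • om y)).hasFDerivAt hz
      have hT : HasFDerivAt (P i j) _ y := (smooth_ro.differentiable (by simp) y).hasFDerivAt.mul (hoi.mul hf)
      rw [hT.fderiv]
      simp only [ContinuousLinearMap.add_apply, ContinuousLinearMap.smul_apply, ContinuousLinearMap.comp_apply, ro_rot, om_rot, smul_zero, add_zero,
        ContinuousLinearMap.prod_apply, ContinuousLinearMap.zero_apply]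
      rw [fderiv_apply_eq, Fin.sum_univ_succ, Finset.mul_sum]
      simp only [Xc, Fin.cons_zero, Fin.cons_succ, zero_mul, zero_add, smul_eq_mul, ContinuousLinearMap.proj_apply, Pi.smul_apply, TT, mul_assoc]
      ring
    rw [bx_TT hF]
    by_cases h : ro y = 0
    · simp [e1, h]
    have hn := om_sq (ro_ne h).1
    simp only [e1]
    have c1 := D_comm (c2_of_smooth hF)
    have hn' : om y 0 ^ 2 + om y 1 ^ 2 + om y 2 ^ 2 = 1 := by rw [← hn]; simp [n2, Fin.sum_univ_three]
    have oe : ∀ i, om y i = psi (n2 y) * y i := fun i => rfl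
    simp only [← Finset.mul_sum]
    congr 1
    have c01 := c1 (Fin.succ 0) (Fin.succ 1)
    have c02 := c1 (Fin.succ 0) (Fin.succ 2)
    have c12 := c1 (Fin.succ 1) (Fin.succ 2)
    simp only [Fin.sum_univ_three, Pi.smul_apply, Pi.sub_apply, smul_eq_mul, Pi.single_apply, mul_sub, ← mul_assoc, ← oe, c01, c02, c12]
    simp only [Fin.isValue, reduceIte, Fin.reduceEq]
    linear_combination (-q.1 * (TT s (om y) (D (Fin.succ 0) (D (Fin.succ 0) F)) q + TT s (om y) (D (Fin.succ 1) (D (Fin.succ 1) F)) q + TT s (om y) (D (Fin.succ 2) (D (Fin.succ 2) F)) q)) * hn'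
  simp only [key]
  have hitgr : ∀ i j, Integrable fun y : Spc => fderiv ℝ (P i j) y (y i • Pi.single j 1 - y j • Pi.single i 1) := by
    intro i j
    have hc : Continuous fun y : Spc => fderiv ℝ (P i j) y (y i • Pi.single j 1 - y j • Pi.single i 1) :=
      ((hPs i j).continuous_fderiv (by simp)).clm_apply (by fun_prop)
    refine hc.integrable_of_hasCompactSupport ?_
    have h1 : HasCompactSupport (P i j) := HasCompactSupport.intro Ka_c (hPz i j)
    refine (h1.fderiv (𝕜 := ℝ)).mono' ?_
    refine (Function.support_subset_iff'.2 fun y hy => ?_).trans subset_closure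
    rw [Function.notMem_support.1 hy]; rfl
  rw [integral_finset_sum _ fun i _ => integrable_finset_sum _ fun j _ => hitgr i j]
  refine Finset.sum_eq_zero fun i _ => ?_
  rw [integral_finset_sum _ fun j _ => hitgr i j]
  exact Finset.sum_eq_zero fun j _ => int_rot (hPs i j) (hPz i j) i j

/-- Derivative in the second (spacetime) variable. -/
def DP (a : Fin 4) (W : ℝ × Pt → ℝ) (z : ℝ × Pt) : ℝ := D a (fun p => W (z.1, p)) z.2
lemma DP_eq {W : ℝ × Pt → ℝ} (hW : ContDiff ℝ ∞ W) (a : Fin 4) : DP a W = fun z => fderiv ℝ W z (0, ev a) := by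
  funext z
  have h := ((hW.differentiable (by simp) z).hasFDerivAt.comp z.2 (hasFDerivAt_prodMk_right (𝕜 := ℝ) z.1 z.2)).fderiv
  show fderiv ℝ (W ∘ fun p => (z.1, p)) z.2 (ev a) = _
  rw [h]; simp
lemma smooth_DP {W : ℝ × Pt → ℝ} (hW : ContDiff ℝ ∞ W) (a : Fin 4) : ContDiff ℝ ∞ (DP a W) := by
  rw [DP_eq hW]
  exact (hW.fderiv_right (m := ∞) (by simp)).clm_apply contDiff_const

/-- The integral operator ∫_0^t W(s, (t,x)) ds. -/
def LL (W : ℝ × Pt → ℝ) (p : Pt) : ℝ := p.1 * ∫ σ in Set.Icc (0:ℝ) 1, W (p.1 * σ, p)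
def HL (W : ℝ × Pt → ℝ) (z : ℝ × Pt) : ℝ := z.1 * ∫ σ in Set.Icc (0:ℝ) 1, W (z.1 * σ, z.2)

lemma smooth_HL {W : ℝ × Pt → ℝ} (hW : ContDiff ℝ ∞ W) : ContDiff ℝ ∞ (HL W) := by
  refine contDiff_fst.mul ?_
  exact par_smooth (E := ℝ × Pt) (Z := ℝ) volume isCompact_Icc (G := fun w => W (w.1.1 * w.2, w.1.2)) (hW.comp (by fun_prop))
lemma smooth_LL {W : ℝ × Pt → ℝ} (hW : ContDiff ℝ ∞ W) : ContDiff ℝ ∞ (LL W) :=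
  (smooth_HL hW).comp (contDiff_fst.prodMk contDiff_id)
lemma HL_eq {W : ℝ × Pt → ℝ} (b : ℝ) (p : Pt) : HL W (b, p) = ∫ s in (0:ℝ)..b, W (s, p) := by
  unfold HL
  rw [integral_Icc_eq_integral_Ioc, ← intervalIntegral.integral_of_le zero_le_one]
  have := intervalIntegral.mul_integral_comp_mul_right (a := 0) (b := 1) (f := fun s => W (s, p)) b
  simp only [zero_mul, one_mul] at this
  rw [← this]
  simp only [mul_comm b]
lemma D_LL {W : ℝ × Pt → ℝ} (hW : ContDiff ℝ ∞ W) (a : Fin 4) :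
    D a (LL W) = fun p => (ev a).1 * W (p.1, p) + LL (DP a W) p := by
  funext p
  have hd := ((smooth_HL hW).differentiable (by simp) (p.1, p)).hasFDerivAt
  have h1 : HasFDerivAt (fun p : Pt => ((p.1, p) : ℝ × Pt)) ((ContinuousLinearMap.fst ℝ ℝ Spc).prod (ContinuousLinearMap.id ℝ Pt)) p :=
    hasFDerivAt_fst.prodMk (hasFDerivAt_id p)
  have h2 : fderiv ℝ (LL W) p = _ := (HasFDerivAt.comp (g := HL W) (f := fun p : Pt => ((p.1, p) : ℝ × Pt)) p hd h1).fderiv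
  show fderiv ℝ (LL W) p (ev a) = _
  rw [h2, ContinuousLinearMap.comp_apply]
  have e : (((ContinuousLinearMap.fst ℝ ℝ Spc).prod (ContinuousLinearMap.id ℝ Pt)) (ev a) : ℝ × Pt) = (ev a).1 • ((1, 0) : ℝ × Pt) + (0, ev a) := by
    simp
  rw [e, map_add, map_smul]
  congr 1
  · rw [smul_eq_mul]; congr 1
    have h3 : HasDerivAt (fun b => HL W (b, p)) (fderiv ℝ (HL W) (p.1, p) (1, 0)) p.1 := by
      have := hd.comp_hasDerivAt p.1 ((hasDerivAt_id p.1).prodMk (hasDerivAt_const p.1 p))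
      exact this
    have h4 : HasDerivAt (fun b => HL W (b, p)) (W (p.1, p)) p.1 := by
      simp only [HL_eq]
      have hc : Continuous fun s => W (s, p) := hW.continuous.comp (by fun_prop)
      exact intervalIntegral.integral_hasDerivAt_right (hc.intervalIntegrable _ _) (hc.stronglyMeasurableAtFilter _ _) hc.continuousAt
    exact h3.unique h4
  · have := congrFun (DP_eq (smooth_HL hW) a) (p.1, p)
    rw [← this]
    show D a (fun q => p.1 * ∫ σ in Set.Icc (0:ℝ) 1, W (p.1 * σ, q)) p = p.1 * _
    have hG : ContDiff ℝ ∞ (fun w : Pt × ℝ => W (p.1 * w.2, w.1)) := hW.comp (by fun_prop)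
    have hs := par_smooth (E := Pt) (Z := ℝ) volume (isCompact_Icc (a := (0:ℝ)) (b := 1)) hG
    rw [D_const_mul (u := fun q => ∫ σ in Set.Icc (0:ℝ) 1, W (p.1 * σ, q)) (diff_of_smooth hs)]
    have := par_D (Z := ℝ) volume (isCompact_Icc (a := (0:ℝ)) (b := 1)) hG a
    simp only at this
    rw [this]
    rfl

lemma rad_norm (x : Spc) : rad x = ‖WithLp.toLp 2 x‖ := by
  rw [EuclideanSpace.norm_eq]; simp [rad]
lemma rad_add_le (x y : Spc) : rad (x + y) ≤ rad x + rad y := by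
  simp only [rad_norm, WithLp.toLp_add]; exact norm_add_le _ _
lemma rad_neg (x : Spc) : rad (-x) = rad x := by simp [rad]
lemma rad_smul' (c : ℝ) (x : Spc) : rad (c • x) = |c| * rad x := by
  simp only [rad_norm, WithLp.toLp_smul, norm_smul, Real.norm_eq_abs]
lemma rad_shift (x o : Spc) (c : ℝ) (ho : n2 o = 1) : rad x ≤ rad (x + c • o) + |c| := by
  have h := rad_add_le (x + c • o) (-(c • o))
  have h1 : rad o = 1 := by unfold rad; rw [show ∑ i, o i ^ 2 = 1 from ho, Real.sqrt_one]
  rwa [add_neg_cancel_right, rad_neg, rad_smul', h1, mul_one] at h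

def VV (F : Pt → ℝ) (s : ℝ) (q : Pt) : ℝ := ∫ y in Ka, ro y * (q.1 * TT s (om y) F q)
def WV (F : Pt → ℝ) (z : ℝ × Pt) : ℝ := VV F z.1 (z.2 - (z.1, 0))
lemma smooth_ro' : ContDiff ℝ ∞ ro := smooth_ro
lemma smooth_WV {F : Pt → ℝ} (hF : ContDiff ℝ ∞ F) : ContDiff ℝ ∞ (WV F) := by
  have := smooth_om
  have := smooth_ro
  refine par_smooth (E := ℝ × Pt) (Z := Spc) volume Ka_c (G := fun w => ro w.2 * ((w.1.2.1 - w.1.1) * F (w.1.1, (w.1.2.2 - 0) + (w.1.2.1 - w.1.1) • om w.2))) ?_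
  have h2 : ContDiff ℝ ∞ (fun w : (ℝ × Pt) × Spc => om w.2) := smooth_om.comp contDiff_snd
  have h1 : ContDiff ℝ ∞ (fun w : (ℝ × Pt) × Spc => ((w.1.1, (w.1.2.2 - 0) + (w.1.2.1 - w.1.1) • om w.2) : Pt)) := by fun_prop
  exact (smooth_ro.comp contDiff_snd).mul (ContDiff.mul (by fun_prop) (hF.comp h1))

lemma smooth_VG {F : Pt → ℝ} (hF : ContDiff ℝ ∞ F) (s : ℝ) : ContDiff ℝ ∞ (fun w : Pt × Spc => ro w.2 * (w.1.1 * TT s (om w.2) F w.1)) := by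
  have h2 : ContDiff ℝ ∞ (fun w : Pt × Spc => om w.2) := smooth_om.comp contDiff_snd
  have h1 : ContDiff ℝ ∞ (fun w : Pt × Spc => ((s, w.1.2 + w.1.1 • om w.2) : Pt)) := by fun_prop
  exact (smooth_ro.comp contDiff_snd).mul (ContDiff.mul (by fun_prop) (hF.comp h1))

lemma D_VV {F : Pt → ℝ} (hF : ContDiff ℝ ∞ F) (s : ℝ) (a : Fin 4) :
    D a (VV F s) = fun q => ∫ y in Ka, ro y * D a (fun q => q.1 * TT s (om y) F q) q := by
  have h := par_D volume Ka_c (smooth_VG hF s) a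
  refine Eq.trans h ?_
  funext q
  congr 1
  funext y
  exact congrFun (D_const_mul (u := fun q => q.1 * TT s (om y) F q) (diff_of_smooth (contDiff_fst.mul (smooth_TT hF s (om y)))) (ro y) a) q

lemma DD_VV {F : Pt → ℝ} (hF : ContDiff ℝ ∞ F) (s : ℝ) (a : Fin 4) :
    D a (D a (VV F s)) = fun q => ∫ y in Ka, ro y * D a (D a (fun q => q.1 * TT s (om y) F q)) q := by
  have h := par_D volume Ka_c (smooth_VG hF s) a
  have hG2 : ContDiff ℝ ∞ (fun w : Pt × Spc => fderiv ℝ (fun w : Pt × Spc => ro w.2 * (w.1.1 * TT s (om w.2) F w.1)) w (ev a, 0)) :=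
    ((smooth_VG hF s).fderiv_right (m := ∞) (by simp)).clm_apply contDiff_const
  have e : ∀ (y : Spc) (q : Pt), fderiv ℝ (fun w : Pt × Spc => ro w.2 * (w.1.1 * TT s (om w.2) F w.1)) (q, y) (ev a, 0) =
      ro y * D a (fun q => q.1 * TT s (om y) F q) q := by
    intro y q
    have h := (((smooth_VG hF s).differentiable (by simp) (q, y)).hasFDerivAt.comp q (hasFDerivAt_prodMk_left (𝕜 := ℝ) q y)).fderiv
    have h3 := congrArg (fun L => L (ev a)) h
    have h4 := congrFun (D_const_mul (u := fun q => q.1 * TT s (om y) F q) (diff_of_smooth (contDiff_fst.mul (smooth_TT hF s (om y)))) (ro y) a) q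
    rw [← h4]
    exact h3.symm
  have h2 := par_D volume Ka_c hG2 a
  simp only [e] at h2
  rw [D_VV hF s a, h2]
  funext q
  congr 1
  funext y
  exact congrFun (D_const_mul (u := D a fun q => q.1 * TT s (om y) F q) (diff_of_smooth (smooth_D (contDiff_fst.mul (smooth_TT hF s (om y))) a)) (ro y) a) q

lemma bx_VV {F : Pt → ℝ} (hF : ContDiff ℝ ∞ F) (s : ℝ) (q : Pt) : bx (VV F s) q = 0 := by
  unfold bx
  simp only [DD_VV hF]
  rw [← mean_zero hF s q]
  simp only [← integral_const_mul]
  rw [← integral_finset_sum]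
  · congr 1; funext y
    unfold bx
    rw [Finset.mul_sum]
    exact Finset.sum_congr rfl fun a _ => by ring
  · intro a _
    refine Integrable.const_mul ?_ _
    have hG2 : ContDiff ℝ ∞ (fun w : Pt × Spc => ro w.2 * (w.1.1 * TT s (om w.2) F w.1)) := smooth_VG hF s
    have hG3 : ContDiff ℝ ∞ (fun w : Pt × Spc => fderiv ℝ (fun w : Pt × Spc => ro w.2 * (w.1.1 * TT s (om w.2) F w.1)) w (ev a, 0)) :=
      (hG2.fderiv_right (m := ∞) (by simp)).clm_apply contDiff_const
    have hG4 : ContDiff ℝ ∞ (fun w : Pt × Spc => fderiv ℝ (fun w : Pt × Spc => fderiv ℝ (fun w : Pt × Spc => ro w.2 * (w.1.1 * TT s (om w.2) F w.1)) w (ev a, 0)) w (ev a, 0)) :=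
      (hG3.fderiv_right (m := ∞) (by simp)).clm_apply contDiff_const
    have par : ∀ (G : Pt × Spc → ℝ) (hG : ContDiff ℝ ∞ G) (q : Pt) (y : Spc), fderiv ℝ G (q, y) (ev a, 0) = D a (fun q => G (q, y)) q := by
      intro G hG q y
      have h := ((hG.differentiable (by simp) (q, y)).hasFDerivAt.comp q (hasFDerivAt_prodMk_left (𝕜 := ℝ) q y)).fderiv
      exact (congrArg (fun L => L (ev a)) h).symm
    have hc : Continuous fun y => ro y * D a (D a (fun q => q.1 * TT s (om y) F q)) q := by
      have := hG4.continuous.comp (by fun_prop : Continuous fun y : Spc => (q, y))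
      refine this.congr fun y => ?_
      show fderiv ℝ _ (q, y) _ = _
      rw [par _ hG3]
      simp only [par _ hG2]
      have e1 : (fun q => D a (fun q => ro y * (q.1 * TT s (om y) F q)) q) = fun q => ro y * D a (fun q => q.1 * TT s (om y) F q) q :=
        D_const_mul (u := fun q => q.1 * TT s (om y) F q) (diff_of_smooth (contDiff_fst.mul (smooth_TT hF s (om y)))) (ro y) a
      rw [e1]
      exact congrFun (D_const_mul (u := D a fun q => q.1 * TT s (om y) F q) (diff_of_smooth (smooth_D (contDiff_fst.mul (smooth_TT hF s (om y))) a)) (ro y) a) q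
    exact hc.continuousOn.integrableOn_compact Ka_c

lemma VV_zero (F : Pt → ℝ) (s : ℝ) (x : Spc) : VV F s (0, x) = 0 := by simp [VV]
lemma D0_VV {F : Pt → ℝ} (hF : ContDiff ℝ ∞ F) (s : ℝ) (x : Spc) : D 0 (VV F s) (0, x) = cro * F (s, x) := by
  rw [D_VV hF]
  show ∫ y in Ka, _ = _
  rw [cro, ← integral_mul_const]
  congr 1; funext y
  congr 1
  have hX : ContDiff ℝ ∞ (fun q : Pt => q.1) := contDiff_fst
  rw [D_mul (diff_of_smooth hX) (diff_of_smooth (smooth_TT hF s (om y)))]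
  have := D_Xc 0 0
  rw [show (fun q : Pt => q.1) = Xc 0 from rfl, this]
  simp [Xc, TT]

lemma DP_shift (V : ℝ → Pt → ℝ) (a : Fin 4) :
    DP a (fun z => V z.1 (z.2 - (z.1, 0))) = fun z => D a (V z.1) (z.2 - (z.1, 0)) := by
  funext z
  show fderiv ℝ (fun p => V z.1 (p - (z.1, 0))) z.2 (ev a) = _
  rw [fderiv_comp_sub]; rfl

/-- Smooth solution of the inhomogeneous wave equation with zero data. -/
lemma duhamel {F : Pt → ℝ} (hF : ContDiff ℝ ∞ F) (hS : Scs F) : ∃ u : Pt → ℝ, ContDiff ℝ ∞ u ∧ Scs u ∧ bx u = F ∧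
    ∀ x, u (0, x) = 0 ∧ D 0 u (0, x) = 0 := by
  have hW := smooth_WV hF
  have hL := smooth_LL hW
  have dW : ∀ a, DP a (WV F) = fun z => D a (VV F z.1) (z.2 - (z.1, 0)) := fun a => DP_shift (fun s => VV F s) a
  have ddW : ∀ a, DP a (DP a (WV F)) = fun z => D a (D a (VV F z.1)) (z.2 - (z.1, 0)) := fun a => by
    rw [dW]; exact DP_shift (fun s => D a (VV F s)) a
  have ez : ∀ p : Pt, p - (p.1, 0) = (0, p.2) := fun p => by ext <;> simp
  have W0 : ∀ p : Pt, WV F (p.1, p) = 0 := fun p => by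
    show VV F p.1 (p - (p.1, 0)) = 0
    rw [ez, VV_zero]
  have d1 : ∀ a, D a (LL (WV F)) = LL (DP a (WV F)) := by
    intro a; rw [D_LL hW]; funext p; rw [W0]; ring
  have d2 : ∀ a, D a (D a (LL (WV F))) = fun p => (ev a).1 * D a (VV F p.1) (0, p.2) + LL (DP a (DP a (WV F))) p := by
    intro a; rw [d1, D_LL (smooth_DP hW a)]; funext p
    congr 2
    rw [dW]; simp only [ez]
  have hb : ∀ p, bx (LL (WV F)) p = -(cro * F p) := by
    intro p
    have key : ∑ a, eta a * LL (DP a (DP a (WV F))) p = 0 := by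
      have : ∀ a, eta a * LL (DP a (DP a (WV F))) p = p.1 * ∫ σ in Set.Icc (0:ℝ) 1, eta a * DP a (DP a (WV F)) (p.1 * σ, p) := by
        intro a; rw [integral_const_mul]; unfold LL; ring
      simp only [this]
      rw [← Finset.mul_sum, ← integral_finset_sum]
      · have : ∀ σ : ℝ, ∑ a, eta a * DP a (DP a (WV F)) (p.1 * σ, p) = 0 := by
          intro σ
          simp only [ddW]
          exact bx_VV hF (p.1 * σ) _
        simp [this]
      · intro a _
        have := (smooth_DP (smooth_DP hW a) a).continuous
        exact (Continuous.continuousOn (by fun_prop)).integrableOn_compact isCompact_Icc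
    unfold bx
    simp only [d2, mul_add, Finset.sum_add_distrib]
    rw [key, add_zero, Fin.sum_univ_succ]
    have e3 : ∀ i : Fin 3, (ev i.succ).1 = 0 := fun i => by simp
    have e0 : (ev 0).1 = 1 := by simp
    simp only [e3, e0]
    rw [D0_VV hF]
    simp [eta]
  have hsc : Scs (LL (WV F)) := by
    obtain ⟨R, hR⟩ := hS
    refine ⟨R, fun p hp => ?_⟩
    unfold LL
    rw [setIntegral_congr_fun (g := fun _ => (0:ℝ)) measurableSet_Icc, integral_zero, mul_zero]
    intro σ hσ
    show VV F (p.1 * σ) (p - (p.1 * σ, 0)) = 0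
    unfold VV
    have : ∀ y, ro y * ((p - (p.1 * σ, 0)).1 * TT (p.1 * σ) (om y) F (p - (p.1 * σ, 0))) = 0 := by
      intro y
      by_cases h : ro y = 0
      · rw [h, zero_mul]
      have ho := om_sq (ro_ne h).1
      unfold TT
      rw [hR, mul_zero, mul_zero]
      have h1 := rad_shift p.2 (om y) (p.1 - p.1 * σ) ho
      have h2 : |p.1 - p.1 * σ| = |p.1| * (1 - σ) := by
        rw [← mul_one_sub, abs_mul, abs_of_nonneg (by linarith [hσ.2] : (0:ℝ) ≤ 1 - σ)]
      have h3 : |p.1 * σ| = |p.1| * σ := by rw [abs_mul, abs_of_nonneg hσ.1]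
      simp only [Prod.fst_sub, Prod.snd_sub, sub_zero]
      rw [h3]; rw [h2] at h1
      linarith
    simp only [this, integral_zero]
  refine ⟨fun p => -cro⁻¹ * LL (WV F) p, contDiff_const.mul hL, hsc.mul_left _, ?_, fun x => ⟨by simp [LL], ?_⟩⟩
  · funext p
    unfold bx
    have : ∀ a, D a (D a (fun p => -cro⁻¹ * LL (WV F) p)) = fun p => -cro⁻¹ * D a (D a (LL (WV F))) p := by
      intro a
      rw [D_const_mul (diff_of_smooth hL), D_const_mul (diff_of_smooth (smooth_D hL a))]
    simp only [this]
    have h := hb p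
    unfold bx at h
    have h5 : ∑ a, eta a * (-cro⁻¹ * D a (D a (LL (WV F))) p) = -cro⁻¹ * ∑ a, eta a * D a (D a (LL (WV F))) p := by
      rw [Finset.mul_sum]; exact Finset.sum_congr rfl fun a _ => by ring
    rw [h5, h]
    have := cro_pos.ne'
    field_simp
  · rw [D_const_mul (diff_of_smooth hL), d1]
    simp [LL]

/-- Smooth solution of the Cauchy problem with compactly supported smooth data. -/
lemma lin_solve {F : Pt → ℝ} (hF : ContDiff ℝ ∞ F) (hS : Scs F) {f g : Spc → ℝ} (hf : ContDiff ℝ ∞ f) (hg : ContDiff ℝ ∞ g)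
    (cf : HasCompactSupport f) (cg : HasCompactSupport g) : ∃ u : Pt → ℝ, ContDiff ℝ ∞ u ∧ Scs u ∧ bx u = F ∧
    ∀ x, u (0, x) = f x ∧ D 0 u (0, x) = g x := by
  have scs : ∀ f : Spc → ℝ, HasCompactSupport f → Scs (fun p => f p.2) := by
    intro f cf
    obtain ⟨R, hR⟩ := (cf.isCompact.image cont_rad).bddAbove
    refine ⟨R, fun p hp => ?_⟩
    by_contra h
    have := hR ⟨p.2, subset_tsupport f h, rfl⟩
    linarith [abs_nonneg p.1]
  have hf2 : ContDiff ℝ ∞ (fun p : Pt => f p.2) := hf.comp contDiff_snd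
  have hg2 : ContDiff ℝ ∞ (fun p : Pt => g p.2) := hg.comp contDiff_snd
  set b : Pt → ℝ := fun p => f p.2 + p.1 * g p.2 with hb
  have hbs : ContDiff ℝ ∞ b := hf2.add (contDiff_fst.mul hg2)
  have hbc : Scs b := (scs f cf).add ((scs g cg).mul_left _)
  obtain ⟨u, hu, hsu, hbu, hd⟩ := duhamel (F := fun p => F p - bx b p) (hF.sub (smooth_bx hbs)) (hS.sub hbc.bx)
  refine ⟨fun p => u p + b p, hu.add hbs, hsu.add hbc, ?_, fun x => ?_⟩
  · funext p
    have h1 : ∀ a, D a (D a (fun p => u p + b p)) = fun p => D a (D a u) p + D a (D a b) p := by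
      intro a
      rw [D_add (diff_of_smooth hu) (diff_of_smooth hbs), D_add (diff_of_smooth (smooth_D hu a)) (diff_of_smooth (smooth_D hbs a))]
    have h2 := congrFun hbu p
    unfold bx at h2 ⊢
    simp only [h1, mul_add, Finset.sum_add_distrib]
    rw [h2]; ring
  · refine ⟨by simp [hb, (hd x).1], ?_⟩
    rw [D_add (diff_of_smooth hu) (diff_of_smooth hbs)]
    simp only [(hd x).2, zero_add]
    have h := slice_Dt (diff_of_smooth hbs) 0 x
    have h2 : HasDerivAt (fun s : ℝ => b (s, x)) (g x) 0 := by
      have := ((hasDerivAt_id (0:ℝ)).mul_const (g x)).const_add (f x)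
      simp only [one_mul] at this
      exact this
    exact h.unique h2

open scoped Convolution in
lemma moll_aux (n : ℕ) : ∀ (F : Type) [NormedAddCommGroup F] [NormedSpace ℝ F] [CompleteSpace F] (g : Spc → F), ContDiff ℝ n g →
    HasCompactSupport g → ∀ ε > 0, ∃ r > 0, ∀ φ : ContDiffBump (0 : Spc), φ.rOut ≤ r → ∀ x,
    ‖iteratedFDeriv ℝ n (fun x => (φ.normed volume ⋆[ContinuousLinearMap.lsmul ℝ ℝ, volume] g) x - g x) x‖ ≤ ε := by
  induction n with
  | zero =>
    intro F _ _ _ g hg cg ε hε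
    have hu := cg.uniformContinuous_of_continuous hg.continuous
    obtain ⟨r, hr, h⟩ := Metric.uniformContinuous_iff.1 hu ε hε
    refine ⟨r, hr, fun φ hφ x => ?_⟩
    rw [norm_iteratedFDeriv_zero, ← dist_eq_norm]
    refine ContDiffBump.dist_normed_convolution_le hg.continuous.aestronglyMeasurable fun y hy => (h ?_).le
    exact lt_of_lt_of_le hy hφ
  | succ n ih =>
    intro F _ _ _ g hg cg ε hε
    have hg1 : ContDiff ℝ 1 g := hg.of_le (by norm_cast; omega)
    have hgd : ContDiff ℝ n (fderiv ℝ g) := hg.fderiv_right (by norm_cast)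
    obtain ⟨r, hr, h⟩ := ih (Spc →L[ℝ] F) (fderiv ℝ g) hgd (cg.fderiv (𝕜 := ℝ)) ε hε
    refine ⟨r, hr, fun φ hφ x => ?_⟩
    rw [← norm_iteratedFDeriv_fderiv]
    refine le_trans (le_of_eq ?_) (h φ hφ x)
    congr 2
    funext y
    have h1 := cg.hasFDerivAt_convolution_right (μ := volume) (f := φ.normed volume) (ContinuousLinearMap.lsmul ℝ ℝ)
      (φ.continuous_normed.locallyIntegrable) hg1 y
    have e : ContinuousLinearMap.precompR Spc (ContinuousLinearMap.lsmul ℝ ℝ : ℝ →L[ℝ] F →L[ℝ] F) = (ContinuousLinearMap.lsmul ℝ ℝ : ℝ →L[ℝ] (Spc →L[ℝ] F) →L[ℝ] (Spc →L[ℝ] F)) := by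
      ext c L v; simp [ContinuousLinearMap.precompR_apply]
    rw [e] at h1
    exact (h1.sub (hg1.differentiable (by norm_num) y).hasFDerivAt).fderiv

/-- Sobolev weights. -/
def sw (δ : ℝ) (k : ℕ) (x : Spc) : ℝ := jb x ^ (δ + k)
lemma sw_eq (δ : ℝ) (k : ℕ) (x : Spc) : (1 + ∑ i, x i ^ 2) ^ ((δ + k) / 2) = sw δ k x := by
  rw [sw, ← jb_sq, ← Real.rpow_natCast, ← Real.rpow_mul (jb_pos x).le]; congr 1; push_cast; ring
lemma sw_pos (δ : ℝ) (k : ℕ) (x : Spc) : 0 < sw δ k x := Real.rpow_pos_of_pos (jb_pos x) _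
lemma cont_jb1 : Continuous jb := by unfold jb; fun_prop
lemma cont_sw (δ : ℝ) (k : ℕ) : Continuous (sw δ k) :=
  cont_jb1.rpow_const fun x => Or.inl (jb_pos x).ne'
def SQ (δ : ℝ) (k : ℕ) (f : Spc → ℝ) (x : Spc) : ℝ := (sw δ k x * ‖iteratedFDeriv ℝ k f x‖) ^ 2
lemma cont_SQ (δ : ℝ) {k m : ℕ} (hk : k ≤ m) {f : Spc → ℝ} (hf : ContDiff ℝ m f) : Continuous (SQ δ k f) :=
  ((cont_sw δ k).mul (hf.continuous_iteratedFDeriv (by exact_mod_cast hk)).norm).pow 2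
lemma SQ_nonneg (δ : ℝ) (k : ℕ) (f : Spc → ℝ) (x : Spc) : 0 ≤ SQ δ k f x := sq_nonneg _

lemma SQ_add (δ : ℝ) {k m : ℕ} (hk : k ≤ m) {f g : Spc → ℝ} (hf : ContDiff ℝ m f) (hg : ContDiff ℝ m g) (x : Spc) :
    SQ δ k (fun x => f x + g x) x ≤ 2 * SQ δ k f x + 2 * SQ δ k g x := by
  unfold SQ
  have h1 : iteratedFDeriv ℝ k (fun x => f x + g x) x = iteratedFDeriv ℝ k f x + iteratedFDeriv ℝ k g x :=
    iteratedFDeriv_add_apply ((hf.of_le (by exact_mod_cast hk)).contDiffAt) ((hg.of_le (by exact_mod_cast hk)).contDiffAt)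
  rw [h1]
  have h2 := norm_add_le (iteratedFDeriv ℝ k f x) (iteratedFDeriv ℝ k g x)
  have h3 := sw_pos δ k x
  have h4 : (sw δ k x * ‖iteratedFDeriv ℝ k f x + iteratedFDeriv ℝ k g x‖) ^ 2 ≤
      (sw δ k x * ‖iteratedFDeriv ℝ k f x‖ + sw δ k x * ‖iteratedFDeriv ℝ k g x‖) ^ 2 := by
    refine pow_le_pow_left₀ (by positivity) ?_ 2
    rw [← mul_add]; exact mul_le_mul_of_nonneg_left h2 h3.le
  nlinarith [sq_nonneg (sw δ k x * ‖iteratedFDeriv ℝ k f x‖ - sw δ k x * ‖iteratedFDeriv ℝ k g x‖)]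

open scoped Convolution in
lemma mollify {m : ℕ} {h : Spc → ℝ} (hh : ContDiff ℝ m h) (ch : HasCompactSupport h) (δ : ℝ) {η : ℝ} (hη : 0 < η) :
    ∃ g : Spc → ℝ, ContDiff ℝ ∞ g ∧ HasCompactSupport g ∧ (∀ x, |g x - h x| ≤ η) ∧ ∀ k ≤ m, Integrable (SQ δ k (fun x => g x - h x)) ∧ ∫ x, SQ δ k (fun x => g x - h x) x ≤ η := by
  obtain ⟨ρ, hρ⟩ := ch.isCompact.isBounded.subset_closedBall (0 : Spc)
  set K := Metric.closedBall (0 : Spc) (ρ + 1) with hK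
  have cK : IsCompact K := isCompact_closedBall _ _
  set I : ℝ := ∑ k ∈ Finset.range (m + 1), ∫ x in K, sw δ k x ^ 2 with hI
  have hI0 : 0 ≤ I := Finset.sum_nonneg fun k _ => integral_nonneg fun x => sq_nonneg _
  obtain ⟨ε, hε, hε2, hε3⟩ : ∃ ε : ℝ, 0 < ε ∧ ε ^ 2 * I ≤ η ∧ ε ≤ η := by
    have hs : 0 < Real.sqrt (η / (I + 1)) := Real.sqrt_pos.2 (by positivity)
    refine ⟨min (Real.sqrt (η / (I + 1))) η, lt_min hs hη, ?_, min_le_right _ _⟩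
    refine le_trans (mul_le_mul_of_nonneg_right (pow_le_pow_left₀ (lt_min hs hη).le (min_le_left _ _) 2) hI0) ?_
    rw [Real.sq_sqrt (by positivity), div_mul_eq_mul_div, div_le_iff₀ (by positivity)]
    nlinarith
  have h1 : ∀ k : ℕ, ∃ r > 0, k ≤ m → ∀ φ : ContDiffBump (0 : Spc), φ.rOut ≤ r → ∀ x,
      ‖iteratedFDeriv ℝ k (fun x => (φ.normed volume ⋆[ContinuousLinearMap.lsmul ℝ ℝ, volume] h) x - h x) x‖ ≤ ε := by
    intro k
    by_cases hk : k ≤ m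
    · obtain ⟨r, hr, h2⟩ := moll_aux k ℝ h (hh.of_le (by exact_mod_cast hk)) ch ε hε
      exact ⟨r, hr, fun _ => h2⟩
    · exact ⟨1, one_pos, fun h => absurd h hk⟩
  choose r hr h2 using h1
  obtain ⟨r0, hr0, hr1⟩ : ∃ r0 : ℝ, 0 < r0 ∧ ∀ k ∈ Finset.range (m + 1), r0 ≤ r k := by
    obtain ⟨k0, _, hk⟩ := Finset.exists_min_image (Finset.range (m + 1)) r ⟨0, by simp⟩
    exact ⟨r k0, hr k0, hk⟩
  let φ : ContDiffBump (0 : Spc) := ⟨min r0 1 / 2, min r0 1, by positivity, by have : 0 < min r0 1 := by positivity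
                                                                               linarith⟩
  have e1 : φ.rOut = min r0 1 := rfl
  set g := φ.normed volume ⋆[ContinuousLinearMap.lsmul ℝ ℝ, volume] h with hg
  have hgs : ContDiff ℝ ∞ g := by
    have := φ.hasCompactSupport_normed (μ := volume) |>.contDiff_convolution_left (μ := volume) (n := (⊤ : ℕ∞)) (ContinuousLinearMap.lsmul ℝ ℝ) φ.contDiff_normed (hh.continuous.locallyIntegrable)
    exact this
  have hgc : HasCompactSupport g := HasCompactSupport.convolution _ φ.hasCompactSupport_normed ch
  have hz : ∀ x ∉ K, g x - h x = 0 := by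
    intro x hx
    have a1 : h x = 0 := by
      by_contra hc
      have := hρ (subset_tsupport h hc)
      refine hx (Metric.closedBall_subset_closedBall (by linarith) this)
    have a2 : g x = 0 := by
      by_contra hc
      have := support_convolution_subset (ContinuousLinearMap.lsmul ℝ ℝ) (μ := volume) (f := φ.normed volume) (g := h) hc
      obtain ⟨y, hy, z, hz, rfl⟩ := this
      rw [φ.support_normed_eq] at hy
      have b1 := hρ (subset_tsupport h hz)
      apply hx
      rw [hK, mem_closedBall_zero_iff]
      rw [mem_closedBall_zero_iff] at b1
      rw [mem_ball_zero_iff, e1] at hy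
      have := norm_add_le y z
      have := min_le_right r0 1
      linarith
    rw [a1, a2, sub_zero]
  refine ⟨g, hgs, hgc, fun x => ?_, fun k hk => ?_⟩
  · have h5 := h2 0 (Nat.zero_le m) φ ((min_le_left _ _).trans (hr1 0 (by simp))) x
    rw [norm_iteratedFDeriv_zero, Real.norm_eq_abs] at h5
    exact h5.trans hε3
  have hd : ContDiff ℝ m (fun x => g x - h x) := (hgs.of_le (by exact_mod_cast le_top)).sub hh
  have hcs : ∀ x ∉ K, SQ δ k (fun x => g x - h x) x = 0 := by
    intro x hx
    have : x ∉ tsupport (fun x => g x - h x) := fun hc =>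
      hx (closure_minimal (Function.support_subset_iff'.2 hz) cK.isClosed hc)
    have h3 : iteratedFDeriv ℝ k (fun x => g x - h x) x = 0 := by
      by_contra hc
      exact this (support_iteratedFDeriv_subset k hc)
    simp [SQ, h3]
  have hitgr : Integrable (SQ δ k (fun x => g x - h x)) :=
    (cont_SQ δ hk hd).integrable_of_hasCompactSupport (HasCompactSupport.intro cK hcs)
  refine ⟨hitgr, ?_⟩
  rw [← setIntegral_eq_integral_of_forall_compl_eq_zero hcs]
  calc ∫ x in K, SQ δ k (fun x => g x - h x) x ≤ ∫ x in K, ε ^ 2 * sw δ k x ^ 2 := by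
        refine setIntegral_mono_on hitgr.integrableOn ?_ cK.measurableSet fun x _ => ?_
        · exact (continuous_const.mul ((cont_sw δ k).pow 2)).continuousOn.integrableOn_compact cK
        · have h5 := h2 k hk φ ((min_le_left _ _).trans (hr1 k (by simp; omega))) x
          unfold SQ
          rw [mul_pow, mul_comm]
          exact mul_le_mul_of_nonneg_right (pow_le_pow_left₀ (norm_nonneg _) h5 2) (sq_nonneg _)
    _ = ε ^ 2 * ∫ x in K, sw δ k x ^ 2 := integral_const_mul _ _
    _ ≤ ε ^ 2 * I := by
        refine mul_le_mul_of_nonneg_left ?_ (sq_nonneg _)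
        exact Finset.single_le_sum (f := fun k => ∫ x in K, sw δ k x ^ 2) (fun k _ => integral_nonneg fun x => sq_nonneg _) (by simp; omega)
    _ ≤ η := hε2

lemma zeta_bd (m : ℕ) (χ : ContDiffBump (0 : Spc)) : ∃ B : ℝ, 0 ≤ B ∧ ∀ i ≤ m, ∀ y, jb y ^ i * ‖iteratedFDeriv ℝ i (fun y => χ y - 1) y‖ ≤ B := by
  have h : ∀ i : ℕ, ∃ B : ℝ, 0 ≤ B ∧ ∀ y, jb y ^ i * ‖iteratedFDeriv ℝ i (fun y => χ y - 1) y‖ ≤ B := by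
    intro i
    have hχ : ContDiff ℝ ∞ (χ : Spc → ℝ) := χ.contDiff
    rcases Nat.eq_zero_or_pos i with rfl | hi
    · refine ⟨1, zero_le_one, fun y => ?_⟩
      rw [norm_iteratedFDeriv_zero, pow_zero, one_mul, Real.norm_eq_abs, abs_le]
      constructor <;> linarith [χ.nonneg (x := y), χ.le_one (x := y)]
    · have e : ∀ y, iteratedFDeriv ℝ i (fun y => χ y - 1) y = iteratedFDeriv ℝ i (χ : Spc → ℝ) y := by
        intro y
        have h1 : iteratedFDeriv ℝ i (fun y => χ y - 1) y = iteratedFDeriv ℝ i (χ : Spc → ℝ) y - iteratedFDeriv ℝ i (fun _ => (1:ℝ)) y :=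
          iteratedFDeriv_sub_apply ((hχ.of_le (by exact_mod_cast le_top)).contDiffAt) contDiff_const.contDiffAt
        rw [h1, iteratedFDeriv_const_of_ne (by omega)]; simp
      have hc : Continuous fun y => jb y ^ i * ‖iteratedFDeriv ℝ i (χ : Spc → ℝ) y‖ :=
        (cont_jb1.pow i).mul (hχ.continuous_iteratedFDeriv (by exact_mod_cast le_top)).norm
      have hs : HasCompactSupport fun y => jb y ^ i * ‖iteratedFDeriv ℝ i (χ : Spc → ℝ) y‖ :=
        ((χ.hasCompactSupport.iteratedFDeriv (𝕜 := ℝ) i).norm).mul_left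
      obtain ⟨B, hB⟩ := hc.bounded_above_of_compact_support hs
      refine ⟨max B 0, le_max_right _ _, fun y => ?_⟩
      rw [e]
      exact (le_abs_self _).trans ((hB y).trans (le_max_left _ _))
  choose B hB h using h
  refine ⟨∑ i ∈ Finset.range (m + 1), B i, Finset.sum_nonneg fun i _ => hB i, fun i hi y => (h i y).trans ?_⟩
  exact Finset.single_le_sum (f := B) (fun i _ => hB i) (by simp; omega)

lemma truncate {m : ℕ} {f : Spc → ℝ} (hf : ContDiff ℝ m f) (δ : ℝ) (hi : ∀ k ≤ m, Integrable (SQ δ k f)) {η : ℝ} (hη : 0 < η) (R : ℝ) :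
    ∃ g : Spc → ℝ, ContDiff ℝ m g ∧ HasCompactSupport g ∧ (∀ x, ‖x‖ ≤ R → g x = f x) ∧ ∀ k ≤ m, Integrable (SQ δ k (fun x => g x - f x)) ∧ ∫ x, SQ δ k (fun x => g x - f x) x ≤ η := by
  let χ : ContDiffBump (0 : Spc) := ⟨1, 2, one_pos, by norm_num⟩
  obtain ⟨B, hB0, hB⟩ := zeta_bd m χ
  have hχ : ContDiff ℝ ∞ (χ : Spc → ℝ) := χ.contDiff
  set ζ : Spc → ℝ := fun y => χ y - 1 with hζ
  have hζs : ContDiff ℝ ∞ ζ := hχ.sub contDiff_const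
  -- the truncated differences
  set T : ℕ → Spc → ℝ := fun n x => ζ (((n : ℝ) + 1)⁻¹ • x) * f x with hT
  have hζR : ∀ n : ℕ, ContDiff ℝ ∞ (fun x : Spc => ζ (((n : ℝ) + 1)⁻¹ • x)) := fun n => hζs.comp (contDiff_const_smul _)
  have hTs : ∀ n, ContDiff ℝ m (T n) := fun n => ((hζR n).of_le (by exact_mod_cast le_top)).mul hf
  have hz : ∀ n : ℕ, ∀ i ≤ m, ∀ x : Spc, jb x ^ i * ‖iteratedFDeriv ℝ i (fun x : Spc => ζ (((n : ℝ) + 1)⁻¹ • x)) x‖ ≤ B := by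
    intro n i hi x
    rw [iteratedFDeriv_comp_const_smul _ (hζs.of_le (by exact_mod_cast le_top))]
    have h1 := hB i hi (((n : ℝ) + 1)⁻¹ • x)
    refine le_trans ?_ h1
    show jb x ^ i * ‖(((n : ℝ) + 1)⁻¹ ^ i) • iteratedFDeriv ℝ i ζ (((n : ℝ) + 1)⁻¹ • x)‖ ≤ _
    rw [norm_smul, ← mul_assoc]
    refine mul_le_mul_of_nonneg_right ?_ (norm_nonneg _)
    rw [Real.norm_of_nonneg (by positivity), ← mul_pow]
    refine pow_le_pow_left₀ (mul_nonneg (jb_pos x).le (by positivity)) ?_ i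
    have hn : (0:ℝ) < (n : ℝ) + 1 := by positivity
    have hn1 : ((n : ℝ) + 1)⁻¹ ≤ 1 := inv_le_one_of_one_le₀ (by linarith [(Nat.cast_nonneg n : (0:ℝ) ≤ n)])
    have hn0 : 0 < ((n : ℝ) + 1)⁻¹ := by positivity
    refine le_of_abs_le (abs_le_of_sq_le_sq ?_ (jb_pos _).le)
    rw [mul_pow, jb_sq, jb_sq]
    have : ∑ j, ((((n : ℝ) + 1)⁻¹ • x) j) ^ 2 = ((n : ℝ) + 1)⁻¹ ^ 2 * ∑ j, x j ^ 2 := by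
      rw [Finset.mul_sum]; exact Finset.sum_congr rfl fun j _ => by simp [mul_pow]
    rw [this]
    nlinarith
  set G : Spc → ℝ := fun x => ∑ j ∈ Finset.range (m + 1), SQ δ j f x with hG
  have hGi : Integrable G := integrable_finset_sum _ fun j hj => hi j (by simp at hj; omega)
  have hG0 : ∀ x, 0 ≤ G x := fun x => Finset.sum_nonneg fun j _ => SQ_nonneg _ _ _ _
  obtain ⟨C, hC0, hC⟩ : ∃ C : ℝ, 0 ≤ C ∧ ∀ n : ℕ, ∀ k ≤ m, ∀ x, SQ δ k (T n) x ≤ C * G x := by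
    refine ⟨(2 ^ m * B) ^ 2, by positivity, fun n k hk x => ?_⟩
    have h1 := norm_iteratedFDeriv_mul_le (N := (m : WithTop ℕ∞)) ((hζR n).of_le (by exact_mod_cast le_top)) hf x (n := k) (by exact_mod_cast hk)
    have hGs : ∀ j ≤ m, sw δ j x * ‖iteratedFDeriv ℝ j f x‖ ≤ Real.sqrt (G x) := fun j hj => by
      refine Real.le_sqrt_of_sq_le ?_
      exact Finset.single_le_sum (f := fun j => SQ δ j f x) (fun j _ => SQ_nonneg _ _ _ _) (by simp; omega)
    have h2 : sw δ k x * ‖iteratedFDeriv ℝ k (T n) x‖ ≤ 2 ^ m * B * Real.sqrt (G x) := by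
      calc sw δ k x * ‖iteratedFDeriv ℝ k (T n) x‖ ≤ sw δ k x * ∑ i ∈ Finset.range (k + 1), ↑(k.choose i) * ‖iteratedFDeriv ℝ i (fun x : Spc => ζ (((n : ℝ) + 1)⁻¹ • x)) x‖ * ‖iteratedFDeriv ℝ (k - i) f x‖ :=
            mul_le_mul_of_nonneg_left h1 (sw_pos _ _ _).le
        _ ≤ ∑ i ∈ Finset.range (k + 1), (k.choose i : ℝ) * (B * Real.sqrt (G x)) := by
            rw [Finset.mul_sum]
            refine Finset.sum_le_sum fun i hi => ?_
            have hik : i ≤ k := by simp at hi; omega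
            have e : sw δ k x = jb x ^ i * sw δ (k - i) x := by
              rw [sw, sw, ← Real.rpow_natCast (jb x) i, ← Real.rpow_add (jb_pos x)]
              congr 1; push_cast [hik]; ring
            have a1 := hz n i (hik.trans hk) x
            have a2 := hGs (k - i) (by omega)
            have := mul_le_mul a1 a2 (by have := sw_pos δ (k-i) x; positivity) hB0
            calc _ = (k.choose i : ℝ) * ((jb x ^ i * ‖iteratedFDeriv ℝ i (fun x : Spc => ζ (((n : ℝ) + 1)⁻¹ • x)) x‖) * (sw δ (k - i) x * ‖iteratedFDeriv ℝ (k - i) f x‖)) := by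
                  rw [e]; ring
              _ ≤ _ := mul_le_mul_of_nonneg_left this (by positivity)
        _ = 2 ^ k * (B * Real.sqrt (G x)) := by
            rw [← Finset.sum_mul]; congr 1
            exact_mod_cast Nat.sum_range_choose k
        _ ≤ 2 ^ m * (B * Real.sqrt (G x)) := by
            refine mul_le_mul_of_nonneg_right (pow_le_pow_right₀ (by norm_num) hk) (by positivity)
        _ = _ := by ring
    calc SQ δ k (T n) x ≤ (2 ^ m * B * Real.sqrt (G x)) ^ 2 := pow_le_pow_left₀ (by have := sw_pos δ k x; positivity) h2 2
      _ = _ := by rw [mul_pow, Real.sq_sqrt (hG0 x)]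
  have hTi : ∀ n, ∀ k ≤ m, Integrable (SQ δ k (T n)) := fun n k hk =>
    (hGi.const_mul C).mono' (cont_SQ δ hk (hTs n)).aestronglyMeasurable (.of_forall fun x => by
      rw [Real.norm_of_nonneg (SQ_nonneg _ _ _ _)]; exact hC n k hk x)
  have hlim : ∀ k ≤ m, Filter.Tendsto (fun n => ∫ x, SQ δ k (T n) x) Filter.atTop (nhds 0) := by
    intro k hk
    have := tendsto_integral_of_dominated_convergence (F := fun n => SQ δ k (T n)) (f := fun _ => (0:ℝ)) (μ := volume) (bound := fun x => C * G x)
      (fun n => (cont_SQ δ hk (hTs n)).aestronglyMeasurable) (hGi.const_mul C) (fun n => .of_forall fun x => by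
        rw [Real.norm_of_nonneg (SQ_nonneg _ _ _ _)]; exact hC n k hk x) (.of_forall fun x => ?_)
    · simpa using this
    · obtain ⟨n0, hn0⟩ := exists_nat_gt ‖x‖
      refine tendsto_const_nhds.congr' ?_
      filter_upwards [Filter.eventually_ge_atTop n0] with n hn
      have hn1 : ‖x‖ < (n : ℝ) + 1 := by
        have : (n0 : ℝ) ≤ n := by exact_mod_cast hn
        linarith
      have hev : T n =ᶠ[nhds x] fun _ => 0 := by
        have ho : IsOpen {y : Spc | ‖y‖ < (n : ℝ) + 1} := isOpen_lt continuous_norm continuous_const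
        filter_upwards [ho.mem_nhds hn1] with y hy
        have hy1 : ‖((n : ℝ) + 1)⁻¹ • y‖ ≤ 1 := by
          rw [norm_smul, Real.norm_of_nonneg (by positivity), inv_mul_le_iff₀ (by positivity)]
          have : ‖y‖ < (n : ℝ) + 1 := hy
          linarith
        have : χ (((n : ℝ) + 1)⁻¹ • y) = 1 := χ.one_of_mem_closedBall (by rw [mem_closedBall_zero_iff]; exact hy1)
        simp [hT, hζ, this]
      have h0 : iteratedFDeriv ℝ k (T n) x = 0 := by
        have := (hev.iteratedFDeriv ℝ k).eq_of_nhds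
        rw [this]
        simp [iteratedFDeriv_zero_fun]
      simp [SQ, h0]
  have hev : ∀ᶠ n in Filter.atTop, ∀ k ∈ Finset.range (m + 1), ∫ x, SQ δ k (T n) x ≤ η := by
    rw [Filter.eventually_all_finset]
    intro k hk
    filter_upwards [(hlim k (by simp at hk; omega)).eventually (gt_mem_nhds hη)] with n hn using hn.le
  obtain ⟨n1, hn1⟩ := exists_nat_gt R
  obtain ⟨n, hn, hnn⟩ := (hev.and (Filter.eventually_ge_atTop n1)).exists
  have e : (fun x => χ (((n : ℝ) + 1)⁻¹ • x) * f x - f x) = T n := by funext x; simp only [hT, hζ]; ring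
  refine ⟨fun x => χ (((n : ℝ) + 1)⁻¹ • x) * f x, ?_, ?_, fun x hx => ?_, fun k hk => ?_⟩
  · exact ((hχ.comp (contDiff_const_smul _)).of_le (by exact_mod_cast le_top)).mul hf
  · refine HasCompactSupport.mul_right ?_
    exact χ.hasCompactSupport.comp_smul (by positivity)
  · have h3 : (n1 : ℝ) ≤ n := by exact_mod_cast hnn
    have : χ (((n : ℝ) + 1)⁻¹ • x) = 1 := χ.one_of_mem_closedBall (by
      rw [mem_closedBall_zero_iff, norm_smul, Real.norm_of_nonneg (by positivity), inv_mul_le_iff₀ (by positivity)]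
      show ‖x‖ ≤ ((n : ℝ) + 1) * 1
      linarith)
    simp [this]
  · rw [e]
    exact ⟨hTi n k hk, hn k (by simp; omega)⟩

lemma approx {m : ℕ} {f : Spc → ℝ} (hf : ContDiff ℝ m f) (δ : ℝ) (hi : ∀ k ≤ m, Integrable (SQ δ k f)) {η : ℝ} (hη : 0 < η) (R : ℝ) :
    ∃ g : Spc → ℝ, ContDiff ℝ ∞ g ∧ HasCompactSupport g ∧ (∀ x, ‖x‖ ≤ R → |g x - f x| ≤ η) ∧ ∀ k ≤ m, Integrable (SQ δ k (fun x => g x - f x)) ∧ ∫ x, SQ δ k (fun x => g x - f x) x ≤ η := by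
  obtain ⟨h, hh, ch, h1R, h1⟩ := truncate hf δ hi (η := η / 4) (by positivity) R
  obtain ⟨g, hg, cg, h2p, h2⟩ := mollify hh ch δ (η := η / 4) (by positivity)
  refine ⟨g, hg, cg, fun x hx => by rw [← h1R x hx]; exact (h2p x).trans (by linarith), fun k hk => ?_⟩
  have hg' : ContDiff ℝ m g := hg.of_le (by exact_mod_cast le_top)
  have e : (fun x => g x - f x) = fun x => (g x - h x) + (h x - f x) := by funext x; ring
  have hb := SQ_add δ hk (hg'.sub hh) (hh.sub hf)
  have hib := ((h2 k hk).1.const_mul 2).add ((h1 k hk).1.const_mul 2)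
  rw [e]
  have hitgr : Integrable (SQ δ k fun x => (g x - h x) + (h x - f x)) :=
    hib.mono' (cont_SQ δ hk ((hg'.sub hh).add (hh.sub hf))).aestronglyMeasurable (.of_forall fun x => by
      rw [Real.norm_of_nonneg (SQ_nonneg _ _ _ _)]; exact hb x)
  refine ⟨hitgr, (integral_mono hitgr hib hb).trans ?_⟩
  have := integral_add ((h2 k hk).1.const_mul 2) ((h1 k hk).1.const_mul 2)
  simp only [integral_const_mul] at this
  refine (le_of_eq this).trans ?_
  linarith [(h1 k hk).2, (h2 k hk).2]

lemma Dw_iFD {v : Pt → ℝ} (hv : ContDiff ℝ ∞ v) {f : Spc → ℝ} (hf : ∀ x, v (0, x) = f x) (w : List (Fin 3)) :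
    ∃ m : Fin w.length → Spc, (∀ j, ‖m j‖ ≤ 1) ∧ ∀ x, Dw (w.map Fin.succ) v (0, x) = iteratedFDeriv ℝ w.length f x m := by
  have hfs : ContDiff ℝ ∞ f := by
    have : f = fun x => v (0, x) := by funext x; rw [hf]
    rw [this]; exact hv.comp (by fun_prop)
  induction w with
  | nil => exact ⟨fun _ => 0, fun j => by simp, fun x => by simp [hf]⟩
  | cons i w ih =>
    obtain ⟨m, hm, h⟩ := ih
    refine ⟨Fin.cons (Pi.single i 1) m, fun j => ?_, fun x => ?_⟩
    · refine Fin.cases ?_ (fun j => ?_) j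
      · rw [Fin.cons_zero]
        refine (pi_norm_le_iff_of_nonneg (by norm_num)).2 fun k => ?_
        by_cases hk : k = i <;> simp [Pi.single_apply, hk]
      · rw [Fin.cons_succ]; exact hm j
    · rw [List.map_cons, Dw_cons, ← slice_D (diff_of_smooth (smooth_Dw hv _))]
      simp only [h]
      have hd : DifferentiableAt ℝ (iteratedFDeriv ℝ w.length f) x :=
        (hfs.differentiable_iteratedFDeriv (by exact_mod_cast WithTop.coe_lt_top _)) x
      show _ = iteratedFDeriv ℝ (w.length + 1) f x (Fin.cons (Pi.single i 1) m : Fin (w.length + 1) → Spc)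
      rw [iteratedFDeriv_succ_apply_left]
      simp only [Fin.cons_zero, Fin.tail_cons]
      have := hd.hasFDerivAt
      have h2 : HasFDerivAt (fun x => iteratedFDeriv ℝ w.length f x m)
        ((ContinuousMultilinearMap.apply ℝ (fun _ : Fin w.length => Spc) ℝ m).comp (fderiv ℝ (iteratedFDeriv ℝ w.length f) x)) x :=
        (ContinuousMultilinearMap.apply ℝ (fun _ : Fin w.length => Spc) ℝ m).hasFDerivAt.comp x this
      rw [h2.fderiv]; rfl

lemma Dw_iFD_le {v : Pt → ℝ} (hv : ContDiff ℝ ∞ v) {f : Spc → ℝ} (hf : ∀ x, v (0, x) = f x) (w : List (Fin 3)) (x : Spc) :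
    Dw (w.map Fin.succ) v (0, x) ^ 2 ≤ ‖iteratedFDeriv ℝ w.length f x‖ ^ 2 := by
  obtain ⟨m, hm, h⟩ := Dw_iFD hv hf w
  rw [h, ← sq_abs]
  refine pow_le_pow_left₀ (abs_nonneg _) ?_ 2
  have := (iteratedFDeriv ℝ w.length f x).le_opNorm m
  rw [Real.norm_eq_abs] at this
  refine this.trans (mul_le_of_le_one_right (norm_nonneg _) (Finset.prod_le_one (fun _ _ => norm_nonneg _) fun j _ => hm j))

lemma word_succ (w : List (Fin 4)) (h : w.count 0 = 0) : ∃ w' : List (Fin 3), w = w'.map Fin.succ := by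
  induction w with
  | nil => exact ⟨[], rfl⟩
  | cons a w ih =>
    rw [List.count_cons] at h
    obtain ⟨w', hw⟩ := ih (by omega)
    have ha : a ≠ 0 := by rintro rfl; simp at h
    obtain ⟨b, rfl⟩ := Fin.exists_succ_eq.2 ha
    exact ⟨b :: w', by rw [List.map_cons, hw]⟩

def SS (N : ℕ) (δ : ℝ) (f g : Spc → ℝ) (x : Spc) : ℝ :=
  ∑ k ∈ Finset.range (N + 2), SQ δ k f x + ∑ k ∈ Finset.range (N + 1), SQ (δ + 1) k g x

lemma jb_rp (δ : ℝ) (k : ℕ) (x : Spc) : jb x ^ (2 * (δ + 1)) * (jb x ^ 2) ^ k = sw (δ + 1) k x ^ 2 := by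
  unfold sw
  rw [← pow_mul, ← Real.rpow_natCast, ← Real.rpow_add (jb_pos x), ← Real.rpow_natCast (_ ^ _) 2, ← Real.rpow_mul (jb_pos x).le]
  congr 1; push_cast; ring

lemma dat_bd (N : ℕ) {δ : ℝ} (hδ : -(1/2) < δ) : ∃ C : ℝ, 0 < C ∧ ∀ u : Pt → ℝ, ContDiff ℝ ∞ u → ∀ f g : Spc → ℝ,
    (∀ x, u (0, x) = f x ∧ D 0 u (0, x) = g x) → ∀ x, WW (2 * (δ + 1)) (0, x) * DAT N u x ≤ C * SS N δ f g x := by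
  refine ⟨(3 * 3 ^ (2 * (δ + 1))) * ((wdd N).card + 1), by positivity, fun u hu f g hd x => ?_⟩
  have h1 : WW (2 * (δ + 1)) (0, x) ≤ 3 * 3 ^ (2 * (δ + 1)) * jb x ^ (2 * (δ + 1)) := by
    unfold WW; simpa using wt_jb_le (a := 2 * (δ + 1)) (by linarith) x
  have hj := jb_pos x
  have hS : 0 ≤ SS N δ f g x := by
    unfold SS
    exact add_nonneg (Finset.sum_nonneg fun _ _ => SQ_nonneg _ _ _ _) (Finset.sum_nonneg fun _ _ => SQ_nonneg _ _ _ _)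
  have h2 : jb x ^ (2 * (δ + 1)) * DAT N u x ≤ (wdd N).card * SS N δ f g x := by
    unfold DAT
    rw [Finset.mul_sum]
    refine (Finset.sum_le_card_nsmul _ _ (SS N δ f g x) fun w hw => ?_).trans (le_of_eq (by rw [nsmul_eq_mul]))
    unfold wdd at hw
    rw [Finset.mem_filter, mem_wd4] at hw
    obtain ⟨hl, hl1, hc⟩ := hw
    rw [← mul_assoc, jb_rp]
    have key : ∀ (δ' : ℝ) (k : ℕ) (h : Spc → ℝ), Dw w u (0, x) ^ 2 ≤ ‖iteratedFDeriv ℝ k h x‖ ^ 2 →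
        sw δ' k x ^ 2 * Dw w u (0, x) ^ 2 ≤ SQ δ' k h x := by
      intro δ' k h hh
      unfold SQ; rw [mul_pow]
      exact mul_le_mul_of_nonneg_left hh (sq_nonneg _)
    rcases Nat.le_one_iff_eq_zero_or_eq_one.1 hc with h0 | h0
    · obtain ⟨w', rfl⟩ := word_succ w h0
      rw [List.length_map] at hl hl1 ⊢
      have e : sw (δ + 1) (w'.length - 1) x = sw δ w'.length x := by
        unfold sw; congr 1; push_cast [hl1]; ring
      rw [e]
      refine (key δ w'.length f (Dw_iFD_le hu (fun x => (hd x).1) w' x)).trans ?_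
      unfold SS
      refine le_trans ?_ (le_add_of_nonneg_right (Finset.sum_nonneg fun _ _ => SQ_nonneg _ _ _ _))
      exact Finset.single_le_sum (f := fun k => SQ δ k f x) (fun _ _ => SQ_nonneg _ _ _ _) (Finset.mem_range.2 (by omega))
    · have hm : (0 : Fin 4) ∈ w := List.count_pos_iff.1 (by omega)
      have hp : w.Perm (w.erase 0 ++ [0]) := (List.perm_cons_erase hm).trans (List.perm_append_singleton 0 _).symm
      obtain ⟨w', hw'⟩ := word_succ (w.erase 0) (by rw [List.count_erase_self]; omega)
      have hlen : w.length - 1 = w'.length := by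
        rw [← List.length_erase_of_mem hm, hw', List.length_map]
      rw [hlen]
      refine (key (δ + 1) w'.length g ?_).trans ?_
      · rw [Dw_perm hu hp, Dw_snoc, hw']
        exact Dw_iFD_le (smooth_D hu 0) (fun x => (hd x).2) w' x
      · unfold SS
        refine le_trans ?_ (le_add_of_nonneg_left (Finset.sum_nonneg fun _ _ => SQ_nonneg _ _ _ _))
        exact Finset.single_le_sum (f := fun k => SQ (δ + 1) k g x) (fun _ _ => SQ_nonneg _ _ _ _) (Finset.mem_range.2 (by omega))
  calc _ ≤ 3 * 3 ^ (2 * (δ + 1)) * jb x ^ (2 * (δ + 1)) * DAT N u x := mul_le_mul_of_nonneg_right h1 (DAT_nonneg _ _ _)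
    _ = 3 * 3 ^ (2 * (δ + 1)) * (jb x ^ (2 * (δ + 1)) * DAT N u x) := by ring
    _ ≤ 3 * 3 ^ (2 * (δ + 1)) * ((wdd N).card * SS N δ f g x) := mul_le_mul_of_nonneg_left h2 (by positivity)
    _ ≤ _ := by
      have : 0 ≤ 3 * (3:ℝ) ^ (2 * (δ + 1)) * SS N δ f g x := by positivity
      nlinarith

lemma SS_add (N : ℕ) (δ : ℝ) {f1 f2 g1 g2 : Spc → ℝ} (h1 : ContDiff ℝ (N + 1 : ℕ) f1) (h2 : ContDiff ℝ (N + 1 : ℕ) f2)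
    (k1 : ContDiff ℝ (N : ℕ) g1) (k2 : ContDiff ℝ (N : ℕ) g2) (x : Spc) :
    SS N δ (fun x => f1 x + f2 x) (fun x => g1 x + g2 x) x ≤ 2 * SS N δ f1 g1 x + 2 * SS N δ f2 g2 x := by
  have a1 := Finset.sum_le_sum fun k (hk : k ∈ Finset.range (N + 2)) => SQ_add δ (k := k) (m := N + 1) (by have := Finset.mem_range.1 hk; omega) h1 h2 x
  have a2 := Finset.sum_le_sum fun k (hk : k ∈ Finset.range (N + 1)) => SQ_add (δ + 1) (k := k) (m := N) (by have := Finset.mem_range.1 hk; omega) k1 k2 x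
  rw [Finset.sum_add_distrib, ← Finset.mul_sum, ← Finset.mul_sum] at a1 a2
  unfold SS; linarith

/-- Bounds on weighted Sobolev data. -/
structure SB (N : ℕ) (δ A : ℝ) (f g : Spc → ℝ) : Prop where
  f : ∀ k ≤ N + 1, Integrable (SQ δ k f) ∧ ∫ x, SQ δ k f x ≤ A
  g : ∀ k ≤ N, Integrable (SQ (δ + 1) k g) ∧ ∫ x, SQ (δ + 1) k g x ≤ A

lemma SB.int {N : ℕ} {δ A : ℝ} {f g : Spc → ℝ} (h : SB N δ A f g) : Integrable (SS N δ f g) :=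
  (integrable_finset_sum _ fun k hk => (h.f k (by have := Finset.mem_range.1 hk; omega)).1).add
    (integrable_finset_sum _ fun k hk => (h.g k (by have := Finset.mem_range.1 hk; omega)).1)

lemma SB.le {N : ℕ} {δ A : ℝ} {f g : Spc → ℝ} (h : SB N δ A f g) : ∫ x, SS N δ f g x ≤ (2 * N + 3) * A := by
  unfold SS
  rw [integral_add (integrable_finset_sum _ fun k hk => (h.f k (by have := Finset.mem_range.1 hk; omega)).1)
    (integrable_finset_sum _ fun k hk => (h.g k (by have := Finset.mem_range.1 hk; omega)).1),
    integral_finset_sum _ (fun k hk => (h.f k (by have := Finset.mem_range.1 hk; omega)).1),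
    integral_finset_sum _ (fun k hk => (h.g k (by have := Finset.mem_range.1 hk; omega)).1)]
  have a1 := Finset.sum_le_card_nsmul (Finset.range (N + 2)) (fun k => ∫ x, SQ δ k f x) A fun k hk => (h.f k (by have := Finset.mem_range.1 hk; omega)).2
  have a2 := Finset.sum_le_card_nsmul (Finset.range (N + 1)) (fun k => ∫ x, SQ (δ + 1) k g x) A fun k hk => (h.g k (by have := Finset.mem_range.1 hk; omega)).2
  rw [nsmul_eq_mul, Finset.card_range] at a1 a2
  push_cast at a1 a2
  linarith

lemma SQ_neg (δ : ℝ) (k : ℕ) (f : Spc → ℝ) : SQ δ k (fun x => - f x) = SQ δ k f := by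
  funext x
  unfold SQ
  rw [show (fun x => - f x) = -f from rfl, iteratedFDeriv_neg, Pi.neg_apply, norm_neg]

lemma SB.neg {N : ℕ} {δ A : ℝ} {f g : Spc → ℝ} (h : SB N δ A f g) : SB N δ A (fun x => - f x) (fun x => - g x) :=
  ⟨by simpa only [SQ_neg] using h.f, by simpa only [SQ_neg] using h.g⟩

lemma DN_le (N : ℕ) {δ : ℝ} (hδ : -(1/2) < δ) : ∃ C : ℝ, 0 < C ∧ ∀ u : Pt → ℝ, ContDiff ℝ ∞ u → Scs u → ∀ (A B : ℝ) (f1 f2 g1 g2 : Spc → ℝ),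
    ContDiff ℝ (N + 1 : ℕ) f1 → ContDiff ℝ (N + 1 : ℕ) f2 → ContDiff ℝ (N : ℕ) g1 → ContDiff ℝ (N : ℕ) g2 →
    SB N δ A f1 g1 → SB N δ B f2 g2 → (∀ x, u (0, x) = f1 x + f2 x ∧ D 0 u (0, x) = g1 x + g2 x) →
    DN (2 * (δ + 1)) N u ≤ C * (A + B) := by
  obtain ⟨C, hC, h⟩ := dat_bd N hδ
  refine ⟨C * (2 * (2 * N + 3)), by positivity, fun u hu hs A B f1 f2 g1 g2 h1 h2 k1 k2 b1 b2 hd => ?_⟩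
  have hb := h u hu (fun x => f1 x + f2 x) (fun x => g1 x + g2 x) hd
  have hi := ((b1.int.const_mul 2).add (b2.int.const_mul 2)).const_mul C
  unfold DN
  refine (integral_mono (int_DN _ N hu hs) hi fun x => (hb x).trans (mul_le_mul_of_nonneg_left (SS_add N δ h1 h2 k1 k2 x) hC.le)).trans ?_
  simp only [Pi.add_apply]
  rw [integral_const_mul, integral_add (b1.int.const_mul 2) (b2.int.const_mul 2), integral_const_mul, integral_const_mul]
  have e1 := b1.le
  have e2 := b2.le
  rw [mul_assoc]
  exact mul_le_mul_of_nonneg_left (by linarith) hC.le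

lemma itr_exists {d : ℕ} (N : ℕ) {δ : ℝ} (hδ : -(1/2) < δ) : ∃ C0 : ℝ, 0 < C0 ∧
    ∀ (M : Fin d → Fin d → Fin d → Matrix (Fin 4) (Fin 4) ℝ) (A : ℝ) (hA : 0 < A) (φ₀ φ₁ : Fin d → Spc → ℝ),
    (∀ i, ContDiff ℝ (N + 1 : ℕ) (φ₀ i) ∧ ContDiff ℝ (N : ℕ) (φ₁ i)) → (∀ i, SB N δ A (φ₀ i) (φ₁ i)) →
    ∃ f, Itr M (2 * (δ + 1)) N (C0 * A) f ∧ ∀ i x, Filter.Tendsto (fun n => f n i (0, x)) Filter.atTop (nhds (φ₀ i x)) ∧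
      Filter.Tendsto (fun n => D 0 (f n i) (0, x)) Filter.atTop (nhds (φ₁ i x)) := by
  obtain ⟨C, hC, hDN⟩ := DN_le N hδ
  refine ⟨5 * C, by positivity, fun M A hA φ₀ φ₁ hc hb => ?_⟩
  choose F Fs Fc Fp Fi using fun (n : ℕ) i => approx (hc i).1 δ (fun k hk => ((hb i).f k hk).1) (η := A / 4 ^ n) (by positivity) n
  choose G Gs Gc Gp Gi using fun (n : ℕ) i => approx (hc i).2 (δ + 1) (fun k hk => ((hb i).g k hk).1) (η := A / 4 ^ n) (by positivity) n
  have eb : ∀ n i, SB N δ (A / 4 ^ n) (fun x => F n i x - φ₀ i x) (fun x => G n i x - φ₁ i x) := fun n i => ⟨Fi n i, Gi n i⟩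
  have hF : ∀ n i, ContDiff ℝ (N + 1 : ℕ) (F n i) := fun n i => (Fs n i).of_le (by exact_mod_cast le_top)
  have hG : ∀ n i, ContDiff ℝ (N : ℕ) (G n i) := fun n i => (Gs n i).of_le (by exact_mod_cast le_top)
  let V := {u : Fin d → Pt → ℝ // ∀ i, ContDiff ℝ ∞ (u i) ∧ Scs (u i)}
  have base : ∃ u : V, ∀ i, bx (u.1 i) = (fun _ => 0) ∧ ∀ x, u.1 i (0, x) = F 0 i x ∧ D 0 (u.1 i) (0, x) = G 0 i x := by
    choose u h1 h2 h3 h4 using fun i => lin_solve (F := fun _ => 0) contDiff_const Scs.zero (Fs 0 i) (Gs 0 i) (Fc 0 i) (Gc 0 i)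
    exact ⟨⟨u, fun i => ⟨h1 i, h2 i⟩⟩, fun i => ⟨h3 i, h4 i⟩⟩
  have step : ∀ (n : ℕ) (v : V), ∃ u : V, ∀ i, bx (u.1 i) = NL M v.1 i ∧ ∀ x, u.1 i (0, x) = F (n + 1) i x ∧ D 0 (u.1 i) (0, x) = G (n + 1) i x := by
    intro n v
    choose u h1 h2 h3 h4 using fun i => lin_solve (F := NL M v.1 i)
      (ContDiff.sum fun k _ => smooth_QF _ (v.2 k.1).1 (v.2 k.2).1) (Scs.sum _ fun k _ => QF_scs _ _ (v.2 k.2).2)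
      (Fs (n + 1) i) (Gs (n + 1) i) (Fc (n + 1) i) (Gc (n + 1) i)
    exact ⟨⟨u, fun i => ⟨h1 i, h2 i⟩⟩, fun i => ⟨h3 i, h4 i⟩⟩
  obtain ⟨u0, hu0⟩ := base
  choose st hst using step
  let f : ℕ → V := fun n => Nat.rec u0 st n
  have hd : ∀ n i x, (f n).1 i (0, x) = F n i x ∧ D 0 ((f n).1 i) (0, x) = G n i x := by
    intro n i x
    cases n with
    | zero => exact (hu0 i).2 x
    | succ n => exact (hst n (f n) i).2 x
  refine ⟨fun n => (f n).1, ⟨fun n i => ((f n).2 i).1, fun n i => ((f n).2 i).2, fun i => (hu0 i).1, fun n i => (hst n (f n) i).1, fun n i => ?_, fun n i => ?_⟩, fun i x => ?_⟩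
  · refine (hDN _ ((f n).2 i).1 ((f n).2 i).2 _ _ _ _ _ _ ((hF n i).sub (hc i).1) (hc i).1 ((hG n i).sub (hc i).2) (hc i).2 (eb n i) (hb i) fun x => ?_).trans ?_
    · rw [(hd n i x).1, (hd n i x).2]; exact ⟨by ring, by ring⟩
    · have : A / 4 ^ n ≤ A := div_le_self hA.le (one_le_pow₀ (by norm_num))
      nlinarith
  · have s1 := ((f (n + 1)).2 i).1
    have s2 := ((f n).2 i).1
    refine (hDN _ (s1.sub s2) (((f (n + 1)).2 i).2.sub ((f n).2 i).2) _ _ _ _ _ _ ((hF (n + 1) i).sub (hc i).1) ((hF n i).sub (hc i).1).neg ((hG (n + 1) i).sub (hc i).2) ((hG n i).sub (hc i).2).neg (eb (n + 1) i) (eb n i).neg fun x => ?_).trans ?_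
    · rw [D_sub (diff_of_smooth s1) (diff_of_smooth s2)]
      simp only [(hd n i x).1, (hd n i x).2, (hd (n + 1) i x).1, (hd (n + 1) i x).2]
      exact ⟨by ring, by ring⟩
    · rw [pow_succ]
      apply le_of_eq
      field_simp
      ring
  · have key : ∀ (h : ℕ → Spc → ℝ) (φ : Spc → ℝ), (∀ (n : ℕ) x, ‖x‖ ≤ n → |h n x - φ x| ≤ A / 4 ^ n) →
        Filter.Tendsto (fun n => h n x) Filter.atTop (nhds (φ x)) := by
      intro h φ hh
      rw [tendsto_iff_norm_sub_tendsto_zero]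
      have hz : Filter.Tendsto (fun n : ℕ => A * (1 / 4 : ℝ) ^ n) Filter.atTop (nhds 0) := by
        simpa using (tendsto_pow_atTop_nhds_zero_of_lt_one (r := (1 / 4 : ℝ)) (by norm_num) (by norm_num)).const_mul A
      refine squeeze_zero' (Filter.Eventually.of_forall fun _ => norm_nonneg _) ?_ hz
      obtain ⟨n0, hn0⟩ := exists_nat_ge ‖x‖
      filter_upwards [Filter.eventually_ge_atTop n0] with n hn
      refine (hh n x (hn0.trans (by exact_mod_cast hn))).trans (le_of_eq ?_)
      rw [one_div, inv_pow]; rfl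
    simp only [(hd _ i x).1, (hd _ i x).2]
    exact ⟨key (fun n => F n i) (φ₀ i) (fun n => Fp n i), key (fun n => G n i) (φ₁ i) (fun n => Gp n i)⟩

lemma ulim {X E : Type*} [NormedAddCommGroup E] [CompleteSpace E] (f : ℕ → X → E) (S : Set X) (c : ℝ)
    (h : ∀ n, ∀ x ∈ S, ‖f (n + 1) x - f n x‖ ^ 2 ≤ c / 2 ^ n) : ∃ g, TendstoUniformlyOn f g Filter.atTop S := by
  classical
  have hr0 : (0:ℝ) ≤ √(1/2) := Real.sqrt_nonneg _
  have hr : √(1/2 : ℝ) < 1 := by rw [Real.sqrt_lt' one_pos]; norm_num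
  have hb : ∀ x ∈ S, ∀ n, dist (f n x) (f (n + 1) x) ≤ √c * √(1/2) ^ n := by
    intro x hx n
    rw [dist_comm, dist_eq_norm]
    have h1 := Real.sqrt_le_sqrt (h n x hx)
    rw [Real.sqrt_sq (norm_nonneg _)] at h1
    refine h1.trans (le_of_eq ?_)
    rw [div_eq_mul_inv, Real.sqrt_mul' _ (by positivity), show ((2:ℝ) ^ n)⁻¹ = (√(1/2) ^ n) ^ 2 by
      rw [← pow_mul, mul_comm, pow_mul, Real.sq_sqrt (by norm_num)]; simp, Real.sqrt_sq (by positivity)]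
  have hl : ∀ x, ∃ l, x ∈ S → Filter.Tendsto (fun n => f n x) Filter.atTop (nhds l) := by
    intro x
    by_cases hx : x ∈ S
    · obtain ⟨l, hl⟩ := cauchySeq_tendsto_of_complete (cauchySeq_of_le_geometric _ _ hr (hb x hx))
      exact ⟨l, fun _ => hl⟩
    · exact ⟨0, fun h => absurd h hx⟩
  choose g hg using hl
  refine ⟨g, Metric.tendstoUniformlyOn_iff.2 fun e he => ?_⟩
  have hz : Filter.Tendsto (fun n : ℕ => √c * √(1/2) ^ n / (1 - √(1/2))) Filter.atTop (nhds 0) := by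
    simpa using ((tendsto_pow_atTop_nhds_zero_of_lt_one hr0 hr).const_mul (√c)).div_const (1 - √(1/2))
  filter_upwards [hz.eventually (gt_mem_nhds he)] with n hn x hx
  rw [dist_comm]
  exact (dist_le_of_le_geometric_of_tendsto _ _ hr (hb x hx) (hg x hx) n).trans_lt hn

lemma nb {E : Type*} [NormedAddCommGroup E] [NormedSpace ℝ E] (T : Pt →L[ℝ] E) : ‖T‖ ^ 2 ≤ 4 * ∑ a, ‖T (ev a)‖ ^ 2 := by
  have h : ‖T‖ ≤ ∑ a, ‖T (ev a)‖ := by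
    refine T.opNorm_le_bound (Finset.sum_nonneg fun _ _ => norm_nonneg _) fun v => ?_
    conv_lhs => rw [pt_decomp v]
    rw [map_sum, Finset.sum_mul]
    refine (norm_sum_le _ _).trans (Finset.sum_le_sum fun a _ => ?_)
    rw [map_smul, norm_smul, mul_comm]
    refine mul_le_mul_of_nonneg_left ?_ (norm_nonneg _)
    refine Fin.cases ?_ (fun i => ?_) a
    · exact norm_fst_le v
    · exact (norm_le_pi_norm v.2 i).trans (norm_snd_le v)
  have h2 := sq_sum_le_card_mul_sum_sq (s := Finset.univ) (f := fun a => ‖T (ev a)‖)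
  have h3 : ‖T‖ ^ 2 ≤ (∑ a, ‖T (ev a)‖) ^ 2 := pow_le_pow_left₀ (norm_nonneg _) h 2
  simp at h2
  linarith

lemma c2lim {U : ℕ → Pt → ℝ} (hU : ∀ n, ContDiff ℝ ∞ (U n)) {c : ℝ}
    (h1 : ∀ n a p, (D a (U (n+1)) p - D a (U n) p) ^ 2 ≤ c / 2 ^ n)
    (h2 : ∀ n a b p, (D a (D b (U (n+1))) p - D a (D b (U n)) p) ^ 2 ≤ c / 2 ^ n) {φ : Pt → ℝ}
    (hφ : ∀ p, Filter.Tendsto (fun n => U n p) Filter.atTop (nhds (φ p))) : ContDiff ℝ 2 φ := by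
  have s1 : ∀ n, ContDiff ℝ ∞ (fderiv ℝ (U n)) := fun n => (hU n).fderiv_right (by simp)
  have s2 : ∀ n, ContDiff ℝ ∞ (fderiv ℝ (fderiv ℝ (U n))) := fun n => (s1 n).fderiv_right (by simp)
  have e2 : ∀ n a b p, (fderiv ℝ (fderiv ℝ (U n)) p (ev a)) (ev b) = D a (D b (U n)) p := by
    intro n a b p
    have hd : DifferentiableAt ℝ (fderiv ℝ (U n)) p := (s1 n).differentiable (by simp) p
    have : HasFDerivAt (D b (U n)) ((ContinuousLinearMap.apply ℝ ℝ (ev b)).comp (fderiv ℝ (fderiv ℝ (U n)) p)) p :=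
      (ContinuousLinearMap.apply ℝ ℝ (ev b)).hasFDerivAt.comp p hd.hasFDerivAt
    show _ = fderiv ℝ (D b (U n)) p (ev a)
    rw [this.fderiv]; rfl
  obtain ⟨G, hG⟩ := ulim (fun n => fderiv ℝ (U n)) Set.univ (16 * c) (by
    intro n p _
    refine (nb _).trans ?_
    have : ∑ a, ‖(fderiv ℝ (U (n+1)) p - fderiv ℝ (U n) p) (ev a)‖ ^ 2 ≤ ∑ a : Fin 4, c / 2 ^ n :=
      Finset.sum_le_sum fun a _ => by
        rw [Real.norm_eq_abs, sq_abs]; exact h1 n a p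
    simp only [Finset.sum_const, Finset.card_univ, Fintype.card_fin, nsmul_eq_mul, Nat.cast_ofNat] at this
    calc _ ≤ 4 * (4 * (c / 2 ^ n)) := by linarith
      _ = _ := by ring)
  obtain ⟨H, hH⟩ := ulim (fun n => fderiv ℝ (fderiv ℝ (U n))) Set.univ (256 * c) (by
    intro n p _
    refine (nb _).trans ?_
    have : ∑ a, ‖(fderiv ℝ (fderiv ℝ (U (n+1))) p - fderiv ℝ (fderiv ℝ (U n)) p) (ev a)‖ ^ 2 ≤ ∑ a : Fin 4, 16 * (c / 2 ^ n) :=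
      Finset.sum_le_sum fun a _ => by
        refine (nb _).trans ?_
        have : ∑ b, ‖((fderiv ℝ (fderiv ℝ (U (n+1))) p - fderiv ℝ (fderiv ℝ (U n)) p) (ev a)) (ev b)‖ ^ 2 ≤ ∑ b : Fin 4, c / 2 ^ n :=
          Finset.sum_le_sum fun b _ => by
            rw [Real.norm_eq_abs, sq_abs, ContinuousLinearMap.sub_apply, ContinuousLinearMap.sub_apply, e2, e2]; exact h2 n a b p
        simp only [Finset.sum_const, Finset.card_univ, Fintype.card_fin, nsmul_eq_mul, Nat.cast_ofNat] at this
        linarith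
    simp only [Finset.sum_const, Finset.card_univ, Fintype.card_fin, nsmul_eq_mul, Nat.cast_ofNat] at this
    calc _ ≤ 4 * (4 * (16 * (c / 2 ^ n))) := by linarith
      _ = _ := by ring)
  rw [tendstoUniformlyOn_univ] at hG hH
  have dG : ∀ p, HasFDerivAt φ (G p) p := fun p =>
    hasFDerivAt_of_tendstoUniformly hG (fun n p => (diff_of_smooth (hU n) p).hasFDerivAt) hφ p
  have dH : ∀ p, HasFDerivAt G (H p) p := fun p =>
    hasFDerivAt_of_tendstoUniformly hH (fun n p => ((s1 n).differentiable (by simp) p).hasFDerivAt) (fun p => hG.tendsto_at p) p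
  have cH : Continuous H := hH.continuous (Filter.Eventually.frequently (.of_forall fun n => (s2 n).continuous))
  have g1 : ContDiff ℝ 1 G := by
    have := (contDiff_succ_iff_hasFDerivAt (𝕜 := ℝ) (n := 0) (f := G)).2 ⟨H, contDiff_zero.2 cH, dH⟩
    simpa using this
  have := (contDiff_succ_iff_hasFDerivAt (𝕜 := ℝ) (n := 1) (f := φ)).2 ⟨G, by exact_mod_cast g1, dG⟩
  rw [show (2 : WithTop ℕ∞) = 1 + 1 by norm_num]
  exact_mod_cast this

lemma sg_eq (v : Pt → ℝ) (p : Pt) (a : Fin 4) : sgrad v p a = deriv (fun s : ℝ => v (p + s • ev a)) 0 := by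
  have h0 : sgrad v p 0 = deriv (fun s : ℝ => v (p + s • ev 0)) 0 := by
    show deriv (fun s => v (s, p.2)) p.1 = _
    have := deriv_comp_sub_const (f := fun s : ℝ => v (p + s • ev 0)) p.1 p.1
    rw [sub_self] at this
    rw [← this]
    congr 1; funext s; congr 1
    ext j <;> simp
  have h1 : ∀ i : Fin 3, pxd i v p = deriv (fun s : ℝ => v (p + s • ev i.succ)) 0 := by
    intro i
    show deriv (fun s => v (p.1, Function.update p.2 i s)) (p.2 i) = _
    have := deriv_comp_sub_const (f := fun s : ℝ => v (p + s • ev i.succ)) (p.2 i) (p.2 i)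
    rw [sub_self] at this
    rw [← this]
    congr 1; funext s; congr 1
    ext j
    · simp
    · by_cases hj : j = i
      · subst hj; simp
      · simp [hj, Pi.single_apply]
  refine Fin.cases h0 (fun i => ?_) a
  rw [← h1 i]
  fin_cases i <;> rfl

lemma mink_eq (m : Fin 11) (v : Pt → ℝ) (p : Pt) : mink m v p = ∑ a, vc m a p * sgrad v p a := by
  have key : ∀ (w : Fin 4 → ℝ) (B : Matrix (Fin 4) (Fin 4) ℝ), va m = w → vB m = B →
      ∑ a, vc m a p * sgrad v p a = ∑ a, (w a + ∑ b, B a b * Xc b p) * sgrad v p a := by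
    rintro w B rfl rfl; rfl
  have e0 : sgrad v p 0 = ptd v p := rfl
  have e1 : sgrad v p 1 = pxd 0 v p := rfl
  have e2 : sgrad v p 2 = pxd 1 v p := rfl
  have e3 : sgrad v p 3 = pxd 2 v p := rfl
  fin_cases m
  · rw [key (Pi.single 0 1) 0 rfl rfl]; simp [Fin.sum_univ_four, mink, e0, e1, e2, e3]
  · rw [key (Pi.single 1 1) 0 rfl rfl]; simp [Fin.sum_univ_four, mink, e0, e1, e2, e3]
  · rw [key (Pi.single 2 1) 0 rfl rfl]; simp [Fin.sum_univ_four, mink, e0, e1, e2, e3]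
  · rw [key (Pi.single 3 1) 0 rfl rfl]; simp [Fin.sum_univ_four, mink, e0, e1, e2, e3, Pi.single_apply]
  · rw [key 0 1 rfl rfl]; simp [Fin.sum_univ_four, Fin.sum_univ_three, mink, vfS, e0, e1, e2, e3, Matrix.one_apply, Xc1, Xc2, Xc3]; try ring
  · rw [key 0 (!![0, -1, 0, 0; -1, 0, 0, 0; 0, 0, 0, 0; 0, 0, 0, 0]) rfl rfl]; simp [Fin.sum_univ_four, mink, vfBoost, e0, e1, e2, e3, Xc1, Xc2, Xc3]; try ring
  · rw [key 0 (!![0, 0, -1, 0; 0, 0, 0, 0; -1, 0, 0, 0; 0, 0, 0, 0]) rfl rfl]; simp [Fin.sum_univ_four, mink, vfBoost, e0, e1, e2, e3, Xc1, Xc2, Xc3]; try ring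
  · rw [key 0 (!![0, 0, 0, -1; 0, 0, 0, 0; 0, 0, 0, 0; -1, 0, 0, 0]) rfl rfl]; simp [Fin.sum_univ_four, mink, vfBoost, e0, e1, e2, e3, Xc1, Xc2, Xc3]; try ring
  · rw [key 0 (!![0, 0, 0, 0; 0, 0, -1, 0; 0, 1, 0, 0; 0, 0, 0, 0]) rfl rfl]; simp [Fin.sum_univ_four, mink, vfRot, e0, e1, e2, e3, Xc1, Xc2, Xc3]; try ring
  · rw [key 0 (!![0, 0, 0, 0; 0, 0, 0, -1; 0, 0, 0, 0; 0, 1, 0, 0]) rfl rfl]; simp [Fin.sum_univ_four, mink, vfRot, e0, e1, e2, e3, Xc1, Xc2, Xc3]; try ring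
  · rw [key 0 (!![0, 0, 0, 0; 0, 0, 0, 0; 0, 0, 0, -1; 0, 0, 1, 0]) rfl rfl]; simp [Fin.sum_univ_four, mink, vfRot, e0, e1, e2, e3, Xc1, Xc2, Xc3]; try ring

lemma line_deriv {v : Pt → ℝ} (hv : ContDiff ℝ ∞ v) (p : Pt) (a : Fin 4) (s : ℝ) :
    HasDerivAt (fun s : ℝ => v (p + s • ev a)) (D a v (p + s • ev a)) s := by
  have h1 : HasDerivAt (fun s : ℝ => p + s • ev a) (ev a) s := by
    simpa using ((hasDerivAt_id s).smul_const (ev a)).const_add p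
  exact (diff_of_smooth hv (p + s • ev a)).hasFDerivAt.comp_hasDerivAt s h1

/-- One more vector field in the limit. -/
lemma lim_step {V : ℕ → Pt → ℝ} (hV : ∀ n, ContDiff ℝ ∞ (V n)) {v : Pt → ℝ} {p : Pt} {c : ℝ}
    (ht : ∀ b, ∀ s ∈ Set.Ioo (-1:ℝ) 1, Filter.Tendsto (fun n => V n (p + s • ev b)) Filter.atTop (nhds (v (p + s • ev b))))
    (hd : ∀ b, ∀ s ∈ Set.Ioo (-1:ℝ) 1, ∀ n, (D b (V (n+1)) (p + s • ev b) - D b (V n) (p + s • ev b)) ^ 2 ≤ c / 2 ^ n) (m : Fin 11) :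
    Filter.Tendsto (fun n => Zf m (V n) p) Filter.atTop (nhds (mink m v p)) := by
  rw [mink_eq]
  unfold Zf
  refine tendsto_finset_sum _ fun b _ => Filter.Tendsto.const_mul _ ?_
  obtain ⟨g, hg⟩ := ulim (fun n (s : ℝ) => D b (V n) (p + s • ev b)) (Set.Ioo (-1) 1) c (by
    intro n s hs; rw [Real.norm_eq_abs, sq_abs]; exact hd b s hs n)
  have h0 : (0:ℝ) ∈ Set.Ioo (-1:ℝ) 1 := by norm_num
  have := hasDerivAt_of_tendstoUniformlyOn isOpen_Ioo hg (.of_forall fun n s _ => line_deriv (hV n) p b s) (ht b) h0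
  rw [sg_eq, this.deriv]
  simpa using hg.tendsto_at h0

/-- Integral along a segment in a coordinate direction. -/
def Le (a : Fin 4) (g : Pt → ℝ≥0∞) (p : Pt) : ℝ≥0∞ := ∫⁻ s in Set.Icc (-1:ℝ) 2, g (p + s • ev a)

lemma meas_shift (a : Fin 4) : Measurable fun z : Pt × ℝ => z.1 + z.2 • ev a :=
  (by fun_prop : Continuous fun z : Pt × ℝ => z.1 + z.2 • ev a).measurable

lemma Le_meas (a : Fin 4) {g : Pt → ℝ≥0∞} (hg : Measurable g) : Measurable (Le a g) := by
  unfold Le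
  exact Measurable.lintegral_prod_right' (f := fun z : Pt × ℝ => g (z.1 + z.2 • ev a)) (hg.comp (meas_shift a))

lemma shift_int (a : Fin 4) (g : Pt → ℝ≥0∞) {B : ℝ≥0∞} (h : ∀ t, ∫⁻ x, g (t, x) ≤ B) (t s : ℝ) :
    ∫⁻ x, g ((t, x) + s • ev a) ≤ B := by
  refine Fin.cases ?_ (fun i => ?_) a
  · simpa using h (t + s)
  · have := lintegral_add_right_eq_self (μ := (volume : Measure Spc)) (fun x => g (t, x)) (s • Pi.single i 1)
    refine le_trans (le_of_eq ?_) (h t)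
    rw [← this]
    refine lintegral_congr fun x => ?_
    congr 1
    ext j <;> simp

lemma Le_int (a : Fin 4) {g : Pt → ℝ≥0∞} (hg : Measurable g) {B : ℝ≥0∞} (h : ∀ t, ∫⁻ x, g (t, x) ≤ B) (t : ℝ) :
    ∫⁻ x, Le a g (t, x) ≤ 3 * B := by
  unfold Le
  rw [lintegral_lintegral_swap]
  · refine (lintegral_mono fun s => shift_int a g h t s).trans ?_
    rw [lintegral_const, Measure.restrict_apply_univ, Real.volume_Icc, mul_comm]
    norm_num
  · exact (hg.comp ((meas_shift a).comp (by fun_prop : Measurable fun z : Spc × ℝ => (((t, z.1) : Pt), z.2)))).aemeasurable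

lemma Le_line {h : Pt → ℝ} (hh : ContDiff ℝ ∞ h) (a : Fin 4) (p : Pt) {s : ℝ} (hs : s ∈ Set.Icc (-1:ℝ) 1) :
    ENNReal.ofReal (h (p + s • ev a) ^ 2) ≤ 2 * Le a (fun q => ENNReal.ofReal (h q ^ 2) + ENNReal.ofReal (D a h q ^ 2)) p := by
  have hc : Continuous fun s : ℝ => D a h (p + s • ev a) := (cont_D (c1_of_smooth hh) a).comp (by fun_prop)
  have := mv (g := fun s => h (p + s • ev a)) (g' := fun s => D a h (p + s • ev a))
    (B := fun s => h (p + s • ev a) ^ 2 + D a h (p + s • ev a) ^ 2) (z := s) one_pos (fun s _ => line_deriv hh p a s) hc.continuousOn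
    (fun s _ => by simp)
  refine this.trans ?_
  rw [show ENNReal.ofReal (2 / 1) = 2 by norm_num]
  refine mul_le_mul_right ?_ 2
  unfold Le
  refine (lintegral_mono_set (Set.Icc_subset_Icc hs.1 (by linarith [hs.2]))).trans (lintegral_mono fun s => ?_)
  rw [ENNReal.ofReal_add (sq_nonneg _) (sq_nonneg _)]

lemma Le_mono (a : Fin 4) {f g : Pt → ℝ≥0∞} {c : ℝ≥0∞} (hc : c ≠ ⊤) (p : Pt) (h : ∀ s : ℝ, f (p + s • ev a) ≤ c * g (p + s • ev a)) :
    Le a f p ≤ c * Le a g p := by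
  unfold Le
  rw [← lintegral_const_mul' _ _ hc]
  exact lintegral_mono h

lemma D_Zf_fun (b : Fin 4) : ∃ n : Fin 11, ∀ f : Pt → ℝ, D b f = Zf n f := by
  fin_cases b
  · exact ⟨0, fun f => by funext p; rw [Zf_of 0 (Pi.single 0 1) 0 rfl rfl]; simp [Pi.single_apply]⟩
  · exact ⟨1, fun f => by funext p; rw [Zf_of 1 (Pi.single 1 1) 0 rfl rfl]; simp [Pi.single_apply]⟩
  · exact ⟨2, fun f => by funext p; rw [Zf_of 2 (Pi.single 2 1) 0 rfl rfl]; simp [Pi.single_apply]⟩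
  · exact ⟨3, fun f => by funext p; rw [Zf_of 3 (Pi.single 3 1) 0 rfl rfl]; simp [Pi.single_apply]⟩

lemma T0 {N : ℕ} {K : List (Fin 11)} (hK : K.length ≤ N) (b : Fin 4) (u : Pt → ℝ) (p : Pt) :
    ENNReal.ofReal (D b (Zw K u) p ^ 2) ≤ ENNReal.ofReal (eW N u p) :=
  ENNReal.ofReal_le_ofReal ((D_sq_le_dsq _ p b).trans (le_eW hK u p))

lemma T1 {N : ℕ} {K : List (Fin 11)} (hK : K.length + 1 ≤ N) (b c : Fin 4) {u : Pt → ℝ} (hu : ContDiff ℝ ∞ u) (p : Pt)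
    {s : ℝ} (hs : s ∈ Set.Icc (-1:ℝ) 1) :
    ENNReal.ofReal (D b (Zw K u) (p + s • ev c) ^ 2) ≤ 4 * Le c (fun q => ENNReal.ofReal (eW N u q)) p := by
  refine (Le_line (smooth_D (smooth_Zw hu K) b) c p hs).trans ?_
  obtain ⟨n, hn⟩ := D_Zf_fun b
  have := Le_mono c (f := fun q => ENNReal.ofReal (D b (Zw K u) q ^ 2) + ENNReal.ofReal (D c (D b (Zw K u)) q ^ 2))
    (g := fun q => ENNReal.ofReal (eW N u q)) (c := 2) (by norm_num) p (fun s => by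
      rw [two_mul, hn, ← Zw_cons]
      refine add_le_add ?_ (T0 (by simpa using hK) c u _)
      rw [Zw_cons, ← hn]
      exact T0 (by omega) b u _)
  calc _ ≤ 2 * (2 * Le c (fun q => ENNReal.ofReal (eW N u q)) p) := mul_le_mul_right this 2
    _ = _ := by rw [← mul_assoc]; norm_num

lemma T2 {N : ℕ} {K : List (Fin 11)} (hK : K.length + 2 ≤ N) (b c e : Fin 4) {u : Pt → ℝ} (hu : ContDiff ℝ ∞ u) (p : Pt)
    {s r : ℝ} (hs : s ∈ Set.Icc (-1:ℝ) 1) (hr : r ∈ Set.Icc (-1:ℝ) 1) :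
    ENNReal.ofReal (D b (Zw K u) (p + s • ev c + r • ev e) ^ 2) ≤ 16 * Le e (Le c (fun q => ENNReal.ofReal (eW N u q))) p := by
  obtain ⟨n, hn⟩ := D_Zf_fun b
  refine (Le_line (smooth_D (smooth_Zw hu K) b) e (p + s • ev c) hr).trans ?_
  have e1 : ∀ s' : ℝ, p + s • ev c + s' • ev e = (p + s' • ev e) + s • ev c := fun s' => by abel
  have : Le e (fun q => ENNReal.ofReal (D b (Zw K u) q ^ 2) + ENNReal.ofReal (D e (D b (Zw K u)) q ^ 2)) (p + s • ev c)
      ≤ 8 * Le e (Le c (fun q => ENNReal.ofReal (eW N u q))) p := by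
    unfold Le
    rw [← lintegral_const_mul' _ _ (by norm_num)]
    refine lintegral_mono fun s' => ?_
    have a1 := T1 (N := N) (K := K) (by omega) b c hu (p + s' • ev e) hs
    have a2 := T1 (N := N) (K := n :: K) (by simp only [List.length_cons]; omega) e c hu (p + s' • ev e) hs
    rw [Zw_cons, ← hn] at a2
    simp only [e1]
    refine (add_le_add a1 a2).trans (le_of_eq ?_)
    rw [← add_mul]; unfold Le; norm_num
  calc _ ≤ 2 * (8 * Le e (Le c (fun q => ENNReal.ofReal (eW N u q))) p) := mul_le_mul_right this 2
    _ = _ := by rw [← mul_assoc]; norm_num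

lemma int_eW (N : ℕ) {u : Pt → ℝ} (hu : ContDiff ℝ ∞ u) (hs : Scs u) {A : ℝ} {t : ℝ} (h : ∫ x, eW N u (t, x) ≤ A) :
    ∫⁻ x, ENNReal.ofReal (eW N u (t, x)) ≤ ENNReal.ofReal A := by
  rw [← ofReal_integral_eq_lintegral_ofReal (slice_int (cont_eW hu N) (hs.eW N) t) (.of_forall fun x => eW_nonneg _ _ _)]
  exact ENNReal.ofReal_le_ofReal h

/-- Almost every point of each time slice is good. -/
lemma good (N : ℕ) {h : ℕ → Pt → ℝ} (hh : ∀ n, ContDiff ℝ ∞ (h n)) (hs : ∀ n, Scs (h n)) {A : ℝ} (hA : 0 ≤ A)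
    (he : ∀ n t, ∫ x, eW N (h n) (t, x) ≤ A / 4 ^ n) (t : ℝ) : ∀ᵐ x : Spc, ∃ C : ℝ, ∀ n,
    (∀ K : List (Fin 11), K.length + 1 ≤ N → ∀ b c, ∀ s ∈ Set.Icc (-1:ℝ) 1, D b (Zw K (h n)) ((t, x) + s • ev c) ^ 2 ≤ C / 2 ^ n) ∧
    (∀ K : List (Fin 11), K.length + 2 ≤ N → ∀ b c e, ∀ s ∈ Set.Icc (-1:ℝ) 1, ∀ r ∈ Set.Icc (-1:ℝ) 1,
      D b (Zw K (h n)) ((t, x) + s • ev c + r • ev e) ^ 2 ≤ C / 2 ^ n) := by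
  set g : ℕ → Pt → ℝ≥0∞ := fun n q => ENNReal.ofReal (eW N (h n) q) with hg
  have gm : ∀ n, Measurable (g n) := fun n => ENNReal.measurable_ofReal.comp (cont_eW (hh n) N).measurable
  have gi : ∀ n t, ∫⁻ x, g n (t, x) ≤ ENNReal.ofReal (A / 4 ^ n) := fun n t => int_eW N (hh n) (hs n) (he n t)
  set S : ℕ → Pt → ℝ≥0∞ := fun n p => ∑ c, Le c (g n) p + ∑ c, ∑ e, Le e (Le c (g n)) p with hS
  have m1 : ∀ n c, Measurable (Le c (g n)) := fun n c => Le_meas c (gm n)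
  have m2 : ∀ n c e, Measurable (Le e (Le c (g n))) := fun n c e => Le_meas e (m1 n c)
  have sl : Measurable fun x : Spc => ((t, x) : Pt) := by fun_prop
  have Sm : ∀ n, Measurable fun x : Spc => S n (t, x) := fun n =>
    (Measurable.add (Finset.measurable_sum _ fun c _ => m1 n c)
      (Finset.measurable_sum _ fun c _ => Finset.measurable_sum _ fun e _ => m2 n c e)).comp sl
  have Si : ∀ n, ∫⁻ x, S n (t, x) ≤ 156 * ENNReal.ofReal (A / 4 ^ n) := by
    intro n
    have i1 : ∀ c t, ∫⁻ x, Le c (g n) (t, x) ≤ 3 * ENNReal.ofReal (A / 4 ^ n) := fun c t => Le_int c (gm n) (gi n) t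
    have i2 : ∀ c e, ∫⁻ x, Le e (Le c (g n)) (t, x) ≤ 9 * ENNReal.ofReal (A / 4 ^ n) := fun c e =>
      (Le_int e (m1 n c) (i1 c) t).trans (le_of_eq (by rw [← mul_assoc]; norm_num))
    simp only [hS]
    rw [lintegral_add_left (f := fun x : Spc => ∑ c, Le c (g n) (t, x)) (Finset.measurable_sum _ fun c _ => (m1 n c).comp sl),
      lintegral_finset_sum _ (f := fun c (x : Spc) => Le c (g n) (t, x)) (fun c _ => (m1 n c).comp sl),
      lintegral_finset_sum _ (f := fun c (x : Spc) => ∑ e, Le e (Le c (g n)) (t, x)) (fun c _ => Finset.measurable_sum _ fun e _ => (m2 n c e).comp sl)]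
    have a1 : ∑ c, ∫⁻ x, Le c (g n) (t, x) ≤ ∑ c : Fin 4, 3 * ENNReal.ofReal (A / 4 ^ n) := Finset.sum_le_sum fun c _ => i1 c t
    have a2 : ∑ c, ∫⁻ x, ∑ e, Le e (Le c (g n)) (t, x) ≤ ∑ c : Fin 4, ∑ e : Fin 4, 9 * ENNReal.ofReal (A / 4 ^ n) :=
      Finset.sum_le_sum fun c _ => by
        rw [lintegral_finset_sum _ (f := fun e (x : Spc) => Le e (Le c (g n)) (t, x)) (fun e _ => (m2 n c e).comp sl)]
        exact Finset.sum_le_sum fun e _ => i2 c e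
    refine (add_le_add a1 a2).trans (le_of_eq ?_)
    simp only [Finset.sum_const, Finset.card_univ, Fintype.card_fin, nsmul_eq_mul]
    rw [← mul_assoc, ← mul_assoc, ← mul_assoc, ← add_mul]
    norm_num
  have fin : ∫⁻ x, ∑' n, 2 ^ n * S n (t, x) ≠ ⊤ := by
    rw [lintegral_tsum fun n => ((Sm n).const_mul _).aemeasurable]
    have : ∀ n, ∫⁻ x, 2 ^ n * S n (t, x) ≤ 156 * ENNReal.ofReal (A * (1/2) ^ n) := by
      intro n
      rw [lintegral_const_mul _ (Sm n)]
      refine (mul_le_mul_right (Si n) _).trans (le_of_eq ?_)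
      rw [mul_left_comm]
      congr 1
      rw [show (2:ℝ≥0∞) ^ n = ENNReal.ofReal (2 ^ n) by rw [ENNReal.ofReal_pow (by norm_num)]; norm_num, ← ENNReal.ofReal_mul (by positivity)]
      congr 1
      rw [show (4:ℝ) = 2 * 2 by norm_num, mul_pow, one_div, inv_pow]; field_simp
    refine ne_top_of_le_ne_top ?_ (ENNReal.tsum_le_tsum this)
    rw [ENNReal.tsum_mul_left]
    exact ENNReal.mul_ne_top (by norm_num) (Summable.tsum_ofReal_ne_top (summable_geometric_two.mul_left A))
  filter_upwards [ae_lt_top' (AEMeasurable.tsum fun n => ((Sm n).const_mul _).aemeasurable) fin] with x hx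
  set T := ∑' n, 2 ^ n * S n (t, x) with hT
  refine ⟨16 * T.toReal, fun n => ?_⟩
  have hle : 16 * S n (t, x) ≤ ENNReal.ofReal (16 * T.toReal / 2 ^ n) := by
    have h1 : 2 ^ n * S n (t, x) ≤ T := ENNReal.le_tsum n
    rw [ENNReal.ofReal_div_of_pos (by positivity), ENNReal.ofReal_mul (by norm_num), ENNReal.ofReal_toReal hx.ne,
      ENNReal.ofReal_pow (by norm_num)]
    rw [ENNReal.le_div_iff_mul_le (by simp) (by simp)]
    calc _ = 16 * (2 ^ n * S n (t, x)) := by norm_num; ring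
      _ ≤ _ := by norm_num; exact mul_le_mul_right h1 16
  have nn : 0 ≤ 16 * T.toReal / 2 ^ n := by positivity
  refine ⟨fun K hK b c s hs => ?_, fun K hK b c e s hs r hr => ?_⟩
  · refine (ENNReal.ofReal_le_ofReal_iff nn).1 (le_trans ?_ hle)
    refine (T1 hK b c (hh n) (t, x) hs).trans (mul_le_mul' (by norm_num) ?_)
    exact le_trans (Finset.single_le_sum (f := fun c => Le c (g n) (t, x)) (fun _ _ => zero_le) (Finset.mem_univ c)) le_self_add
  · refine (ENNReal.ofReal_le_ofReal_iff nn).1 (le_trans ?_ hle)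
    refine (T2 hK b c e (hh n) (t, x) hs hr).trans (mul_le_mul' le_rfl ?_)
    refine le_trans ?_ (le_add_self)
    refine le_trans ?_ (Finset.single_le_sum (f := fun c => ∑ e, Le e (Le c (g n)) (t, x)) (fun _ _ => zero_le) (Finset.mem_univ c))
    exact Finset.single_le_sum (f := fun e => Le e (Le c (g n)) (t, x)) (fun _ _ => zero_le) (Finset.mem_univ e)

open Filter in
/-- A rapidly converging sequence. -/
structure Cv (N : ℕ) (U : ℕ → Pt → ℝ) (A : ℝ) (φ : Pt → ℝ) : Prop where
  sm : ∀ n, ContDiff ℝ ∞ (U n)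
  sc : ∀ n, Scs (U n)
  A0 : 0 ≤ A
  df : ∀ n, AB N (fun p => U (n + 1) p - U n p) (A / 4 ^ n)
  lm : ∀ p, Tendsto (fun n => U n p) atTop (nhds (φ p))

def MZ (L : List (Fin 11)) (v : Pt → ℝ) : Pt → ℝ := applyOps (L.map mink) v

lemma MZ_cons (m : Fin 11) (L : List (Fin 11)) (v : Pt → ℝ) : MZ (m :: L) v = mink m (MZ L v) := rfl

lemma four_two {A : ℝ} (hA : 0 ≤ A) (n : ℕ) : A / 4 ^ n ≤ A / 2 ^ n :=
  div_le_div_of_nonneg_left hA (by positivity) (pow_le_pow_left₀ (by norm_num) (by norm_num) n)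

lemma mink_Zf {u : Pt → ℝ} (hu : Differentiable ℝ u) (m : Fin 11) : mink m u = Zf m u := by
  funext p; rw [mink_eq, sgrad_eq (hu p)]; rfl

namespace Cv
open Filter
variable {N : ℕ} {U : ℕ → Pt → ℝ} {A : ℝ} {φ : Pt → ℝ}

lemma dd (h : Cv N U A φ) (n : ℕ) (K : List (Fin 11)) (b : Fin 4) (p : Pt) :
    D b (Zw K (U (n+1))) p - D b (Zw K (U n)) p = D b (Zw K (fun p => U (n + 1) p - U n p)) p := by
  rw [Zw_sub (h.sm _) (h.sm _)]
  rw [D_sub (diff_of_smooth (smooth_Zw (h.sm _) K)) (diff_of_smooth (smooth_Zw (h.sm _) K))]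

lemma pb (h : Cv N U A φ) (n : ℕ) {K : List (Fin 11)} (hK : 3 + K.length ≤ N) (b : Fin 4) (p : Pt) :
    (D b (Zw K (U (n+1))) p - D b (Zw K (U n)) p) ^ 2 ≤ A / 2 ^ n := by
  rw [h.dd]
  exact ((D_sq_le_dsq _ p b).trans ((h.df n).pd K hK p)).trans (four_two h.A0 n)

lemma lim (h : Cv N U A φ) (L : List (Fin 11)) (hL : L.length + 2 ≤ N) (p : Pt) :
    Tendsto (fun n => Zw L (U n) p) atTop (nhds (MZ L φ p)) := by
  induction L generalizing p with
  | nil => exact h.lm p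
  | cons m L ih =>
    simp only [List.length_cons] at hL
    rw [MZ_cons]
    exact lim_step (fun n => smooth_Zw (h.sm n) L) (fun b s _ => ih (by omega) _) (fun b s _ n => h.pb n (by omega) b _) m

lemma lim_ae (h : Cv N U A φ) (hN : 8 ≤ N) (t : ℝ) :
    ∀ᵐ x : Spc, ∀ L : List (Fin 11), L.length ≤ N → Tendsto (fun n => Zw L (U n) (t, x)) atTop (nhds (MZ L φ (t, x))) := by
  filter_upwards [good N (h := fun n p => U (n + 1) p - U n p) (fun n => (h.sm _).sub (h.sm _)) (fun n => (h.sc _).sub (h.sc _))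
    h.A0 (fun n t => (h.df n).en t) t] with x ⟨C, hC⟩
  have st : ∀ L : List (Fin 11), L.length + 1 ≤ N → ∀ c, ∀ s ∈ Set.Ioo (-1:ℝ) 1,
      Tendsto (fun n => Zw L (U n) ((t, x) + s • ev c)) atTop (nhds (MZ L φ ((t, x) + s • ev c))) := by
    intro L hL c s hs
    cases L with
    | nil => exact h.lm _
    | cons m L =>
      simp only [List.length_cons] at hL
      refine lim_step (fun n => smooth_Zw (h.sm n) L) (fun b s _ => h.lim L (by omega) _) (c := C) (fun b r hr n => ?_) m
      rw [h.dd]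
      exact (hC n).2 L (by omega) b c b s (Set.Ioo_subset_Icc_self hs) r (Set.Ioo_subset_Icc_self hr)
  intro L hL
  cases L with
  | nil => exact h.lm _
  | cons m L =>
    simp only [List.length_cons] at hL
    refine lim_step (fun n => smooth_Zw (h.sm n) L) (fun b s hs => st L (by omega) b s hs) (c := C) (fun b r hr n => ?_) m
    rw [h.dd]
    exact (hC n).1 L (by omega) b b r (Set.Ioo_subset_Icc_self hr)

lemma c2 (h : Cv N U A φ) (hN : 8 ≤ N) : ContDiff ℝ 2 φ := by
  refine c2lim h.sm (c := A) (fun n a p => h.pb n (K := []) (by simp; omega) a p) (fun n a b p => ?_) h.lm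
  obtain ⟨m, hm⟩ := D_Zf_fun b
  rw [hm, hm]
  exact h.pb n (K := [m]) (by simp; omega) a p

lemma limD (h : Cv N U A φ) (hN : 8 ≤ N) (a : Fin 4) (p : Pt) :
    Tendsto (fun n => D a (U n) p) atTop (nhds (D a φ p)) := by
  obtain ⟨m, hm⟩ := D_Zf_fun a
  have := h.lim [m] (by simp; omega) p
  rw [show MZ [m] φ = mink m φ from rfl, mink_Zf ((h.c2 hN).differentiable (by norm_num))] at this
  simpa only [hm, Zw_cons, Zw_nil] using this

lemma limDD (h : Cv N U A φ) (hN : 8 ≤ N) (a b : Fin 4) (p : Pt) :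
    Tendsto (fun n => D a (D b (U n)) p) atTop (nhds (D a (D b φ) p)) := by
  obtain ⟨m, hm⟩ := D_Zf_fun a
  obtain ⟨k, hk⟩ := D_Zf_fun b
  have := h.lim [m, k] (by simp; omega) p
  rw [show MZ [m, k] φ = mink m (mink k φ) from rfl, mink_Zf ((h.c2 hN).differentiable (by norm_num)), ← hk,
    mink_Zf ((contDiff_D (m := 1) (h.c2 hN) (by norm_num) b).differentiable (by norm_num)), ← hm] at this
  simpa only [hm, hk, Zw_cons, Zw_nil] using this
end Cv

open Filter in
/-- The limit of the iteration exists. -/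
lemma Cv_exists {N : ℕ} (hN : 8 ≤ N) {U : ℕ → Pt → ℝ} {A : ℝ} (hA : 0 ≤ A) (sm : ∀ n, ContDiff ℝ ∞ (U n)) (sc : ∀ n, Scs (U n))
    (df : ∀ n, AB N (fun p => U (n + 1) p - U n p) (A / 4 ^ n)) : ∃ φ, Cv N U A φ := by
  obtain ⟨g, hg⟩ := ulim U Set.univ A (fun n p _ => by
    rw [Real.norm_eq_abs, sq_abs]
    exact ((df n).pt [] (by simp; omega) p).trans (four_two hA n))
  exact ⟨g, sm, sc, hA, df, fun p => hg.tendsto_at (Set.mem_univ p)⟩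

open Filter in
lemma eq_lim {d N : ℕ} (hN : 8 ≤ N) {M : Fin d → Fin d → Fin d → Matrix (Fin 4) (Fin 4) ℝ} {f : ℕ → Fin d → Pt → ℝ} {A : ℝ}
    {φ : Fin d → Pt → ℝ} (h : ∀ i, Cv N (fun n => f n i) A (φ i)) (he : ∀ n i, bx (f (n + 1) i) = NL M (f n) i) (i : Fin d) (p : Pt) :
    bx (φ i) p = NL M φ i p := by
  have h1 : Tendsto (fun n => bx (f n i) p) atTop (nhds (bx (φ i) p)) :=
    tendsto_finset_sum _ fun a _ => ((h i).limDD hN a a p).const_mul _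
  have h2 : Tendsto (fun n => NL M (f n) i p) atTop (nhds (NL M φ i p)) :=
    tendsto_finset_sum _ fun k _ => tendsto_finset_sum _ fun a _ => tendsto_finset_sum _ fun b _ =>
      ((((h k.1).limD hN a p)).mul ((h k.2).limD hN b p)).const_mul _
  have h3 := h1.comp (tendsto_add_atTop_nat 1)
  refine tendsto_nhds_unique h3 (h2.congr fun n => ?_)
  simp only [Function.comp]; rw [he]

lemma cs_line {g g' : ℝ → ℝ} {h : ℝ} (hh : 0 < h) (hg : ∀ s, HasDerivAt g (g' s) s) (hc : Continuous g') :
    ENNReal.ofReal (((g h - g 0) / h) ^ 2) ≤ ENNReal.ofReal (1 / h) * ∫⁻ s in Set.Ioc 0 h, ENNReal.ofReal (g' s ^ 2) := by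
  have i1 : ∫ s in (0:ℝ)..h, g' s = g h - g 0 :=
    intervalIntegral.integral_eq_sub_of_hasDerivAt (fun s _ => hg s) (hc.intervalIntegrable _ _)
  set m := (g h - g 0) / h with hm
  have hmh : m * h = g h - g 0 := div_mul_cancel₀ _ hh.ne'
  have i2 : 0 ≤ ∫ s in (0:ℝ)..h, (g' s - m) ^ 2 := intervalIntegral.integral_nonneg hh.le fun s _ => sq_nonneg _
  have i3 : ∫ s in (0:ℝ)..h, (g' s - m) ^ 2 = ∫ s in (0:ℝ)..h, ((g' s ^ 2 - 2 * m * g' s) + m ^ 2) :=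
    intervalIntegral.integral_congr fun s _ => by ring
  have c1 : Continuous fun s => g' s ^ 2 := hc.pow 2
  have c2 : Continuous fun s => 2 * m * g' s := continuous_const.mul hc
  rw [intervalIntegral.integral_add (f := fun s => g' s ^ 2 - 2 * m * g' s) ((c1.sub c2).intervalIntegrable _ _) (continuous_const.intervalIntegrable _ _),
    intervalIntegral.integral_sub (c1.intervalIntegrable _ _) (c2.intervalIntegrable _ _), intervalIntegral.integral_const_mul, i1,
    intervalIntegral.integral_const, smul_eq_mul, ← hmh] at i3
  have i4 : m ^ 2 ≤ 1 / h * ∫ s in (0:ℝ)..h, g' s ^ 2 := by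
    rw [one_div, inv_mul_eq_div, le_div_iff₀ hh]; nlinarith
  refine (ENNReal.ofReal_le_ofReal i4).trans (le_of_eq ?_)
  rw [ENNReal.ofReal_mul (by positivity), intervalIntegral.integral_of_le hh.le,
    ofReal_integral_eq_lintegral_ofReal ((c1.intervalIntegrable 0 h).1) (.of_forall fun s => sq_nonneg _)]

lemma WW_shift {a : ℝ} (ha : 1 ≤ a) (p : Pt) (c : Fin 4) {s : ℝ} (h0 : 0 ≤ s) (h1 : s ≤ 1/2) :
    WW a p ≤ 2 ^ a * WW a (p + s • ev c) := by
  refine wt_comp ha (le_trans ?_ (div_le_div_of_nonneg_right (one_le_jq _) (by norm_num)))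
  refine le_trans ?_ h1
  refine Fin.cases ?_ (fun i => ?_) c
  · simp [abs_of_nonneg h0]
  · have := jb_lip (p.2 + s • Pi.single i 1) p.2
    simp only [Prod.fst_add, Prod.snd_add, Prod.smul_fst, Prod.smul_snd, ev_succ, smul_zero, add_zero, sub_sub_sub_cancel_right]
    refine this.trans (le_of_eq ?_)
    simp [Pi.single_apply, abs_of_nonneg h0, apply_ite abs]

lemma ae_shift {P : Pt → Prop} (h : ∀ t, ∀ᵐ x : Spc, P (t, x)) (t s : ℝ) (c : Fin 4) : ∀ᵐ x : Spc, P ((t, x) + s • ev c) := by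
  refine Fin.cases ?_ (fun i => ?_) c
  · simpa using h (t + s)
  · have := (measurePreserving_add_right (volume : Measure Spc) (s • Pi.single i 1)).quasiMeasurePreserving.ae (h t)
    refine this.mono fun x hx => ?_
    convert hx using 1
    ext j <;> simp

/-- Weighted bound for difference quotients of smooth functions. -/
lemma quot_bd {a : ℝ} (ha : 1 ≤ a) {N : ℕ} {u : Pt → ℝ} (hu : ContDiff ℝ ∞ u) (hs : Scs u) {E : ℝ}
    (hE : ∀ t, 0 ≤ t → EN a N u t ≤ E) {L : List (Fin 11)} (hL : L.length ≤ N) (c : Fin 4) {t h : ℝ} (ht : 0 ≤ t) (h0 : 0 < h)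
    (h1 : h ≤ 1/2) : ∫⁻ x : Spc, ENNReal.ofReal (WW a (t, x) * ((Zw L u ((t, x) + h • ev c) - Zw L u (t, x)) / h) ^ 2)
      ≤ ENNReal.ofReal (2 ^ a * E) := by
  classical
  set g : Pt → ℝ≥0∞ := fun q => if 0 ≤ q.1 then ENNReal.ofReal (2 ^ a * (WW a q * eW N u q)) else 0 with hg
  have gc : Continuous fun q => 2 ^ a * (WW a q * eW N u q) := continuous_const.mul ((smooth_WW a).continuous.mul (cont_eW hu N))
  have gm : Measurable g := Measurable.ite (measurableSet_le measurable_const measurable_fst)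
    (ENNReal.measurable_ofReal.comp gc.measurable) measurable_const
  have gi : ∀ t, ∫⁻ x, g (t, x) ≤ ENNReal.ofReal (2 ^ a * E) := by
    intro t
    by_cases ht : 0 ≤ t
    · simp only [hg, ht, if_true]
      rw [← ofReal_integral_eq_lintegral_ofReal ((int_EN a N hu hs t).const_mul _) (.of_forall fun x =>
        mul_nonneg (by positivity) (mul_nonneg (WW_pos _ _).le (eW_nonneg _ _ _))), integral_const_mul]
      exact ENNReal.ofReal_le_ofReal (mul_le_mul_of_nonneg_left (hE t ht) (by positivity))
    · simp [hg, ht]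
  have pt : ∀ x : Spc, ENNReal.ofReal (WW a (t, x) * ((Zw L u ((t, x) + h • ev c) - Zw L u (t, x)) / h) ^ 2) ≤
      ENNReal.ofReal (1 / h) * ∫⁻ s in Set.Ioc 0 h, g ((t, x) + s • ev c) := by
    intro x
    have := cs_line (g := fun s => Zw L u ((t, x) + s • ev c)) h0 (fun s => line_deriv (smooth_Zw hu L) (t, x) c s)
      ((cont_D (c1_of_smooth (smooth_Zw hu L)) c).comp (by fun_prop))
    simp only [zero_smul, add_zero] at this
    rw [ENNReal.ofReal_mul (WW_pos _ _).le]
    refine (mul_le_mul_right this _).trans ?_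
    rw [mul_left_comm]
    refine mul_le_mul_right ?_ _
    rw [← lintegral_const_mul' _ _ ENNReal.ofReal_ne_top]
    refine setLIntegral_mono' measurableSet_Ioc fun s hs => ?_
    have tn : 0 ≤ ((t, x) + s • ev c : Pt).1 := by
      refine Fin.cases ?_ (fun i => ?_) c
      · simp; linarith [hs.1]
      · simpa using ht
    simp only [hg, tn, if_true]
    rw [← ENNReal.ofReal_mul (WW_pos _ _).le]
    refine ENNReal.ofReal_le_ofReal ?_
    have b1 := WW_shift ha (t, x) c hs.1.le (hs.2.trans h1)
    have b2 := (D_sq_le_dsq (Zw L u) ((t, x) + s • ev c) c).trans (le_eW hL u _)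
    calc _ ≤ 2 ^ a * WW a ((t, x) + s • ev c) * eW N u ((t, x) + s • ev c) :=
          mul_le_mul b1 b2 (sq_nonneg _) (mul_nonneg (by positivity) (WW_pos _ _).le)
      _ = _ := by ring
  refine (lintegral_mono pt).trans ?_
  rw [lintegral_const_mul' _ _ ENNReal.ofReal_ne_top, lintegral_lintegral_swap
    (f := fun (x : Spc) (s : ℝ) => g ((t, x) + s • ev c)) (gm.comp ((meas_shift c).comp (by fun_prop : Measurable fun z : Spc × ℝ => (((t, z.1) : Pt), z.2)))).aemeasurable]
  refine (mul_le_mul_right (lintegral_mono fun s => shift_int c g gi t s) _).trans (le_of_eq ?_)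
  rw [lintegral_const, Measure.restrict_apply_univ, Real.volume_Ioc, mul_left_comm, ← ENNReal.ofReal_mul (by positivity), sub_zero,
    one_div_mul_cancel h0.ne', ENNReal.ofReal_one, mul_one]

open Filter in
lemma final_e {a : ℝ} (ha : 1 ≤ a) {N : ℕ} (hN : 8 ≤ N) {U : ℕ → Pt → ℝ} {A : ℝ} {φ : Pt → ℝ} (hc : Cv N U A φ) {E : ℝ}
    (hE : ∀ n t, 0 ≤ t → EN a N (U n) t ≤ E) {L : List (Fin 11)} (hL : L.length ≤ N) (c : Fin 4) {t : ℝ} (ht : 0 ≤ t) :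
    ∃ G : Spc → ℝ≥0∞, AEMeasurable G ∧ (∀ x, ENNReal.ofReal (WW a (t, x) * sgrad (MZ L φ) (t, x) c ^ 2) ≤ G x) ∧
      ∫⁻ x, G x ≤ ENNReal.ofReal (2 ^ a * E) := by
  set h : ℕ → ℝ := fun k => 1 / ((k:ℝ) + 2) with hh
  have h0 : ∀ k, 0 < h k := fun k => by positivity
  have h1 : ∀ k, h k ≤ 1 / 2 := fun k => one_div_le_one_div_of_le (by norm_num) (by have := k.cast_nonneg (α := ℝ); linarith)
  have hl : Tendsto h atTop (nhds 0) := by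
    have := (tendsto_one_div_add_atTop_nhds_zero_nat (𝕜 := ℝ)).comp (tendsto_add_atTop_nat 1)
    refine this.congr fun k => ?_
    simp only [Function.comp, hh]; push_cast; ring
  set Q : ℕ → ℕ → Spc → ℝ≥0∞ := fun n k x =>
    ENNReal.ofReal (WW a (t, x) * ((Zw L (U n) ((t, x) + h k • ev c) - Zw L (U n) (t, x)) / h k) ^ 2) with hQ
  set R : ℕ → Spc → ℝ≥0∞ := fun k x =>
    ENNReal.ofReal (WW a (t, x) * ((MZ L φ ((t, x) + h k • ev c) - MZ L φ (t, x)) / h k) ^ 2) with hR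
  have Qm : ∀ k n, Measurable (Q n k) := fun k n => by
    have cz := (smooth_Zw (hc.sm n) L).continuous
    have cw := (smooth_WW a).continuous
    exact ENNReal.measurable_ofReal.comp (by fun_prop : Continuous fun x : Spc =>
      WW a (t, x) * ((Zw L (U n) ((t, x) + h k • ev c) - Zw L (U n) (t, x)) / h k) ^ 2).measurable
  have Qi : ∀ k n, ∫⁻ x, Q n k x ≤ ENNReal.ofReal (2 ^ a * E) := fun k n =>
    quot_bd ha (hc.sm n) (hc.sc n) (hE n) hL c ht (h0 k) (h1 k)
  have QR : ∀ k, (fun x => liminf (fun n => Q n k x) atTop) =ᵐ[volume] R k := by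
    intro k
    filter_upwards [hc.lim_ae hN t, ae_shift (P := fun q => ∀ L : List (Fin 11), L.length ≤ N →
      Tendsto (fun n => Zw L (U n) q) atTop (nhds (MZ L φ q))) (hc.lim_ae hN) t (h k) c] with x x1 x2
    refine Tendsto.liminf_eq (ENNReal.tendsto_ofReal (Tendsto.const_mul _ ?_))
    exact (((x2 L hL).sub (x1 L hL)).div_const _).pow 2
  have Ri : ∀ k, ∫⁻ x, R k x ≤ ENNReal.ofReal (2 ^ a * E) := fun k => by
    rw [← lintegral_congr_ae (QR k)]
    refine (lintegral_liminf_le (Qm k)).trans ?_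
    exact liminf_le_of_le ⟨0, by simp⟩ fun b hb => by
      obtain ⟨n, hn⟩ := hb.exists
      exact hn.trans (Qi k n)
  have Rm : ∀ k, AEMeasurable (R k) := fun k => ⟨_, Measurable.liminf (Qm k), (QR k).symm⟩
  have key : ∀ x, ENNReal.ofReal (WW a (t, x) * sgrad (MZ L φ) (t, x) c ^ 2) ≤ liminf (fun k => R k x) atTop := by
    intro x
    rw [sg_eq]
    by_cases hd : DifferentiableAt ℝ (fun s : ℝ => MZ L φ ((t, x) + s • ev c)) 0
    · refine le_of_eq (Tendsto.liminf_eq (ENNReal.tendsto_ofReal (Tendsto.const_mul _ (Tendsto.pow ?_ 2)))).symm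
      have h2 := hd.hasDerivAt.tendsto_slope.comp (tendsto_nhdsWithin_iff.2 ⟨hl, .of_forall fun k => (h0 k).ne'⟩)
      refine h2.congr fun k => ?_
      simp [slope_def_field]
    · rw [deriv_zero_of_not_differentiableAt hd]; simp
  have mm : AEMeasurable fun x => liminf (fun k => R k x) atTop :=
    ⟨fun x => liminf (fun k => liminf (fun n => Q n k x) atTop) atTop, Measurable.liminf fun k => Measurable.liminf (Qm k), by
      filter_upwards [ae_all_iff.2 QR] with x hx
      simp only [hx]⟩
  refine ⟨_, mm, key, (lintegral_liminf_le' Rm).trans ?_⟩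
  exact liminf_le_of_le ⟨0, by simp⟩ fun b hb => by
    obtain ⟨n, hn⟩ := hb.exists
    exact hn.trans (Ri n)

/-- The bound in the form of the theorem. -/
lemma final_L2 {δ α : ℝ} (hδ1 : -(1/2) < δ) (hα1 : 0 < α) {v : Pt → ℝ} {t B : ℝ} (hB : 0 ≤ B)
    (h : ∀ c, ∃ G : Spc → ℝ≥0∞, AEMeasurable G ∧ (∀ x, ENNReal.ofReal (WW (2 * (δ + 1)) (t, x) * sgrad v (t, x) c ^ 2) ≤ G x) ∧
      ∫⁻ x, G x ≤ ENNReal.ofReal B) :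
    L2 (fun x => √(w1 δ α (rad x - t)) * gradAbs v (t, x)) ≤ (32 * B) ^ (1/2 : ℝ) := by
  unfold L2
  refine Real.rpow_le_rpow (integral_nonneg fun x => sq_nonneg _) ?_ (by norm_num)
  by_cases hi : Integrable fun x : Spc => (√(w1 δ α (rad x - t)) * gradAbs v (t, x)) ^ 2
  swap
  · rw [integral_undef hi]; positivity
  rw [← ENNReal.ofReal_le_ofReal_iff (by positivity), ofReal_integral_eq_lintegral_ofReal hi (.of_forall fun x => sq_nonneg _)]
  choose G hm hG hi using h
  have pt : ∀ x : Spc, ENNReal.ofReal ((√(w1 δ α (rad x - t)) * gradAbs v (t, x)) ^ 2) ≤ 8 * ∑ c, G c x := by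
    intro x
    have w := w1_le δ α hδ1 hα1 t x
    have w0 : 0 ≤ w1 δ α (rad x - t) := by unfold w1; split_ifs <;> positivity
    have g : gradAbs v (t, x) ^ 2 ≤ 4 * ∑ c, sgrad v (t, x) c ^ 2 := by
      have := sq_sum_le_card_mul_sum_sq (s := (Finset.univ : Finset (Fin 4))) (f := fun c => |sgrad v (t, x) c|)
      simpa [gradAbs] using this
    have p : (√(w1 δ α (rad x - t)) * gradAbs v (t, x)) ^ 2 ≤ 8 * ∑ c, WW (2 * (δ + 1)) (t, x) * sgrad v (t, x) c ^ 2 := by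
      rw [mul_pow, Real.sq_sqrt w0, ← Finset.mul_sum]
      refine (mul_le_mul w g (sq_nonneg _) (mul_nonneg (by norm_num) (wt_pos _ _).le)).trans (le_of_eq ?_)
      show 2 * WW (2 * (δ + 1)) (t, x) * _ = _
      ring
    refine (ENNReal.ofReal_le_ofReal p).trans ?_
    rw [ENNReal.ofReal_mul (by norm_num), ENNReal.ofReal_sum_of_nonneg fun c _ => mul_nonneg (WW_pos _ _).le (sq_nonneg _)]
    norm_num
    exact mul_le_mul_right (Finset.sum_le_sum fun c _ => hG c x) _
  refine (lintegral_mono pt).trans ?_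
  rw [lintegral_const_mul' _ _ (by norm_num), lintegral_finset_sum' _ fun c _ => hm c]
  refine (mul_le_mul_right (Finset.sum_le_sum fun c _ => hi c) _).trans (le_of_eq ?_)
  simp only [Finset.sum_const, Finset.card_univ, Fintype.card_fin, nsmul_eq_mul]
  rw [ENNReal.ofReal_mul (by norm_num), ← mul_assoc]; norm_num

def WK (K : ℝ) (p : Pt) : ℝ := expNegInvGlue (K - (jb p.2 + p.1))
lemma smooth_WK (K : ℝ) : ContDiff ℝ 1 (WK K) :=
  (expNegInvGlue.contDiff (n := 1)).comp (contDiff_const.sub ((c1_of_smooth smooth_jb).add contDiff_fst))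
lemma Scs_WK (K : ℝ) : Scs (WK K) := ⟨K, fun p hp => expNegInvGlue.zero_of_nonpos (by
  linarith [rad_le_jb p.2, neg_abs_le p.1])⟩
lemma D_WK (K : ℝ) (p : Pt) : ∃ g : ℝ, 0 ≤ g ∧ D 0 (WK K) p = -g ∧ ∀ i : Fin 3, D i.succ (WK K) p = -g * (p.2 i / jb p.2) := by
  have hd : Differentiable ℝ fun p : Pt => jb p.2 := diff_of_smooth smooth_jb
  have he : HasDerivAt expNegInvGlue (deriv expNegInvGlue (K - (jb p.2 + p.1))) (K - (jb p.2 + p.1)) :=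
    ((expNegInvGlue.contDiff (n := 1)).differentiable (by norm_num) _).hasDerivAt
  have h1 := he.comp (jb p.2 + p.1) ((hasDerivAt_id (jb p.2 + p.1)).const_sub K)
  have f1 : ∀ a, D a (fun p : Pt => p.1) p = (ev a).1 := fun a => by
    show fderiv ℝ (fun p : Pt => p.1) p (ev a) = _
    rw [(hasFDerivAt_fst (𝕜 := ℝ) (p := p)).fderiv]; rfl
  have key : ∀ a, D a (WK K) p = -(deriv expNegInvGlue (K - (jb p.2 + p.1))) * (D a (fun p => jb p.2) p + (ev a).1) := fun a => by
    have := D_comp (g := fun p : Pt => jb p.2 + p.1) (p := p) h1 ((hd.add differentiable_fst) p) a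
    rw [D_add hd differentiable_fst] at this
    simp only [f1, mul_neg, mul_one] at this
    exact this
  refine ⟨_, expNegInvGlue.monotone.deriv_nonneg (x := K - (jb p.2 + p.1)), ?_, fun i => ?_⟩
  · rw [key, D_jb_zero]; simp
  · rw [key, D_jb_succ]; simp

lemma flux (K : ℝ) (u : Pt → ℝ) (p : Pt) :
    D 0 (WK K) p * dsq u p - 2 * (∑ i : Fin 3, D i.succ (WK K) p * (D 0 u p * D i.succ u p)) ≤ 0 := by
  obtain ⟨g, hg, h0, h1⟩ := D_WK K p
  have hj := jb_sq p.2
  have hp := jb_pos p.2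
  have ho : ∑ i, (p.2 i / jb p.2) ^ 2 ≤ 1 := by
    simp only [div_pow]; rw [← Finset.sum_div, div_le_one (by positivity)]; linarith
  simp only [h0, h1, dsq, Fin.sum_univ_succ (n := 3)]
  have : ∑ i : Fin 3, 2 * (p.2 i / jb p.2) * (D 0 u p * D i.succ u p) ≤ ∑ i : Fin 3, ((p.2 i / jb p.2) ^ 2 * D 0 u p ^ 2 + D i.succ u p ^ 2) :=
    Finset.sum_le_sum fun i _ => by nlinarith [sq_nonneg (p.2 i / jb p.2 * D 0 u p - D i.succ u p)]
  rw [Finset.sum_add_distrib, ← Finset.sum_mul] at this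
  have e : ∑ i : Fin 3, -g * (p.2 i / jb p.2) * (D 0 u p * D i.succ u p) =
      -(g / 2) * ∑ i : Fin 3, 2 * (p.2 i / jb p.2) * (D 0 u p * D i.succ u p) := by
    rw [Finset.mul_sum]; exact Finset.sum_congr rfl fun i _ => by ring
  rw [e]
  nlinarith [mul_le_mul_of_nonneg_right ho (sq_nonneg (D 0 u p))]

section
variable {d : ℕ} {M : Fin d → Fin d → Fin d → Matrix (Fin 4) (Fin 4) ℝ} {φ ψ : Fin d → Pt → ℝ}

lemma D_dif (hφ : ∀ i, ContDiff ℝ 2 (φ i)) (hψ : ∀ i, ContDiff ℝ 2 (ψ i)) (i : Fin d) (a : Fin 4) :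
    D a (fun p => ψ i p - φ i p) = fun p => D a (ψ i) p - D a (φ i) p :=
  D_sub ((hψ i).differentiable (by norm_num)) ((hφ i).differentiable (by norm_num)) a

lemma src_bd (hφ : ∀ i, ContDiff ℝ 2 (φ i)) (hψ : ∀ i, ContDiff ℝ 2 (ψ i))
    (eφ : ∀ i p, 0 ≤ p.1 → bx (φ i) p = NL M φ i p) (eψ : ∀ i p, 0 ≤ p.1 → bx (ψ i) p = NL M ψ i p) (T K : ℝ) :
    ∃ C : ℝ, 0 ≤ C ∧ ∀ t x, 0 ≤ t → t ≤ T → rad x ≤ K → ∀ i,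
      -2 * (D 0 (fun p => ψ i p - φ i p) (t, x) * bx (fun p => ψ i p - φ i p) (t, x)) ≤ C * ∑ k, dsq (fun p => ψ k p - φ k p) (t, x) := by
  have c1 : ∀ (χ : Fin d → Pt → ℝ), (∀ i, ContDiff ℝ 2 (χ i)) → ∀ k a, Continuous (D a (χ k)) := fun χ h k a =>
    cont_D ((h k).of_le (by norm_num)) a
  have hc : Continuous fun p => ∑ k, ∑ a, (|D a (φ k) p| + |D a (ψ k) p|) :=
    continuous_finset_sum _ fun k _ => continuous_finset_sum _ fun a _ => ((c1 φ hφ k a).abs).add ((c1 ψ hψ k a).abs)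
  obtain ⟨B, hB⟩ := ((isCompact_Icc (a := (0:ℝ)) (b := T)).prod (compact_rad K)).exists_bound_of_continuousOn hc.continuousOn
  set B' := max B 0
  set m : ℝ := ∑ i, ∑ k : Fin d × Fin d, ∑ a, ∑ b, |M i k.1 k.2 a b| with hm
  refine ⟨2 * (m * (2 * B')), by positivity, fun t x h0 h1 hx i => ?_⟩
  set p : Pt := (t, x)
  set G := ∑ k, dsq (fun p => ψ k p - φ k p) p with hG
  have G0 : 0 ≤ G := Finset.sum_nonneg fun k _ => dsq_nonneg _ _
  have bw : ∀ k a, |D a (ψ k) p - D a (φ k) p| ≤ √G := fun k a => by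
    refine Real.abs_le_sqrt (le_trans ?_ (Finset.single_le_sum (f := fun k => dsq (fun p => ψ k p - φ k p) p)
      (fun k _ => dsq_nonneg _ _) (Finset.mem_univ k)))
    have := D_sq_le_dsq (fun p => ψ k p - φ k p) p a
    rwa [D_dif hφ hψ] at this
  have bb : ∀ k a, |D a (φ k) p| + |D a (ψ k) p| ≤ B' := fun k a => by
    have h2 := hB p ⟨⟨h0, h1⟩, hx⟩
    rw [Real.norm_eq_abs] at h2
    refine le_trans ?_ ((le_abs_self _).trans (h2.trans (le_max_left _ _)))
    refine le_trans ?_ (Finset.single_le_sum (f := fun k => ∑ a, (|D a (φ k) p| + |D a (ψ k) p|))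
      (fun k _ => Finset.sum_nonneg fun a _ => by positivity) (Finset.mem_univ k))
    exact Finset.single_le_sum (f := fun a => |D a (φ k) p| + |D a (ψ k) p|) (fun a _ => by positivity) (Finset.mem_univ a)
  have hb : bx (fun p => ψ i p - φ i p) p = bx (ψ i) p - bx (φ i) p := by
    unfold bx
    rw [← Finset.sum_sub_distrib]
    refine Finset.sum_congr rfl fun a _ => ?_
    rw [D_dif hφ hψ, D_sub ((contDiff_D (m := 1) (hψ i) (by norm_num) a).differentiable (by norm_num))
      ((contDiff_D (m := 1) (hφ i) (by norm_num) a).differentiable (by norm_num))]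
    ring
  have hs : |bx (fun p => ψ i p - φ i p) p| ≤ m * (2 * B') * √G := by
    rw [hb, eφ i p h0, eψ i p h0]
    have e : NL M ψ i p - NL M φ i p = ∑ k : Fin d × Fin d, ∑ a, ∑ b, M i k.1 k.2 a b *
        (D a (ψ k.1) p * D b (ψ k.2) p - D a (φ k.1) p * D b (φ k.2) p) := by
      simp only [NL, QF, ← Finset.sum_sub_distrib, mul_sub]
    rw [e]
    have t1 : ∀ (k : Fin d × Fin d) a b, |M i k.1 k.2 a b * (D a (ψ k.1) p * D b (ψ k.2) p - D a (φ k.1) p * D b (φ k.2) p)| ≤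
        |M i k.1 k.2 a b| * (2 * B' * √G) := fun k a b => by
      rw [abs_mul]
      refine mul_le_mul_of_nonneg_left ?_ (abs_nonneg _)
      rw [show D a (ψ k.1) p * D b (ψ k.2) p - D a (φ k.1) p * D b (φ k.2) p =
        (D a (ψ k.1) p - D a (φ k.1) p) * D b (ψ k.2) p + D a (φ k.1) p * (D b (ψ k.2) p - D b (φ k.2) p) by ring]
      refine (abs_add_le _ _).trans ?_
      rw [abs_mul, abs_mul]
      have b1 := bw k.1 a
      have b2 := bw k.2 b
      have b3 := bb k.1 a
      have b4 := bb k.2 b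
      have e1 := mul_le_mul b1 (show |D b (ψ k.2) p| ≤ B' by linarith [abs_nonneg (D b (φ k.2) p)]) (abs_nonneg _) (Real.sqrt_nonneg _)
      have e2 := mul_le_mul (show |D a (φ k.1) p| ≤ B' by linarith [abs_nonneg (D a (ψ k.1) p)]) b2 (abs_nonneg _) (le_max_right _ _)
      linarith
    refine (Finset.abs_sum_le_sum_abs _ _).trans ?_
    calc _ ≤ ∑ k : Fin d × Fin d, ∑ a, ∑ b, |M i k.1 k.2 a b| * (2 * B' * √G) := Finset.sum_le_sum fun k _ =>
          (Finset.abs_sum_le_sum_abs _ _).trans (Finset.sum_le_sum fun a _ =>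
            (Finset.abs_sum_le_sum_abs _ _).trans (Finset.sum_le_sum fun b _ => t1 k a b))
      _ = (∑ k : Fin d × Fin d, ∑ a, ∑ b, |M i k.1 k.2 a b|) * (2 * B' * √G) := by simp only [Finset.sum_mul]
      _ ≤ m * (2 * B' * √G) := mul_le_mul_of_nonneg_right (Finset.single_le_sum
          (f := fun i => ∑ k : Fin d × Fin d, ∑ a, ∑ b, |M i k.1 k.2 a b|) (fun i _ => by positivity) (Finset.mem_univ i)) (by positivity)
      _ = _ := by ring
  have h0' : |D 0 (fun p => ψ i p - φ i p) p| ≤ √G := by rw [D_dif hφ hψ]; exact bw i 0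
  have fin := mul_le_mul h0' hs (abs_nonneg _) (Real.sqrt_nonneg _)
  rw [← abs_mul] at fin
  have := neg_le_abs (D 0 (fun p => ψ i p - φ i p) p * bx (fun p => ψ i p - φ i p) p)
  have sg := Real.mul_self_sqrt G0
  calc _ ≤ 2 * (√G * (m * (2 * B') * √G)) := by linarith
    _ = 2 * (m * (2 * B')) * (√G * √G) := by ring
    _ = _ := by rw [sg]

lemma uniq (hφ : ∀ i, ContDiff ℝ 2 (φ i)) (hψ : ∀ i, ContDiff ℝ 2 (ψ i))
    (eφ : ∀ i p, 0 ≤ p.1 → bx (φ i) p = NL M φ i p) (eψ : ∀ i p, 0 ≤ p.1 → bx (ψ i) p = NL M ψ i p)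
    (i0 : ∀ i x, ψ i (0, x) = φ i (0, x)) (i1 : ∀ i x, D 0 (ψ i) (0, x) = D 0 (φ i) (0, x)) (i : Fin d) (p : Pt) (hp : 0 ≤ p.1) :
    ψ i p = φ i p := by
  set w : Fin d → Pt → ℝ := fun i p => ψ i p - φ i p with hw
  have w2 : ∀ i, ContDiff ℝ 2 (w i) := fun i => (hψ i).sub (hφ i)
  have w1' : ∀ i, ContDiff ℝ 1 (w i) := fun i => (w2 i).of_le (by norm_num)
  have z0 : ∀ i x, dsq (w i) (0, x) = 0 := fun i x => by
    refine Finset.sum_eq_zero fun a _ => ?_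
    rw [sq_eq_zero_iff]
    refine Fin.cases ?_ (fun j => ?_) a
    · rw [hw, D_dif hφ hψ]; exact sub_eq_zero.2 (i1 i x)
    · have := pxd_eq j ((w1' i).differentiable (by norm_num) (0, x))
      rw [← this]
      show deriv (fun s => ψ i (0, Function.update x j s) - φ i (0, Function.update x j s)) (x j) = 0
      simp [i0]
  have key : ∀ t x, 0 ≤ t → ∀ i, dsq (w i) (t, x) = 0 := by
    intro T x hT i
    set K := T + jb x + 1 with hK
    obtain ⟨C, hC, hb⟩ := src_bd hφ hψ eφ eψ T K
    set E : ℝ → ℝ := fun t => ∑ i, ∫ x, WK K (t, x) * dsq (w i) (t, x) with hE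
    have ci : ∀ i, Continuous fun p => WK K p * dsq (w i) p := fun i => (smooth_WK K).continuous.mul (cont_dsq (w1' i))
    have si : ∀ i, Scs fun p => WK K p * dsq (w i) p := fun i => (Scs_WK K).mul_right _
    have nn : ∀ i p, 0 ≤ WK K p * dsq (w i) p := fun i p => mul_nonneg (expNegInvGlue.nonneg _) (dsq_nonneg _ _)
    have E0 : E 0 = 0 := by simp [hE, z0]
    have hd : ∀ t, ∃ e', HasDerivAt E e' t ∧ (0 ≤ t → t ≤ T → e' ≤ d * C * E t) := by
      intro t
      refine ⟨_, HasDerivAt.fun_sum fun i _ => energy_deriv (w2 i) (smooth_WK K) (Or.inr (Scs_WK K)) t, fun h0 h1 => ?_⟩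
      have I : ∀ i ∈ (Finset.univ : Finset (Fin d)), (∫ x, (D 0 (WK K) (t, x) * dsq (w i) (t, x) -
          2 * (∑ j : Fin 3, D j.succ (WK K) (t, x) * (D 0 (w i) (t, x) * D j.succ (w i) (t, x)))
          - 2 * (WK K (t, x) * (D 0 (w i) (t, x) * bx (w i) (t, x))))) ≤ C * E t := by
        intro i _
        have e : C * E t = ∫ x, C * ∑ k, WK K (t, x) * dsq (w k) (t, x) := by
          rw [integral_const_mul, integral_finset_sum _ fun k _ => slice_int (ci k) (si k) t]
        by_cases hi : Integrable fun x => (D 0 (WK K) (t, x) * dsq (w i) (t, x) -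
          2 * (∑ j : Fin 3, D j.succ (WK K) (t, x) * (D 0 (w i) (t, x) * D j.succ (w i) (t, x)))
          - 2 * (WK K (t, x) * (D 0 (w i) (t, x) * bx (w i) (t, x))))
        · rw [e]
          refine integral_mono hi ((integrable_finset_sum _ fun k _ => slice_int (ci k) (si k) t).const_mul C) fun x => ?_
          have f := flux K (w i) (t, x)
          simp only
          rw [← Finset.mul_sum]
          by_cases hx : rad x ≤ K
          · have := mul_le_mul_of_nonneg_left (hb t x h0 h1 hx i) (expNegInvGlue.nonneg (K - (jb x + t)))
            have r : WK K (t, x) = expNegInvGlue (K - (jb x + t)) := rfl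
            rw [← r] at this
            calc _ ≤ WK K (t, x) * (-2 * (D 0 (w i) (t, x) * bx (w i) (t, x))) := by linarith
              _ ≤ _ := this
              _ = _ := by ring
          · have : WK K (t, x) = 0 := expNegInvGlue.zero_of_nonpos (by
              show K - (jb x + t) ≤ 0
              linarith [rad_le_jb x, not_le.1 hx])
            rw [this]; simp only [zero_mul, mul_zero, sub_zero]; exact f
        · rw [integral_undef hi]
          exact mul_nonneg hC (Finset.sum_nonneg fun k _ => integral_nonneg fun x => nn k _)
      refine (Finset.sum_le_sum I).trans (le_of_eq ?_)
      simp [mul_assoc]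
    choose e' he' hle using hd
    have gr : AntitoneOn (fun t => Real.exp (-(d * C) * t) * E t) (Set.Icc 0 T) := by
      have hder : ∀ t, HasDerivAt (fun t => Real.exp (-(d * C) * t) * E t)
          (Real.exp (-(d * C) * t) * (-(d * C)) * E t + Real.exp (-(d * C) * t) * e' t) t := fun t => by
        have h1 : HasDerivAt (fun t => Real.exp (-(d * C) * t)) (Real.exp (-(d * C) * t) * (-(d * C))) t := by
          simpa using ((hasDerivAt_id t).const_mul (-(d * C))).exp
        exact h1.mul (he' t)
      refine antitoneOn_of_deriv_nonpos (convex_Icc 0 T) (fun t _ => (hder t).continuousAt.continuousWithinAt)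
        (fun t _ => (hder t).differentiableAt.differentiableWithinAt) fun t ht => ?_
      rw [interior_Icc] at ht
      rw [(hder t).deriv]
      have := mul_le_mul_of_nonneg_left (hle t ht.1.le ht.2.le) (Real.exp_pos (-(d * C) * t)).le
      linarith
    have eT := gr (Set.left_mem_Icc.2 hT) (Set.right_mem_Icc.2 hT) hT
    simp only [E0, mul_zero] at eT
    have ET : E T ≤ 0 := nonpos_of_mul_nonpos_right eT (Real.exp_pos _)
    have ii : ∫ x, WK K (T, x) * dsq (w i) (T, x) = 0 := by
      refine le_antisymm (le_trans ?_ ET) (integral_nonneg fun x => nn i _)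
      exact Finset.single_le_sum (f := fun i => ∫ x, WK K (T, x) * dsq (w i) (T, x)) (fun k _ => integral_nonneg fun x => nn k _)
        (Finset.mem_univ i)
    rw [integral_eq_zero_iff_of_nonneg (fun x => nn i _) (slice_int (ci i) (si i) T)] at ii
    have cc : Continuous fun x : Spc => WK K (T, x) * dsq (w i) (T, x) := (ci i).comp (by fun_prop)
    have := congrFun ((Continuous.ae_eq_iff_eq volume cc continuous_const).1 ii) x
    refine (mul_eq_zero.1 this).resolve_left (ne_of_gt (expNegInvGlue.pos_of_pos ?_))
    show 0 < K - (jb x + T)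
    rw [hK]; linarith
  have lin : ∀ s ∈ Set.Ico 0 p.1, HasDerivWithinAt (fun s => w i (s, p.2)) 0 (Set.Ici s) s := fun s hs => by
    have h1 := slice_Dt ((w1' i).differentiable (by norm_num)) s p.2
    have h2 : D 0 (w i) (s, p.2) = 0 := by
      have := (D_sq_le_dsq (w i) (s, p.2) 0).trans (key s p.2 hs.1 i).le
      exact pow_eq_zero_iff (two_ne_zero) |>.1 (le_antisymm this (sq_nonneg _))
    rw [h2] at h1
    exact h1.hasDerivWithinAt
  have := constant_of_has_deriv_right_zero (f := fun s => w i (s, p.2)) (a := 0) (b := p.1)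
    (((w2 i).continuous.comp (by fun_prop : Continuous fun s : ℝ => ((s, p.2) : Pt))).continuousOn) lin p.1 ⟨hp, le_rfl⟩
  have h3 : ψ i p - φ i p = ψ i (0, p.2) - φ i (0, p.2) := this
  rw [i0, sub_self, sub_eq_zero] at h3
  exact h3
end

lemma null_mat {Q : (Fin 4 → ℝ) → (Fin 4 → ℝ) → ℝ} (h : IsNullForm Q) : ∃ M : Matrix (Fin 4) (Fin 4) ℝ, NullM M ∧
    ∀ X Y, Q X Y = ∑ a, ∑ b, M a b * (X a * Y b) := by
  obtain ⟨c, e, he⟩ := h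
  refine ⟨fun a b => c * (if a = b then eta a else 0) + (e a b - e b a), ⟨2 * c, fun a b => ?_⟩, fun X Y => ?_⟩
  · by_cases hab : a = b
    · subst hab; simp; ring
    · simp [hab, Ne.symm hab]
  · rw [he]
    simp only [add_mul, sub_mul, Finset.sum_add_distrib, Finset.sum_sub_distrib]
    rw [Finset.sum_comm (f := fun a b => e b a * (X a * Y b))]
    have h1 : ∑ a, ∑ b, e a b * Qform a b X Y = ∑ a, ∑ b, e a b * (X a * Y b) - ∑ a, ∑ b, e a b * (X b * Y a) := by
      simp only [← Finset.sum_sub_distrib, Qform, mul_sub]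
    rw [h1]
    congr 1
    simp [Q0form, Fin.sum_univ_four, eta]
    ring

lemma sob_le {m : ℕ} {δ ε : ℝ} {u : Spc → ℝ} (hm : MemSob m δ u) (h : sobNorm m δ u ≤ ε) {k : ℕ} (hk : k ≤ m) :
    Integrable (SQ δ k u) ∧ ∫ x, SQ δ k u x ≤ ε ^ 2 := by
  have e : (fun x : Spc => ((1 + ∑ i, x i ^ 2) ^ ((δ + k) / 2) * ‖iteratedFDeriv ℝ k u x‖) ^ 2) = SQ δ k u := by
    funext x; rw [sw_eq]; rfl
  have h1 := hm k hk
  rw [e] at h1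
  refine ⟨h1, ?_⟩
  have nn : 0 ≤ ∫ x, SQ δ k u x := integral_nonneg fun x => SQ_nonneg _ _ _ _
  have h2 : (∫ x, SQ δ k u x) ^ (1/2 : ℝ) ≤ ε := by
    rw [← e]
    refine le_trans ?_ h
    exact Finset.single_le_sum (f := fun k : ℕ => (∫ x : Spc, ((1 + ∑ i, x i ^ 2) ^ ((δ + k) / 2) * ‖iteratedFDeriv ℝ k u x‖) ^ 2) ^ (1/2 : ℝ))
      (fun k _ => Real.rpow_nonneg (integral_nonneg fun x => sq_nonneg _) _) (Finset.mem_range.2 (by omega))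
  rw [← Real.sqrt_eq_rpow] at h2
  calc _ = √(∫ x, SQ δ k u x) ^ 2 := (Real.sq_sqrt nn).symm
    _ ≤ _ := pow_le_pow_left₀ (Real.sqrt_nonneg _) h2 2

lemma sob_nonneg (m : ℕ) (δ : ℝ) (u : Spc → ℝ) : 0 ≤ sobNorm m δ u :=
  Finset.sum_nonneg fun k _ => Real.rpow_nonneg (integral_nonneg fun x => sq_nonneg _) _

lemma multi_map {L : List Op} (h : IsMulti L) : ∃ L' : List (Fin 11), L = L'.map mink := by
  induction L with
  | nil => exact ⟨[], rfl⟩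
  | cons Z L ih =>
    obtain ⟨L', rfl⟩ := ih fun Y hY => h Y (List.mem_cons_of_mem _ hY)
    obtain ⟨n, rfl⟩ := h Z List.mem_cons_self
    exact ⟨n :: L', rfl⟩

/-- global existence and weighted energy bounds for the background
system □φ_i = Q_i(∂φ,∂φ) with small weighted Sobolev data. -/
theorem background_global_existence (d : ℕ) (hd : 1 ≤ d) (N : ℕ) (hN : 8 ≤ N)
    (δ α : ℝ) (hδ1 : -(1/2) < δ) (hδ2 : δ < 1/2) (hα1 : 0 < α) (hα2 : α < 1)
    (Qs : Fin d → Fin d → Fin d → (Fin 4 → ℝ) → (Fin 4 → ℝ) → ℝ)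
    (hQs : ∀ i k l, IsNullForm (Qs i k l)) :
    ∃ ε₀ > 0, ∃ C > 0, ∀ ε : ℝ, 0 < ε → ε ≤ ε₀ →
      ∀ φ₀ φ₁ : Fin d → Spc → ℝ,
        (∀ i, ContDiff ℝ (N + 1 : ℕ) (φ₀ i) ∧ ContDiff ℝ (N : ℕ) (φ₁ i)) →
        (∀ i, MemSob (N + 1) δ (φ₀ i) ∧ MemSob N (δ + 1) (φ₁ i)) →
        (∑ i, sobNorm (N + 1) δ (φ₀ i)) + (∑ i, sobNorm N (δ + 1) (φ₁ i)) ≤ ε →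
        ∃ φ : Fin d → Pt → ℝ,
          (∀ i, ContDiff ℝ 2 (φ i)) ∧
          (∀ i, ∀ p : Pt, 0 ≤ p.1 →
            box (φ i) p = ∑ k, ∑ l, Qs i k l (sgrad (φ k) p) (sgrad (φ l) p)) ∧
          (∀ i x, φ i (0, x) = φ₀ i x ∧ ptd (φ i) (0, x) = φ₁ i x) ∧
          (∀ ψ : Fin d → Pt → ℝ, (∀ i, ContDiff ℝ 2 (ψ i)) →
            (∀ i, ∀ p : Pt, 0 ≤ p.1 →
              box (ψ i) p = ∑ k, ∑ l, Qs i k l (sgrad (ψ k) p) (sgrad (ψ l) p)) →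
            (∀ i x, ψ i (0, x) = φ₀ i x ∧ ptd (ψ i) (0, x) = φ₁ i x) →
            ∀ i, ∀ p : Pt, 0 ≤ p.1 → ψ i p = φ i p) ∧
          (∀ i, ∀ t : ℝ, 0 ≤ t → ∀ L : List Op, IsMulti L → L.length ≤ N →
            L2 (fun x => Real.sqrt (w1 δ α (rad x - t)) * gradAbs (applyOps L (φ i)) (t, x))
              ≤ C * ε) := by
  choose M hM hQ using fun i k l => null_mat (hQs i k l)
  set a := 2 * (δ + 1) with ha'
  have ha : 1 ≤ a := by rw [ha']; linarith
  obtain ⟨E1, hE1, K1, hK1, it1⟩ := iter ha hN M hM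
  obtain ⟨E2, hE2, K2, hK2, it2⟩ := iter ha hN (fun i k l => rM (M i k l)) fun i k l => NullM_rM (hM i k l)
  obtain ⟨C2, hC2, hAB⟩ := XB_AB ha N
  obtain ⟨C0, hC0, hI⟩ := itr_exists (d := d) N hδ1
  set K := max K1 K2 with hKd
  have hK : 0 ≤ K := hK1.trans (le_max_left _ _)
  have qe : ∀ (χ : Fin d → Pt → ℝ), (∀ i, ContDiff ℝ 2 (χ i)) → ∀ i p,
      ∑ k, ∑ l, Qs i k l (sgrad (χ k) p) (sgrad (χ l) p) = NL M χ i p := by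
    intro χ hχ i p
    simp only [hQ, NL, QF, Fintype.sum_prod_type]
    refine Finset.sum_congr rfl fun k _ => Finset.sum_congr rfl fun l _ => ?_
    rw [sgrad_eq ((hχ k).differentiable (by norm_num) p), sgrad_eq ((hχ l).differentiable (by norm_num) p)]
  refine ⟨√(min E1 E2 / C0), Real.sqrt_pos.2 (div_pos (lt_min hE1 hE2) hC0), √(32 * (2 ^ a * (K1 * C0))) + 1, by positivity,
    fun ε he hle φ₀ φ₁ hc hs hn => ?_⟩
  set E := C0 * ε ^ 2 with hE
  have Ep : 0 ≤ E := by positivity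
  have Em : E ≤ min E1 E2 := by
    have h1 : ε ^ 2 ≤ min E1 E2 / C0 := by
      have := pow_le_pow_left₀ he.le hle 2
      rwa [Real.sq_sqrt (div_pos (lt_min hE1 hE2) hC0).le] at this
    rw [le_div_iff₀ hC0] at h1
    linarith
  have s1 : 0 ≤ ∑ i, sobNorm (N + 1) δ (φ₀ i) := Finset.sum_nonneg fun i _ => sob_nonneg _ _ _
  have s2 : 0 ≤ ∑ i, sobNorm N (δ + 1) (φ₁ i) := Finset.sum_nonneg fun i _ => sob_nonneg _ _ _
  have sb : ∀ i, SB N δ (ε ^ 2) (φ₀ i) (φ₁ i) := fun i => by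
    have b1 := Finset.single_le_sum (f := fun i => sobNorm (N + 1) δ (φ₀ i)) (fun i _ => sob_nonneg _ _ _) (Finset.mem_univ i)
    have b2 := Finset.single_le_sum (f := fun i => sobNorm N (δ + 1) (φ₁ i)) (fun i _ => sob_nonneg _ _ _) (Finset.mem_univ i)
    exact ⟨fun k hk => sob_le (hs i).1 (by linarith) hk, fun k hk => sob_le (hs i).2 (by linarith) hk⟩
  obtain ⟨f, hf, hlim⟩ := hI M (ε ^ 2) (by positivity) φ₀ φ₁ hc sb
  have x1 := it1 E Ep (Em.trans (min_le_left _ _)) f hf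
  have x2 := it2 E Ep (Em.trans (min_le_right _ _)) _ hf.rv
  have kk : ∀ K' : ℝ, K' ≤ K → ∀ n : ℕ, K' * E / 4 ^ n ≤ K * E / 4 ^ n := fun K' h n =>
    div_le_div_of_nonneg_right (mul_le_mul_of_nonneg_right h Ep) (by positivity)
  have ab : ∀ i n, AB N (fun p => f (n + 1) i p - f n i p) (C2 * (K * E) / 4 ^ n) := fun i n => by
    rw [mul_div_assoc]
    exact hAB _ ((hf.sm _ i).sub (hf.sm _ i)) ((hf.sc _ i).sub (hf.sc _ i)) _ ((x1 n i).2.mono (kk _ (le_max_left _ _) n))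
      ((x2 n i).2.mono (kk _ (le_max_right _ _) n))
  choose φ hφ using fun i => Cv_exists hN (U := fun n => f n i) (by positivity) (fun n => hf.sm n i) (fun n => hf.sc n i) (ab i)
  have c2 : ∀ i, ContDiff ℝ 2 (φ i) := fun i => (hφ i).c2 hN
  have eq : ∀ i p, bx (φ i) p = NL M φ i p := eq_lim hN hφ hf.eq
  have ini : ∀ i x, φ i (0, x) = φ₀ i x ∧ ptd (φ i) (0, x) = φ₁ i x := fun i x =>
    ⟨tendsto_nhds_unique ((hφ i).lm (0, x)) (hlim i x).1, by
      rw [ptd_eq ((c2 i).differentiable (by norm_num) _)]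
      exact tendsto_nhds_unique ((hφ i).limD hN 0 (0, x)) (hlim i x).2⟩
  refine ⟨φ, c2, fun i p _ => by rw [box_eq (c2 i), eq, qe φ c2], ini, fun ψ p2 pe pi i p hp => ?_, fun i t ht L hL hLN => ?_⟩
  · refine uniq c2 p2 (fun i p _ => eq i p) (fun i p hp => ?_) (fun i x => ?_) (fun i x => ?_) i p hp
    · rw [← box_eq (p2 i), pe i p hp, qe ψ p2]
    · rw [(pi i x).1, (ini i x).1]
    · rw [← ptd_eq ((c2 i).differentiable (by norm_num) _), ← ptd_eq ((p2 i).differentiable (by norm_num) _), (pi i x).2, (ini i x).2]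
  · obtain ⟨L', rfl⟩ := multi_map hL
    rw [List.length_map] at hLN
    have := final_L2 (α := α) hδ1 hα1 (v := MZ L' (φ i)) (t := t) (B := 2 ^ a * (K1 * E)) (by positivity) fun c =>
      final_e ha hN (hφ i) (fun n t ht => (x1 n i).1.1 t ht) hLN c ht
    refine le_trans this ?_
    rw [← Real.sqrt_eq_rpow, hE, show 32 * (2 ^ a * (K1 * (C0 * ε ^ 2))) = (32 * (2 ^ a * (K1 * C0))) * ε ^ 2 by ring,
      Real.sqrt_mul (by positivity), Real.sqrt_sq he.le]
    nlinarith
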